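/- Almost all perfect graphs are class one: if P_n is sampled uniformly at random from 𝒫_n, then P(χ′(P_n) = Δ(P_n)) → 1 as n → ∞, where χ′ denotes the chromatic index and Δ the maximum degree. -/

import Mathlib

open scoped Classical
open Filter

noncomputable section

/-- A finite simple graph is perfect if every induced subgraph has chromatic number
equal to clique number. -/
def IsPerfect {V : Type*} (G : SimpleGraph V) : Prop :=
  ∀ s : Set V, (G.induce s).chromaticNumber = ((G.induce s).cliqueNum : ℕ∞)

/-- `(G, C)` is a unipolar arrangement: `C` is a clique (the central clique) and every
connected component of the subgraph induced on the complement of `C` is a clique. -/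
def IsUnipolarArrangement {V : Type*} (G : SimpleGraph V) (C : Set V) : Prop :=
  G.IsClique C ∧
    ∀ u v : (Cᶜ : Set V), (G.induce Cᶜ).Reachable u v → u ≠ v → (G.induce Cᶜ).Adj u v

def IsUnipolar {V : Type*} (G : SimpleGraph V) : Prop :=
  ∃ C : Set V, IsUnipolarArrangement G C

def IsCoUnipolar {V : Type*} (G : SimpleGraph V) : Prop := IsUnipolar Gᶜ

def IsGenSplit {V : Type*} (G : SimpleGraph V) : Prop := IsUnipolar G ∨ IsCoUnipolar G

/-- the `m`-th Bell number: the number of partitions of an `m`-element set. -/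
def bell (m : ℕ) : ℕ := Nat.card (Finpartition (Finset.univ : Finset (Fin m)))

/-- `ℓ_{n,k} = C(n,k) · 2^{k(n-k)} · B_{n-k}` -/
def ell (n k : ℕ) : ℕ := Nat.choose n k * 2 ^ (k * (n - k)) * bell (n - k)

/-- `𝓛_n = Σ_{k=0}^n ℓ_{n,k}` -/
def scrL (n : ℕ) : ℕ := ∑ k ∈ Finset.range (n + 1), ell n k

/-- the number of perfect graphs on `{1,…,n}` -/
def perfectCount (n : ℕ) : ℕ := Nat.card {G : SimpleGraph (Fin n) // IsPerfect G}

/-- independence number -/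
def indepNum {V : Type*} (G : SimpleGraph V) : ℕ := Gᶜ.cliqueNum

/-- The chromatic index of `G`: the least number of colours in a proper edge colouring,
i.e. a colouring of the edges such that edges sharing a vertex get distinct colours. -/
def edgeChromaticNumber {V : Type*} (G : SimpleGraph V) : ℕ :=
  sInf {k : ℕ | ∃ f : G.edgeSet → Fin k, ∀ e₁ e₂ : G.edgeSet, e₁ ≠ e₂ →
    (∃ v, v ∈ (e₁ : Sym2 V) ∧ v ∈ (e₂ : Sym2 V)) → f e₁ ≠ f e₂}

/-! ### Vizing fans -/

section Vizing

variable {V : Type*} {k : ℕ}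

/-- `c` restricted to the edges of `G` is a proper edge colouring. -/
def ProperEdge (G : SimpleGraph V) (c : Sym2 V → Fin k) : Prop :=
  ∀ x y z, G.Adj x y → G.Adj x z → y ≠ z → c s(x, y) ≠ c s(x, z)

/-- The colour `γ` does not appear on the edges of `G` at `v`. -/
def MissesColour (G : SimpleGraph V) (c : Sym2 V → Fin k) (v : V) (γ : Fin k) : Prop :=
  ∀ w, G.Adj v w → c s(v, w) ≠ γ

/-- Deletion of one edge. -/
def deleteEdge (G : SimpleGraph V) (x y : V) : SimpleGraph V := G.deleteEdges {s(x, y)}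

lemma deleteEdge_adj {G : SimpleGraph V} {x y v w : V} :
    (deleteEdge G x y).Adj v w ↔ G.Adj v w ∧ s(v, w) ∉ ({s(x, y)} : Set (Sym2 V)) :=
  SimpleGraph.deleteEdges_adj

lemma exists_missesColour [Fintype V] (G : SimpleGraph V) (c : Sym2 V → Fin k) (v : V)
    (h : G.degree v < k) : ∃ γ, MissesColour G c v γ := by
  by_contra hcon
  unfold MissesColour at hcon
  push Not at hcon
  choose w hw hc using hcon
  have hinj : Function.Injective w := fun a b hab => by rw [← hc a, ← hc b, hab]
  have : (Finset.univ.image w).card ≤ (G.neighborFinset v).card := by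
    apply Finset.card_le_card
    intro z hz
    obtain ⟨a, -, rfl⟩ := Finset.mem_image.1 hz
    simpa using hw a
  rw [Finset.card_image_of_injective _ hinj, Finset.card_univ, Fintype.card_fin] at this
  rw [SimpleGraph.card_neighborFinset_eq_degree] at this
  omega

lemma not_three_ends [Fintype V] (K : SimpleGraph V) (hK : ∀ v, K.degree v ≤ 2) {a b d : V}
    (hab : a ≠ b) (had : a ≠ d) (hbd : b ≠ d) (ha : K.degree a ≤ 1) (hb : K.degree b ≤ 1)
    (hd : K.degree d ≤ 1) (rb : K.Reachable a b) (rd : K.Reachable a d) : False := by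
  set C := K.connectedComponentMk a with hC
  have hconn : (K.induce C.supp).Connected := C.connected_toSimpleGraph
  have h1 := hconn.card_vert_le_card_edgeSet_add_one
  have h2 := (K.induce C.supp).sum_degrees_eq_twice_card_edges
  have hdeg : ∀ v : C.supp, (K.induce C.supp).degree v ≤ K.degree v := by
    intro v
    rw [← SimpleGraph.card_neighborFinset_eq_degree, ← SimpleGraph.card_neighborFinset_eq_degree]
    apply Finset.card_le_card_of_injOn (fun w : C.supp => (w : V))
    · intro w hw
      simpa using hw
    · intro x _ y _ h
      exact Subtype.ext h
  have am : a ∈ C.supp := by simp [hC]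
  have bm : b ∈ C.supp := by
    rw [SimpleGraph.ConnectedComponent.mem_supp_iff, hC, SimpleGraph.ConnectedComponent.eq]
    exact rb.symm
  have dm : d ∈ C.supp := by
    rw [SimpleGraph.ConnectedComponent.mem_supp_iff, hC, SimpleGraph.ConnectedComponent.eq]
    exact rd.symm
  have h3 : ∑ v : C.supp, (K.induce C.supp).degree v ≤
      ∑ v : C.supp, (2 - (if v ∈ ({⟨a, am⟩, ⟨b, bm⟩, ⟨d, dm⟩} : Finset C.supp) then 1 else 0)) := by
    apply Finset.sum_le_sum
    intro v _
    have := hdeg v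
    have h2 := hK v
    split_ifs with h
    · simp only [Finset.mem_insert, Finset.mem_singleton] at h
      rcases h with rfl | rfl | rfl
      · exact this.trans ha
      · exact this.trans hb
      · exact this.trans hd
    · omega
  have h4 : ∑ v : C.supp, (2 - (if v ∈ ({⟨a, am⟩, ⟨b, bm⟩, ⟨d, dm⟩} : Finset C.supp) then 1 else 0))
      + 3 = 2 * Fintype.card C.supp := by
    have : ∑ v : C.supp, (if v ∈ ({⟨a, am⟩, ⟨b, bm⟩, ⟨d, dm⟩} : Finset C.supp) then 1 else 0) = 3 := by
      rw [Finset.sum_ite_mem, Finset.univ_inter, Finset.sum_const, smul_eq_mul, mul_one]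
      apply Finset.card_eq_three.2
      exact ⟨⟨a, am⟩, ⟨b, bm⟩, ⟨d, dm⟩, fun h => hab (congrArg Subtype.val h),
        fun h => had (congrArg Subtype.val h), fun h => hbd (congrArg Subtype.val h), rfl⟩
    rw [← this, ← Finset.sum_add_distrib]
    rw [Finset.sum_congr rfl (g := fun _ => 2)]
    · simp [mul_comm]
    · intro v _
      split_ifs <;> rfl
  rw [Nat.card_eq_fintype_card, Nat.card_eq_fintype_card] at h1
  rw [SimpleGraph.edgeFinset_card] at h2
  omega

/-- Exchanging two colours on a set of vertices closed under edges of these colours. -/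
def kempeSwap (c : Sym2 V → Fin k) (S : Set V) (α β : Fin k) (e : Sym2 V) : Fin k :=
  if ∃ v ∈ e, v ∈ S then Equiv.swap α β (c e) else c e

variable {G : SimpleGraph V} {c : Sym2 V → Fin k} {S : Set V} {α β : Fin k}

lemma kempeSwap_of_mem {v w : V} (hv : v ∈ S) :
    kempeSwap c S α β s(v, w) = Equiv.swap α β (c s(v, w)) := by
  rw [kempeSwap, if_pos ⟨v, by simp, hv⟩]

lemma kempeSwap_of_notMem
    (hS : ∀ v w, v ∈ S → G.Adj v w → (c s(v, w) = α ∨ c s(v, w) = β) → w ∈ S)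
    {v w : V} (hv : v ∉ S) (hvw : G.Adj v w) :
    kempeSwap c S α β s(v, w) = c s(v, w) := by
  rw [kempeSwap]
  split_ifs with h
  · obtain ⟨u, hu, huS⟩ := h
    rcases Sym2.mem_iff.1 hu with rfl | rfl
    · exact absurd huS hv
    · apply Equiv.swap_apply_of_ne_of_ne
      · intro h
        exact hv (hS u v huS hvw.symm (Or.inl (by rwa [Sym2.eq_swap])))
      · intro h
        exact hv (hS u v huS hvw.symm (Or.inr (by rwa [Sym2.eq_swap])))
  · rfl

lemma ProperEdge.kempeSwap (hc : ProperEdge G c)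
    (hS : ∀ v w, v ∈ S → G.Adj v w → (c s(v, w) = α ∨ c s(v, w) = β) → w ∈ S) :
    ProperEdge G (kempeSwap c S α β) := by
  intro x y z hy hz hyz
  by_cases hx : x ∈ S
  · rw [kempeSwap_of_mem hx, kempeSwap_of_mem hx]
    exact fun h => hc x y z hy hz hyz ((Equiv.swap α β).injective h)
  · rw [kempeSwap_of_notMem hS hx hy, kempeSwap_of_notMem hS hx hz]
    exact hc x y z hy hz hyz

lemma rotate_fan {x y : V} (hc : ProperEdge (deleteEdge G x y) c)
    (t : ℕ) (Y : ℕ → V) (γ : ℕ → Fin k) (h0 : Y 0 = y)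
    (hinj : ∀ i ≤ t, ∀ j ≤ t, Y i = Y j → i = j)
    (hadj : ∀ i ≤ t, G.Adj x (Y i))
    (hmiss : ∀ i ≤ t, MissesColour (deleteEdge G x y) c (Y i) (γ i))
    (hcol : ∀ i < t, c s(x, Y (i + 1)) = γ i)
    (hlast : MissesColour (deleteEdge G x y) c x (γ t)) :
    ∃ c' : Sym2 V → Fin k, ProperEdge G c' := by
  set H := deleteEdge G x y with hH
  have Hadj : ∀ u v, G.Adj u v → s(u, v) ≠ s(x, y) → H.Adj u v := by
    intro u v h1 h2
    rw [hH, deleteEdge_adj]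
    exact ⟨h1, by simpa using h2⟩
  have hxH : ∀ i < t, H.Adj x (Y (i + 1)) := by grind
  let F : V → Option ℕ := fun w => if h : ∃ i ≤ t, Y i = w then some h.choose else none
  have hF : ∀ i ≤ t, F (Y i) = some i := by
    intro i hi
    have h : ∃ j ≤ t, Y j = Y i := ⟨i, hi, rfl⟩
    simp only [F, dif_pos h]
    rw [hinj _ h.choose_spec.1 _ hi h.choose_spec.2]
  let γ' : V → Fin k := fun w => if h : ∃ i ≤ t, Y i = w then γ h.choose else c s(x, w)
  have hγ' : ∀ i ≤ t, γ' (Y i) = γ i := by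
    intro i hi
    have h : ∃ j ≤ t, Y j = Y i := ⟨i, hi, rfl⟩
    simp only [γ', dif_pos h]
    rw [hinj _ h.choose_spec.1 _ hi h.choose_spec.2]
  have hγn : ∀ w, (¬ ∃ i ≤ t, Y i = w) → γ' w = c s(x, w) := by
    intro w h
    simp only [γ', dif_neg h]
  let c' : Sym2 V → Fin k := fun e => if h : x ∈ e then γ' (Sym2.Mem.other h) else c e
  have hcx : ∀ w, c' s(x, w) = γ' w := by
    intro w
    have h : x ∈ s(x, w) := by simp
    simp only [c', dif_pos h]
    congr 1
    exact Sym2.congr_right.1 (Sym2.other_spec h)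
  have hcn : ∀ v w, v ≠ x → w ≠ x → c' s(v, w) = c s(v, w) := by grind
  have hn0 : ∀ w, (¬ ∃ i ≤ t, Y i = w) → G.Adj x w → H.Adj x w := by
    intro w hw h
    apply Hadj _ _ h
    intro h2
    apply hw ⟨0, by omega, ?_⟩
    rw [h0]
    exact (Sym2.congr_right.1 h2).symm
  have hγne : ∀ i ≤ t, ∀ w, H.Adj x w → (∀ j ≤ t, w = Y j → j ≠ i + 1) → γ i ≠ c s(x, w) := by
    intro i hi w hw hj
    rcases Nat.lt_or_ge i t with h | h
    · rw [← hcol i h]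
      apply hc _ _ _ (hxH i h) hw
      rintro rfl
      exact hj (i + 1) (by omega) rfl rfl
    · obtain rfl : i = t := by omega
      exact (hlast w hw).symm
  refine ⟨c', ?_⟩
  have key : ∀ a b, G.Adj x a → G.Adj x b → a ≠ b → (∃ i ≤ t, Y i = a) → γ' a ≠ γ' b := by
    rintro a b ha hb hab ⟨i, hi, rfl⟩
    rw [hγ' i hi]
    by_cases h : ∃ j ≤ t, Y j = b
    · obtain ⟨j, hj, rfl⟩ := h
      rw [hγ' j hj]
      have hij : i ≠ j := fun h => hab (by rw [h])
      rcases Nat.lt_or_ge j t with h | h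
      · rw [← hcol j h]
        apply hγne i hi _ (hxH j h)
        intro j' hj' he
        have := hinj _ (by omega) _ hj' he
        omega
      · obtain rfl : j = t := by omega
        have hi' : i < j := by omega
        rw [← hcol i hi']
        exact hlast _ (hxH i hi')
    · rw [hγn b h]
      apply hγne i hi b (hn0 b h hb)
      intro j hj hb
      exact absurd ⟨j, hj, hb.symm⟩ h
  have keyv : ∀ v b, v ≠ x → G.Adj v x → G.Adj v b → b ≠ x → c' s(v, x) ≠ c' s(v, b) := by
    intro v b hv hvx hvb hb
    rw [Sym2.eq_swap, hcx, hcn v b hv hb]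
    have hvbH : H.Adj v b := by grind
    by_cases h : ∃ j ≤ t, Y j = v
    · obtain ⟨j, hj, rfl⟩ := h
      rw [hγ' j hj]
      exact (hmiss j hj b hvbH).symm
    · rw [hγn v h, Sym2.eq_swap]
      exact hc v x b (hn0 v h hvx.symm).symm hvbH hb.symm
  intro v a b ha hb hab
  by_cases hv : v = x
  · subst hv
    rw [hcx, hcx]
    by_cases h1 : ∃ i ≤ t, Y i = a
    · exact key a b ha hb hab h1
    · by_cases h2 : ∃ i ≤ t, Y i = b
      · exact (key b a hb ha hab.symm h2).symm
      · rw [hγn a h1, hγn b h2]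
        exact hc v a b (hn0 a h1 ha) (hn0 b h2 hb) hab
  · by_cases hax : a = x
    · subst hax
      exact keyv v b hv ha hb hab.symm
    · by_cases hbx : b = x
      · subst hbx
        exact (keyv v a hv hb ha hab).symm
      · rw [hcn v a hv hax, hcn v b hv hbx]
        apply hc v a b _ _ hab
        · apply Hadj _ _ ha
          intro h
          have : x ∈ s(v, a) := by rw [h]; simp
          simp at this
          tauto
        · apply Hadj _ _ hb
          intro h
          have : x ∈ s(v, b) := by rw [h]; simp
          simp at this
          tauto

lemma degree_deleteEdges_lt [Fintype V] {x y : V} (hxy : G.Adj x y) :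
    (deleteEdge G x y).degree x < G.degree x := by
  rw [← SimpleGraph.card_neighborFinset_eq_degree, ← SimpleGraph.card_neighborFinset_eq_degree]
  apply Finset.card_lt_card
  rw [Finset.ssubset_iff_of_subset]
  · refine ⟨y, by simpa using hxy, ?_⟩
    simp [deleteEdge_adj]
  · intro w hw
    simp only [SimpleGraph.mem_neighborFinset, deleteEdge_adj] at hw ⊢
    exact hw.1

lemma degree_deleteEdges_le [Fintype V] {x y : V} (v : V) :
    (deleteEdge G x y).degree v ≤ G.degree v :=
  SimpleGraph.degree_le_of_le (SimpleGraph.deleteEdges_le _)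

/-- The subgraph of edges coloured `α` or `β`. -/
def twoColour (G : SimpleGraph V) (c : Sym2 V → Fin k) (α β : Fin k) : SimpleGraph V where
  Adj u v := G.Adj u v ∧ (c s(u, v) = α ∨ c s(u, v) = β)
  symm := ⟨fun u v h => ⟨h.1.symm, by rw [Sym2.eq_swap]; exact h.2⟩⟩
  loopless := ⟨fun u h => h.1.ne rfl⟩

lemma extend_colouring [Fintype V] {x y : V} (hxy : G.Adj x y)
    (hc : ProperEdge (deleteEdge G x y) c)
    (hx : G.degree x ≤ k) (hw : ∀ w, G.Adj x w → G.degree w < k) :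
    ∃ c' : Sym2 V → Fin k, ProperEdge G c' := by
  set H := deleteEdge G x y with hH
  have hHG : ∀ u v, H.Adj u v → G.Adj u v := fun u v h => by
    rw [hH, deleteEdge_adj] at h
    exact h.1
  obtain ⟨α, hα⟩ := exists_missesColour H c x ((degree_deleteEdges_lt hxy).trans_le hx)
  have hβ : ∀ w, ∃ b, G.Adj x w → MissesColour H c w b := by
    intro w
    by_cases h : G.Adj x w
    · obtain ⟨b, hb⟩ := exists_missesColour H c w ((degree_deleteEdges_le w).trans_lt (hw w h))
      exact ⟨b, fun _ => hb⟩
    · exact ⟨α, fun h' => absurd h' h⟩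
  choose B hB using hβ
  let next : V → V := fun w => if h : ∃ z, H.Adj x z ∧ c s(x, z) = B w then h.choose else w
  have hnext : ∀ w, ¬ MissesColour H c x (B w) → H.Adj x (next w) ∧ c s(x, next w) = B w := by
    intro w h
    unfold MissesColour at h
    push Not at h
    simp only [next, dif_pos h]
    exact h.choose_spec
  let Y : ℕ → V := fun i => next^[i] y
  have hY : ∀ i, Y (i + 1) = next (Y i) := fun i => Function.iterate_succ_apply' _ _ _
  have hex : ∃ i, MissesColour H c x (B (Y i)) ∨ ∃ j < i, B (Y j) = B (Y i) := by
    obtain ⟨a, b, hab, h⟩ := Finite.exists_ne_map_eq_of_infinite (fun i => B (Y i))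
    rcases lt_or_gt_of_ne hab with h' | h'
    · exact ⟨b, Or.inr ⟨a, h', h⟩⟩
    · exact ⟨a, Or.inr ⟨b, h', h.symm⟩⟩
  set t := Nat.find hex with ht
  have hmin : ∀ i < t, ¬ MissesColour H c x (B (Y i)) ∧ ∀ j < i, B (Y j) ≠ B (Y i) := by
    intro i hi
    have := Nat.find_min hex hi
    push Not at this
    exact this
  have hadjH : ∀ i < t, H.Adj x (Y (i + 1)) ∧ c s(x, Y (i + 1)) = B (Y i) := by
    intro i hi
    rw [hY]
    exact hnext _ (hmin i hi).1
  have hadj : ∀ i ≤ t, G.Adj x (Y i) := by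
    intro i hi
    rcases i with _ | i
    · exact hxy
    · exact hHG _ _ (hadjH i (by omega)).1
  have hdist : ∀ i < t, ∀ j < t, B (Y i) = B (Y j) → i = j := by grind
  have hy0 : ∀ i < t, Y (i + 1) ≠ y := by
    intro i hi h
    have := (hadjH i hi).1
    rw [h, hH, deleteEdge_adj] at this
    exact this.2 rfl
  have hinj : ∀ i ≤ t, ∀ j ≤ t, Y i = Y j → i = j := by
    intro i hi j hj h
    rcases i with _ | i <;> rcases j with _ | j
    · rfl
    · exact absurd h.symm (hy0 j (by omega))
    · exact absurd h (hy0 i (by omega))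
    · have h1 := (hadjH i (by omega)).2
      have h2 := (hadjH j (by omega)).2
      rw [h] at h1
      rw [hdist i (by omega) j (by omega) (h1.symm.trans h2)]
  have hmissB : ∀ i ≤ t, MissesColour H c (Y i) (B (Y i)) := fun i hi => hB _ (hadj i hi)
  by_cases hend : MissesColour H c x (B (Y t))
  · exact rotate_fan hc t Y (fun i => B (Y i)) rfl hinj hadj hmissB (fun i hi => (hadjH i hi).2) hend
  obtain ⟨j, hjt, hj⟩ := (Nat.find_spec hex).resolve_left hend
  rw [← ht] at hj hjt
  set β := B (Y t) with hβdef
  have hαβ : α ≠ β := by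
    rintro h
    rw [← h] at hend
    exact hend hα
  set K : SimpleGraph V := twoColour H c α β with hK
  have hKdeg : ∀ v, K.degree v ≤ 2 := by
    intro v
    rw [← SimpleGraph.card_neighborFinset_eq_degree]
    calc _ ≤ ({α, β} : Finset (Fin k)).card := by
          apply Finset.card_le_card_of_injOn (fun w => c s(v, w))
          · intro w hw
            have : K.Adj v w := by simpa using hw
            simpa using this.2
          · intro w hw w' hw' h
            by_contra hne
            have h1 : K.Adj v w := by simpa using hw
            have h2 : K.Adj v w' := by simpa using hw'
            exact hc v w w' h1.1 h2.1 hne h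
      _ ≤ 2 := Finset.card_le_two
  have hKdeg1 : ∀ v, (MissesColour H c v α ∨ MissesColour H c v β) → K.degree v ≤ 1 := by
    intro v hv
    rw [← SimpleGraph.card_neighborFinset_eq_degree]
    rw [Finset.card_le_one]
    intro w hw w' hw'
    have h1 : K.Adj v w := by simpa using hw
    have h2 : K.Adj v w' := by simpa using hw'
    by_contra hne
    have := hc v w w' h1.1 h2.1 hne
    rcases hv with hv | hv
    · have a1 := hv w h1.1
      have a2 := hv w' h2.1
      have a3 := h1.2
      have a4 := h2.2
      apply this
      rw [a3.resolve_left a1, a4.resolve_left a2]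
    · have a1 := hv w h1.1
      have a2 := hv w' h2.1
      have a3 := h1.2
      have a4 := h2.2
      apply this
      rw [a3.resolve_right a1, a4.resolve_right a2]
  have hclosed : ∀ z, ∀ v w, v ∈ {u | K.Reachable z u} → H.Adj v w →
      (c s(v, w) = α ∨ c s(v, w) = β) → w ∈ {u | K.Reachable z u} := by
    intro z v w hv h1 h2
    exact SimpleGraph.Reachable.trans hv (SimpleGraph.Adj.reachable ⟨h1, h2⟩)
  -- rotate a fan whose last vertex can be recoloured by `α` after a Kempe change
  have final : ∀ s ≤ t, B (Y s) = β → ¬ K.Reachable (Y s) x →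
      (∀ i < s, B (Y i) = β → ¬ K.Reachable (Y s) (Y i)) →
      ∃ c' : Sym2 V → Fin k, ProperEdge G c' := by
    intro s hs hsβ hsx hsi
    set S : Set V := {u | K.Reachable (Y s) u} with hS
    have hxS : x ∉ S := hsx
    have hpres : ∀ v, v ∉ S → ∀ γ, MissesColour H c v γ →
        MissesColour H (kempeSwap c S α β) v γ := by
      intro v hv γ h w hvw
      rw [kempeSwap_of_notMem (hclosed (Y s)) hv hvw]
      exact h w hvw
    have hpres' : ∀ v, v ∈ S → ∀ γ, MissesColour H c v γ →
        MissesColour H (kempeSwap c S α β) v (Equiv.swap α β γ) := by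
      intro v hv γ h w hvw
      rw [kempeSwap_of_mem hv]
      exact fun h' => h w hvw ((Equiv.swap α β).injective h')
    refine rotate_fan (hc.kempeSwap (hclosed (Y s))) s Y (fun i => if i = s then α else B (Y i)) rfl
      (fun i hi j hj => hinj i (by omega) j (by omega)) (fun i hi => hadj i (by omega)) ?_ ?_ ?_
    · intro i hi
      by_cases his : i = s
      · subst his
        simp only [if_true]
        have : Y i ∈ S := SimpleGraph.Reachable.refl _
        have h2 := hpres' _ this β (by rw [← hsβ]; exact hmissB i hs)
        rwa [Equiv.swap_apply_right] at h2
      · simp only [if_neg his]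
        have hi' : i < s := by omega
        by_cases hiS : Y i ∈ S
        · have h2 := hpres' _ hiS _ (hmissB i (by omega))
          rwa [Equiv.swap_apply_of_ne_of_ne] at h2
          · rintro h
            exact (hmin i (by omega)).1 (by rw [h]; exact hα)
          · intro h
            exact hsi i hi' h hiS
        · exact hpres _ hiS _ (hmissB i (by omega))
    · intro i hi
      rw [kempeSwap_of_notMem (hclosed (Y s)) hxS (hadjH i (by omega)).1, if_neg (by omega)]
      exact (hadjH i (by omega)).2
    · rw [if_pos rfl]
      exact hpres _ hxS _ hα
  by_cases hjx : K.Reachable (Y j) x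
  · apply final t le_rfl rfl
    · intro htx
      refine not_three_ends K hKdeg (a := x) (b := Y j) (d := Y t) (hadj j hjt.le).ne
        (hadj t le_rfl).ne ?_ (hKdeg1 _ (Or.inl hα)) (hKdeg1 _ (Or.inr ?_)) (hKdeg1 _ (Or.inr ?_))
        hjx.symm htx.symm
      · intro h
        have := hinj j hjt.le t le_rfl h
        omega
      · rw [← hj]; exact hmissB j hjt.le
      · exact hmissB t le_rfl
    · intro i hi hiβ hr
      have hij : i = j := hdist i hi j hjt (hiβ.trans hj.symm)
      subst hij
      refine not_three_ends K hKdeg (a := x) (b := Y i) (d := Y t) (hadj i hjt.le).ne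
        (hadj t le_rfl).ne ?_ (hKdeg1 _ (Or.inl hα)) (hKdeg1 _ (Or.inr ?_)) (hKdeg1 _ (Or.inr ?_))
        hjx.symm (hjx.symm.trans hr.symm)
      · intro h
        have := hinj i hjt.le t le_rfl h
        omega
      · rw [← hj]; exact hmissB i hjt.le
      · exact hmissB t le_rfl
  · apply final j hjt.le hj hjx
    intro i hi hiβ
    exact absurd (hdist i (by omega) j hjt (hiβ.trans hj.symm)) (by omega)

/-- A graph in which the vertices of degree `k` form an independent set, and all degrees are at
most `k`, has a proper edge colouring with `k` colours. -/
theorem exists_properEdge [Fintype V] (hk : 0 < k) (G : SimpleGraph V) (h1 : ∀ v, G.degree v ≤ k)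
    (h2 : ∀ v w, G.degree v = k → G.degree w = k → ¬ G.Adj v w) :
    ∃ c : Sym2 V → Fin k, ProperEdge G c := by
  induction hm : G.edgeFinset.card using Nat.strong_induction_on generalizing G with
  | _ m ih =>
  by_cases hE : ∃ x y, G.Adj x y
  · have : ∃ x y, G.Adj x y ∧ ∀ w, G.Adj x w → G.degree w < k := by
      by_cases h : ∃ x y, G.Adj x y ∧ G.degree x = k
      · obtain ⟨x, y, hxy, hx⟩ := h
        refine ⟨x, y, hxy, fun w hw => lt_of_le_of_ne (h1 w) fun hwk => h2 x w hx hwk hw⟩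
      · push Not at h
        obtain ⟨x, y, hxy⟩ := hE
        exact ⟨x, y, hxy, fun w hw => lt_of_le_of_ne (h1 w) (h w x hw.symm)⟩
    obtain ⟨x, y, hxy, hw⟩ := this
    obtain ⟨c, hc⟩ := ih _ (by
        rw [← hm]
        apply Finset.card_lt_card
        rw [SimpleGraph.edgeFinset_ssubset_edgeFinset]
        refine lt_of_le_of_ne (SimpleGraph.deleteEdges_le _) ?_
        intro h
        have h' : (deleteEdge G x y).Adj x y := by rw [h]; exact hxy
        rw [deleteEdge_adj] at h'
        exact h'.2 rfl) (deleteEdge G x y)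
      (fun v => (degree_deleteEdges_le v).trans (h1 v))
      (fun v w hv hw' hvw => h2 v w (le_antisymm (h1 v) (hv ▸ degree_deleteEdges_le v))
        (le_antisymm (h1 w) (hw' ▸ degree_deleteEdges_le w)) (by
          rw [deleteEdge_adj] at hvw
          exact hvw.1)) rfl
    exact extend_colouring hxy hc (h1 x) hw
  · exact ⟨fun _ => ⟨0, hk⟩, fun x y _ h => absurd ⟨x, y, h⟩ hE⟩

end Vizing

/-- A graph whose maximum degree is attained at a unique vertex is class one. -/
theorem edgeChromaticNumber_eq_maxDegree {V : Type*} [Fintype V] (G : SimpleGraph V)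
    (h : ∀ v w, G.degree v = G.maxDegree → G.degree w = G.maxDegree → v = w) :
    edgeChromaticNumber G = G.maxDegree := by
  have hlow : ∀ k (f : G.edgeSet → Fin k), (∀ e₁ e₂ : G.edgeSet, e₁ ≠ e₂ →
      (∃ v, v ∈ (e₁ : Sym2 V) ∧ v ∈ (e₂ : Sym2 V)) → f e₁ ≠ f e₂) → G.maxDegree ≤ k := by
    intro k f hf
    apply SimpleGraph.maxDegree_le_of_forall_degree_le
    intro v
    rw [← SimpleGraph.card_neighborFinset_eq_degree]
    have : (G.neighborFinset v).attach.card ≤ (Finset.univ : Finset (Fin k)).card := by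
      apply Finset.card_le_card_of_injOn (fun w : {w // w ∈ G.neighborFinset v} =>
        f ⟨s(v, w), (SimpleGraph.mem_neighborFinset _ _ _).1 w.2⟩)
      · intro w _
        simp
      · intro w _ w' _ hww
        by_contra hne
        refine hf _ _ ?_ ⟨v, by simp, by simp⟩ hww
        intro h'
        apply hne
        apply Subtype.ext
        exact Sym2.congr_right.1 (congrArg Subtype.val h')
    simpa using this
  apply le_antisymm
  · apply Nat.sInf_le
    rcases Nat.eq_zero_or_pos G.maxDegree with h0 | h0
    · have : IsEmpty G.edgeSet := by
        constructor
        rintro ⟨e, he⟩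
        induction e with
        | _ x y =>
          have := G.degree_le_maxDegree x
          have h2 : 0 < G.degree x := by
            rw [SimpleGraph.degree_pos_iff_exists_adj]
            exact ⟨y, he⟩
          omega
      exact ⟨fun e => isEmptyElim e, fun e => isEmptyElim e⟩
    · obtain ⟨c, hc⟩ := exists_properEdge h0 G G.degree_le_maxDegree (by
        intro v w hv hw hvw
        exact hvw.ne (h v w hv hw))
      refine ⟨fun e => c e, ?_⟩
      rintro ⟨e₁, h₁⟩ ⟨e₂, h₂⟩ hne ⟨v, hv1, hv2⟩
      obtain ⟨a, rfl⟩ := hv1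
      obtain ⟨b, rfl⟩ := hv2
      exact hc v a b h₁ h₂ (fun hab => hne (by subst hab; rfl))
  · apply le_csInf
    · rcases Nat.eq_zero_or_pos (Fintype.card G.edgeSet) with h0 | h0
      · have : IsEmpty G.edgeSet := Fintype.card_eq_zero_iff.1 h0
        exact ⟨0, fun e => isEmptyElim e, fun e => isEmptyElim e⟩
      · exact ⟨_, Fintype.equivFin G.edgeSet, fun e₁ e₂ hne _ h' =>
          hne ((Fintype.equivFin G.edgeSet).injective h')⟩
    · rintro k ⟨f, hf⟩
      exact hlow k f hf

/-! ### Unipolar graphs are perfect and perfect graphs have no induced five-cycle -/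

section Perfect

variable {V : Type*}

/-- There is no induced cycle of length five. -/
def C5Free (G : SimpleGraph V) : Prop :=
  ∀ a b c d e, G.Adj a b → G.Adj b c → G.Adj c d → G.Adj d e → G.Adj e a → ¬ G.Adj a c →
    ¬ G.Adj a d → ¬ G.Adj b d → ¬ G.Adj b e → ¬ G.Adj c e → False

/-- There is no induced path on three vertices inside `S`. -/
def P3FreeOn (G : SimpleGraph V) (S : Set V) : Prop :=
  ∀ u ∈ S, ∀ v ∈ S, ∀ w ∈ S, G.Adj u v → G.Adj v w → u ≠ w → G.Adj u w

lemma isUnipolarArrangement_iff {G : SimpleGraph V} {C : Set V} :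
    IsUnipolarArrangement G C ↔ G.IsClique C ∧ P3FreeOn G Cᶜ := by
  constructor
  · rintro ⟨h1, h2⟩
    refine ⟨h1, fun u hu v hv w hw huv hvw hne => ?_⟩
    have a1 : (G.induce Cᶜ).Adj ⟨u, hu⟩ ⟨v, hv⟩ := huv
    have a2 : (G.induce Cᶜ).Adj ⟨v, hv⟩ ⟨w, hw⟩ := hvw
    exact h2 ⟨u, hu⟩ ⟨w, hw⟩ (a1.reachable.trans a2.reachable)
      (fun h => hne (congrArg Subtype.val h))
  · rintro ⟨h1, h2⟩
    refine ⟨h1, ?_⟩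
    have key : ∀ u v : (Cᶜ : Set V), (G.induce Cᶜ).Walk u v → u = v ∨ (G.induce Cᶜ).Adj u v := by
      intro u v p
      induction p with
      | nil => exact Or.inl rfl
      | @cons u v w h p ih =>
        rcases ih with rfl | ih
        · exact Or.inr h
        · by_cases huw : u = w
          · exact Or.inl huw
          · exact Or.inr (h2 u u.2 v v.2 w w.2 h ih (fun h => huw (Subtype.ext h)))
    rintro u v ⟨p⟩ hne
    exact (key u v p).resolve_left hne

lemma IsUnipolar.induce {G : SimpleGraph V} (h : IsUnipolar G) (s : Set V) :
    IsUnipolar (G.induce s) := by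
  obtain ⟨C, hC⟩ := h
  rw [isUnipolarArrangement_iff] at hC
  refine ⟨{x | (x : V) ∈ C}, isUnipolarArrangement_iff.2 ⟨?_, ?_⟩⟩
  · intro x hx y hy hxy
    exact hC.1 hx hy (fun h => hxy (Subtype.ext h))
  · intro u hu v hv w hw huv hvw hne
    exact hC.2 u hu v hv w hw huv hvw (fun h => hne (Subtype.ext h))

lemma IsUnipolar.colorable [Finite V] {G : SimpleGraph V} (h : IsUnipolar G) :
    G.Colorable G.cliqueNum := by
  have := Fintype.ofFinite V
  obtain ⟨C, hC⟩ := h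
  rw [isUnipolarArrangement_iff] at hC
  obtain ⟨hC, hD⟩ := hC
  set ω := G.cliqueNum with hω
  have hcl : ∀ s : Finset V, G.IsClique s → s.card ≤ ω := fun s hs => hs.card_le_cliqueNum
  obtain ⟨φ, hφ⟩ : ∃ φ : V → Fin ω, Set.InjOn φ C := by
    have h1 : (Finset.univ.filter (· ∈ C)).card ≤ (Finset.univ : Finset (Fin ω)).card := by
      rw [Finset.card_univ, Fintype.card_fin]
      apply hcl
      intro x hx y hy
      exact hC (by simpa using hx) (by simpa using hy)
    by_cases h0 : Nonempty (Fin ω)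
    · obtain ⟨φ, h2, h3⟩ := Set.Finite.exists_injOn_of_encard_le
        (s := C) (t := (Set.univ : Set (Fin ω))) (Set.toFinite _) (by
          rw [Set.encard_eq_coe_toFinset_card, Set.encard_eq_coe_toFinset_card]
          simpa using h1)
      exact ⟨φ, h3⟩
    · have : IsEmpty V := by
        constructor
        intro v
        have h1 := hcl {v} (by simp)
        rw [Finset.card_singleton] at h1
        exact h0 ⟨⟨0, h1⟩⟩
      exact ⟨fun v => isEmptyElim v, fun v => isEmptyElim v⟩
  -- an equivalence relation on the complement of `C`
  have hK : ∀ u : V, ∃ g : V → Fin ω, u ∉ C → ∀ v, v ∉ C → (v = u ∨ G.Adj u v) →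
      (∀ c ∈ C, G.Adj c v → g v ≠ φ c) ∧ ∀ w, w ∉ C → (w = u ∨ G.Adj u w) → v ≠ w → g v ≠ g w := by
    intro u
    by_cases huC : u ∈ C
    · exact ⟨φ, fun h => absurd huC h⟩
    have hcliq : ∀ v w, v ∉ C → w ∉ C → (v = u ∨ G.Adj u v) → (w = u ∨ G.Adj u w) → v ≠ w →
        G.Adj v w := by
      intro v w hv hw h1 h2 hne
      rcases h1 with rfl | h1
      · exact h2.resolve_left hne.symm
      · rcases h2 with rfl | h2
        · exact h1.symm
        · exact hD v hv u huC w hw h1.symm h2 hne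
    let ι := {v : V // v ∉ C ∧ (v = u ∨ G.Adj u v)}
    let t : ι → Finset (Fin ω) := fun v =>
      Finset.univ \ (Finset.univ.filter fun c => c ∈ C ∧ G.Adj c v).image φ
    have hall := (Finset.all_card_le_biUnion_card_iff_exists_injective t).1 (by
      intro X
      rcases X.eq_empty_or_nonempty with rfl | ⟨v0, hv0⟩
      · simp
      set Z := Finset.univ.filter fun c => c ∈ C ∧ ∀ v ∈ X, G.Adj c v with hZ
      have h1 : (X.image (Subtype.val : ι → V) ∪ Z).card ≤ ω := by
        apply hcl
        intro x hx y hy hxy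
        have hx' : (∃ h, (⟨x, h⟩ : ι) ∈ X) ∨ x ∈ Z := by
          simpa [ι] using hx
        have hy' : (∃ h, (⟨y, h⟩ : ι) ∈ X) ∨ y ∈ Z := by
          simpa [ι] using hy
        rcases hx' with ⟨h, hx'⟩ | hx' <;> rcases hy' with ⟨h', hy'⟩ | hy'
        · exact hcliq x y h.1 h'.1 h.2 h'.2 hxy
        · exact ((Finset.mem_filter.1 hy').2.2 _ hx').symm
        · exact ((Finset.mem_filter.1 hx').2.2 _ hy')
        · exact hC ((Finset.mem_filter.1 hx').2.1) ((Finset.mem_filter.1 hy').2.1) hxy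
      rw [Finset.card_union_of_disjoint, Finset.card_image_of_injective _ Subtype.val_injective] at h1
      · have h2 : (Finset.univ \ Z.image φ) ⊆ X.biUnion t := by
          intro a ha
          by_contra hcon
          simp only [Finset.mem_biUnion, t, Finset.mem_sdiff, Finset.mem_univ, true_and,
            Finset.mem_image, Finset.mem_filter, not_exists, not_and, not_not, not_forall] at hcon ha
          obtain ⟨c0, ⟨hc0, hcv0⟩, rfl⟩ := hcon v0 hv0
          apply ha c0 _ rfl
          simp only [hZ, Finset.mem_filter, Finset.mem_univ, true_and]
          refine ⟨hc0, fun v hv => ?_⟩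
          obtain ⟨c1, ⟨hc1, hcv1⟩, h3⟩ := hcon v hv
          rwa [← hφ hc1 hc0 h3]
        have h3 := Finset.card_le_card h2
        rw [Finset.card_sdiff_of_subset (Finset.subset_univ _), Finset.card_univ, Fintype.card_fin]
          at h3
        have h4 : (Z.image φ).card ≤ Z.card := Finset.card_image_le
        omega
      · rw [Finset.disjoint_left]
        intro x hx hx2
        obtain ⟨v, -, rfl⟩ := Finset.mem_image.1 hx
        exact v.2.1 (Finset.mem_filter.1 hx2).2.1)
    obtain ⟨g, hg, hgt⟩ := hall
    refine ⟨fun v => if h : v ∉ C ∧ (v = u ∨ G.Adj u v) then g ⟨v, h⟩ else φ v, ?_⟩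
    intro _ v hv hvu
    beta_reduce
    rw [dif_pos ⟨hv, hvu⟩]
    constructor
    · intro c hc hcv h
      have := hgt ⟨v, hv, hvu⟩
      simp only [t, Finset.mem_sdiff, Finset.mem_image, Finset.mem_filter, Finset.mem_univ,
        true_and] at this
      exact this ⟨c, ⟨hc, hcv⟩, h.symm⟩
    · intro w hw hwu hne
      rw [dif_pos ⟨hw, hwu⟩]
      exact fun h => hne (congrArg Subtype.val (hg h))
  choose g hg using hK
  -- choose a representative of each class
  have hrep : ∃ r : V → V, (∀ v, v ∉ C → r v ∉ C ∧ (r v = v ∨ G.Adj (r v) v)) ∧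
      ∀ v w, v ∉ C → w ∉ C → G.Adj v w → r v = r w := by
    let S : Setoid V :=
      { r := fun v w => v = w ∨ (v ∉ C ∧ w ∉ C ∧ G.Adj v w)
        iseqv := ⟨fun v => Or.inl rfl,
          fun h => h.imp Eq.symm (fun h => ⟨h.2.1, h.1, h.2.2.symm⟩), by
            rintro v w z (rfl | ⟨h1, h2, h3⟩) h'
            · exact h'
            · rcases h' with rfl | ⟨h4, h5, h6⟩
              · exact Or.inr ⟨h1, h2, h3⟩
              · by_cases hvz : v = z
                · exact Or.inl hvz
                · exact Or.inr ⟨h1, h5, hD v h1 w h2 z h5 h3 h6 hvz⟩⟩ }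
    refine ⟨fun v => (Quotient.mk S v).out, fun v hv => ?_, fun v w hv hw hvw => ?_⟩
    · show (Quotient.mk S v).out ∉ C ∧ ((Quotient.mk S v).out = v ∨ G.Adj (Quotient.mk S v).out v)
      have h1 : S.r ((Quotient.mk S v).out) v := Quotient.exact (Quotient.out_eq _)
      rcases h1 with h1 | h1
      · exact ⟨by rw [h1]; exact hv, Or.inl h1⟩
      · exact ⟨h1.1, Or.inr h1.2.2⟩
    · have : Quotient.mk S v = Quotient.mk S w := Quotient.sound (Or.inr ⟨hv, hw, hvw⟩)
      simp only [this]
  obtain ⟨r, hr1, hr2⟩ := hrep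
  have hr3 : ∀ v, v ∉ C → (v = r v ∨ G.Adj (r v) v) := fun v hv => (hr1 v hv).2.imp Eq.symm id
  refine ⟨SimpleGraph.Coloring.mk (fun v => if v ∈ C then φ v else g (r v) v) ?_⟩
  intro v w hvw
  by_cases hv : v ∈ C <;> by_cases hw : w ∈ C <;> simp only [hv, hw, if_true, if_false]
  · exact fun h => hvw.ne (hφ hv hw h)
  · exact ((hg (r w) (hr1 w hw).1 w hw (hr3 w hw)).1 v hv hvw).symm
  · exact (hg (r v) (hr1 v hv).1 v hv (hr3 v hv)).1 w hw hvw.symm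
  · have h1 := hr3 v hv
    rw [hr2 v w hv hw hvw] at h1 ⊢
    exact (hg (r w) (hr1 w hw).1 v hv h1).2 w hw (hr3 w hw) hvw.ne

theorem IsUnipolar.isPerfect [Finite V] {G : SimpleGraph V} (h : IsUnipolar G) : IsPerfect G := by
  intro s
  exact le_antisymm (h.induce s).colorable.chromaticNumber_le
    SimpleGraph.cliqueNum_le_chromaticNumber

lemma IsPerfect.c5Free [Finite V] {G : SimpleGraph V} (h : IsPerfect G) : C5Free G := by
  intro a b c d e hab hbc hcd hde hea hac had hbd hbe hce
  have := Fintype.ofFinite V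
  set s : Set V := {a, b, c, d, e} with hs
  have hω : (G.induce s).cliqueNum ≤ 2 := by
    by_contra hcon
    push Not at hcon
    obtain ⟨t, ht⟩ := (G.induce s).exists_isNClique_cliqueNum
    have h3t : 2 < t.card := by rw [ht.2]; exact hcon
    obtain ⟨x, hx, y, hy, z, hz, hxy, hxz, hyz⟩ := Finset.two_lt_card.1 h3t
    have h1 : G.Adj x y := ht.1 hx hy hxy
    have h2 : G.Adj x z := ht.1 hx hz hxz
    have h3 : G.Adj y z := ht.1 hy hz hyz
    obtain ⟨x, hx'⟩ := x
    obtain ⟨y, hy'⟩ := y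
    obtain ⟨z, hz'⟩ := z
    simp only at h1 h2 h3
    have hea' := hea.symm
    have hac' := fun h => hac (G.adj_symm h)
    have had' := fun h => had (G.adj_symm h)
    have hbd' := fun h => hbd (G.adj_symm h)
    have hbe' := fun h => hbe (G.adj_symm h)
    have hce' := fun h => hce (G.adj_symm h)
    clear hx hy hz hxy hxz hyz ht
    simp only [hs, Set.mem_insert_iff, Set.mem_singleton_iff] at hx' hy' hz'
    rcases hx' with rfl | rfl | rfl | rfl | rfl <;> rcases hy' with rfl | rfl | rfl | rfl | rfl <;>
      first
      | exact G.irrefl h1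
      | contradiction
      | (rcases hz' with rfl | rfl | rfl | rfl | rfl <;>
          first | exact G.irrefl h2 | exact G.irrefl h3 | contradiction)
  have hcol : (G.induce s).Colorable 2 := by
    rw [← SimpleGraph.chromaticNumber_le_iff_colorable, h s]
    exact_mod_cast hω
  obtain ⟨f⟩ := hcol
  have hf : ∀ x y (hx : x ∈ s) (hy : y ∈ s), G.Adj x y → f ⟨x, hx⟩ ≠ f ⟨y, hy⟩ :=
    fun x y hx hy hxy => f.valid (show (G.induce s).Adj ⟨x, hx⟩ ⟨y, hy⟩ from hxy)
  have h1 := hf a b (by simp [hs]) (by simp [hs]) hab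
  have h2 := hf b c (by simp [hs]) (by simp [hs]) hbc
  have h3 := hf c d (by simp [hs]) (by simp [hs]) hcd
  have h4 := hf d e (by simp [hs]) (by simp [hs]) hde
  have h5 := hf e a (by simp [hs]) (by simp [hs]) hea
  generalize f ⟨a, _⟩ = A at *
  generalize f ⟨b, _⟩ = B at *
  generalize f ⟨c, _⟩ = C at *
  generalize f ⟨d, _⟩ = D at *
  generalize f ⟨e, _⟩ = E at *
  omega

lemma C5Free.compl {G : SimpleGraph V} (h : C5Free G) : C5Free Gᶜ := by
  intro a b c d e hab hbc hcd hde hea hac had hbd hbe hce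
  simp only [SimpleGraph.compl_adj, not_and, not_not] at *
  have n1 : a ≠ c := by rintro rfl; exact hcd.2 (had hcd.1)
  have n2 : a ≠ d := by rintro rfl; exact hcd.2 ((hac (Ne.symm hcd.1)).symm)
  have n3 : b ≠ d := by rintro rfl; exact hde.2 (hbe hde.1)
  have n4 : b ≠ e := by rintro rfl; exact hde.2 ((hbd (Ne.symm hde.1)).symm)
  have n5 : c ≠ e := by rintro rfl; exact hea.2 ((hac (Ne.symm hea.1)).symm)
  exact h a c e b d (hac n1) (hce n5) (hbe n4).symm (hbd n3) (had n2).symm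
    (fun h => hea.2 h.symm) hab.2 (fun h => hbc.2 h.symm) hcd.2 (fun h => hde.2 h.symm)

lemma C5Free.comap {W : Type*} {G : SimpleGraph V} (h : C5Free G) (f : W → V) :
    C5Free (G.comap f) :=
  fun a b c d e => h (f a) (f b) (f c) (f d) (f e)

end Perfect

/-! ### Counting graphs by deleting few vertices -/

section Counting

/-- The number of graphs on `n` vertices without induced five-cycle. -/
def countC5Free (n : ℕ) : ℕ := Set.ncard {G : SimpleGraph (Fin n) | C5Free G}

/-- The number of unipolar graphs on `n` vertices. -/
def countUnipolar (n : ℕ) : ℕ := Set.ncard {G : SimpleGraph (Fin n) | IsUnipolar G}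

/-- The neighbourhood of `v` inside `Q`. -/
def nbrIn {V : Type*} (G : SimpleGraph V) (Q : Finset V) (v : V) : Finset V := Q.filter (G.Adj v)

lemma mem_nbrIn {V : Type*} {G : SimpleGraph V} {Q : Finset V} {v w : V} :
    w ∈ nbrIn G Q v ↔ w ∈ Q ∧ G.Adj v w := Finset.mem_filter

/-- The graph obtained by removing all edges touching `Q`. -/
def delVerts {V : Type*} (G : SimpleGraph V) (Q : Finset V) : SimpleGraph V where
  Adj u v := G.Adj u v ∧ u ∉ Q ∧ v ∉ Q
  symm := ⟨fun _ _ h => ⟨h.1.symm, h.2.2, h.2.1⟩⟩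
  loopless := ⟨fun _ h => h.1.ne rfl⟩

lemma delVerts_adj {V : Type*} {G : SimpleGraph V} {Q : Finset V} {u v : V} :
    (delVerts G Q).Adj u v ↔ G.Adj u v ∧ u ∉ Q ∧ v ∉ Q := Iff.rfl

lemma delVerts_nbrIn_inj {V : Type*} {G G' : SimpleGraph V} {Q : Finset V}
    (h1 : delVerts G Q = delVerts G' Q) (h2 : nbrIn G Q = nbrIn G' Q) : G = G' := by
  ext u v
  by_cases hv : v ∈ Q
  · have := congrFun h2 u
    have h3 : v ∈ nbrIn G Q u ↔ v ∈ nbrIn G' Q u := by rw [this]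
    simpa [mem_nbrIn, hv] using h3
  · by_cases hu : u ∈ Q
    · have := congrFun h2 v
      have h3 : u ∈ nbrIn G Q v ↔ u ∈ nbrIn G' Q v := by rw [this]
      simpa [mem_nbrIn, hu, SimpleGraph.adj_comm] using h3
    · have h3 : (delVerts G Q).Adj u v ↔ (delVerts G' Q).Adj u v := by rw [h1]
      simpa [delVerts_adj, hu, hv] using h3

lemma ncard_delVerts_le (n : ℕ) (Q : Finset (Fin n))
    (Ψ : SimpleGraph (Fin n) → Set (Fin n → Finset (Fin n))) (b : ℝ)
    (hb : ∀ H, ((Ψ H).ncard : ℝ) ≤ b) :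
    (Set.ncard {G | C5Free G ∧ nbrIn G Q ∈ Ψ (delVerts G Q)} : ℝ) ≤
      countC5Free (n - Q.card) * b := by
  set A : Set (SimpleGraph (Fin n)) := {G | C5Free G ∧ nbrIn G Q ∈ Ψ (delVerts G Q)} with hA
  have hb0 : 0 ≤ b := le_trans (Nat.cast_nonneg _) (hb ⊥)
  have h1 := Finset.card_le_mul_card_image (f := fun G => delVerts G Q) A.toFinset ⌊b⌋₊ (by
    intro H _
    rw [Nat.le_floor_iff hb0]
    refine le_trans ?_ (hb H)
    rw [← Set.ncard_coe_finset]
    refine Nat.cast_le.2 ?_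
    apply Set.ncard_le_ncard_of_injOn (fun G => nbrIn G Q)
    · intro G hG
      simp only [Finset.coe_filter, Set.mem_toFinset, Set.mem_ofPred_eq] at hG
      rw [← hG.2]
      exact hG.1.2
    · intro G hG G' hG' h
      simp only [Finset.coe_filter, Set.mem_ofPred_eq] at hG hG'
      exact delVerts_nbrIn_inj (hG.2.trans hG'.2.symm) h)
  have hcard : (Qᶜ).card = n - Q.card := by rw [Finset.card_compl, Fintype.card_fin]
  let e := (Qᶜ).orderEmbOfFin hcard
  have h2 : (A.toFinset.image (fun G => delVerts G Q)).card ≤ countC5Free (n - Q.card) := by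
    rw [← Set.ncard_coe_finset, countC5Free]
    apply Set.ncard_le_ncard_of_injOn (fun H => H.comap e)
    · intro H hH
      simp only [Finset.coe_image, Set.mem_image, Set.coe_toFinset] at hH
      obtain ⟨G, hG, rfl⟩ := hH
      have : (delVerts G Q).comap e = G.comap e := by
        ext u v
        have hu : e u ∈ Qᶜ := Finset.orderEmbOfFin_mem _ _ _
        have hv : e v ∈ Qᶜ := Finset.orderEmbOfFin_mem _ _ _
        rw [Finset.mem_compl] at hu hv
        simp [delVerts_adj, hu, hv]
      show C5Free _
      rw [this]
      exact hG.1.comap e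
    · intro H hH H' hH' h
      simp only [Finset.coe_image, Set.mem_image, Set.coe_toFinset] at hH hH'
      obtain ⟨G, hG, rfl⟩ := hH
      obtain ⟨G', hG', rfl⟩ := hH'
      ext u v
      by_cases hu : u ∈ Q
      · simp [delVerts_adj, hu]
      by_cases hv : v ∈ Q
      · simp [delVerts_adj, hv]
      have hr : Set.range e = (Qᶜ : Finset (Fin n)) := Finset.range_orderEmbOfFin _ _
      have hu' : u ∈ Set.range e := by rw [hr]; simpa using hu
      have hv' : v ∈ Set.range e := by rw [hr]; simpa using hv
      obtain ⟨x, rfl⟩ := hu'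
      obtain ⟨y, rfl⟩ := hv'
      have : ((delVerts G Q).comap e).Adj x y ↔ ((delVerts G' Q).comap e).Adj x y := by
        simp only at h
        rw [h]
      exact this
  rw [← Set.ncard_eq_toFinset_card'] at h1
  calc (A.ncard : ℝ) ≤ (⌊b⌋₊ * (A.toFinset.image (fun G => delVerts G Q)).card : ℕ) := by
        exact_mod_cast h1
    _ ≤ b * countC5Free (n - Q.card) := by
        push_cast
        exact mul_le_mul (Nat.floor_le hb0) (by exact_mod_cast h2) (by positivity) hb0
    _ = _ := mul_comm _ _

/-- The upper bound for the number of exceptional graphs. -/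
def rareBound (c : ℝ) (K n : ℕ) : ℝ :=
  ∑ q ∈ Finset.Icc 1 K, countC5Free (n - q) * (2 : ℝ) ^ (((q : ℝ) / 2 - c) * n)

/-- A property of graphs which few graphs without induced five-cycle have. -/
def Rare (P : (n : ℕ) → SimpleGraph (Fin n) → Prop) : Prop :=
  ∃ c > 0, ∃ K, ∀ᶠ n in atTop, (Set.ncard {G : SimpleGraph (Fin n) | C5Free G ∧ P n G} : ℝ) ≤
    rareBound c K n

lemma rareBound_mono {c c' : ℝ} (hc : c' ≤ c) {K K' : ℕ} (hK : K ≤ K') (n : ℕ) :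
    rareBound c K n ≤ rareBound c' K' n := by
  unfold rareBound
  calc _ ≤ ∑ q ∈ Finset.Icc 1 K, countC5Free (n - q) * (2 : ℝ) ^ (((q : ℝ) / 2 - c') * n) := by
        apply Finset.sum_le_sum
        intro q _
        gcongr
        norm_num
    _ ≤ _ := by
        apply Finset.sum_le_sum_of_subset_of_nonneg
        · exact Finset.Icc_subset_Icc_right hK
        · intros
          positivity

lemma two_mul_rareBound {c : ℝ} (hc : 0 < c) (K : ℕ) :
    ∀ᶠ n in atTop, 2 * rareBound c K n ≤ rareBound (c / 2) K n := by
  have h : ∀ᶠ n : ℕ in atTop, 2 / c ≤ (n : ℝ) := tendsto_natCast_atTop_atTop.eventually_ge_atTop _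
  filter_upwards [h] with n hn
  unfold rareBound
  rw [Finset.mul_sum]
  apply Finset.sum_le_sum
  intro q _
  have h1 : ((q : ℝ) / 2 - c / 2) * n = c / 2 * n + ((q : ℝ) / 2 - c) * n := by ring
  rw [h1, Real.rpow_add (by norm_num)]
  have h2 : (2 : ℝ) ≤ 2 ^ (c / 2 * n) := by
    have : (1 : ℝ) ≤ c / 2 * n := by
      rw [div_le_iff₀ hc] at hn
      linarith
    calc (2 : ℝ) = 2 ^ (1 : ℝ) := by norm_num
      _ ≤ _ := Real.rpow_le_rpow_of_exponent_le (by norm_num) this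
  calc _ = 2 * (countC5Free (n - q) * (2 : ℝ) ^ (((q : ℝ) / 2 - c) * n)) := rfl
    _ ≤ 2 ^ (c / 2 * n) * (countC5Free (n - q) * (2 : ℝ) ^ (((q : ℝ) / 2 - c) * n)) := by gcongr
    _ = _ := by ring

lemma Rare.or {P Q : (n : ℕ) → SimpleGraph (Fin n) → Prop} (hP : Rare P) (hQ : Rare Q) :
    Rare (fun n G => P n G ∨ Q n G) := by
  obtain ⟨c, hc, K, hP⟩ := hP
  obtain ⟨c', hc', K', hQ⟩ := hQ
  have hm : 0 < min c c' := lt_min hc hc'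
  refine ⟨min c c' / 2, by positivity, max K K', ?_⟩
  filter_upwards [hP, hQ, two_mul_rareBound hm (max K K')] with n h1 h2 h3
  refine le_trans ?_ h3
  have h4 : {G : SimpleGraph (Fin n) | C5Free G ∧ (P n G ∨ Q n G)} =
      {G | C5Free G ∧ P n G} ∪ {G | C5Free G ∧ Q n G} := by
    ext G
    simp only [Set.mem_ofPred_eq, Set.mem_union]
    tauto
  rw [h4]
  have h5 := Set.ncard_union_le {G : SimpleGraph (Fin n) | C5Free G ∧ P n G} {G | C5Free G ∧ Q n G}
  have h6 := rareBound_mono (min_le_left c c') (le_max_left K K') n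
  have h7 := rareBound_mono (min_le_right c c') (le_max_right K K') n
  have h5' : (({G : SimpleGraph (Fin n) | C5Free G ∧ P n G} ∪
      {G | C5Free G ∧ Q n G}).ncard : ℝ) ≤
    ({G : SimpleGraph (Fin n) | C5Free G ∧ P n G}.ncard : ℝ) +
      ({G : SimpleGraph (Fin n) | C5Free G ∧ Q n G}.ncard : ℝ) := by exact_mod_cast h5
  linarith

lemma Rare.mono {P Q : (n : ℕ) → SimpleGraph (Fin n) → Prop} (hP : Rare P)
    (h : ∀ᶠ n in atTop, ∀ G, C5Free G → Q n G → P n G) : Rare Q := by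
  obtain ⟨c, hc, K, hP⟩ := hP
  refine ⟨c, hc, K, ?_⟩
  filter_upwards [hP, h] with n h1 h2
  refine le_trans ?_ h1
  norm_cast
  exact Set.ncard_le_ncard (fun G hG => ⟨hG.1, h2 G hG.1 hG.2⟩) (Set.toFinite _)

lemma Rare.compl {P : (n : ℕ) → SimpleGraph (Fin n) → Prop} (hP : Rare P) :
    Rare (fun n G => P n Gᶜ) := by
  obtain ⟨c, hc, K, hP⟩ := hP
  refine ⟨c, hc, K, ?_⟩
  filter_upwards [hP] with n h1
  refine le_trans ?_ h1
  norm_cast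
  apply Set.ncard_le_ncard_of_injOn (fun G => Gᶜ)
  · intro G hG
    exact ⟨hG.1.compl, hG.2⟩
  · intro G _ G' _ h
    exact compl_injective h

lemma rare_false : Rare (fun _ _ => False) := by
  refine ⟨1, one_pos, 0, Eventually.of_forall fun n => ?_⟩
  simp [rareBound]

/-- The filter of properties which all but few graphs without induced five-cycle have. -/
def typicalGraphs : Filter (Σ n, SimpleGraph (Fin n)) where
  sets := {S | Rare fun n G => (⟨n, G⟩ : Σ n, SimpleGraph (Fin n)) ∉ S}
  univ_sets := rare_false.mono (Eventually.of_forall fun n G _ h => h (Set.mem_univ _))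
  sets_of_superset := fun h hST => h.mono (Eventually.of_forall fun n G _ h' h'' => h' (hST h''))
  inter_sets := fun h h' => (h.or h').mono (Eventually.of_forall fun n G _ h'' => by
    by_contra hcon
    push Not at hcon
    exact h'' hcon)

lemma eventually_typicalGraphs {P : (Σ n, SimpleGraph (Fin n)) → Prop} :
    (∀ᶠ x in typicalGraphs, P x) ↔ Rare fun n G => ¬ P ⟨n, G⟩ := Iff.rfl

lemma typical_c5Free : ∀ᶠ x in typicalGraphs, C5Free x.2 := by
  rw [eventually_typicalGraphs]
  exact rare_false.mono (Eventually.of_forall fun n G h h' => h' h)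

lemma typical_of_eventually {p : ℕ → Prop} (h : ∀ᶠ n in atTop, p n) :
    ∀ᶠ x in typicalGraphs, p x.1 := by
  rw [eventually_typicalGraphs]
  exact rare_false.mono (h.mono fun n hn G _ h' => h' hn)

lemma typical_compl {P : (n : ℕ) → SimpleGraph (Fin n) → Prop}
    (h : ∀ᶠ x in typicalGraphs, P x.1 x.2) : ∀ᶠ x in typicalGraphs, P x.1 x.2ᶜ :=
  Rare.compl (P := fun n G => ¬ P n G) h

/-- Properties detected on the neighbourhoods in a set of bounded size. -/
lemma rare_of_nbrIn {q : ℕ} (hq : 1 ≤ q) {c : ℝ} (hc : 0 < c)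
    {P : (n : ℕ) → Finset (Fin n) → SimpleGraph (Fin n) → Prop}
    (h : ∀ᶠ n in atTop, ∀ Q : Finset (Fin n), Q.card = q →
      ∃ Ψ : SimpleGraph (Fin n) → Set (Fin n → Finset (Fin n)),
        (∀ H, ((Ψ H).ncard : ℝ) ≤ (2 : ℝ) ^ (((q : ℝ) / 2 - c) * n)) ∧
        ∀ G, C5Free G → P n Q G → nbrIn G Q ∈ Ψ (delVerts G Q)) :
    ∀ᶠ x in typicalGraphs, ∀ Q : Finset (Fin x.1), Q.card = q → ¬ P x.1 Q x.2 := by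
  rw [eventually_typicalGraphs]
  refine ⟨c / 2, by positivity, q, ?_⟩
  have hlim : ∀ᶠ n : ℕ in atTop, ((n : ℝ)) ^ q ≤ (2 : ℝ) ^ (c / 2 * n) := by
    have h1 := isLittleO_pow_const_const_pow_of_one_lt (R := ℝ) q
      (r := (2 : ℝ) ^ (c / 2)) (Real.one_lt_rpow (by norm_num) (by positivity))
    filter_upwards [h1.bound one_pos] with n hn
    rw [one_mul, Real.norm_of_nonneg (by positivity), Real.norm_of_nonneg (by positivity)] at hn
    rwa [Real.rpow_mul (by norm_num), Real.rpow_natCast]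
  filter_upwards [h, hlim] with n h1 h2
  have h3 : {G : SimpleGraph (Fin n) | C5Free G ∧ ¬ ∀ Q : Finset (Fin n), Q.card = q → ¬ P n Q G} ⊆
      ⋃ Q ∈ (Finset.univ : Finset (Fin n)).powersetCard q, {G | C5Free G ∧ P n Q G} := by
    rintro G ⟨hG, hG'⟩
    push Not at hG'
    obtain ⟨Q, hQ, hP⟩ := hG'
    simp only [Set.mem_iUnion, Finset.mem_powersetCard]
    exact ⟨Q, ⟨Finset.subset_univ _, hQ⟩, hG, hP⟩
  have h4 := (Set.ncard_le_ncard h3 (Set.toFinite _)).trans (Finset.set_ncard_biUnion_le _ _)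
  have h5 : ∀ Q ∈ (Finset.univ : Finset (Fin n)).powersetCard q,
      (Set.ncard {G : SimpleGraph (Fin n) | C5Free G ∧ P n Q G} : ℝ) ≤
        countC5Free (n - q) * (2 : ℝ) ^ (((q : ℝ) / 2 - c) * n) := by
    intro Q hQ
    have hQ' := (Finset.mem_powersetCard.1 hQ).2
    obtain ⟨Ψ, hΨ, hmem⟩ := h1 Q hQ'
    have := ncard_delVerts_le n Q Ψ _ hΨ
    rw [hQ'] at this
    refine le_trans ?_ this
    norm_cast
    exact Set.ncard_le_ncard (fun G hG => ⟨hG.1, hmem G hG.1 hG.2⟩) (Set.toFinite _)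
  calc _ ≤ ∑ Q ∈ (Finset.univ : Finset (Fin n)).powersetCard q,
        (Set.ncard {G : SimpleGraph (Fin n) | C5Free G ∧ P n Q G} : ℝ) := by exact_mod_cast h4
    _ ≤ ∑ Q ∈ (Finset.univ : Finset (Fin n)).powersetCard q,
        countC5Free (n - q) * (2 : ℝ) ^ (((q : ℝ) / 2 - c) * n) := Finset.sum_le_sum h5
    _ = (n.choose q : ℝ) * (countC5Free (n - q) * (2 : ℝ) ^ (((q : ℝ) / 2 - c) * n)) := by
        rw [Finset.sum_const, Finset.card_powersetCard, Finset.card_univ, Fintype.card_fin,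
          nsmul_eq_mul]
    _ ≤ (2 : ℝ) ^ (c / 2 * n) * (countC5Free (n - q) * (2 : ℝ) ^ (((q : ℝ) / 2 - c) * n)) := by
        gcongr
        refine le_trans ?_ h2
        exact_mod_cast Nat.choose_le_pow n q
    _ = countC5Free (n - q) * (2 : ℝ) ^ (((q : ℝ) / 2 - c / 2) * n) := by
        rw [mul_left_comm, ← Real.rpow_add (by norm_num)]
        congr 2
        ring
    _ ≤ _ := by
        unfold rareBound
        exact Finset.single_le_sum
          (f := fun q : ℕ => countC5Free (n - q) * (2 : ℝ) ^ (((q : ℝ) / 2 - c / 2) * n))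
          (fun _ _ => by positivity) (Finset.mem_Icc.2 ⟨hq, le_rfl⟩)

end Counting

/-! ### Lower bounds for the number of unipolar graphs -/

section UnipolarCount

lemma IsUnipolar.comap {V W : Type*} {G : SimpleGraph V} (h : IsUnipolar G) (f : W ↪ V) :
    IsUnipolar (G.comap f) := by
  obtain ⟨C, hC⟩ := h
  rw [isUnipolarArrangement_iff] at hC
  refine ⟨f ⁻¹' C, isUnipolarArrangement_iff.2 ⟨?_, ?_⟩⟩
  · intro x hx y hy hxy
    exact hC.1 hx hy (fun h => hxy (f.injective h))
  · intro u hu v hv w hw huv hvw hne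
    exact hC.2 (f u) hu (f v) hv (f w) hw huv hvw (fun h => hne (f.injective h))

/-- Add a new last vertex with neighbourhood `S`. -/
def addVertex {n : ℕ} (G : SimpleGraph (Fin n)) (S : Finset (Fin n)) :
    SimpleGraph (Fin (n + 1)) where
  Adj u v := (∃ x y, u = Fin.castSucc x ∧ v = Fin.castSucc y ∧ G.Adj x y) ∨
    (u = Fin.last n ∧ ∃ x ∈ S, v = Fin.castSucc x) ∨ (v = Fin.last n ∧ ∃ x ∈ S, u = Fin.castSucc x)
  symm := ⟨by
    rintro u v (⟨x, y, h1, h2, h3⟩ | h | h)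
    · exact Or.inl ⟨y, x, h2, h1, h3.symm⟩
    · exact Or.inr (Or.inr h)
    · exact Or.inr (Or.inl h)⟩
  loopless := ⟨by
    rintro u (⟨x, y, h1, h2, h3⟩ | ⟨h, x, _, h'⟩ | ⟨h, x, _, h'⟩)
    · exact h3.ne (Fin.castSucc_injective _ (h1.symm.trans h2))
    · exact (Fin.castSucc_ne_last x) (h'.symm.trans h)
    · exact (Fin.castSucc_ne_last x) (h'.symm.trans h)⟩

lemma addVertex_castSucc {n : ℕ} {G : SimpleGraph (Fin n)} {S : Finset (Fin n)} {x y : Fin n} :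
    (addVertex G S).Adj x.castSucc y.castSucc ↔ G.Adj x y := by
  simp [addVertex, Fin.castSucc_inj, Fin.castSucc_ne_last]

lemma addVertex_last {n : ℕ} {G : SimpleGraph (Fin n)} {S : Finset (Fin n)} {x : Fin n} :
    (addVertex G S).Adj (Fin.last n) x.castSucc ↔ x ∈ S := by
  simp [addVertex, Fin.castSucc_inj, Fin.castSucc_ne_last, (Fin.castSucc_ne_last _).symm]

lemma countUnipolar_succ (n : ℕ) :
    (2 : ℝ) ^ ((n : ℝ) / 2) * countUnipolar n ≤ countUnipolar (n + 1) := by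
  have hC : ∀ G : SimpleGraph (Fin n), ∃ C : Finset (Fin n), IsUnipolar G →
      (G.IsClique C ∧ P3FreeOn G (C : Set (Fin n))ᶜ) := by
    intro G
    by_cases h : IsUnipolar G
    · obtain ⟨C, hC⟩ := h
      rw [isUnipolarArrangement_iff] at hC
      exact ⟨C.toFinset, fun _ => by simpa using hC⟩
    · exact ⟨∅, fun h' => absurd h' h⟩
  choose C hC using hC
  let fam : SimpleGraph (Fin n) → Finset (Finset (Fin n)) := fun G =>
    if n ≤ 2 * (C G).card then Finset.Icc ∅ (C G) else Finset.Icc (C G) Finset.univ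
  let A : Finset (SimpleGraph (Fin n)) := {G : SimpleGraph (Fin n) | IsUnipolar G}.toFinset
  have h1 : (A.sigma fam).card ≤ countUnipolar (n + 1) := by
    rw [← Set.ncard_coe_finset, countUnipolar]
    apply Set.ncard_le_ncard_of_injOn (fun p => addVertex p.1 p.2)
    · rintro ⟨G, S⟩ hp
      simp only [Finset.coe_sigma, Set.mem_sigma_iff, Finset.mem_coe, A, Set.mem_toFinset,
        Set.mem_ofPred_eq] at hp
      obtain ⟨hG, hS⟩ := hp
      obtain ⟨c1, c2⟩ := hC G hG
      by_cases hc : n ≤ 2 * (C G).card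
      · simp only [fam, if_pos hc, Finset.mem_Icc] at hS
        refine ⟨Fin.castSucc '' (C G), isUnipolarArrangement_iff.2 ⟨?_, ?_⟩⟩
        · rintro _ ⟨x, hx, rfl⟩ _ ⟨y, hy, rfl⟩ hxy
          rw [addVertex_castSucc]
          exact c1 hx hy (fun h => hxy (by rw [h]))
        · have hl : ∀ v, v ∉ Fin.castSucc '' (C G : Set (Fin n)) →
              ¬ (addVertex G S).Adj (Fin.last n) v := by
            intro v hv
            induction v using Fin.lastCases with
            | last => exact SimpleGraph.irrefl _
            | cast v =>
              rw [addVertex_last]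
              exact fun h => hv ⟨v, hS.2 h, rfl⟩
          intro u hu v hv w hw huv hvw hne
          induction u using Fin.lastCases with
          | last => exact absurd huv (hl v hv)
          | cast u =>
          induction v using Fin.lastCases with
          | last => exact absurd hvw (hl w hw)
          | cast v =>
          induction w using Fin.lastCases with
          | last => exact absurd hvw.symm (hl _ hv)
          | cast w =>
            rw [addVertex_castSucc] at *
            exact c2 u (fun h => hu ⟨u, h, rfl⟩) v (fun h => hv ⟨v, h, rfl⟩) w
              (fun h => hw ⟨w, h, rfl⟩) huv hvw (fun h => hne (by rw [h]))
      · simp only [fam, if_neg hc, Finset.mem_Icc] at hS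
        refine ⟨Fin.castSucc '' (C G) ∪ {Fin.last n}, isUnipolarArrangement_iff.2 ⟨?_, ?_⟩⟩
        · rintro _ (⟨x, hx, rfl⟩ | rfl) _ (⟨y, hy, rfl⟩ | rfl) hxy
          · rw [addVertex_castSucc]
            exact c1 hx hy (fun h => hxy (by rw [h]))
          · rw [SimpleGraph.adj_comm, addVertex_last]
            exact hS.1 hx
          · rw [addVertex_last]
            exact hS.1 hy
          · exact absurd rfl hxy
        · intro u hu v hv w hw huv hvw hne
          have hl : Fin.last n ∈ Fin.castSucc '' (C G : Set (Fin n)) ∪ {Fin.last n} := Or.inr rfl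
          induction u using Fin.lastCases with
          | last => exact absurd hl hu
          | cast u =>
          induction v using Fin.lastCases with
          | last => exact absurd hl hv
          | cast v =>
          induction w using Fin.lastCases with
          | last => exact absurd hl hw
          | cast w =>
            rw [addVertex_castSucc] at *
            exact c2 u (fun h => hu (Or.inl ⟨u, h, rfl⟩)) v (fun h => hv (Or.inl ⟨v, h, rfl⟩)) w
              (fun h => hw (Or.inl ⟨w, h, rfl⟩)) huv hvw (fun h => hne (by rw [h]))
    · rintro ⟨G, S⟩ _ ⟨G', S'⟩ _ h
      simp only at h
      have e1 : G = G' := by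
        ext x y
        rw [← addVertex_castSucc (S := S), h, addVertex_castSucc]
      have e2 : S = S' := by
        ext x
        rw [← addVertex_last (G := G), h, addVertex_last]
      subst e1 e2
      rfl
  rw [Finset.card_sigma] at h1
  have h2 : ∀ G ∈ A, (2 : ℝ) ^ ((n : ℝ) / 2) ≤ (fam G).card := by
    intro G _
    by_cases hc : n ≤ 2 * (C G).card
    · simp only [fam, if_pos hc]
      rw [Finset.card_Icc_finset (Finset.empty_subset _), Finset.card_empty, Nat.sub_zero]
      push_cast
      rw [← Real.rpow_natCast]
      apply Real.rpow_le_rpow_of_exponent_le (by norm_num)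
      have : (n : ℝ) ≤ 2 * (C G).card := by exact_mod_cast hc
      linarith
    · simp only [fam, if_neg hc]
      have h3 : (C G).card ≤ n := by simpa using (C G).card_le_univ
      rw [Finset.card_Icc_finset (Finset.subset_univ _), Finset.card_univ, Fintype.card_fin]
      push_cast
      rw [← Real.rpow_natCast]
      apply Real.rpow_le_rpow_of_exponent_le (by norm_num)
      rw [Nat.cast_sub h3]
      have : 2 * ((C G).card : ℝ) ≤ n := by exact_mod_cast (by omega : 2 * (C G).card ≤ n)
      linarith
  have hA : A.card = countUnipolar n := by rw [countUnipolar, Set.ncard_eq_toFinset_card']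
  calc _ = ∑ G ∈ A, (2 : ℝ) ^ ((n : ℝ) / 2) := by
        rw [Finset.sum_const, hA, nsmul_eq_mul, mul_comm]
    _ ≤ ∑ G ∈ A, ((fam G).card : ℝ) := Finset.sum_le_sum h2
    _ ≤ _ := by exact_mod_cast h1

lemma countUnipolar_add (n q : ℕ) :
    (2 : ℝ) ^ ((q : ℝ) * n / 2) * countUnipolar n ≤ countUnipolar (n + q) := by
  induction q with
  | zero => simp
  | succ q ih =>
    have h1 := countUnipolar_succ (n + q)
    rw [← Nat.add_assoc]
    refine le_trans ?_ h1
    calc _ = (2 : ℝ) ^ ((n : ℝ) / 2) * (2 ^ ((q : ℝ) * n / 2) * countUnipolar n) := by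
          rw [← mul_assoc, ← Real.rpow_add (by norm_num)]
          congr 2
          push_cast
          ring
      _ ≤ (2 : ℝ) ^ (((n + q : ℕ) : ℝ) / 2) * (2 ^ ((q : ℝ) * n / 2) * countUnipolar n) := by
          gcongr
          · norm_num
          · exact Nat.le_add_right _ _
      _ ≤ _ := by gcongr

lemma one_le_countUnipolar (n : ℕ) : 1 ≤ countUnipolar n := by
  rw [countUnipolar, Nat.one_le_iff_ne_zero, ← Nat.pos_iff_ne_zero, Set.ncard_pos (Set.toFinite _)]
  exact ⟨⊥, ∅, isUnipolarArrangement_iff.2 ⟨by simp, fun u _ v _ w _ h => absurd h (by simp)⟩⟩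

lemma ncard_isUnipolar_le {W : Type*} [Fintype W] :
    Set.ncard {G : SimpleGraph W | IsUnipolar G} ≤ countUnipolar (Fintype.card W) := by
  have e := (Fintype.equivFin W)
  apply Set.ncard_le_ncard_of_injOn (fun G => G.comap e.symm)
  · intro G hG
    exact hG.comap e.symm.toEmbedding
  · intro G _ G' _ h
    ext u v
    have : (G.comap e.symm).Adj (e u) (e v) ↔ (G'.comap e.symm).Adj (e u) (e v) := by
      simp only at h
      rw [h]
    simpa using this

/-- The unipolar graph with central clique `α` and side given by the fibres of `l`. -/
def unipolarGraph {α β γ : Type*} (f : α → β → Bool) (l : β → γ) : SimpleGraph (α ⊕ β) where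
  Adj u v := match u, v with
    | Sum.inl a, Sum.inl a' => a ≠ a'
    | Sum.inl a, Sum.inr b => f a b = true
    | Sum.inr b, Sum.inl a => f a b = true
    | Sum.inr b, Sum.inr b' => b ≠ b' ∧ l b = l b'
  symm := ⟨by
    rintro (a | b) (a' | b') h
    · exact Ne.symm h
    · exact h
    · exact h
    · exact ⟨h.1.symm, h.2.symm⟩⟩
  loopless := ⟨by
    rintro (a | b) h
    · exact h rfl
    · exact h.1 rfl⟩

lemma unipolarGraph_isUnipolar {α β γ : Type*} (f : α → β → Bool) (l : β → γ) :
    IsUnipolar (unipolarGraph f l) := by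
  refine ⟨Set.range Sum.inl, isUnipolarArrangement_iff.2 ⟨?_, ?_⟩⟩
  · rintro _ ⟨a, rfl⟩ _ ⟨b, rfl⟩ h
    exact fun h' => h (by rw [h'])
  · rintro (u | u) hu (v | v) hv (w | w) hw huv hvw hne
    any_goals first | exact absurd ⟨_, rfl⟩ hu | exact absurd ⟨_, rfl⟩ hv | exact absurd ⟨_, rfl⟩ hw
    exact ⟨fun h => hne (by rw [h]), huv.2.trans hvw.2⟩

lemma countUnipolar_lower (a K m : ℕ) :
    2 ^ (a * (K + m)) * K ^ m ≤ countUnipolar (a + (K + m)) := by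
  have h := ncard_isUnipolar_le (W := Fin a ⊕ (Fin K ⊕ Fin m))
  simp only [Fintype.card_sum, Fintype.card_fin] at h
  refine le_trans ?_ h
  have h2 : (Finset.univ : Finset ((Fin a → (Fin K ⊕ Fin m) → Bool) × (Fin m → Fin K))).card =
      2 ^ (a * (K + m)) * K ^ m := by
    rw [Finset.card_univ]
    simp only [Fintype.card_prod, Fintype.card_fun, Fintype.card_sum, Fintype.card_fin,
      Fintype.card_bool]
    rw [mul_comm a, pow_mul]
  rw [← h2, ← Set.ncard_coe_finset]
  apply Set.ncard_le_ncard_of_injOn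
    (fun p => unipolarGraph p.1 (Sum.elim id p.2 : Fin K ⊕ Fin m → Fin K))
  · intro p _
    exact unipolarGraph_isUnipolar _ _
  · rintro ⟨f, l⟩ _ ⟨f', l'⟩ _ h
    simp only at h
    have e1 : f = f' := by
      funext x y
      have h3 : (unipolarGraph f (Sum.elim id l : Fin K ⊕ Fin m → Fin K)).Adj (Sum.inl x) (Sum.inr y)
        ↔ (unipolarGraph f' (Sum.elim id l' : Fin K ⊕ Fin m → Fin K)).Adj (Sum.inl x) (Sum.inr y) := by
          rw [h]
      have h3' : f x y = true ↔ f' x y = true := h3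
      exact Bool.eq_iff_iff.2 h3'
    have e2 : l = l' := by
      funext x
      have h3 : (unipolarGraph f (Sum.elim id l : Fin K ⊕ Fin m → Fin K)).Adj
          (Sum.inr (Sum.inr x)) (Sum.inr (Sum.inl (l x)))
        ↔ (unipolarGraph f' (Sum.elim id l' : Fin K ⊕ Fin m → Fin K)).Adj
          (Sum.inr (Sum.inr x)) (Sum.inr (Sum.inl (l x))) := by
          rw [h]
      have h4 := h3.1 ⟨by simp, rfl⟩
      exact h4.2.symm
    rw [e1, e2]

end UnipolarCount

/-! ### Growth of the number of unipolar graphs -/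

section Growth

lemma eventually_countUnipolar_ge (A : ℝ) (hA : 0 < A) :
    ∀ᶠ n : ℕ in atTop,
      A ^ n * (n : ℝ) ^ ((n : ℝ) / 5) * 2 ^ ((n : ℝ) ^ 2 / 4) ≤ countUnipolar n := by
  have hlog : ∀ᶠ n : ℕ in atTop, 400 * (Real.log A + 1) ≤ Real.log n :=
    (Real.tendsto_log_atTop.comp tendsto_natCast_atTop_atTop).eventually_ge_atTop _
  filter_upwards [hlog, eventually_ge_atTop 900] with n hL hn
  have hn' : (900 : ℝ) ≤ n := by exact_mod_cast hn
  have hsq : (30 : ℝ) ≤ Real.sqrt n := Real.le_sqrt_of_sq_le (by linarith)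
  have hsq2 := Real.mul_self_sqrt (show (0 : ℝ) ≤ n by linarith)
  set K : ℕ := ⌈(n : ℝ) ^ ((9 : ℝ) / 20)⌉₊ with hK
  have hK1 : (n : ℝ) ^ ((9 : ℝ) / 20) ≤ K := Nat.le_ceil _
  have hK0 : (0 : ℝ) < K := lt_of_lt_of_le (Real.rpow_pos_of_pos (by linarith) _) hK1
  have hK2 : (K : ℝ) ≤ n / 20 := by
    have h1 := (Nat.ceil_lt_add_one (Real.rpow_nonneg (show (0 : ℝ) ≤ n by linarith)
      ((9 : ℝ) / 20))).le
    have h2 : (n : ℝ) ^ ((9 : ℝ) / 20) ≤ Real.sqrt n := by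
      rw [Real.sqrt_eq_rpow]
      exact Real.rpow_le_rpow_of_exponent_le (by linarith) (by norm_num)
    rw [← hK] at h1
    nlinarith
  have hab : n = n / 2 + (n - n / 2) := by omega
  have hb : (n : ℝ) / 2 ≤ (n - n / 2 : ℕ) := by
    have : n ≤ 2 * (n - n / 2) := by omega
    have : (n : ℝ) ≤ 2 * (n - n / 2 : ℕ) := by exact_mod_cast this
    linarith
  have hKb : K ≤ n - n / 2 := by
    have : (K : ℝ) ≤ (n - n / 2 : ℕ) := by linarith
    exact_mod_cast this
  obtain ⟨m, hm⟩ := Nat.exists_eq_add_of_le hKb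
  have hm' : (9 : ℝ) / 20 * n ≤ m := by
    have : ((n - n / 2 : ℕ) : ℝ) = K + m := by exact_mod_cast hm
    linarith
  have h := countUnipolar_lower (n / 2) K m
  rw [← hm, ← hab] at h
  have hprod : (n : ℝ) ^ 2 / 4 - 1 ≤ ((n / 2 * (n - n / 2) : ℕ) : ℝ) := by
    push_cast
    have h1 : ((n - n / 2 : ℕ) : ℝ) = n - (n / 2 : ℕ) := by
      rw [Nat.cast_sub (by omega)]
    rw [h1]
    have h2 : 2 * (n / 2) ≤ n := by omega
    have h3 : n ≤ 2 * (n / 2) + 1 := by omega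
    have h2' : 2 * ((n / 2 : ℕ) : ℝ) ≤ n := by exact_mod_cast h2
    have h3' : (n : ℝ) ≤ 2 * ((n / 2 : ℕ) : ℝ) + 1 := by exact_mod_cast h3
    nlinarith
  have h' : (2 : ℝ) ^ (n / 2 * (n - n / 2)) * (K : ℝ) ^ m ≤ countUnipolar n := by exact_mod_cast h
  refine le_trans ?_ h'
  have hn0 : (0 : ℝ) < n := by linarith
  rw [← Real.log_le_log_iff (by positivity) (by positivity), Real.log_mul (by positivity)
    (by positivity), Real.log_mul (by positivity) (by positivity), Real.log_mul (by positivity)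
    (by positivity), Real.log_pow, Real.log_rpow (by linarith), Real.log_rpow (by norm_num),
    Real.log_pow, Real.log_pow]
  have hlK : 9 / 20 * Real.log n ≤ Real.log K := by
    rw [← Real.log_rpow hn0]
    exact Real.log_le_log (by positivity) hK1
  have hln : 0 ≤ Real.log n := Real.log_nonneg (by linarith)
  have h5 : 9 / 20 * n * (9 / 20 * Real.log n) ≤ m * Real.log K := by
    apply mul_le_mul hm' hlK (by positivity) (by positivity)
  have hl2 : 0 < Real.log 2 := Real.log_pos (by norm_num)
  have hl2' : Real.log 2 ≤ 1 := by linarith [Real.log_two_lt_d9]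
  have h6 : ((n : ℝ) ^ 2 / 4 - 1) * Real.log 2 ≤ ((n / 2 * (n - n / 2) : ℕ) : ℝ) * Real.log 2 := by
    gcongr
  nlinarith

lemma eventually_le_mul_countUnipolar (A : ℝ) (hA : 0 < A) {ε : ℝ} (hε : 0 < ε) :
    ∀ᶠ n : ℕ in atTop,
      A ^ n * (n : ℝ) ^ ((n : ℝ) / 5) * 2 ^ ((n : ℝ) ^ 2 / 4) ≤ ε * countUnipolar n := by
  have h1 : ∀ᶠ n : ℕ in atTop, 1 / ε ≤ 2 ^ n :=
    (tendsto_pow_atTop_atTop_of_one_lt (by norm_num)).eventually_ge_atTop _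
  filter_upwards [eventually_countUnipolar_ge (2 * A) (by positivity), h1] with n hn h1
  rw [mul_pow] at hn
  rw [div_le_iff₀ hε] at h1
  calc _ = 1 * (A ^ n * (n : ℝ) ^ ((n : ℝ) / 5) * 2 ^ ((n : ℝ) ^ 2 / 4)) := by ring
    _ ≤ (2 ^ n * ε) * (A ^ n * (n : ℝ) ^ ((n : ℝ) / 5) * 2 ^ ((n : ℝ) ^ 2 / 4)) := by gcongr
    _ = ε * (2 ^ n * A ^ n * (n : ℝ) ^ ((n : ℝ) / 5) * 2 ^ ((n : ℝ) ^ 2 / 4)) := by ring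
    _ ≤ _ := by gcongr

lemma rareBound_le {c C : ℝ} {K n : ℕ} (hC : 0 ≤ C) (hK : K ≤ n)
    (h : ∀ m < n, (countC5Free m : ℝ) ≤ C * countUnipolar m) :
    rareBound c K n ≤ C * (K * (2 : ℝ) ^ ((K : ℝ) ^ 2 / 2 - c * n)) * countUnipolar n := by
  unfold rareBound
  have h1 : ∀ q ∈ Finset.Icc 1 K, countC5Free (n - q) * (2 : ℝ) ^ (((q : ℝ) / 2 - c) * n) ≤
      C * (2 : ℝ) ^ ((K : ℝ) ^ 2 / 2 - c * n) * countUnipolar n := by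
    intro q hq
    rw [Finset.mem_Icc] at hq
    have h2 := h (n - q) (by omega)
    have h3 := countUnipolar_add (n - q) q
    rw [Nat.sub_add_cancel (by omega)] at h3
    have h4 : ((n - q : ℕ) : ℝ) = n - q := by rw [Nat.cast_sub (by omega)]
    have h5 : ((q : ℝ) / 2 - c) * n = (q : ℝ) * (n - q : ℕ) / 2 + ((q : ℝ) ^ 2 / 2 - c * n) := by
      rw [h4]; ring
    have hqK : (q : ℝ) ≤ K := by exact_mod_cast hq.2
    calc _ ≤ (C * countUnipolar (n - q)) * (2 : ℝ) ^ (((q : ℝ) / 2 - c) * n) := by gcongr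
      _ = C * (2 : ℝ) ^ ((q : ℝ) ^ 2 / 2 - c * n) *
          (2 ^ ((q : ℝ) * (n - q : ℕ) / 2) * countUnipolar (n - q)) := by
        rw [h5, Real.rpow_add (by norm_num)]; ring
      _ ≤ _ := by
        gcongr
        norm_num
  refine (Finset.sum_le_sum h1).trans ?_
  rw [Finset.sum_const, Nat.card_Icc, nsmul_eq_mul]
  apply le_of_eq
  push_cast
  ring

lemma tendsto_rareFactor {c : ℝ} (hc : 0 < c) (C : ℝ) (K : ℕ) :
    Tendsto (fun n : ℕ => C * (K * (2 : ℝ) ^ ((K : ℝ) ^ 2 / 2 - c * n))) atTop (nhds 0) := by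
  have h1 : Tendsto (fun n : ℕ => ((2 : ℝ) ^ (-c)) ^ n) atTop (nhds 0) :=
    tendsto_pow_atTop_nhds_zero_of_lt_one (by positivity)
      (Real.rpow_lt_one_of_one_lt_of_neg (by norm_num) (by linarith))
  have h2 := h1.const_mul (C * (K * (2 : ℝ) ^ ((K : ℝ) ^ 2 / 2)))
  rw [mul_zero] at h2
  refine h2.congr fun n => ?_
  rw [← Real.rpow_natCast (2 ^ (-c)) n, ← Real.rpow_mul (by norm_num) (-c), sub_eq_add_neg,
    Real.rpow_add (by norm_num), neg_mul]
  ring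

lemma countC5Free_le_of_rare {P : (n : ℕ) → SimpleGraph (Fin n) → Prop} (hP : Rare P) {B : ℝ}
    (hB : ∀ᶠ n in atTop, (Set.ncard {G : SimpleGraph (Fin n) | C5Free G ∧ ¬ P n G} : ℝ) ≤
      B * countUnipolar n) :
    ∃ C, 0 ≤ C ∧ ∀ n, (countC5Free n : ℝ) ≤ C * countUnipolar n := by
  obtain ⟨c, hc, K, hP⟩ := hP
  have ht := (tendsto_rareFactor hc 1 K).eventually (gt_mem_nhds (show (0 : ℝ) < 1 / 2 by norm_num))
  obtain ⟨n₀, hn₀⟩ := eventually_atTop.1 (hP.and (hB.and (ht.and (eventually_ge_atTop K))))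
  set C : ℝ := 2 * |B| + ∑ n ∈ Finset.range n₀, (countC5Free n : ℝ) with hC
  have hC0 : 0 ≤ C := by positivity
  refine ⟨C, hC0, fun n => ?_⟩
  induction n using Nat.strong_induction_on with
  | _ n ih =>
    have hU : (1 : ℝ) ≤ countUnipolar n := by exact_mod_cast one_le_countUnipolar n
    by_cases hn : n < n₀
    · have h1 : (countC5Free n : ℝ) ≤ ∑ n ∈ Finset.range n₀, (countC5Free n : ℝ) :=
        Finset.single_le_sum (f := fun n => (countC5Free n : ℝ)) (fun _ _ => by positivity)
          (Finset.mem_range.2 hn)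
      have h2 : (countC5Free n : ℝ) ≤ C := by
        have := abs_nonneg B
        linarith
      nlinarith
    · obtain ⟨h1, h2, h3, h4⟩ := hn₀ n (by omega)
      have h5 := rareBound_le (c := c) hC0 h4 ih
      have h6 : (countC5Free n : ℝ) ≤
          (Set.ncard {G : SimpleGraph (Fin n) | C5Free G ∧ P n G} : ℝ) +
          (Set.ncard {G : SimpleGraph (Fin n) | C5Free G ∧ ¬ P n G} : ℝ) := by
        have h7 : {G : SimpleGraph (Fin n) | C5Free G} =
          {G : SimpleGraph (Fin n) | C5Free G ∧ P n G} ∪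
          {G : SimpleGraph (Fin n) | C5Free G ∧ ¬ P n G} := by
          ext G
          exact ⟨fun h => (em (P n G)).imp (fun h' => ⟨h, h'⟩) (fun h' => ⟨h, h'⟩),
            fun h => h.elim And.left And.left⟩
        have h8 := Set.ncard_union_le {G : SimpleGraph (Fin n) | C5Free G ∧ P n G}
          {G : SimpleGraph (Fin n) | C5Free G ∧ ¬ P n G}
        rw [← h7] at h8
        exact_mod_cast h8
      have h9 : C * (K * (2 : ℝ) ^ ((K : ℝ) ^ 2 / 2 - c * n)) ≤ C * (1 / 2) := by
        rw [one_mul] at h3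
        exact mul_le_mul_of_nonneg_left h3.le hC0
      have h10 : B ≤ C / 2 := by
        have h11 : 0 ≤ ∑ n ∈ Finset.range n₀, (countC5Free n : ℝ) := by positivity
        have := le_abs_self B
        linarith
      nlinarith

lemma Rare.eventually_le {P : (n : ℕ) → SimpleGraph (Fin n) → Prop} (hP : Rare P) {C : ℝ}
    (hC : 0 ≤ C) (h : ∀ n, (countC5Free n : ℝ) ≤ C * countUnipolar n) {ε : ℝ} (hε : 0 < ε) :
    ∀ᶠ n in atTop, (Set.ncard {G : SimpleGraph (Fin n) | C5Free G ∧ P n G} : ℝ) ≤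
      ε * countUnipolar n := by
  obtain ⟨c, hc, K, hP⟩ := hP
  have ht := (tendsto_rareFactor hc C K).eventually (gt_mem_nhds hε)
  filter_upwards [hP, ht, eventually_ge_atTop K] with n h1 h2 h3
  refine h1.trans ((rareBound_le hC h3 fun m _ => h m).trans ?_)
  gcongr

end Growth

/-! ### Typical graphs: number of types and random-like behaviour -/

section Typical

/-- The number of ways in which the neighbourhoods of the vertices outside `S` can be chosen is
large, whenever they are restricted by four families of subsets of `S`. -/
def ManyTypes {V : Type*} [Fintype V] (G : SimpleGraph V) (S : Finset V) : Prop :=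
  ∀ (κ : V → Fin 4) (F : Fin 4 → Finset (Finset V)), (∀ i, F i ⊆ S.powerset) →
    (∀ v ∉ S, nbrIn G S v ∈ F (κ v)) →
      (2 : ℝ) ^ (((S.card : ℝ) / 2 - 3) * Fintype.card V) ≤ ∏ v ∈ Sᶜ, ((F (κ v)).card : ℝ)

lemma nbrIn_subset {V : Type*} (G : SimpleGraph V) (S : Finset V) (v : V) : nbrIn G S v ⊆ S :=
  Finset.filter_subset _ _

lemma typical_manyTypes (s : ℕ) :
    ∀ᶠ x in typicalGraphs, ∀ S : Finset (Fin x.1), S.card = s → ManyTypes x.2 S := by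
  rcases Nat.eq_zero_or_pos s with rfl | hs
  · refine Eventually.of_forall fun x S hS κ F hF h => ?_
    obtain rfl : S = ∅ := Finset.card_eq_zero.1 hS
    have h1 : ∀ v ∈ (∅ : Finset (Fin x.1))ᶜ, (1 : ℝ) ≤ ((F (κ v)).card : ℝ) := by
      intro v _
      exact_mod_cast Finset.card_pos.2 ⟨_, h v (Finset.notMem_empty v)⟩
    refine le_trans ?_ (Finset.one_le_prod h1)
    apply Real.rpow_le_one_of_one_le_of_nonpos (by norm_num)
    have : (0 : ℝ) ≤ Fintype.card (Fin x.1) := by positivity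
    simp only [Finset.card_empty, Nat.cast_zero]
    nlinarith
  have key := rare_of_nbrIn hs (c := 1 / 2) (by norm_num)
    (P := fun n S G => ¬ ManyTypes G S) ?_
  · filter_upwards [key] with x hx S hS
    exact not_not.1 (hx S hS)
  set D : ℕ := (2 ^ 2 ^ s) ^ 4 * (2 ^ s) ^ s with hD
  have hlim : ∀ᶠ n : ℕ in atTop, (D : ℝ) ≤ (2 : ℝ) ^ ((1 / 2 : ℝ) * n) := by
    have h1 : Tendsto (fun n : ℕ => ((2 : ℝ) ^ (1 / 2 : ℝ)) ^ n) atTop atTop :=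
      tendsto_pow_atTop_atTop_of_one_lt (Real.one_lt_rpow (by norm_num) (by norm_num))
    filter_upwards [h1.eventually_ge_atTop (D : ℝ)] with n hn
    rwa [Real.rpow_mul (by norm_num), Real.rpow_natCast]
  filter_upwards [hlim] with n hn S hS
  set cert : Finset ((Fin n → Fin 4) × (Fin 4 → Finset (Finset (Fin n)))) :=
    (Finset.univ ×ˢ Fintype.piFinset fun _ => S.powerset.powerset).filter fun p =>
      ∏ v ∈ Sᶜ, ((p.2 (p.1 v)).card : ℝ) < (2 : ℝ) ^ (((s : ℝ) / 2 - 3) * n) with hcert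
  set box : (Fin n → Fin 4) × (Fin 4 → Finset (Finset (Fin n))) → Finset (Fin n → Finset (Fin n)) :=
    fun p => Fintype.piFinset fun v => if v ∈ S then S.powerset else p.2 (p.1 v) with hbox
  refine ⟨fun _ => ⋃ p ∈ cert, (box p : Set _), fun _ => ?_, fun G _ hG => ?_⟩
  · have h1 := Finset.set_ncard_biUnion_le cert (fun p => (box p : Set (Fin n → Finset (Fin n))))
    have h2 : ∀ p ∈ cert, (((box p : Set (Fin n → Finset (Fin n))).ncard : ℕ) : ℝ) ≤
        ((2 ^ s) ^ s : ℕ) * (2 : ℝ) ^ (((s : ℝ) / 2 - 3) * n) := by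
      intro p hp
      rw [Set.ncard_coe_finset, hbox]
      simp only [Fintype.card_piFinset]
      rw [← Finset.prod_mul_prod_compl S]
      push_cast
      have e1 : ∏ v ∈ S, (((if v ∈ S then S.powerset else p.2 (p.1 v)).card : ℕ) : ℝ) =
          (2 ^ s) ^ s := by
        rw [Finset.prod_congr rfl (g := fun _ => ((2 : ℝ) ^ s)), Finset.prod_const, hS]
        intro v hv
        rw [if_pos hv, Finset.card_powerset, hS]
        push_cast
        rfl
      have e2 : ∏ v ∈ Sᶜ, (((if v ∈ S then S.powerset else p.2 (p.1 v)).card : ℕ) : ℝ) =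
          ∏ v ∈ Sᶜ, ((p.2 (p.1 v)).card : ℝ) := by
        apply Finset.prod_congr rfl
        intro v hv
        rw [if_neg (Finset.mem_compl.1 hv)]
      rw [e1, e2]
      gcongr
      exact (Finset.mem_filter.1 hp).2.le
    have h3 : cert.card ≤ 4 ^ n * (2 ^ 2 ^ s) ^ 4 := by
      refine (Finset.card_filter_le _ _).trans ?_
      rw [Finset.card_product, Fintype.card_piFinset]
      simp [Finset.card_powerset, hS]
    calc _ ≤ ∑ p ∈ cert, (((box p : Set (Fin n → Finset (Fin n))).ncard : ℕ) : ℝ) := by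
          exact_mod_cast h1
      _ ≤ ∑ p ∈ cert, ((2 ^ s) ^ s : ℕ) * (2 : ℝ) ^ (((s : ℝ) / 2 - 3) * n) :=
          Finset.sum_le_sum h2
      _ = cert.card * (((2 ^ s) ^ s : ℕ) * (2 : ℝ) ^ (((s : ℝ) / 2 - 3) * n)) := by
          rw [Finset.sum_const, nsmul_eq_mul]
      _ ≤ (4 ^ n * (2 ^ 2 ^ s) ^ 4 : ℕ) * (((2 ^ s) ^ s : ℕ) *
            (2 : ℝ) ^ (((s : ℝ) / 2 - 3) * n)) := by
          gcongr
      _ = D * (2 : ℝ) ^ ((2 : ℝ) * n) * (2 : ℝ) ^ (((s : ℝ) / 2 - 3) * n) := by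
          have h4 : (2 : ℝ) ^ ((2 : ℝ) * n) = 4 ^ n := by
            rw [Real.rpow_mul (by norm_num), Real.rpow_natCast]
            norm_num
          rw [hD, h4]
          push_cast
          ring
      _ ≤ (2 : ℝ) ^ ((1 / 2 : ℝ) * n) * (2 : ℝ) ^ ((2 : ℝ) * n) *
            (2 : ℝ) ^ (((s : ℝ) / 2 - 3) * n) := by gcongr
      _ = _ := by
          rw [← Real.rpow_add (by norm_num), ← Real.rpow_add (by norm_num)]
          congr 1
          ring
  · unfold ManyTypes at hG
    push Not at hG
    obtain ⟨κ, F, hF, hκ, hlt⟩ := hG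
    simp only [Set.mem_iUnion]
    refine ⟨(κ, F), ?_, ?_⟩
    · rw [hcert, Finset.mem_filter]
      refine ⟨Finset.mem_product.2 ⟨Finset.mem_univ _, Fintype.mem_piFinset.2 fun i =>
        Finset.mem_powerset.2 (hF i)⟩, ?_⟩
      rw [hS, Fintype.card_fin] at hlt
      refine lt_of_le_of_lt (le_of_eq ?_) hlt
      congr!
    · rw [Finset.mem_coe, hbox]
      refine Fintype.mem_piFinset.2 fun v => ?_
      by_cases hv : v ∈ S
      · rw [if_pos hv]
        exact Finset.mem_powerset.2 (nbrIn_subset _ _ _)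
      · rw [if_neg hv]
        exact hκ v hv

lemma exists_card_small_subsets_le {γ : ℝ} (hγ : 0 < γ) : ∃ e > 0, ∀ n : ℕ,
    (((Finset.univ : Finset (Finset (Fin n))).filter fun E => (E.card : ℝ) ≤ e * n).card : ℝ) ≤
      (2 : ℝ) ^ (γ * n) := by
  set y : ℝ := (2 : ℝ) ^ (γ / 2) with hy
  have hy1 : 1 < y := Real.one_lt_rpow (by norm_num) (by positivity)
  set x : ℝ := min (y - 1) (1 / 2) with hx
  have hx0 : 0 < x := lt_min (by linarith) (by norm_num)
  have hx1 : x ≤ 1 / 2 := min_le_right _ _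
  have hxy : 1 + x ≤ y := by linarith [min_le_left (y - 1) (1 / 2)]
  have hlx : Real.log x < 0 := Real.log_neg hx0 (by linarith)
  have hl2 : 0 < Real.log 2 := Real.log_pos (by norm_num)
  set e : ℝ := γ / 2 * Real.log 2 / (-Real.log x) with he
  have he0 : 0 < e := div_pos (by positivity) (by linarith)
  have hxe : x ^ e = y⁻¹ := by
    rw [hy, ← Real.rpow_neg (by norm_num), Real.rpow_def_of_pos hx0,
      Real.rpow_def_of_pos (by norm_num), he]
    congr 1
    have := hlx.ne
    field_simp
  refine ⟨e, he0, fun n => ?_⟩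
  have h1 : (1 + x) ^ n = ∑ E : Finset (Fin n), x ^ E.card := by
    have := Finset.prod_add (fun _ : Fin n => x) (fun _ => 1) Finset.univ
    simp only [Finset.prod_const, Finset.card_univ, Fintype.card_fin, one_pow, mul_one,
      Finset.powerset_univ] at this
    rw [add_comm, this]
  have h2 : ∑ E ∈ (Finset.univ : Finset (Finset (Fin n))).filter fun E => (E.card : ℝ) ≤ e * n,
      x ^ (e * n) ≤ (1 + x) ^ n := by
    rw [h1]
    refine le_trans (Finset.sum_le_sum (g := fun E : Finset (Fin n) => x ^ E.card) ?_)
      (Finset.sum_le_sum_of_subset_of_nonneg (Finset.subset_univ _) fun _ _ _ => by positivity)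
    intro E hE
    rw [← Real.rpow_natCast]
    exact Real.rpow_le_rpow_of_exponent_ge hx0 (by linarith) (Finset.mem_filter.1 hE).2
  rw [Finset.sum_const, nsmul_eq_mul, Real.rpow_mul hx0.le, hxe, Real.rpow_natCast, inv_pow] at h2
  have h3 : (1 + x) ^ n ≤ y ^ n := by gcongr
  have h4 : (2 : ℝ) ^ (γ * n) = y ^ n * y ^ n := by
    rw [← mul_pow, hy, ← Real.rpow_add (by norm_num), add_halves, Real.rpow_mul (by norm_num),
      Real.rpow_natCast]
  rw [h4]
  have hyn : 0 < y ^ n := by positivity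
  rw [← div_eq_mul_inv, div_le_iff₀ hyn] at h2
  nlinarith

/-- `W` contains `k` disjoint pairs of vertices related by `ρ`. -/
def HasMatching {V : Type*} (ρ : V → V → Prop) (W : Finset V) (k : ℕ) : Prop :=
  ∃ f : Fin k × Bool ↪ V, (∀ p, f p ∈ W) ∧ ∀ i, ρ (f (i, false)) (f (i, true))

lemma ncard_matching_types {V : Type*} [Fintype V] (Q R E : Finset V) {k : ℕ}
    (f : Fin k × Bool ↪ V) (hf : ∀ p, f p ∈ R) (pred : V → Finset V) {π π' : Finset V}
    (hπ : π ⊆ Q) (hπ' : π' ⊆ Q) (hQ : 1 ≤ Q.card) :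
    (Set.ncard {τ : V → Finset V | (∀ v, τ v ⊆ Q) ∧ (∀ v ∉ R, τ v = pred v) ∧
      ∀ i, f (i, false) ∉ E → f (i, true) ∉ E →
        ¬ (τ (f (i, false)) = π ∧ τ (f (i, true)) = π')} : ℝ) ≤
      ((2 : ℝ) ^ Q.card) ^ R.card * (1 - (4 ^ Q.card)⁻¹) ^ ((k : ℝ) - E.card) := by
  set M : Finset (Fin k) :=
    Finset.univ.filter fun i => f (i, false) ∉ E ∧ f (i, true) ∉ E with hM
  have hMk : k ≤ M.card + E.card := by
    have h1 : (Mᶜ).card ≤ E.card := by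
      apply Finset.card_le_card_of_injOn
        (fun i => if f (i, false) ∈ E then f (i, false) else f (i, true))
      · intro i hi
        simp only [hM, Finset.coe_compl, Set.mem_compl_iff, Finset.mem_coe, Finset.mem_filter,
          Finset.mem_univ, true_and, not_and_or, not_not] at hi
        by_cases h : f (i, false) ∈ E
        · simp [h]
        · simpa [h] using hi
      · intro i _ j _ h
        simp only at h
        split_ifs at h <;> simpa using f.injective h
    rw [Finset.card_compl, Fintype.card_fin] at h1
    omega
  set N : Finset V := (M ×ˢ (Finset.univ : Finset Bool)).map f with hN
  have hNR : N ⊆ R := by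
    intro v hv
    obtain ⟨p, _, rfl⟩ := Finset.mem_map.1 hv
    exact hf p
  have hNcard : N.card = 2 * M.card := by
    rw [hN, Finset.card_map, Finset.card_product, Finset.card_univ, Fintype.card_bool, mul_comm]
  set target : Finset (((R \ N : Finset V) → Finset V) × (M → Finset V × Finset V)) :=
    (Fintype.piFinset fun _ => Q.powerset) ×ˢ
      (Fintype.piFinset fun _ => (Q.powerset ×ˢ Q.powerset).erase (π, π')) with htarget
  have htc : target.card = (2 ^ Q.card) ^ (R.card - 2 * M.card) * (4 ^ Q.card - 1) ^ M.card := by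
    rw [htarget, Finset.card_product, Fintype.card_piFinset, Fintype.card_piFinset]
    simp only [Finset.card_powerset, Finset.prod_const, Finset.card_univ, Fintype.card_coe]
    rw [Finset.card_erase_of_mem (Finset.mem_product.2 ⟨Finset.mem_powerset.2 hπ,
      Finset.mem_powerset.2 hπ'⟩), Finset.card_product, Finset.card_powerset,
      Finset.card_sdiff_of_subset hNR, hNcard, ← mul_pow]
    norm_num
  have hle : Set.ncard {τ : V → Finset V | (∀ v, τ v ⊆ Q) ∧ (∀ v ∉ R, τ v = pred v) ∧
      ∀ i, f (i, false) ∉ E → f (i, true) ∉ E →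
        ¬ (τ (f (i, false)) = π ∧ τ (f (i, true)) = π')} ≤ target.card := by
    rw [← Set.ncard_coe_finset]
    apply Set.ncard_le_ncard_of_injOn (fun τ => (fun v : (R \ N : Finset V) => τ v,
      fun i : M => (τ (f (i, false)), τ (f (i, true)))))
    · rintro τ ⟨h1, h2, h3⟩
      rw [Finset.mem_coe, htarget, Finset.mem_product]
      refine ⟨Fintype.mem_piFinset.2 fun v => Finset.mem_powerset.2 (h1 _),
        Fintype.mem_piFinset.2 fun i => Finset.mem_erase.2 ⟨?_, Finset.mem_product.2
          ⟨Finset.mem_powerset.2 (h1 _), Finset.mem_powerset.2 (h1 _)⟩⟩⟩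
      have hi := (Finset.mem_filter.1 i.2).2
      intro h
      exact h3 i hi.1 hi.2 ⟨congrArg Prod.fst h, congrArg Prod.snd h⟩
    · rintro τ ⟨h1, h2, h3⟩ τ' ⟨h1', h2', h3'⟩ h
      simp only [Prod.mk.injEq] at h
      funext v
      by_cases hv : v ∈ R
      · by_cases hvN : v ∈ N
        · obtain ⟨⟨i, b⟩, hp, rfl⟩ := Finset.mem_map.1 hvN
          have := congrFun h.2 ⟨i, (Finset.mem_product.1 hp).1⟩
          simp only [Prod.mk.injEq] at this
          cases b
          · exact this.1
          · exact this.2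
        · exact congrFun h.1 ⟨v, Finset.mem_sdiff.2 ⟨hv, hvN⟩⟩
      · rw [h2 v hv, h2' v hv]
  have h4 : (1 : ℝ) ≤ 4 ^ Q.card := one_le_pow₀ (by norm_num)
  have h2MR : 2 * M.card ≤ R.card := hNcard ▸ Finset.card_le_card hNR
  calc _ ≤ (target.card : ℝ) := by exact_mod_cast hle
    _ = ((2 : ℝ) ^ Q.card) ^ (R.card - 2 * M.card) * (4 ^ Q.card - 1) ^ M.card := by
      rw [htc, Nat.cast_mul, Nat.cast_pow, Nat.cast_pow, Nat.cast_pow,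
        Nat.cast_sub (Nat.one_le_pow _ _ (by norm_num))]
      push_cast
      rfl
    _ = ((2 : ℝ) ^ Q.card) ^ R.card * (1 - (4 ^ Q.card)⁻¹) ^ M.card := by
      have e1 : (4 : ℝ) ^ Q.card - 1 = ((2 : ℝ) ^ Q.card) ^ 2 * (1 - (4 ^ Q.card)⁻¹) := by
        rw [← pow_mul, mul_comm Q.card 2, pow_mul]
        norm_num
        field_simp
      rw [e1, mul_pow, ← mul_assoc, ← pow_mul _ 2, ← pow_add, Nat.sub_add_cancel h2MR]
    _ ≤ _ := by
      rw [← Real.rpow_natCast _ M.card]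
      have h5 : (1 : ℝ) < 4 ^ Q.card := one_lt_pow₀ (by norm_num) (by omega)
      have h6 : ((4 : ℝ) ^ Q.card)⁻¹ < 1 := inv_lt_one_of_one_lt₀ h5
      have h7 : 0 < ((4 : ℝ) ^ Q.card)⁻¹ := by positivity
      gcongr ?_ * ?_
      apply Real.rpow_le_rpow_of_exponent_ge (by linarith) (by linarith)
      rw [sub_le_iff_le_add]
      exact_mod_cast hMk

end Typical

section Certificates

lemma eventually_poly_le (d : ℕ) (D : ℝ) {γ : ℝ} (hγ : 0 < γ) :
    ∀ᶠ n : ℕ in atTop, D * ((n : ℝ) + 2) ^ d ≤ (2 : ℝ) ^ (γ * n) := by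
  have h1 := isLittleO_pow_const_const_pow_of_one_lt (R := ℝ) d
    (r := (2 : ℝ) ^ γ) (Real.one_lt_rpow (by norm_num) hγ)
  have hc : 0 < ((|D| + 1) * 3 ^ d)⁻¹ := by positivity
  filter_upwards [h1.bound hc, eventually_ge_atTop 1] with n hn hn1
  rw [Real.norm_of_nonneg (by positivity), Real.norm_of_nonneg (by positivity),
    inv_mul_eq_div, le_div_iff₀ (by positivity)] at hn
  rw [Real.rpow_mul (by norm_num), Real.rpow_natCast]
  refine le_trans ?_ hn
  have h2 : (1 : ℝ) ≤ n := by exact_mod_cast hn1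
  calc D * ((n : ℝ) + 2) ^ d ≤ (|D| + 1) * (3 * n) ^ d := by
        gcongr
        · linarith [le_abs_self D]
        · linarith
    _ = _ := by rw [mul_pow]; ring

/-- A typical graph has no large structure violating a certificate for the adjacencies
to a bounded set `Q`. -/
lemma typical_of_certificate {q : ℕ} (hq : 1 ≤ q) {μ : ℝ} (hμ : 0 < μ) :
    ∃ e > 0, ∀ (Cert : ℕ → Type) [∀ n, Fintype (Cert n)] (d : ℕ),
      (∀ n, Fintype.card (Cert n) ≤ (n + 2) ^ d) →
    ∀ (side : ∀ n, Cert n → Finset (Fin n) → SimpleGraph (Fin n) → Finset (Fin n))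
      (pred : ∀ n, Cert n → Finset (Fin n) → SimpleGraph (Fin n) → Fin n → Finset (Fin n))
      (rel : ∀ n, Cert n → SimpleGraph (Fin n) → Fin n → Fin n → Prop),
    ∀ᶠ x in typicalGraphs, ∀ Q : Finset (Fin x.1), Q.card = q →
      ¬ ∃ (z : Cert x.1) (E π π' : Finset (Fin x.1)), π ⊆ Q ∧ π' ⊆ Q ∧ (E.card : ℝ) ≤ e * x.1 ∧
        ((side x.1 z Q (delVerts x.2 Q)).card : ℝ) ≤ (1 / 2 + e) * x.1 ∧
        (∀ v, v ∉ Q → v ∉ side x.1 z Q (delVerts x.2 Q) → v ∉ E →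
          nbrIn x.2 Q v = pred x.1 z Q (delVerts x.2 Q) v) ∧
        HasMatching (rel x.1 z (delVerts x.2 Q)) (side x.1 z Q (delVerts x.2 Q)) ⌈μ * x.1⌉₊ ∧
        ∀ b b' : Fin x.1, b ∈ side x.1 z Q (delVerts x.2 Q) →
          b' ∈ side x.1 z Q (delVerts x.2 Q) → b ∉ E → b' ∉ E → rel x.1 z (delVerts x.2 Q) b b' →
            nbrIn x.2 Q b = π → nbrIn x.2 Q b' = π' → False := by
  have h4q : (1 : ℝ) < 4 ^ q := one_lt_pow₀ (by norm_num) (by omega)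
  have h6 : ((4 : ℝ) ^ q)⁻¹ < 1 := inv_lt_one_of_one_lt₀ h4q
  have h7 : 0 < ((4 : ℝ) ^ q)⁻¹ := by positivity
  set β : ℝ := -Real.logb 2 (1 - ((4 : ℝ) ^ q)⁻¹) with hβ
  have hβ0 : 0 < β := neg_pos.2 (Real.logb_neg (by norm_num) (by linarith) (by linarith))
  have hβ2 : 1 - ((4 : ℝ) ^ q)⁻¹ = (2 : ℝ) ^ (-β) := by
    rw [hβ, neg_neg, Real.rpow_logb (by norm_num) (by norm_num) (by linarith)]
  set γ : ℝ := β * μ / 8 with hγ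
  have hγ0 : 0 < γ := by positivity
  obtain ⟨e₁, he₁, hE⟩ := exists_card_small_subsets_le hγ0
  set e : ℝ := min e₁ (β * μ / (8 * (2 * q + β))) with he
  have he0 : 0 < e := lt_min he₁ (by positivity)
  have he2 : (2 * q + β) * e ≤ β * μ / 8 := by
    calc (2 * q + β) * e ≤ (2 * q + β) * (β * μ / (8 * (2 * q + β))) := by
          gcongr
          exact min_le_right _ _
      _ = _ := by field_simp
  refine ⟨e, he0, fun Cert _ d hd side pred rel => ?_⟩
  refine rare_of_nbrIn hq (c := β * μ / 2) (by positivity)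
    (P := fun n Q G => ∃ (z : Cert n) (E π π' : Finset (Fin n)), π ⊆ Q ∧ π' ⊆ Q ∧
        (E.card : ℝ) ≤ e * n ∧ ((side n z Q (delVerts G Q)).card : ℝ) ≤ (1 / 2 + e) * n ∧
        (∀ v, v ∉ Q → v ∉ side n z Q (delVerts G Q) → v ∉ E →
          nbrIn G Q v = pred n z Q (delVerts G Q) v) ∧
        HasMatching (rel n z (delVerts G Q)) (side n z Q (delVerts G Q)) ⌈μ * n⌉₊ ∧
        ∀ b b' : Fin n, b ∈ side n z Q (delVerts G Q) → b' ∈ side n z Q (delVerts G Q) → b ∉ E →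
          b' ∉ E → rel n z (delVerts G Q) b b' →
            nbrIn G Q b = π → nbrIn G Q b' = π' → False) ?_
  filter_upwards [eventually_poly_le d ((2 ^ q) ^ q * (2 ^ q * 2 ^ q)) hγ0] with n hn Q hQ
  set X : SimpleGraph (Fin n) → Cert n × Finset (Fin n) × Finset (Fin n) × Finset (Fin n) →
      Set (Fin n → Finset (Fin n)) := fun H p =>
    {τ | (∀ v, τ v ⊆ Q) ∧ (∀ v ∉ side n p.1 Q H ∪ Q ∪ p.2.1, τ v = pred n p.1 Q H v) ∧
        ∀ b b', b ∈ side n p.1 Q H → b' ∈ side n p.1 Q H → b ∉ p.2.1 → b' ∉ p.2.1 → rel n p.1 H b b' →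
            τ b = p.2.2.1 → τ b' = p.2.2.2 → False} with hX
  set I : SimpleGraph (Fin n) →
      Finset (Cert n × Finset (Fin n) × Finset (Fin n) × Finset (Fin n)) := fun H =>
    (Finset.univ ×ˢ (Finset.univ.filter fun E : Finset (Fin n) => (E.card : ℝ) ≤ e₁ * n) ×ˢ
      Q.powerset ×ˢ Q.powerset).filter fun p => (p.2.1.card : ℝ) ≤ e * n ∧
        ((side n p.1 Q H).card : ℝ) ≤ (1 / 2 + e) * n ∧
        HasMatching (rel n p.1 H) (side n p.1 Q H) ⌈μ * n⌉₊ with hI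
  have hIc : ∀ H, ((I H).card : ℝ) ≤ (n + 2) ^ d * (2 : ℝ) ^ (γ * n) * (2 ^ q * 2 ^ q) := by
    intro H
    have h1 : (I H).card ≤ Fintype.card (Cert n) *
        ((Finset.univ.filter fun E : Finset (Fin n) => (E.card : ℝ) ≤ e₁ * n).card *
          (2 ^ q * 2 ^ q)) := by
      refine (Finset.card_filter_le _ _).trans (le_of_eq ?_)
      rw [Finset.card_product, Finset.card_product, Finset.card_product, Finset.card_powerset, hQ,
        Finset.card_univ]
    have h2 : (Fintype.card (Cert n) : ℝ) ≤ (n + 2) ^ d := by exact_mod_cast hd n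
    calc ((I H).card : ℝ) ≤ (Fintype.card (Cert n) *
        ((Finset.univ.filter fun E : Finset (Fin n) => (E.card : ℝ) ≤ e₁ * n).card *
          (2 ^ q * 2 ^ q)) : ℕ) := Nat.cast_le.2 h1
      _ = (Fintype.card (Cert n) : ℝ) *
        ((Finset.univ.filter fun E : Finset (Fin n) => (E.card : ℝ) ≤ e₁ * n).card *
          (2 ^ q * 2 ^ q)) := by
          rw [Nat.cast_mul, Nat.cast_mul, Nat.cast_mul, Nat.cast_pow, Nat.cast_ofNat]
      _ ≤ (n + 2) ^ d * ((2 : ℝ) ^ (γ * n) * (2 ^ q * 2 ^ q)) := by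
          exact mul_le_mul h2 (mul_le_mul_of_nonneg_right (hE n) (by positivity))
            (mul_nonneg (Nat.cast_nonneg _) (by positivity)) (by positivity)
      _ = _ := by ring
  have hXc : ∀ H, ∀ p ∈ I H, ((X H p).ncard : ℝ) ≤
      (2 ^ q) ^ q * (2 : ℝ) ^ (((q : ℝ) / 2 - 7 / 8 * (β * μ)) * n) := by
    rintro H ⟨z, E, π, π'⟩ hp
    rw [hI, Finset.mem_filter] at hp
    obtain ⟨hp1, hp2, hp3, f, hf1, hf2⟩ := hp
    simp only [Finset.mem_product, Finset.mem_powerset] at hp1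
    set R : Finset (Fin n) := side n z Q H ∪ Q ∪ E with hR
    have hRc : (R.card : ℝ) ≤ (1 / 2 + e) * n + q + e * n := by
      have h1 : R.card ≤ (side n z Q H).card + Q.card + E.card :=
        (Finset.card_union_le _ _).trans (Nat.add_le_add_right (Finset.card_union_le _ _) _)
      have h2 : (R.card : ℝ) ≤ (side n z Q H).card + Q.card + E.card := by exact_mod_cast h1
      rw [hQ] at h2
      linarith
    have h1 := ncard_matching_types Q R E f (fun p => by simp [hR, hf1 p]) (pred n z Q H)
      hp1.2.2.1 hp1.2.2.2 (by omega)
    have h2 : (X H (z, E, π, π')).ncard ≤ Set.ncard {τ : Fin n → Finset (Fin n) |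
      (∀ v, τ v ⊆ Q) ∧ (∀ v ∉ R, τ v = pred n z Q H v) ∧
      ∀ i, f (i, false) ∉ E → f (i, true) ∉ E →
        ¬ (τ (f (i, false)) = π ∧ τ (f (i, true)) = π')} := by
      apply Set.ncard_le_ncard _ (Set.toFinite _)
      rintro τ ⟨h3, h4, h5⟩
      exact ⟨h3, h4, fun i hi hi' h => h5 _ _ (hf1 _) (hf1 _) hi hi' (hf2 i) h.1 h.2⟩
    refine (Nat.cast_le.2 h2).trans (h1.trans ?_)
    rw [hQ, hβ2, ← Real.rpow_mul (by norm_num), ← pow_mul, ← Real.rpow_natCast 2 (q * R.card),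
      ← Real.rpow_add (by norm_num), ← pow_mul, ← Real.rpow_natCast 2 (q * q),
      ← Real.rpow_add (by norm_num)]
    apply Real.rpow_le_rpow_of_exponent_le (by norm_num)
    push_cast
    have hk : μ * n ≤ (⌈μ * n⌉₊ : ℝ) := Nat.le_ceil _
    have h3 : (q : ℝ) * R.card ≤ q * ((1 / 2 + e) * n + q + e * n) := by gcongr
    have h4 : β * ((μ - e) * n) ≤ β * ((⌈μ * n⌉₊ : ℝ) - E.card) := by
      gcongr
      linarith
    have h5 : (2 * q + β) * e * n ≤ β * μ / 8 * n := by gcongr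
    linarith
  refine ⟨fun H => ⋃ p ∈ I H, X H p, fun H => ?_, fun G _ hG => ?_⟩
  · have h1 := Finset.set_ncard_biUnion_le (I H) (X H)
    calc ((⋃ p ∈ I H, X H p).ncard : ℝ) ≤ ∑ p ∈ I H, ((X H p).ncard : ℝ) := by
          exact_mod_cast h1
      _ ≤ ∑ p ∈ I H, (2 ^ q) ^ q * (2 : ℝ) ^ (((q : ℝ) / 2 - 7 / 8 * (β * μ)) * n) :=
          Finset.sum_le_sum (hXc H)
      _ = (I H).card * ((2 ^ q) ^ q * (2 : ℝ) ^ (((q : ℝ) / 2 - 7 / 8 * (β * μ)) * n)) := by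
          rw [Finset.sum_const, nsmul_eq_mul]
      _ ≤ ((n + 2) ^ d * (2 : ℝ) ^ (γ * n) * (2 ^ q * 2 ^ q)) *
          ((2 ^ q) ^ q * (2 : ℝ) ^ (((q : ℝ) / 2 - 7 / 8 * (β * μ)) * n)) := by
          gcongr
          exact hIc H
      _ = ((2 ^ q) ^ q * (2 ^ q * 2 ^ q) * ((n : ℝ) + 2) ^ d) * ((2 : ℝ) ^ (γ * n) *
          (2 : ℝ) ^ (((q : ℝ) / 2 - 7 / 8 * (β * μ)) * n)) := by ring
      _ ≤ (2 : ℝ) ^ (γ * n) * ((2 : ℝ) ^ (γ * n) *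
          (2 : ℝ) ^ (((q : ℝ) / 2 - 7 / 8 * (β * μ)) * n)) := by gcongr
      _ ≤ _ := by
          rw [← Real.rpow_add (by norm_num), ← Real.rpow_add (by norm_num)]
          apply Real.rpow_le_rpow_of_exponent_le (by norm_num)
          have h3 : 0 ≤ β * μ * n := by positivity
          rw [hγ]
          linarith
  · obtain ⟨z, E, π, π', h1, h2, h3, h4, h5, h6, h7⟩ := hG
    simp only [Set.mem_iUnion]
    refine ⟨(z, E, π, π'), ?_, ?_⟩
    · rw [hI, Finset.mem_filter]
      refine ⟨?_, h3, h4, h6⟩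
      simp only [Finset.mem_product, Finset.mem_univ, Finset.mem_filter, Finset.mem_powerset,
        true_and]
      refine ⟨h3.trans ?_, h1, h2⟩
      gcongr
      exact min_le_left _ _
    · refine ⟨fun v => nbrIn_subset _ _ _, fun v hv => ?_, h7⟩
      simp only [Finset.mem_union, not_or] at hv
      exact h5 v hv.1.2 hv.1.1 hv.2

end Certificates

/-! ### Finding a homogeneous cube configuration -/

section Cube

lemma exists_clique_or_coclique (a b : ℕ) : ∃ N : ℕ, ∀ {V : Type} (G : SimpleGraph V) (S : Finset V),
    N ≤ S.card → (∃ T ⊆ S, T.card = a ∧ G.IsClique (T : Set V)) ∨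
      (∃ T ⊆ S, T.card = b ∧ Gᶜ.IsClique (T : Set V)) := by
  induction a generalizing b with
  | zero => exact ⟨0, fun G S _ => Or.inl ⟨∅, by simp, by simp, by simp⟩⟩
  | succ a iha =>
    induction b with
    | zero => exact ⟨0, fun G S _ => Or.inr ⟨∅, by simp, by simp, by simp⟩⟩
    | succ b ihb =>
      obtain ⟨N₁, h₁⟩ := iha (b + 1)
      obtain ⟨N₂, h₂⟩ := ihb
      refine ⟨N₁ + N₂ + 1, fun {V} G S hS => ?_⟩
      obtain ⟨v, hv⟩ : S.Nonempty := Finset.card_pos.1 (by omega)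
      have hsplit : ((S.erase v).filter (G.Adj v)).card +
          ((S.erase v).filter (fun w => ¬ G.Adj v w)).card = S.card - 1 := by
        rw [Finset.card_filter_add_card_filter_not, Finset.card_erase_of_mem hv]
      have hins : ∀ (H : SimpleGraph V) (T : Finset V), (∀ w ∈ T, H.Adj v w) →
          H.IsClique (T : Set V) → (insert v T).card = T.card + 1 ∧
            H.IsClique (insert v T : Finset V) := by
        intro H T h hT
        refine ⟨Finset.card_insert_of_notMem fun h' => (h v h').ne rfl, ?_⟩
        rw [Finset.coe_insert, SimpleGraph.isClique_insert]
        exact ⟨hT, fun w hw _ => h w hw⟩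
      rcases Nat.lt_or_ge ((S.erase v).filter (G.Adj v)).card N₁ with h | h
      · rcases h₂ G ((S.erase v).filter (fun w => ¬ G.Adj v w)) (by omega) with
          ⟨T, hT, hc, hcl⟩ | ⟨T, hT, hc, hcl⟩
        · exact Or.inl ⟨T, fun x hx => Finset.mem_of_mem_erase (Finset.mem_filter.1 (hT hx)).1,
            hc, hcl⟩
        · have h3 := hins Gᶜ T (fun w hw => by
            have := Finset.mem_filter.1 (hT hw)
            exact ⟨(Finset.ne_of_mem_erase this.1).symm, this.2⟩) hcl
          refine Or.inr ⟨insert v T, ?_, by rw [h3.1, hc], h3.2⟩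
          exact Finset.insert_subset hv fun x hx =>
            Finset.mem_of_mem_erase (Finset.mem_filter.1 (hT hx)).1
      · rcases h₁ G _ h with ⟨T, hT, hc, hcl⟩ | ⟨T, hT, hc, hcl⟩
        · have h3 := hins G T (fun w hw => (Finset.mem_filter.1 (hT hw)).2) hcl
          refine Or.inl ⟨insert v T, ?_, by rw [h3.1, hc], h3.2⟩
          exact Finset.insert_subset hv fun x hx =>
            Finset.mem_of_mem_erase (Finset.mem_filter.1 (hT hx)).1
        · exact Or.inr ⟨T, fun x hx => Finset.mem_of_mem_erase (Finset.mem_filter.1 (hT hx)).1,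
            hc, hcl⟩

lemma exists_homogeneous (k : ℕ) : ∃ N : ℕ, ∀ {V : Type} (G : SimpleGraph V) (S : Finset V),
    N ≤ S.card → ∃ T ⊆ S, T.card = k ∧ ∃ c : Bool, ∀ u ∈ T, ∀ v ∈ T, u ≠ v →
      (G.Adj u v ↔ c = true) := by
  obtain ⟨N, hN⟩ := exists_clique_or_coclique k k
  refine ⟨N, fun G S hS => ?_⟩
  rcases hN G S hS with ⟨T, hT, hc, hcl⟩ | ⟨T, hT, hc, hcl⟩
  · exact ⟨T, hT, hc, true, fun u hu v hv h => by simpa using hcl hu hv h⟩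
  · exact ⟨T, hT, hc, false, fun u hu v hv h => by
      simpa using ((SimpleGraph.compl_adj _ _ _).1 (hcl hu hv h)).2⟩

lemma card_filter_card_lt_le {V : Type*} (S : Finset V) (K : ℕ) :
    (S.powerset.filter fun E => E.card < K).card ≤ K * (S.card + 1) ^ K := by
  have h1 : (S.powerset.filter fun E => E.card < K) ⊆
      (Finset.range K).biUnion fun i => S.powersetCard i := by
    intro E hE
    rw [Finset.mem_filter, Finset.mem_powerset] at hE
    exact Finset.mem_biUnion.2 ⟨E.card, Finset.mem_range.2 hE.2, Finset.mem_powersetCard.2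
      ⟨hE.1, rfl⟩⟩
  refine (Finset.card_le_card h1).trans (Finset.card_biUnion_le.trans ?_)
  have h2 : ∀ i ∈ Finset.range K, (S.powersetCard i).card ≤ (S.card + 1) ^ K := by
    intro i hi
    rw [Finset.card_powersetCard]
    refine (Nat.choose_le_pow _ _).trans ((Nat.pow_le_pow_left (Nat.le_succ _) i).trans ?_)
    exact Nat.pow_le_pow_right (Nat.succ_pos _) (Finset.mem_range.1 hi).le
  refine (Finset.sum_le_sum h2).trans (le_of_eq ?_)
  simp

lemma exists_shattered (K : ℕ) : ∃ s₀ : ℕ, ∀ s, s₀ ≤ s → ∀ {V : Type} [Fintype V]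
    (G : SimpleGraph V) (S : Finset V), 1 ≤ Fintype.card V → S.card = s → ManyTypes G S →
      ∃ T ⊆ S, T.card = K ∧ ∀ Y ⊆ T, ∃ v ∉ S, ∀ t ∈ T, G.Adj v t ↔ t ∈ Y := by
  have h1 := eventually_poly_le K K (show (0 : ℝ) < 1 / 4 by norm_num)
  obtain ⟨s₀, hs₀⟩ := eventually_atTop.1 h1
  refine ⟨max s₀ 16, fun s hs V _ G S hV hS hG => ?_⟩
  set 𝒜 : Finset (Finset V) := (Finset.univ.filter (· ∉ S)).image (nbrIn G S) with h𝒜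
  have h𝒜S : 𝒜 ⊆ S.powerset := by
    intro X hX
    obtain ⟨v, _, rfl⟩ := Finset.mem_image.1 hX
    exact Finset.mem_powerset.2 (nbrIn_subset _ _ _)
  have h2 := hG (fun _ => 0) (fun _ => 𝒜) (fun _ => h𝒜S) (fun v hv =>
    Finset.mem_image.2 ⟨v, by simpa using hv, rfl⟩)
  have hn : (1 : ℝ) ≤ Fintype.card V := by exact_mod_cast hV
  have hs16 : (16 : ℝ) ≤ s := by exact_mod_cast (le_max_right _ _).trans hs
  have h3 : (2 : ℝ) ^ ((s : ℝ) / 2 - 3) ≤ 𝒜.card := by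
    by_contra hcon
    push Not at hcon
    rw [Finset.prod_const, hS] at h2
    have hpos : 0 < (2 : ℝ) ^ (((s : ℝ) / 2 - 3) * Fintype.card V) := by positivity
    have h𝒜1 : (1 : ℝ) ≤ 𝒜.card := by
      rcases Nat.eq_zero_or_pos 𝒜.card with h0 | h0
      · rw [h0, Nat.cast_zero] at h2
        by_cases he : (Sᶜ : Finset V).card = 0
        · rw [he, pow_zero] at h2
          have h5 : (1 : ℝ) < (2 : ℝ) ^ (((s : ℝ) / 2 - 3) * Fintype.card V) :=
            Real.one_lt_rpow (by norm_num) (by nlinarith)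
          linarith
        · rw [zero_pow he] at h2
          linarith
      · exact_mod_cast h0
    have h4 : ((𝒜.card : ℝ)) ^ (Sᶜ : Finset V).card ≤ ((𝒜.card : ℝ)) ^ Fintype.card V :=
      pow_le_pow_right₀ h𝒜1 (Finset.card_le_univ _)
    have h5 : ((𝒜.card : ℝ)) ^ Fintype.card V < ((2 : ℝ) ^ ((s : ℝ) / 2 - 3)) ^ Fintype.card V :=
      pow_lt_pow_left₀ hcon (by linarith) (by omega)
    rw [← Real.rpow_natCast (2 ^ ((s : ℝ) / 2 - 3)), ← Real.rpow_mul (by norm_num)] at h5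
    linarith
  have h4 : ∃ T ∈ 𝒜.shatterer, K ≤ T.card := by
    by_contra hcon
    push Not at hcon
    have h5 : 𝒜.shatterer ⊆ S.powerset.filter fun E => E.card < K := by
      intro T hT
      rw [Finset.mem_filter]
      refine ⟨?_, hcon T hT⟩
      obtain ⟨u, hu, hTu⟩ := (Finset.mem_shatterer.1 hT).exists_superset
      exact Finset.mem_powerset.2 (hTu.trans (Finset.mem_powerset.1 (h𝒜S hu)))
    have h6 := (Finset.card_le_card_shatterer 𝒜).trans
      ((Finset.card_le_card h5).trans (card_filter_card_lt_le S K))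
    have h7 : (𝒜.card : ℝ) ≤ K * ((s : ℝ) + 1) ^ K := by
      rw [hS] at h6
      exact_mod_cast h6
    have h8 := hs₀ s ((le_max_left _ _).trans hs)
    have h9 : (K : ℝ) * ((s : ℝ) + 1) ^ K ≤ K * ((s : ℝ) + 2) ^ K := by
      gcongr
      linarith
    have h10 : (2 : ℝ) ^ ((1 : ℝ) / 4 * s) < (2 : ℝ) ^ ((s : ℝ) / 2 - 3) :=
      Real.rpow_lt_rpow_of_exponent_lt (by norm_num) (by linarith)
    linarith
  obtain ⟨T', hT', hKT⟩ := h4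
  obtain ⟨T, hT, hTK⟩ := Finset.exists_subset_card_eq hKT
  have hsh : 𝒜.Shatters T := (Finset.mem_shatterer.1 hT').mono_right hT
  refine ⟨T, ?_, hTK, fun Y hY => ?_⟩
  · obtain ⟨u, hu, hTu⟩ := hsh.exists_superset
    exact hTu.trans (Finset.mem_powerset.1 (h𝒜S hu))
  · have hTS : T ⊆ S := by
      obtain ⟨u, hu, hTu⟩ := hsh.exists_superset
      exact hTu.trans (Finset.mem_powerset.1 (h𝒜S hu))
    obtain ⟨u, hu, hTu⟩ := hsh hY
    obtain ⟨v, hv, rfl⟩ := Finset.mem_image.1 hu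
    refine ⟨v, by simpa using hv, fun t ht => ?_⟩
    rw [← hTu, Finset.mem_inter, mem_nbrIn]
    exact ⟨fun h => ⟨ht, hTS ht, h⟩, fun h => h.2.2⟩

/-- Two homogeneous sets, the first indexed by the traces on the second. -/
structure CubeConfig {V : Type*} (G : SimpleGraph V) (m : ℕ) where
  s : (Fin m → Bool) → V
  t : Fin m → V
  t_inj : Function.Injective t
  ne : ∀ σ i, s σ ≠ t i
  adj : ∀ σ i, G.Adj (s σ) (t i) ↔ σ i = true
  cs : Bool
  ct : Bool
  hcs : ∀ σ τ, σ ≠ τ → (G.Adj (s σ) (s τ) ↔ cs = true)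
  hct : ∀ i j, i ≠ j → (G.Adj (t i) (t j) ↔ ct = true)

lemma CubeConfig.s_inj {V : Type*} {G : SimpleGraph V} {m : ℕ} (c : CubeConfig G m) :
    Function.Injective c.s := by
  intro σ τ h
  funext i
  have h1 := c.adj σ i
  rw [h, c.adj τ i] at h1
  exact (Bool.eq_iff_iff.2 h1).symm

lemma exists_cubeConfig (m : ℕ) : ∃ s n₀ : ℕ, ∀ {V : Type} [Fintype V] (G : SimpleGraph V),
    n₀ ≤ Fintype.card V → (∀ S : Finset V, S.card = s → ManyTypes G S) →
      Nonempty (CubeConfig G m) := by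
  obtain ⟨N, hN⟩ := exists_homogeneous (Fintype.card (Fin m → Bool))
  obtain ⟨s, hs⟩ := exists_shattered (Fintype.card (((Fin m → Bool) ↪ Fin N) × Fin m))
  obtain ⟨n₀, hn₀⟩ := exists_homogeneous s
  refine ⟨s, n₀ + 1, fun {V} _ G hV hG => ?_⟩
  obtain ⟨S, -, hSs, ct, hct⟩ := hn₀ G Finset.univ (by rw [Finset.card_univ]; omega)
  obtain ⟨T, hTS, hT, hsh⟩ := hs s le_rfl G S (by omega) hSs (hG S hSs)
  rw [← Fintype.card_coe T] at hT
  have e : T ≃ ((Fin m → Bool) ↪ Fin N) × Fin m := Fintype.equivOfCardEq hT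
  have hv : ∀ j : Fin N, ∃ v ∉ S, ∀ φ i, G.Adj v (e.symm (φ, i)) ↔ ∃ σ : Fin m → Bool,
      φ σ = j ∧ σ i = true := by
    intro j
    obtain ⟨v, hv, h⟩ := hsh ((Finset.univ.filter fun x : T => ∃ σ : Fin m → Bool,
      (e x).1 σ = j ∧ σ (e x).2 = true).map (Function.Embedding.subtype _)) (by
        intro x hx
        obtain ⟨y, -, rfl⟩ := Finset.mem_map.1 hx
        exact y.2)
    refine ⟨v, hv, fun φ i => ?_⟩
    rw [h _ (e.symm (φ, i)).2]
    simp
  choose v hvS hv using hv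
  obtain ⟨J, -, hJ, cs, hcs⟩ := hN (SimpleGraph.comap v G) Finset.univ (by simp)
  rw [← Fintype.card_coe J] at hJ
  have g : (Fin m → Bool) ≃ J := Fintype.equivOfCardEq hJ.symm
  let φ : (Fin m → Bool) ↪ Fin N := g.toEmbedding.trans (Function.Embedding.subtype _)
  refine ⟨⟨fun σ => v (φ σ), fun i => e.symm (φ, i), ?_, ?_, ?_, cs, ct, ?_, ?_⟩⟩
  · intro i j h
    have h1 := e.symm.injective (Subtype.ext h)
    exact (Prod.mk.inj h1).2
  · intro σ i h
    exact hvS (φ σ) (h ▸ hTS (e.symm (φ, i)).2)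
  · intro σ i
    rw [hv]
    constructor
    · rintro ⟨τ, h, h'⟩
      rwa [← φ.injective h]
    · exact fun h => ⟨σ, rfl, h⟩
  · intro σ τ h
    exact hcs _ (g σ).2 _ (g τ).2 (φ.injective.ne h)
  · intro i j h
    refine hct _ (hTS (e.symm (φ, i)).2) _ (hTS (e.symm (φ, j)).2) fun h1 => h ?_
    exact (Prod.mk.inj (e.symm.injective (Subtype.ext h1))).2

lemma card_le_of_forall_pair_ne {r m : ℕ} (f : Fin r × Bool ↪ Fin m) (X : Finset (Fin m → Bool))
    (p : Bool × Bool) (h : ∀ i, ∀ x ∈ X, ¬ (x (f (i, false)) = p.1 ∧ x (f (i, true)) = p.2)) :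
    (X.card : ℝ) ≤ (3 / 4 : ℝ) ^ r * 2 ^ m := by
  rcases Nat.eq_zero_or_pos r with rfl | hr
  · have h1 := Finset.card_le_univ X
    rw [Fintype.card_fun, Fintype.card_bool, Fintype.card_fin] at h1
    rw [pow_zero, one_mul]
    exact_mod_cast h1
  set v₀ : Fin m := f (⟨0, hr⟩, false)
  set b : Bool → Finset (Fin m) := fun c => if c = true then {v₀} else ∅ with hb
  have hbi : Function.Injective b := by
    intro c d h
    cases c <;> cases d <;> simp_all
  have hbs : ∀ c, b c ⊆ {v₀} := by
    intro c
    cases c <;> simp [hb]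
  have h2 := ncard_matching_types ({v₀} : Finset (Fin m)) Finset.univ ∅ f (fun _ => Finset.mem_univ _)
    (fun _ => ∅) (hbs p.1) (hbs p.2) (by simp)
  have h3 : X.card ≤ Set.ncard {τ : Fin m → Finset (Fin m) | (∀ v, τ v ⊆ {v₀}) ∧
      (∀ v ∉ (Finset.univ : Finset (Fin m)), τ v = ∅) ∧ ∀ i, f (i, false) ∉ (∅ : Finset (Fin m)) →
        f (i, true) ∉ (∅ : Finset (Fin m)) →
          ¬ (τ (f (i, false)) = b p.1 ∧ τ (f (i, true)) = b p.2)} := by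
    rw [← Set.ncard_coe_finset]
    apply Set.ncard_le_ncard_of_injOn (fun x v => b (x v))
    · intro x hx
      refine ⟨fun v => hbs _, fun v hv => absurd (Finset.mem_univ v) hv, fun i _ _ h' => ?_⟩
      exact h i x hx ⟨hbi h'.1, hbi h'.2⟩
    · intro x _ y _ hxy
      funext v
      exact hbi (congrFun hxy v)
  refine (Nat.cast_le.2 h3).trans (h2.trans (le_of_eq ?_))
  norm_num [mul_comm]

lemma exists_pair_pattern {r m : ℕ} (f : Fin (2 * r) × Bool ↪ Fin m) (X₁ X₂ : Finset (Fin m → Bool))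
    (h₁ : (3 / 4 : ℝ) ^ r * 2 ^ m < X₁.card) (h₂ : (3 / 4 : ℝ) ^ r * 2 ^ m < X₂.card)
    (p p' : Bool × Bool) : ∃ i, (∃ x ∈ X₁, x (f (i, false)) = p.1 ∧ x (f (i, true)) = p.2) ∧
      ∃ x ∈ X₂, x (f (i, false)) = p'.1 ∧ x (f (i, true)) = p'.2 := by
  by_contra hcon
  have key : ∀ (X : Finset (Fin m → Bool)) (q : Bool × Bool) (I : Finset (Fin (2 * r))),
      r ≤ I.card → (∀ i ∈ I, ¬ ∃ x ∈ X, x (f (i, false)) = q.1 ∧ x (f (i, true)) = q.2) →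
        (X.card : ℝ) ≤ (3 / 4 : ℝ) ^ r * 2 ^ m := by
    intro X q I hI hX
    let g : Fin r ↪ I := (Fin.castLEEmb hI).trans I.equivFin.symm.toEmbedding
    let f' : Fin r × Bool ↪ Fin m :=
      ⟨fun x => f (g x.1, x.2), fun x y h => by
        have h1 := Prod.mk.inj (f.injective h)
        exact Prod.ext (g.injective (Subtype.ext h1.1)) h1.2⟩
    exact card_le_of_forall_pair_ne f' X q fun i x hx h => hX _ (g i).2 ⟨x, hx, h⟩
  let I := Finset.univ.filter fun i : Fin (2 * r) =>
    ¬ ∃ x ∈ X₁, x (f (i, false)) = p.1 ∧ x (f (i, true)) = p.2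
  let I' := Finset.univ.filter fun i : Fin (2 * r) =>
    ¬ ¬ ∃ x ∈ X₁, x (f (i, false)) = p.1 ∧ x (f (i, true)) = p.2
  have hI : I.card + I'.card = 2 * r := by
    rw [Finset.card_filter_add_card_filter_not, Finset.card_univ, Fintype.card_fin]
  rcases le_or_gt r I.card with h | h
  · exact absurd (key X₁ p I h fun i hi => (Finset.mem_filter.1 hi).2) (not_le.2 h₁)
  · refine absurd (key X₂ p' I' (by omega) fun i hi h' => ?_) (not_le.2 h₂)
    exact hcon ⟨i, not_not.1 (Finset.mem_filter.1 hi).2, h'⟩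

lemma exists_pairs_embedding {m k : ℕ} (Y Z : Finset (Fin m)) (hY : k ≤ Y.card) (hZ : k ≤ Z.card)
    (h : Disjoint Y Z) : ∃ f : Fin k × Bool ↪ Fin m, (∀ i, f (i, false) ∈ Y) ∧
      ∀ i, f (i, true) ∈ Z := by
  let g : Fin k ↪ Y := (Fin.castLEEmb hY).trans Y.equivFin.symm.toEmbedding
  let g' : Fin k ↪ Z := (Fin.castLEEmb hZ).trans Z.equivFin.symm.toEmbedding
  refine ⟨⟨fun x => if x.2 = true then (g' x.1 : Fin m) else g x.1, ?_⟩, fun i => ?_, fun i => ?_⟩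
  · rintro ⟨i, _ | _⟩ ⟨j, _ | _⟩ hij
    · simpa using g.injective (Subtype.ext (by simpa using hij))
    · have h1 : (g i : Fin m) = g' j := by simpa using hij
      exact absurd (h1 ▸ (g' j).2) (Finset.disjoint_left.1 h (g i).2)
    · have h1 : (g' i : Fin m) = g j := by simpa using hij
      exact absurd (h1 ▸ (g' i).2) (Finset.disjoint_left.1 h (g j).2)
    · simpa using g'.injective (Subtype.ext (by simpa using hij))
  · exact (g i).2
  · exact (g' i).2

lemma exists_pairs_embedding_self {m k : ℕ} (Y : Finset (Fin m)) (hY : 2 * k ≤ Y.card) :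
    ∃ f : Fin k × Bool ↪ Fin m, (∀ i, f (i, false) ∈ Y) ∧ ∀ i, f (i, true) ∈ Y := by
  obtain ⟨Y', hY', hc⟩ := Finset.exists_subset_card_eq (show k ≤ Y.card by omega)
  obtain ⟨f, h1, h2⟩ := exists_pairs_embedding Y' (Y \ Y') (k := k) hc.ge
    (by rw [Finset.card_sdiff_of_subset hY']; omega) Finset.disjoint_sdiff
  exact ⟨f, fun i => hY' (h1 i), fun i => (Finset.mem_sdiff.1 (h2 i)).1⟩

/-- Every vertex is nearly trivial either to the first or to the second homogeneous set. -/
lemma CubeConfig.dichotomy {V : Type*} {G : SimpleGraph V} {m : ℕ} (c : CubeConfig G m)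
    (hG : C5Free G) (r : ℕ) {v : V} :
    (Finset.univ.filter fun i => G.Adj v (c.t i)).card < 4 * r ∨
      m < (Finset.univ.filter fun i => G.Adj v (c.t i)).card + 4 * r ∨
      ((Finset.univ.filter fun σ => G.Adj v (c.s σ)).card : ℝ) ≤ (3 / 4 : ℝ) ^ r * 2 ^ m ∨
      ((Finset.univ.filter fun σ => ¬ G.Adj v (c.s σ)).card : ℝ) ≤ (3 / 4 : ℝ) ^ r * 2 ^ m := by
  by_contra hcon
  push Not at hcon
  obtain ⟨hY, hZ, hX₁, hX₂⟩ := hcon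
  set Y := Finset.univ.filter fun i => G.Adj v (c.t i) with hYdef
  set Z := Finset.univ.filter fun i => ¬ G.Adj v (c.t i) with hZdef
  have hYZ : Y.card + Z.card = m := by
    rw [Finset.card_filter_add_card_filter_not, Finset.card_univ, Fintype.card_fin]
  have hd : Disjoint Y Z := Finset.disjoint_filter_filter_not _ _ _
  have mY : ∀ {i}, i ∈ Y → G.Adj v (c.t i) := fun h => (Finset.mem_filter.1 h).2
  have mZ : ∀ {i}, i ∈ Z → ¬ G.Adj v (c.t i) := fun h => (Finset.mem_filter.1 h).2
  have hne : ∀ {σ τ : Fin m → Bool} {i}, σ i ≠ τ i → σ ≠ τ := fun h h' => h (h' ▸ rfl)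
  have adj' : ∀ σ i, G.Adj (c.t i) (c.s σ) ↔ σ i = true := fun σ i => by
    rw [G.adj_comm, c.adj]
  by_cases hcs : c.cs = true <;> by_cases hct : c.ct = true
  · obtain ⟨f, hf, hf'⟩ := exists_pairs_embedding Y Z (k := 2 * r) (by omega) (by omega) hd
    obtain ⟨i, ⟨x, hx, h1, h2⟩, y, hy, h3, h4⟩ :=
      exists_pair_pattern f _ _ hX₁ hX₂ (false, false) (false, true)
    rw [Finset.mem_filter] at hx hy
    have hxy := c.hcs x y (hne (h2.trans_ne (by rw [h4]; simp)))
    have htt := c.hct (f (i, true)) (f (i, false)) (f.injective.ne (by simp))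
    simp only at h1 h2 h3 h4
    exact hG v (c.s x) (c.s y) (c.t (f (i, true))) (c.t (f (i, false))) hx.2 (hxy.2 hcs)
      ((c.adj _ _).2 h4) (htt.2 hct) (G.adj_symm (mY (hf i))) hy.2 (mZ (hf' i))
      (by simp [c.adj, h2]) (by simp [c.adj, h1]) (by simp [c.adj, h3])
  · obtain ⟨f, hf, hf'⟩ := exists_pairs_embedding_self Y (k := 2 * r) (by omega)
    obtain ⟨i, ⟨x, hx, h1, h2⟩, y, hy, h3, h4⟩ :=
      exists_pair_pattern f _ _ hX₂ hX₂ (true, false) (false, true)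
    rw [Finset.mem_filter] at hx hy
    have hxy := c.hcs x y (hne (h2.trans_ne (by rw [h4]; simp)))
    have htt := c.hct (f (i, false)) (f (i, true)) (f.injective.ne (by simp))
    simp only at h1 h2 h3 h4
    exact hG v (c.t (f (i, false))) (c.s x) (c.s y) (c.t (f (i, true))) (mY (hf i))
      ((adj' _ _).2 h1) (hxy.2 hcs) ((c.adj _ _).2 h4) (G.adj_symm (mY (hf' i))) hx.2 hy.2
      (by simp [adj', h3]) (by simp [htt, hct]) (by simp [c.adj, h2])
  · obtain ⟨f, hf, hf'⟩ := exists_pairs_embedding_self Z (k := 2 * r) (by omega)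
    obtain ⟨i, ⟨x, hx, h1, h2⟩, y, hy, h3, h4⟩ :=
      exists_pair_pattern f _ _ hX₁ hX₁ (true, false) (false, true)
    rw [Finset.mem_filter] at hx hy
    have hxy := c.hcs x y (hne (h2.trans_ne (by rw [h4]; simp)))
    have htt := c.hct (f (i, false)) (f (i, true)) (f.injective.ne (by simp))
    simp only at h1 h2 h3 h4
    exact hG v (c.s x) (c.t (f (i, false))) (c.t (f (i, true))) (c.s y) hx.2
      ((c.adj _ _).2 h1) (htt.2 hct) ((adj' _ _).2 h4) (G.adj_symm hy.2) (mZ (hf i)) (mZ (hf' i))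
      (by simp [c.adj, h2]) (by simp [hxy, hcs]) (by simp [adj', h3])
  · obtain ⟨f, hf, hf'⟩ := exists_pairs_embedding Y Z (k := 2 * r) (by omega) (by omega) hd
    obtain ⟨i, ⟨x, hx, h1, h2⟩, y, hy, h3, h4⟩ :=
      exists_pair_pattern f _ _ hX₁ hX₂ (false, true) (true, true)
    rw [Finset.mem_filter] at hx hy
    have hxy := c.hcs x y (hne (h1.trans_ne (by rw [h3]; simp)))
    have htt := c.hct (f (i, true)) (f (i, false)) (f.injective.ne (by simp))
    simp only at h1 h2 h3 h4
    exact hG v (c.s x) (c.t (f (i, true))) (c.s y) (c.t (f (i, false))) hx.2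
      ((c.adj _ _).2 h2) ((adj' _ _).2 h4) ((c.adj _ _).2 h3) (G.adj_symm (mY (hf i)))
      (mZ (hf' i)) hy.2 (by simp [hxy, hcs]) (by simp [c.adj, h1]) (by simp [htt, hct])

end Cube

/-! ### Consequences of having many types -/

section Full

lemma ManyTypes.full {V : Type*} [Fintype V] {G : SimpleGraph V} {S : Finset V}
    (hG : ManyTypes G S) (M Exc : Finset V) (𝓡 𝓣 : Finset (Finset V)) {ρ g : ℝ} (hρ : 0 ≤ ρ)
    (hg : 0 ≤ g) (hgs : g ≤ S.card) (h : ∀ v ∉ S, v ∉ M → v ∉ Exc → nbrIn G S v ∈ 𝓡)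
    (h𝓡 : (𝓡.card : ℝ) ≤ 2 ^ ρ) (h𝓣 : (𝓣.card : ℝ) ≤ 2 ^ ((S.card : ℝ) - g)) :
    g * (Set.ncard {v | v ∈ M ∧ v ∉ S ∧ nbrIn G S v ∈ 𝓣} : ℝ) ≤ S.card * Exc.card +
      ρ * Fintype.card V + S.card * M.card - ((S.card : ℝ) / 2 - 3) * Fintype.card V := by
  set κ : V → Fin 4 := fun v => if v ∈ Exc then 0 else if v ∉ M then 1 else
    if nbrIn G S v ∈ 𝓣 then 2 else 3 with hκ
  set F : Fin 4 → Finset (Finset V) := ![S.powerset, 𝓡 ∩ S.powerset, 𝓣 ∩ S.powerset, S.powerset]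
    with hF
  have hpw : ∀ v, nbrIn G S v ∈ S.powerset := fun v => Finset.mem_powerset.2 (nbrIn_subset _ _ _)
  have h1 := hG κ F (by
      intro i
      fin_cases i
      · exact subset_rfl
      · exact Finset.inter_subset_right
      · exact Finset.inter_subset_right
      · exact subset_rfl) (by
      intro v hv
      simp only [hκ]
      split_ifs with h2 h3 h4
      · exact hpw v
      · exact Finset.mem_inter.2 ⟨h4, hpw v⟩
      · exact hpw v
      · exact Finset.mem_inter.2 ⟨h v hv h3 h2, hpw v⟩)
  set x : V → ℝ := fun v => (if v ∈ Exc then (S.card : ℝ) else 0) + ρ +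
    (if v ∈ M then (S.card : ℝ) else 0) - (if v ∈ M ∧ v ∉ S ∧ nbrIn G S v ∈ 𝓣 then g else 0)
    with hx
  have hpc : ((S.powerset.card : ℕ) : ℝ) = 2 ^ (S.card : ℝ) := by
    rw [Finset.card_powerset, Real.rpow_natCast]
    push_cast
    rfl
  have hs0 : (0 : ℝ) ≤ S.card := Nat.cast_nonneg _
  have hmono : ∀ {a b : ℝ}, a ≤ b → (2 : ℝ) ^ a ≤ 2 ^ b := fun h =>
    Real.rpow_le_rpow_of_exponent_le (by norm_num) h
  have h2 : ∀ v ∈ (Sᶜ : Finset V), ((F (κ v)).card : ℝ) ≤ 2 ^ (x v) := by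
    intro v hv
    have hv' : v ∉ S := by simpa using hv
    have hF0 : ((F 0).card : ℝ) = 2 ^ (S.card : ℝ) := hpc
    have hF3 : ((F 3).card : ℝ) = 2 ^ (S.card : ℝ) := hpc
    have hF1 : ((F 1).card : ℝ) ≤ 2 ^ ρ :=
      (Nat.cast_le.2 (Finset.card_le_card Finset.inter_subset_left)).trans h𝓡
    have hF2 : ((F 2).card : ℝ) ≤ 2 ^ ((S.card : ℝ) - g) :=
      (Nat.cast_le.2 (Finset.card_le_card Finset.inter_subset_left)).trans h𝓣
    simp only [hκ, hx, hv', not_false_eq_true, true_and]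
    split_ifs with h2 h3 h4 h5 h6 h7 <;> first
      | exact hF0.le.trans (hmono (by linarith))
      | exact hF1.trans (hmono (by linarith))
      | exact hF2.trans (hmono (by linarith))
      | exact hF3.le.trans (hmono (by linarith))
      | (exfalso; tauto)
  have h3 := h1.trans (Finset.prod_le_prod (fun _ _ => Nat.cast_nonneg _) h2)
  rw [← Real.rpow_sum_of_pos (by norm_num), Real.rpow_le_rpow_left_iff (by norm_num)] at h3
  have h4 : ∑ v ∈ (Sᶜ : Finset V), x v ≤ S.card * Exc.card + ρ * Fintype.card V + S.card * M.card -
      g * (Set.ncard {v | v ∈ M ∧ v ∉ S ∧ nbrIn G S v ∈ 𝓣} : ℝ) := by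
    simp only [hx, Finset.sum_sub_distrib, Finset.sum_add_distrib]
    have e1 : ∀ W : Finset V, ∑ v ∈ (Sᶜ : Finset V), (if v ∈ W then (S.card : ℝ) else 0) ≤
        S.card * W.card := by
      intro W
      refine (Finset.sum_le_sum_of_subset_of_nonneg (Finset.subset_univ _)
        (fun v _ _ => by split_ifs <;> simp)).trans (le_of_eq ?_)
      rw [Finset.sum_ite_mem, Finset.univ_inter, Finset.sum_const, nsmul_eq_mul, mul_comm]
    have e2 : ∑ _v ∈ (Sᶜ : Finset V), ρ ≤ ρ * Fintype.card V := by
      rw [Finset.sum_const, nsmul_eq_mul, mul_comm]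
      exact mul_le_mul_of_nonneg_left (Nat.cast_le.2 (Finset.card_le_univ _)) hρ
    have e3 : ∑ v ∈ (Sᶜ : Finset V), (if v ∈ M ∧ v ∉ S ∧ nbrIn G S v ∈ 𝓣 then g else 0) =
        g * (Set.ncard {v | v ∈ M ∧ v ∉ S ∧ nbrIn G S v ∈ 𝓣} : ℝ) := by
      rw [← Finset.sum_filter, Finset.sum_const, nsmul_eq_mul, mul_comm, ← Set.ncard_coe_finset]
      congr 3
      ext v
      simp only [Finset.coe_filter, Finset.mem_compl, Set.mem_ofPred_eq]
      tauto
    linarith [e1 Exc, e1 M]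
  linarith

/-- The adjacencies of `v` to `b` and `b'` are prescribed by `p`. -/
def AdjPat {V : Type*} (G : SimpleGraph V) (v b b' : V) (p : Bool × Bool) : Prop :=
  (G.Adj v b ↔ p.1 = true) ∧ (G.Adj v b' ↔ p.2 = true)

/-- Almost all triples from `Y` realise every pattern on one of the pairs given by `f`. -/
def Generic {V : Type*} [Fintype V] (G : SimpleGraph V) (Y : Finset V) {q : ℕ}
    (f : Fin q × Bool → V) (ε : ℝ) : Prop :=
  ∀ p₁ p₂ p₃ : Bool × Bool, (Set.ncard {y : V × V × V | y.1 ∈ Y ∧ y.2.1 ∈ Y ∧ y.2.2 ∈ Y ∧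
    ∀ i, ¬ (AdjPat G y.1 (f (i, false)) (f (i, true)) p₁ ∧
      AdjPat G y.2.1 (f (i, false)) (f (i, true)) p₂ ∧
      AdjPat G y.2.2 (f (i, false)) (f (i, true)) p₃)} : ℝ) ≤ ε * (Fintype.card V : ℝ) ^ 3

lemma AdjPat.compl_iff {V : Type*} {G : SimpleGraph V} {v b b' : V} {p : Bool × Bool}
    (h : v ≠ b) (h' : v ≠ b') : AdjPat Gᶜ v b b' p ↔ AdjPat G v b b' (!p.1, !p.2) := by
  unfold AdjPat
  rw [SimpleGraph.compl_adj, SimpleGraph.compl_adj]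
  rcases p with ⟨_ | _, _ | _⟩ <;> simp [h, h']

lemma Generic.compl {V : Type*} [Fintype V] {G : SimpleGraph V} {Y : Finset V} {q : ℕ}
    {f : Fin q × Bool → V} {ε : ℝ} (h : Generic G Y f ε) (hf : ∀ x, f x ∉ Y) :
    Generic Gᶜ Y f ε := by
  intro p₁ p₂ p₃
  refine le_trans ?_ (h (!p₁.1, !p₁.2) (!p₂.1, !p₂.2) (!p₃.1, !p₃.2))
  refine Nat.cast_le.2 (Set.ncard_le_ncard ?_ (Set.toFinite _))
  rintro ⟨y₁, y₂, y₃⟩ ⟨h1, h2, h3, h4⟩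
  refine ⟨h1, h2, h3, fun i => ?_⟩
  have hne : ∀ {y}, y ∈ Y → ∀ x, y ≠ f x := fun hy x h => hf x (h ▸ hy)
  have := h4 i
  rwa [AdjPat.compl_iff (hne h1 _) (hne h1 _), AdjPat.compl_iff (hne h2 _) (hne h2 _),
    AdjPat.compl_iff (hne h3 _) (hne h3 _)] at this

lemma sum_filter_card_le {V β : Type*} [Fintype V] (M : Finset V) (W : Finset β) (P : V → β → Prop)
    (Bad : V → Prop) {x B : ℝ} (hB : 0 ≤ B) (hx : ((M.filter Bad).card : ℝ) ≤ x)
    (h : ∀ u ∈ M, ¬ Bad u → ((W.filter (P u)).card : ℝ) ≤ B) :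
    ((((M ×ˢ W).filter fun z => P z.1 z.2).card : ℕ) : ℝ) ≤ x * W.card + M.card * B := by
  have h1 : ((M ×ˢ W).filter fun z => P z.1 z.2).card = ∑ u ∈ M, (W.filter (P u)).card := by
    rw [Finset.card_filter, Finset.sum_product]
    exact Finset.sum_congr rfl fun u _ => (Finset.card_filter _ _).symm
  rw [h1, Nat.cast_sum]
  have h2 : ∀ u ∈ M, ((W.filter (P u)).card : ℝ) ≤ (if Bad u then (W.card : ℝ) else 0) + B := by
    intro u hu
    split_ifs with hb
    · have : ((W.filter (P u)).card : ℝ) ≤ W.card := Nat.cast_le.2 (Finset.card_filter_le _ _)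
      linarith
    · have := h u hu hb
      linarith
  refine (Finset.sum_le_sum h2).trans ?_
  rw [Finset.sum_add_distrib, ← Finset.sum_filter, Finset.sum_const, Finset.sum_const,
    nsmul_eq_mul, nsmul_eq_mul]
  have := mul_le_mul_of_nonneg_right hx (Nat.cast_nonneg (α := ℝ) W.card)
  linarith

lemma card_heavy_mul_le {α β : Type*} (P : Finset α) (W : Finset β) (F : α → β → Prop) (L : ℝ) :
    ((P.filter fun a => L < ((W.filter (F a)).card : ℝ)).card : ℝ) * L ≤
      (((P ×ˢ W).filter fun z => F z.1 z.2).card : ℕ) := by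
  have h1 : ((P ×ˢ W).filter fun z => F z.1 z.2).card = ∑ u ∈ P, (W.filter (F u)).card := by
    rw [Finset.card_filter, Finset.sum_product]
    exact Finset.sum_congr rfl fun u _ => (Finset.card_filter _ _).symm
  rw [h1, Nat.cast_sum, ← nsmul_eq_mul, ← Finset.sum_const]
  refine (Finset.sum_le_sum fun a ha => (Finset.mem_filter.1 ha).2.le).trans ?_
  exact Finset.sum_le_sum_of_subset_of_nonneg (Finset.filter_subset _ _)
    fun _ _ _ => Nat.cast_nonneg _

lemma card_triples_le {V : Type*} [Fintype V] {α : Type*} (M : Finset V) (τ : V → α) (PP : Finset α)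
    (hτ : ∀ v ∈ M, τ v ∈ PP) {L x : ℝ} (hL : 0 < L) (hx : 0 ≤ x)
    (h : ∀ 𝓣 : Finset α, (𝓣.card : ℝ) ≤ L → (Set.ncard {v | v ∈ M ∧ τ v ∈ 𝓣} : ℝ) ≤ x)
    (F : α → α → α → Prop)
    (hF : ((((PP ×ˢ PP ×ˢ PP).filter fun z => F z.1 z.2.1 z.2.2).card : ℕ) : ℝ) ≤ L ^ 3) :
    ((((M ×ˢ M ×ˢ M).filter fun z => F (τ z.1) (τ z.2.1) (τ z.2.2)).card : ℕ) : ℝ) ≤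
      3 * x * (Fintype.card V : ℝ) ^ 2 := by
  replace h : ∀ 𝓣 : Finset α, (𝓣.card : ℝ) ≤ L → ((M.filter fun v => τ v ∈ 𝓣).card : ℝ) ≤ x := by
    intro 𝓣 h𝓣
    have := h 𝓣 h𝓣
    rwa [← Finset.coe_filter, Set.ncard_coe_finset] at this
  set n : ℝ := (Fintype.card V : ℝ) with hn
  have hM : (M.card : ℝ) ≤ n := Nat.cast_le.2 (Finset.card_le_univ _)
  have hM0 : (0 : ℝ) ≤ M.card := Nat.cast_nonneg _
  have hn0 : (0 : ℝ) ≤ n := Nat.cast_nonneg _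
  set 𝓣₁ := PP.filter fun a => L ^ 2 <
    (((PP ×ˢ PP).filter fun z => F a z.1 z.2).card : ℝ) with h𝓣₁
  have h1 : (𝓣₁.card : ℝ) ≤ L := by
    have h2 := card_heavy_mul_le PP (PP ×ˢ PP) (fun a z => F a z.1 z.2) (L ^ 2)
    have h3 := h2.trans hF
    have h4 : (0 : ℝ) < L ^ 2 := by positivity
    have h5 : (𝓣₁.card : ℝ) * L ^ 2 ≤ L * L ^ 2 := by rw [← pow_succ' L 2]; exact h3
    exact le_of_mul_le_mul_right h5 h4
  have h2 := sum_filter_card_le M (M ×ˢ M) (fun u z => F (τ u) (τ z.1) (τ z.2))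
    (fun v => τ v ∈ 𝓣₁) (x := x) (B := 2 * x * n) (by positivity)
    (by convert h _ h1) (by
      intro u hu hbad
      set 𝓣₂ := PP.filter fun b => L < ((PP.filter (F (τ u) b)).card : ℝ) with h𝓣₂
      have h3 : (𝓣₂.card : ℝ) ≤ L := by
        have h4 := card_heavy_mul_le PP PP (F (τ u)) L
        have h5 : ((((PP ×ˢ PP).filter fun z => F (τ u) z.1 z.2).card : ℕ) : ℝ) ≤ L ^ 2 := by
          by_contra hc
          exact hbad (Finset.mem_filter.2 ⟨hτ u hu, not_le.1 hc⟩)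
        have h6 : (𝓣₂.card : ℝ) * L ≤ L * L := by rw [← sq]; exact h4.trans h5
        exact le_of_mul_le_mul_right h6 hL
      have h4 := sum_filter_card_le M M (fun v w => F (τ u) (τ v) (τ w))
        (fun v => τ v ∈ 𝓣₂) (x := x) (B := x) hx (by convert h _ h3) (by
          intro v hv hbad'
          have h5 : ((PP.filter (F (τ u) (τ v))).card : ℝ) ≤ L := by grind
          refine le_trans (Nat.cast_le.2 (Finset.card_le_card (?_ : _ ⊆ M.filter fun w =>
            τ w ∈ PP.filter (F (τ u) (τ v))))) (by convert h _ h5)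
          intro w hw
          rw [Finset.mem_filter] at hw ⊢
          exact ⟨hw.1, Finset.mem_filter.2 ⟨hτ w hw.1, hw.2⟩⟩)
      refine h4.trans ?_
      have := mul_le_mul_of_nonneg_left hM hx
      linarith)
  refine h2.trans ?_
  rw [Finset.card_product]
  push_cast
  have h3 : x * ((M.card : ℝ) * M.card) ≤ x * (n * n) :=
    mul_le_mul_of_nonneg_left (mul_le_mul hM hM hM0 hn0) hx
  have h4 : (M.card : ℝ) * (2 * x * n) ≤ n * (2 * x * n) :=
    mul_le_mul_of_nonneg_right hM (by positivity)
  nlinarith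

/-- The traces `a`, `b`, `c` do not realise the prescribed pattern on any pair of `f`. -/
def TripleAvoids {V : Type*} {q : ℕ} (f : Fin q × Bool → V) (p₁ p₂ p₃ : Bool × Bool)
    (a b c : Finset V) : Prop :=
  ∀ i, ¬ (((f (i, false) ∈ a ↔ p₁.1 = true) ∧ (f (i, true) ∈ a ↔ p₁.2 = true)) ∧
    ((f (i, false) ∈ b ↔ p₂.1 = true) ∧ (f (i, true) ∈ b ↔ p₂.2 = true)) ∧
    ((f (i, false) ∈ c ↔ p₃.1 = true) ∧ (f (i, true) ∈ c ↔ p₃.2 = true)))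

lemma card_triples_avoiding_le {V : Type*} {q : ℕ} (f : Fin q × Bool ↪ V) (p₁ p₂ p₃ : Bool × Bool) :
    (((Finset.univ.map f).powerset ×ˢ (Finset.univ.map f).powerset ×ˢ
      (Finset.univ.map f).powerset).filter fun z =>
        TripleAvoids f p₁ p₂ p₃ z.1 z.2.1 z.2.2).card ≤ 63 ^ q := by
  set W := Finset.univ.erase ((p₁, p₂, p₃) : (Bool × Bool) × (Bool × Bool) × (Bool × Bool)) with hW
  have hWc : W.card = 63 := by
    rw [hW, Finset.card_erase_of_mem (Finset.mem_univ _)]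
    rfl
  have h1 : (Fintype.piFinset fun _ : Fin q => W).card = 63 ^ q := by
    rw [Fintype.card_piFinset, Finset.prod_const, hWc, Finset.card_univ, Fintype.card_fin]
  rw [← h1]
  set b : Finset V → Fin q → Bool × Bool :=
    fun a i => (decide (f (i, false) ∈ a), decide (f (i, true) ∈ a)) with hb
  have hb' : ∀ a i (p : Bool × Bool), b a i = p ↔
      ((f (i, false) ∈ a ↔ p.1 = true) ∧ (f (i, true) ∈ a ↔ p.2 = true)) := by grind
  have hbi : ∀ a ∈ (Finset.univ.map f).powerset, ∀ a' ∈ (Finset.univ.map f).powerset,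
      (∀ i, b a i = b a' i) → a = a' := by
    intro a ha a' ha' h
    rw [Finset.mem_powerset] at ha ha'
    have hx : ∀ x : Fin q × Bool, f x ∈ a ↔ f x ∈ a' := by
      rintro ⟨i, _ | _⟩
      · simpa [hb] using (Prod.mk.inj (h i)).1
      · simpa [hb] using (Prod.mk.inj (h i)).2
    ext v
    constructor
    · intro hv
      obtain ⟨x, -, rfl⟩ := Finset.mem_map.1 (ha hv)
      exact (hx x).1 hv
    · intro hv
      obtain ⟨x, -, rfl⟩ := Finset.mem_map.1 (ha' hv)
      exact (hx x).2 hv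
  refine Finset.card_le_card_of_injOn (fun z i => (b z.1 i, b z.2.1 i, b z.2.2 i)) ?_ ?_
  · intro z hz
    have hz' := (Finset.mem_filter.1 hz).2
    refine Fintype.mem_piFinset.2 fun i => Finset.mem_erase.2 ⟨fun h => hz' i ?_, Finset.mem_univ _⟩
    have h1 := Prod.mk.inj h
    have h2 := Prod.mk.inj h1.2
    exact ⟨(hb' _ _ _).1 h1.1, (hb' _ _ _).1 h2.1, (hb' _ _ _).1 h2.2⟩
  · rintro ⟨a₁, a₂, a₃⟩ hz ⟨c₁, c₂, c₃⟩ hz' h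
    have hz := Finset.mem_product.1 (Finset.mem_filter.1 hz).1
    have hz' := Finset.mem_product.1 (Finset.mem_filter.1 hz').1
    have hz2 := Finset.mem_product.1 hz.2
    have hz2' := Finset.mem_product.1 hz'.2
    have hh : ∀ i, (b a₁ i, b a₂ i, b a₃ i) = (b c₁ i, b c₂ i, b c₃ i) := congrFun h
    rw [hbi a₁ hz.1 c₁ hz'.1 fun i => congrArg (fun x => x.1) (hh i),
      hbi a₂ hz2.1 c₂ hz2'.1 fun i => congrArg (fun x => x.2.1) (hh i),
      hbi a₃ hz2.2 c₃ hz2'.2 fun i => congrArg (fun x => x.2.2) (hh i)]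

lemma ManyTypes.generic {V : Type*} [Fintype V] {G : SimpleGraph V} {q : ℕ}
    (f : Fin q × Bool ↪ V) (hG : ManyTypes G (Finset.univ.map f)) (hq : 1 ≤ q)
    (M Exc : Finset V) (hM : ∀ x, f x ∉ M) (𝓡 : Finset (Finset V)) {ρ ε : ℝ} (hρ : 0 ≤ ρ)
    (hε : 0 ≤ ε) (h : ∀ v ∉ Finset.univ.map f, v ∉ M → v ∉ Exc → nbrIn G (Finset.univ.map f) v ∈ 𝓡)
    (h𝓡 : (𝓡.card : ℝ) ≤ 2 ^ ρ) (hb : 2 * q * (Exc.card : ℝ) + ρ * Fintype.card V +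
      2 * q * (M.card : ℝ) - ((q : ℝ) - 3) * Fintype.card V ≤ ε * (q / 1500) * Fintype.card V) :
    Generic G M f ε := by
  set Q := Finset.univ.map f with hQ
  have hQc : Q.card = 2 * q := by
    rw [hQ, Finset.card_map, Finset.card_univ, Fintype.card_prod, Fintype.card_fin,
      Fintype.card_bool, mul_comm]
  have hq' : (1 : ℝ) ≤ q := by exact_mod_cast hq
  set n : ℝ := (Fintype.card V : ℝ) with hn
  have hn0 : (0 : ℝ) ≤ n := Nat.cast_nonneg _
  have hMQ : ∀ v ∈ M, v ∉ Q := by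
    intro v hv hv'
    obtain ⟨x, -, rfl⟩ := Finset.mem_map.1 hv'
    exact hM x hv
  intro p₁ p₂ p₃
  have h1 := card_triples_le M (nbrIn G Q) Q.powerset
    (fun v _ => Finset.mem_powerset.2 (nbrIn_subset _ _ _)) (L := 2 ^ ((Q.card : ℝ) - q / 500))
    (x := ε / 3 * n) (by positivity) (by positivity) (by
      intro 𝓣 h𝓣
      have h2 := hG.full M Exc 𝓡 𝓣 hρ (g := q / 500) (by positivity)
        (by rw [hQc]; push_cast; linarith) h h𝓡 h𝓣
      rw [hQc] at h2
      push_cast at h2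
      have h3 : {v | v ∈ M ∧ v ∉ Q ∧ nbrIn G Q v ∈ 𝓣} = {v | v ∈ M ∧ nbrIn G Q v ∈ 𝓣} := by
        ext v
        have := hMQ v
        simp only [Set.mem_ofPred_eq]
        tauto
      rw [h3] at h2
      have h4 : (q : ℝ) / 500 * (Set.ncard {v | v ∈ M ∧ nbrIn G Q v ∈ 𝓣} : ℝ) ≤
          q / 500 * (ε / 3 * n) := by
        linarith
      exact le_of_mul_le_mul_left h4 (by linarith))
    (TripleAvoids f p₁ p₂ p₃) (by
      refine (Nat.cast_le.2 (card_triples_avoiding_le f p₁ p₂ p₃)).trans ?_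
      rw [hQc, ← Real.rpow_natCast _ 3, ← Real.rpow_mul (by norm_num)]
      push_cast
      have e1 : (2 : ℝ) ^ ((2 * (q : ℝ) - q / 500) * 3) =
          ((2 : ℝ) ^ (6 - 3 / 500 : ℝ)) ^ q := by
        rw [← Real.rpow_natCast, ← Real.rpow_mul (by norm_num)]
        congr 1
        ring
      rw [e1]
      refine pow_le_pow_left₀ (by norm_num) ?_ q
      have e2 : (2 : ℝ) ^ (3 / 500 : ℝ) ≤ 64 / 63 := by
        have e3 : (8 : ℝ) ≤ (64 / 63 : ℝ) ^ 500 := by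
          have := one_add_mul_le_pow (show (-2 : ℝ) ≤ 1 / 63 by norm_num) 500
          rw [show (1 : ℝ) + 1 / 63 = 64 / 63 by norm_num] at this
          exact le_trans (by norm_num) this
        have e4 : ((2 : ℝ) ^ (3 / 500 : ℝ)) ^ 500 ≤ (64 / 63 : ℝ) ^ 500 := by
          rw [← Real.rpow_natCast (2 ^ (3 / 500 : ℝ)), ← Real.rpow_mul (by norm_num)]
          refine le_trans (le_of_eq ?_) e3
          norm_num
        exact le_of_pow_le_pow_left₀ (by norm_num) (by norm_num) e4
      rw [Real.rpow_sub (by norm_num)]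
      rw [le_div_iff₀ (by positivity)]
      have e5 : (2 : ℝ) ^ (6 : ℝ) = 64 := by norm_num
      rw [e5]
      linarith)
  refine le_trans (Nat.cast_le.2 ?_) (h1.trans (le_of_eq ?_))
  · rw [← Set.ncard_coe_finset]
    refine Set.ncard_le_ncard ?_ (Finset.finite_toSet _)
    rintro ⟨y₁, y₂, y₃⟩ ⟨m1, m2, m3, m4⟩
    rw [Finset.mem_coe, Finset.mem_filter]
    refine ⟨Finset.mem_product.2 ⟨m1, Finset.mem_product.2 ⟨m2, m3⟩⟩, fun i hi => m4 i ?_⟩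
    have hQf : ∀ x, f x ∈ Q := fun x => Finset.mem_map_of_mem f (Finset.mem_univ x)
    simpa only [AdjPat, mem_nbrIn, hQf, true_and] using hi
  · ring

end Full

/-! ### The basic partition -/

section Base

/-- The number of (ordered) induced paths with three vertices inside `X`. -/
def P3Count {V : Type*} (G : SimpleGraph V) (X : Finset V) : ℕ :=
  Set.ncard {z : V × V × V | z.1 ∈ X ∧ z.2.1 ∈ X ∧ z.2.2 ∈ X ∧ G.Adj z.1 z.2.1 ∧
    G.Adj z.2.1 z.2.2 ∧ z.1 ≠ z.2.2 ∧ ¬ G.Adj z.1 z.2.2}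

/-- The vertices with at least `a` neighbours and `b` non-neighbours among the values of `t`. -/
def midVerts {V : Type*} [Fintype V] (G : SimpleGraph V) {m : ℕ} (t : Fin m → V) (a b : ℕ) :
    Finset V :=
  Finset.univ.filter fun v => v ∉ Set.range t ∧
    a ≤ (Finset.univ.filter fun i => G.Adj v (t i)).card ∧
    b ≤ (Finset.univ.filter fun i => ¬ G.Adj v (t i)).card

/-- The complement of a finite set of vertices. -/
def otherVerts {V : Type*} [Fintype V] (X : Finset V) : Finset V :=
  Finset.univ.filter fun v => v ∉ X

lemma mem_otherVerts {V : Type*} [Fintype V] {X : Finset V} {v : V} :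
    v ∈ otherVerts X ↔ v ∉ X := by
  simp [otherVerts]

lemma mem_midVerts {V : Type*} [Fintype V] {G : SimpleGraph V} {m : ℕ} {t : Fin m → V} {a b : ℕ}
    {v : V} : v ∈ midVerts G t a b ↔ v ∉ Set.range t ∧
    a ≤ (Finset.univ.filter fun i => G.Adj v (t i)).card ∧
    b ≤ (Finset.univ.filter fun i => ¬ G.Adj v (t i)).card := by
  simp [midVerts]

lemma midVerts_compl {V : Type*} [Fintype V] (G : SimpleGraph V) {m : ℕ} (t : Fin m → V)
    (a b : ℕ) : midVerts Gᶜ t a b = midVerts G t b a := by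
  ext v
  rw [mem_midVerts, mem_midVerts]
  refine and_congr_right fun hv => ?_
  have hne : ∀ i, v ≠ t i := fun i h => hv ⟨i, h.symm⟩
  have h1 : ∀ i, Gᶜ.Adj v (t i) ↔ ¬ G.Adj v (t i) := fun i => by simp [hne i]
  simp only [h1, not_not]
  exact and_comm

lemma midVerts_delVerts {V : Type*} [Fintype V] (G : SimpleGraph V) {m : ℕ} {t : Fin m → V}
    (ht : Function.Injective t) (a : ℕ) (Q : Finset V) (hQ : Q.card ≤ 3) :
    (∀ v ∈ midVerts (delVerts G Q) t a (a + 3), v ∈ midVerts G t a a) ∧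
      ∀ v ∈ midVerts G t (a + 3) (a + 3), v ∉ Q → v ∈ midVerts (delVerts G Q) t a (a + 3) := by
  have hc : (Finset.univ.filter fun i => t i ∈ Q).card ≤ 3 := by
    refine le_trans (Finset.card_le_card_of_injOn t ?_ ht.injOn) hQ
    intro i hi
    simpa using hi
  constructor
  · intro v hv
    rw [mem_midVerts] at hv ⊢
    refine ⟨hv.1, hv.2.1.trans (Finset.card_le_card fun i hi => ?_), ?_⟩
    · simp only [Finset.mem_filter, Finset.mem_univ, true_and, delVerts_adj] at hi ⊢
      exact hi.1
    · by_cases hvQ : v ∈ Q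
      · have h0 : a = 0 := by
          have : (Finset.univ.filter fun i => (delVerts G Q).Adj v (t i)) = ∅ := by
            apply Finset.filter_false_of_mem
            intro i _ h
            exact (delVerts_adj.1 h).2.1 hvQ
          have h2 := hv.2.1
          rw [this] at h2
          simpa using h2
        omega
      · have h1 : (Finset.univ.filter fun i => ¬ (delVerts G Q).Adj v (t i)).card ≤
            (Finset.univ.filter fun i => ¬ G.Adj v (t i)).card +
              (Finset.univ.filter fun i => t i ∈ Q).card := by
          refine (Finset.card_le_card fun i hi => ?_).trans (Finset.card_union_le _ _)
          simp only [Finset.mem_filter, Finset.mem_univ, true_and, Finset.mem_union,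
            delVerts_adj] at hi ⊢
          tauto
        have := hv.2.2
        omega
  · intro v hv hvQ
    rw [mem_midVerts] at hv ⊢
    refine ⟨hv.1, ?_, hv.2.2.trans (Finset.card_le_card fun i hi => ?_)⟩
    · have h1 : (Finset.univ.filter fun i => G.Adj v (t i)).card ≤
            (Finset.univ.filter fun i => (delVerts G Q).Adj v (t i)).card +
              (Finset.univ.filter fun i => t i ∈ Q).card := by
        refine (Finset.card_le_card fun i hi => ?_).trans (Finset.card_union_le _ _)
        simp only [Finset.mem_filter, Finset.mem_univ, true_and, Finset.mem_union,
          delVerts_adj] at hi ⊢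
        tauto
      have := hv.2.1
      omega
    · simp only [Finset.mem_filter, Finset.mem_univ, true_and, delVerts_adj] at hi ⊢
      tauto

lemma P3Count_le_of_generic {V : Type*} [Fintype V] {G : SimpleGraph V} (hG : C5Free G)
    {M : Finset V} {q : ℕ} {f : Fin q × Bool → V} (hf : ∀ x y, x ≠ y → G.Adj (f x) (f y)) {ε : ℝ}
    (h : Generic G M f ε) : (P3Count G M : ℝ) ≤ 2 * ε * (Fintype.card V : ℝ) ^ 3 := by
  have h1 := h (true, true) (false, false) (false, false)
  have h2 := h (false, false) (false, false) (true, true)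
  have h3 := add_le_add h1 h2
  rw [← Nat.cast_add] at h3
  refine le_trans ?_ (h3.trans (by linarith))
  rw [P3Count]
  refine Nat.cast_le.2 ((Set.ncard_le_ncard ?_ (Set.toFinite _)).trans (Set.ncard_union_le _ _))
  rintro ⟨x, y, z⟩ ⟨hx, hy, hz, hxy, hyz, hne, hxz⟩
  simp only at hx hy hz hxy hyz hne hxz
  by_contra hcon
  rw [Set.mem_union, not_or] at hcon
  have e1 : ∃ i, AdjPat G x (f (i, false)) (f (i, true)) (true, true) ∧
      AdjPat G y (f (i, false)) (f (i, true)) (false, false) ∧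
      AdjPat G z (f (i, false)) (f (i, true)) (false, false) := by
    by_contra hc
    exact hcon.1 ⟨hx, hy, hz, fun i hi => hc ⟨i, hi⟩⟩
  have e2 : ∃ i, AdjPat G x (f (i, false)) (f (i, true)) (false, false) ∧
      AdjPat G y (f (i, false)) (f (i, true)) (false, false) ∧
      AdjPat G z (f (i, false)) (f (i, true)) (true, true) := by
    by_contra hc
    exact hcon.2 ⟨hx, hy, hz, fun i hi => hc ⟨i, hi⟩⟩
  obtain ⟨i, hi⟩ := e1
  obtain ⟨j, hj⟩ := e2
  simp only [AdjPat, Bool.false_eq_true, iff_false, iff_true] at hi hj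
  have hij : (j, false) ≠ (i, false) := by
    rintro h
    rw [h] at hj
    exact hj.1.1 hi.1.1
  exact hG x y z (f (j, false)) (f (i, false)) hxy hyz hj.2.2.1 (hf _ _ hij)
    (G.adj_symm hi.1.1) hxz hj.1.1 hj.2.1.1 hi.2.1.1 hi.2.2.1

/-- The subsets of `Q` that are nearly empty or nearly everything. -/
def nearTrivial {V : Type*} (e : ℝ) (Q : Finset V) : Finset (Finset V) :=
  Q.powerset.filter fun E => (E.card : ℝ) ≤ e * Q.card ∨ ((Q \ E).card : ℝ) ≤ e * Q.card

lemma exists_nearTrivial {γ : ℝ} (hγ : 0 < γ) : ∃ e > 0, ∀ {V : Type} (Q : Finset V),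
    ((nearTrivial e Q).card : ℝ) ≤ 2 ^ (γ * Q.card + 1) := by
  obtain ⟨e, he, h⟩ := exists_card_small_subsets_le hγ
  refine ⟨e, he, fun {V} Q => ?_⟩
  have h1 : (Q.powerset.filter fun E => (E.card : ℝ) ≤ e * Q.card).card ≤
      (Finset.univ.filter fun E : Finset (Fin Q.card) => (E.card : ℝ) ≤ e * Q.card).card := by
    have g := Q.equivFin
    refine Finset.card_le_card_of_injOn
      (fun E => Finset.univ.filter fun i => ((g.symm i : Q) : V) ∈ E) ?_ ?_
    · intro E hE
      rw [Finset.mem_coe, Finset.mem_filter, Finset.mem_powerset] at hE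
      rw [Finset.mem_coe, Finset.mem_filter]
      refine ⟨Finset.mem_univ _, le_trans (Nat.cast_le.2 ?_) hE.2⟩
      refine Finset.card_le_card_of_injOn (fun i => ((g.symm i : Q) : V)) ?_ ?_
      · intro i hi
        simpa using hi
      · intro i _ j _ hij
        exact g.symm.injective (Subtype.ext hij)
    · intro E hE E' hE' hEE
      rw [Finset.mem_coe, Finset.mem_filter, Finset.mem_powerset] at hE hE'
      have h2 : ∀ v (hv : v ∈ Q), v ∈ E ↔ v ∈ E' := by
        intro v hv
        have h3 := Finset.ext_iff.1 hEE (g ⟨v, hv⟩)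
        simpa using h3
      ext v
      exact ⟨fun hv => (h2 v (hE.1 hv)).1 hv, fun hv => (h2 v (hE'.1 hv)).2 hv⟩
  have h2 : (Q.powerset.filter fun E => ((Q \ E).card : ℝ) ≤ e * Q.card).card ≤
      (Q.powerset.filter fun E => (E.card : ℝ) ≤ e * Q.card).card := by
    refine Finset.card_le_card_of_injOn (fun E => Q \ E) ?_ ?_
    · intro E hE
      rw [Finset.mem_coe, Finset.mem_filter] at hE ⊢
      exact ⟨Finset.mem_powerset.2 Finset.sdiff_subset, hE.2⟩
    · intro E hE E' hE' hEE
      rw [Finset.mem_coe, Finset.mem_filter, Finset.mem_powerset] at hE hE'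
      have hEE' : Q \ E = Q \ E' := hEE
      rw [← Finset.sdiff_sdiff_eq_self hE.1, hEE', Finset.sdiff_sdiff_eq_self hE'.1]
  have h3 : (nearTrivial e Q).card ≤
      2 * (Q.powerset.filter fun E => (E.card : ℝ) ≤ e * Q.card).card := by
    rw [nearTrivial, Finset.filter_or]
    refine (Finset.card_union_le _ _).trans ?_
    omega
  have h4 := (Nat.cast_le (α := ℝ)).2 h1
  have h5 := (Nat.cast_le (α := ℝ)).2 h3
  have h6 := h Q.card
  push_cast at h5
  rw [Real.rpow_add_one (by norm_num)]
  linarith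

/-- A balanced partition into parts that are almost free of paths with three vertices, up to
complementation. -/
structure BasePartition {V : Type*} [Fintype V] (G : SimpleGraph V) (X Y : Finset V) (ε : ℝ) :
    Prop where
  mem_iff : ∀ v, v ∈ Y ↔ v ∉ X
  card_left : (X.card : ℝ) ≤ (1 / 2 + ε) * Fintype.card V
  card_right : (Y.card : ℝ) ≤ (1 / 2 + ε) * Fintype.card V
  left : (P3Count G X : ℝ) ≤ ε * (Fintype.card V : ℝ) ^ 3 ∨
    (P3Count Gᶜ X : ℝ) ≤ ε * (Fintype.card V : ℝ) ^ 3
  right : (P3Count G Y : ℝ) ≤ ε * (Fintype.card V : ℝ) ^ 3 ∨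
    (P3Count Gᶜ Y : ℝ) ≤ ε * (Fintype.card V : ℝ) ^ 3

lemma BasePartition.symm {V : Type*} [Fintype V] {G : SimpleGraph V} {X Y : Finset V} {ε : ℝ}
    (h : BasePartition G X Y ε) : BasePartition G Y X ε :=
  ⟨fun v => by rw [h.mem_iff v, not_not], h.card_right, h.card_left, h.right, h.left⟩

lemma BasePartition.compl {V : Type*} [Fintype V] {G : SimpleGraph V} {X Y : Finset V} {ε : ℝ}
    (h : BasePartition G X Y ε) : BasePartition Gᶜ X Y ε :=
  ⟨h.mem_iff, h.card_left, h.card_right, by rw [compl_compl]; exact h.left.symm,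
    by rw [compl_compl]; exact h.right.symm⟩

lemma BasePartition.mono {V : Type*} [Fintype V] {G : SimpleGraph V} {X Y : Finset V} {ε ε' : ℝ}
    (h : BasePartition G X Y ε) (hε : ε ≤ ε') : BasePartition G X Y ε' := by
  have h1 : ∀ {a : ℝ} (k : ℕ), a ≤ ε * (Fintype.card V : ℝ) ^ k →
      a ≤ ε' * (Fintype.card V : ℝ) ^ k := fun k ha =>
    ha.trans (mul_le_mul_of_nonneg_right hε (by positivity))
  have h2 : (1 / 2 + ε) * (Fintype.card V : ℝ) ≤ (1 / 2 + ε') * Fintype.card V :=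
    mul_le_mul_of_nonneg_right (by linarith) (Nat.cast_nonneg _)
  exact ⟨h.mem_iff, h.card_left.trans h2, h.card_right.trans h2, h.left.imp (h1 3) (h1 3),
    h.right.imp (h1 3) (h1 3)⟩

lemma P3Count_le_add {V : Type*} [Fintype V] (G : SimpleGraph V) (X X' : Finset V) {x : ℝ}
    (hx : (Set.ncard {v | v ∈ X ∧ v ∉ X'} : ℝ) ≤ x) :
    (P3Count G X : ℝ) ≤ P3Count G X' + 3 * x * (Fintype.card V : ℝ) ^ 2 := by
  set D := {v | v ∈ X ∧ v ∉ X'} with hD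
  have h1 : P3Count G X ≤ P3Count G X' + (Set.ncard (D ×ˢ (Set.univ : Set (V × V))) +
      Set.ncard ((Set.univ : Set V) ×ˢ (D ×ˢ (Set.univ : Set V))) +
      Set.ncard ((Set.univ : Set V) ×ˢ ((Set.univ : Set V) ×ˢ D))) := by
    rw [P3Count, P3Count]
    refine (Set.ncard_le_ncard (t := _ ∪ (_ ∪ _ ∪ _)) ?_ (Set.toFinite _)).trans
      ((Set.ncard_union_le _ _).trans (Nat.add_le_add le_rfl ((Set.ncard_union_le _ _).trans
        (Nat.add_le_add (Set.ncard_union_le _ _) le_rfl))))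
    rintro ⟨a, b, c⟩ ⟨ha, hb, hc, h⟩
    by_cases ha' : a ∈ X'
    · by_cases hb' : b ∈ X'
      · by_cases hc' : c ∈ X'
        · exact Or.inl ⟨ha', hb', hc', h⟩
        · exact Or.inr (Or.inr ⟨trivial, trivial, hc, hc'⟩)
      · exact Or.inr (Or.inl (Or.inr ⟨trivial, ⟨hb, hb'⟩, trivial⟩))
    · exact Or.inr (Or.inl (Or.inl ⟨⟨ha, ha'⟩, trivial⟩))
  simp only [Set.ncard_prod, Set.ncard_univ, Nat.card_eq_fintype_card, Fintype.card_prod] at h1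
  have h2 := (Nat.cast_le (α := ℝ)).2 h1
  push_cast at h2
  have h3 := mul_le_mul_of_nonneg_right hx (sq_nonneg (Fintype.card V : ℝ))
  nlinarith

lemma Generic.P3Count_le {V : Type*} [Fintype V] {G : SimpleGraph V} (hG : C5Free G)
    {M : Finset V} {q : ℕ} {f : Fin q × Bool ↪ V} (hM : ∀ x, f x ∉ M) (c : Bool)
    (hf : ∀ x y, x ≠ y → (G.Adj (f x) (f y) ↔ c = true)) {ε : ℝ} (h : Generic G M f ε) :
    (P3Count G M : ℝ) ≤ 2 * ε * (Fintype.card V : ℝ) ^ 3 ∨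
      (P3Count Gᶜ M : ℝ) ≤ 2 * ε * (Fintype.card V : ℝ) ^ 3 := by
  cases c
  · refine Or.inr (P3Count_le_of_generic hG.compl (f := f) ?_ (h.compl hM))
    intro x y hxy
    rw [SimpleGraph.compl_adj, hf x y hxy]
    exact ⟨f.injective.ne hxy, by simp⟩
  · exact Or.inl (P3Count_le_of_generic hG (f := f) (fun x y hxy => (hf x y hxy).2 rfl) h)

lemma card_nbrIn_map {V ι : Type*} [Fintype ι] (G : SimpleGraph V) (f : ι ↪ V) (v : V) :
    (nbrIn G (Finset.univ.map f) v).card = (Finset.univ.filter fun i => G.Adj v (f i)).card ∧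
    (Finset.univ.map f \ nbrIn G (Finset.univ.map f) v).card =
      (Finset.univ.filter fun i => ¬ G.Adj v (f i)).card := by
  constructor
  · rw [← Finset.card_map f]
    congr 1
    ext w
    simp only [mem_nbrIn, Finset.mem_map, Finset.mem_univ, true_and, Finset.mem_filter]
    constructor
    · rintro ⟨⟨i, rfl⟩, h⟩
      exact ⟨i, h, rfl⟩
    · rintro ⟨i, h, rfl⟩
      exact ⟨⟨i, rfl⟩, h⟩
  · rw [← Finset.card_map f]
    congr 1
    ext w
    simp only [mem_nbrIn, Finset.mem_map, Finset.mem_univ, true_and, Finset.mem_filter,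
      Finset.mem_sdiff]
    constructor
    · rintro ⟨⟨i, rfl⟩, h⟩
      exact ⟨i, fun h' => h ⟨⟨i, rfl⟩, h'⟩, rfl⟩
    · rintro ⟨i, h, rfl⟩
      exact ⟨⟨i, rfl⟩, fun h' => h h'.2⟩

lemma ManyTypes.half {V : Type} [Fintype V] {G : SimpleGraph V} {q : ℕ} {f : Fin q × Bool ↪ V}
    (hG : ManyTypes G (Finset.univ.map f)) (hq : 1 ≤ q) {M : Finset V} (hM : ∀ x, f x ∉ M)
    {e γ η : ℝ} (hγ : 0 < γ) (hη : 0 < η) (hη' : η ≤ 1 / 8)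
    (h : ∀ v ∉ Finset.univ.map f, v ∉ M →
      nbrIn G (Finset.univ.map f) v ∈ nearTrivial e (Finset.univ.map f))
    (hnt : ((nearTrivial e (Finset.univ.map f)).card : ℝ) ≤
      2 ^ (γ * (Finset.univ.map f).card + 1))
    (hγη : γ * (2 * q : ℕ) + 4 ≤ η * (2 * q : ℕ)) :
    (1 / 2 - η) * Fintype.card V ≤ M.card ∧ ((M.card : ℝ) ≤ (1 / 2 + η) * Fintype.card V →
      Generic G M f (6000 * η) ∧ (Set.ncard {v | v ∈ M ∧ v ∉ Finset.univ.map f ∧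
        nbrIn G (Finset.univ.map f) v ∈ nearTrivial e (Finset.univ.map f)} : ℝ) ≤
          8 * η * Fintype.card V) := by
  have hc : (Finset.univ.map f).card = 2 * q := by
    rw [Finset.card_map, Finset.card_univ, Fintype.card_prod, Fintype.card_fin,
      Fintype.card_bool, mul_comm]
  rw [hc] at hnt
  have hq' : (1 : ℝ) ≤ q := by exact_mod_cast hq
  have hρ : 0 ≤ γ * (2 * q : ℕ) + 1 := by positivity
  have h' : ∀ v ∉ Finset.univ.map f, v ∉ M → v ∉ (∅ : Finset V) →
      nbrIn G (Finset.univ.map f) v ∈ nearTrivial e (Finset.univ.map f) :=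
    fun v h1 h2 _ => h v h1 h2
  have hn : (0 : ℝ) ≤ Fintype.card V := Nat.cast_nonneg _
  push_cast at hγη
  have hgap := mul_le_mul_of_nonneg_right hγη hn
  refine ⟨?_, fun hM' => ⟨?_, ?_⟩⟩
  · have h1 := hG.full M ∅ _ ∅ hρ le_rfl (Nat.cast_nonneg _) h' hnt (by
      rw [Finset.card_empty, Nat.cast_zero]; positivity)
    rw [hc] at h1
    push_cast at h1
    have h2 : 0 ≤ (2 * (q : ℝ)) * (M.card - (1 / 2 - η) * Fintype.card V) := by
      simp only [Finset.card_empty, Nat.cast_zero] at h1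
      linarith
    have h3 := nonneg_of_mul_nonneg_right h2 (by positivity)
    linarith
  · refine ManyTypes.generic f hG hq M ∅ hM _ hρ (by positivity) h' hnt ?_
    have h3 := mul_le_mul_of_nonneg_left hM' (by positivity : (0 : ℝ) ≤ 2 * q)
    push_cast
    simp only [Finset.card_empty, Nat.cast_zero]
    linarith
  · have h1 := hG.full M ∅ _ (nearTrivial e (Finset.univ.map f)) hρ (g := q / 2) (by positivity)
      (by rw [hc]; push_cast; linarith) h' hnt (hnt.trans (by
        refine Real.rpow_le_rpow_of_exponent_le (by norm_num) ?_
        rw [hc]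
        push_cast
        nlinarith))
    rw [hc] at h1
    push_cast at h1
    simp only [Finset.card_empty, Nat.cast_zero] at h1
    have h3 := mul_le_mul_of_nonneg_left hM' (by positivity : (0 : ℝ) ≤ 2 * q)
    have h4 : (q / 2 : ℝ) * (Set.ncard {v | v ∈ M ∧ v ∉ Finset.univ.map f ∧
        nbrIn G (Finset.univ.map f) v ∈ nearTrivial e (Finset.univ.map f)} : ℝ) ≤
        (q / 2 : ℝ) * (8 * η * Fintype.card V) := by linarith
    exact le_of_mul_le_mul_left h4 (by positivity)

lemma CubeConfig.basePartition {V : Type} [Fintype V] {G : SimpleGraph V} (hG : C5Free G)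
    {k r : ℕ} (c : CubeConfig G (2 * k)) {e γ η : ℝ} (hγ : 0 < γ) (hη : 0 < η) (hη' : η ≤ 1 / 8)
    (hS : ∀ S : Finset V, S.card = 2 ^ (2 * k) ∨ S.card = 2 * k → ManyTypes G S)
    (hnt : ∀ S : Finset V, ((nearTrivial e S).card : ℝ) ≤ 2 ^ (γ * S.card + 1))
    (hr : (3 / 4 : ℝ) ^ r ≤ e) (hk : 1 ≤ k) (hre : ((4 * r + 3 : ℕ) : ℝ) ≤ e * (2 * k : ℕ))
    (hγη : γ * (2 * k : ℕ) + 4 ≤ η * (2 * k : ℕ)) :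
    BasePartition G (midVerts G c.t (4 * r) (4 * r))
        (otherVerts (midVerts G c.t (4 * r) (4 * r))) (13000 * η) ∧
      (Set.ncard {v | v ∈ midVerts G c.t (4 * r) (4 * r) ∧
        v ∉ midVerts G c.t (4 * r + 3) (4 * r + 3)} : ℝ) ≤ 13000 * η * Fintype.card V := by
  set A := midVerts G c.t (4 * r) (4 * r) with hA
  have et : Fin k × Bool ≃ Fin (2 * k) := Fintype.equivOfCardEq (by simp [mul_comm])
  obtain ⟨l, hl⟩ : ∃ l, 2 * k = l + 1 := ⟨2 * k - 1, by omega⟩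
  have es : Fin (2 ^ l) × Bool ≃ (Fin (2 * k) → Bool) :=
    Fintype.equivOfCardEq (by simp [hl, pow_succ])
  set f : Fin k × Bool ↪ V := et.toEmbedding.trans ⟨c.t, c.t_inj⟩ with hf
  set g : Fin (2 ^ l) × Bool ↪ V := es.toEmbedding.trans ⟨c.s, c.s_inj⟩ with hg
  have hfm : Finset.univ.map f = Finset.univ.map ⟨c.t, c.t_inj⟩ := by
    rw [hf, ← Finset.map_map, Finset.map_univ_equiv]
  have hgm : Finset.univ.map g = Finset.univ.map ⟨c.s, c.s_inj⟩ := by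
    rw [hg, ← Finset.map_map, Finset.map_univ_equiv]
  have hfc : (Finset.univ.map f).card = 2 * k := by simp [mul_comm]
  have hgc : (Finset.univ.map g).card = 2 ^ (2 * k) := by simp [hl, pow_succ]
  have hn : (0 : ℝ) ≤ Fintype.card V := Nat.cast_nonneg _
  set B := Finset.univ.filter fun v => v ∉ Finset.univ.map g ∧
    nbrIn G (Finset.univ.map g) v ∉ nearTrivial e (Finset.univ.map g) with hB
  have hBm : ∀ v, v ∈ B ↔ v ∉ Finset.univ.map g ∧
      nbrIn G (Finset.univ.map g) v ∉ nearTrivial e (Finset.univ.map g) := by simp [hB]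
  have hnear : ∀ (S : Finset V) v, nbrIn G S v ∈ nearTrivial e S ↔
      ((nbrIn G S v).card : ℝ) ≤ e * S.card ∨ ((S \ nbrIn G S v).card : ℝ) ≤ e * S.card := by
    intro S v
    simp [nearTrivial, nbrIn_subset]
  have hAB : ∀ v ∈ A, v ∉ B := by
    intro v hv hvB
    rw [hBm, hnear, hgc, hgm, (card_nbrIn_map _ _ _).1, (card_nbrIn_map _ _ _).2] at hvB
    rw [hA, mem_midVerts] at hv
    have hpow := mul_le_mul_of_nonneg_right hr (by positivity : (0 : ℝ) ≤ 2 ^ (2 * k))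
    have hsum : (Finset.univ.filter fun i => G.Adj v (c.t i)).card +
        (Finset.univ.filter fun i => ¬ G.Adj v (c.t i)).card = 2 * k := by
      rw [Finset.card_filter_add_card_filter_not, Finset.card_univ, Fintype.card_fin]
    refine hvB.2 ?_
    push_cast
    rcases c.dichotomy hG r (v := v) with h | h | h | h
    · omega
    · omega
    · exact Or.inl (h.trans hpow)
    · exact Or.inr (h.trans hpow)
  have hsmall : ∀ v ∉ Finset.univ.map f, v ∉ midVerts G c.t (4 * r + 3) (4 * r + 3) →
      nbrIn G (Finset.univ.map f) v ∈ nearTrivial e (Finset.univ.map f) := by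
    intro v hv hvA
    rw [hnear, hfc, hfm, (card_nbrIn_map _ _ _).1, (card_nbrIn_map _ _ _).2]
    rw [mem_midVerts] at hvA
    have hv' : v ∉ Set.range c.t := by
      rintro ⟨i, rfl⟩
      refine hv ?_
      rw [hfm]
      exact Finset.mem_map.2 ⟨i, Finset.mem_univ _, rfl⟩
    by_cases h1 : 4 * r + 3 ≤ (Finset.univ.filter fun i => G.Adj v (c.t i)).card
    · refine Or.inr (le_trans (Nat.cast_le.2 ?_) hre)
      by_contra h2
      exact hvA ⟨hv', h1, by push Not at h2; exact h2.le⟩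
    · refine Or.inl (le_trans (Nat.cast_le.2 ?_) hre)
      push Not at h1
      exact h1.le
  have hmono : ∀ v, v ∈ midVerts G c.t (4 * r + 3) (4 * r + 3) → v ∈ A := by
    intro v hv
    rw [mem_midVerts] at hv
    rw [hA, mem_midVerts]
    exact ⟨hv.1, by omega, by omega⟩
  have hfA : ∀ x, f x ∉ A := by
    intro x hx
    rw [hA, mem_midVerts] at hx
    exact hx.1 ⟨_, rfl⟩
  have hgB : ∀ x, g x ∉ B := fun x hx =>
    ((hBm _).1 hx).1 (Finset.mem_map.2 ⟨x, Finset.mem_univ _, rfl⟩)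
  have HT := (hS _ (Or.inr hfc)).half (e := e) (γ := γ) hk hfA hγ hη hη'
    (fun v h1 h2 => hsmall v h1 fun h3 => h2 (hmono v h3)) (hnt _) hγη
  have hkl : ((2 * k : ℕ) : ℝ) ≤ (2 * 2 ^ l : ℕ) := by
    have : 2 * k < 2 ^ (2 * k) := Nat.lt_two_pow_self
    rw [hl, pow_succ, ← hl] at this
    exact Nat.cast_le.2 (by omega)
  have hγη0 : γ ≤ η := by
    by_contra hcon
    have := mul_le_mul_of_nonneg_right (not_le.1 hcon).le (Nat.cast_nonneg (α := ℝ) (2 * k))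
    linarith
  have HS := (hS _ (Or.inl hgc)).half (e := e) (γ := γ) (η := η) Nat.one_le_two_pow hgB hγ hη hη'
    (fun v h1 h2 => by by_contra h3; exact h2 ((hBm v).2 ⟨h1, h3⟩)) (hnt _) (by
      nlinarith [mul_le_mul_of_nonneg_left hkl (sub_nonneg.2 hγη0)])
  have hdis : Disjoint A B := Finset.disjoint_left.2 hAB
  have hcard : (A.card : ℝ) + B.card ≤ Fintype.card V := by
    rw [← Nat.cast_add, ← Finset.card_union_of_disjoint hdis]
    exact Nat.cast_le.2 (Finset.card_le_univ _)
  have hAc : (A.card : ℝ) ≤ (1 / 2 + η) * Fintype.card V := by linarith [HS.1]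
  have hBc : (B.card : ℝ) ≤ (1 / 2 + η) * Fintype.card V := by linarith [HT.1]
  set B₀ := otherVerts A with hB₀
  have hAB₀ : (A.card : ℝ) + B₀.card = Fintype.card V := by
    have := Finset.card_filter_add_card_filter_not (s := (Finset.univ : Finset V)) (· ∈ A)
    rw [Finset.filter_univ_mem, Finset.card_univ] at this
    exact_mod_cast this
  have hηn : 0 ≤ η * (Fintype.card V : ℝ) := by positivity
  have hηn3 : 0 ≤ η * (Fintype.card V : ℝ) ^ 3 := by positivity
  have hBB : (Set.ncard {v | v ∈ B₀ ∧ v ∉ B} : ℝ) ≤ 2 * η * Fintype.card V := by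
    have h1 : {v | v ∈ B₀ ∧ v ∉ B} = ((B₀ \ B : Finset V) : Set V) := by ext; simp
    have h2 : B ⊆ B₀ := fun v hv => by
      rw [hB₀, mem_otherVerts]
      exact fun h => hAB v h hv
    have h3 := Finset.card_sdiff_add_card_eq_card h2
    rw [h1, Set.ncard_coe_finset]
    have h4 : ((B₀ \ B).card : ℝ) + B.card = B₀.card := by exact_mod_cast h3
    linarith [HS.1, HT.1]
  have hP3A := (HT.2 hAc).1.P3Count_le hG hfA c.ct
    (fun x y hxy => c.hct _ _ (et.injective.ne hxy))
  have hP3B := (HS.2 hBc).1.P3Count_le hG hgB c.cs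
    (fun x y hxy => c.hcs _ _ (es.injective.ne hxy))
  refine ⟨⟨fun v => mem_otherVerts, by linarith, by linarith [HT.1], ?_, ?_⟩, ?_⟩
  · exact hP3A.imp (fun h => h.trans (by linarith)) (fun h => h.trans (by linarith))
  · refine hP3B.imp (fun h => ?_) (fun h => ?_)
    · have := P3Count_le_add G B₀ B hBB
      nlinarith
    · have := P3Count_le_add Gᶜ B₀ B hBB
      nlinarith
  · refine le_trans (Nat.cast_le.2 (Set.ncard_le_ncard ?_ (Set.toFinite _)))
      ((HT.2 hAc).2.trans (by linarith))
    intro v hv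
    have hvf : v ∉ Finset.univ.map f := by
      intro h
      obtain ⟨x, -, rfl⟩ := Finset.mem_map.1 h
      exact hfA x hv.1
    exact ⟨hv.1, hvf, hsmall v hvf hv.2⟩

lemma exists_base {ε : ℝ} (hε : 0 < ε) : ∃ r m : ℕ, ∀ᶠ x in typicalGraphs,
    ∃ t : Fin m → Fin x.1, Function.Injective t ∧
      BasePartition x.2 (midVerts x.2 t (4 * r) (4 * r))
        (otherVerts (midVerts x.2 t (4 * r) (4 * r))) ε ∧
      (Set.ncard {v | v ∈ midVerts x.2 t (4 * r) (4 * r) ∧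
        v ∉ midVerts x.2 t (4 * r + 3) (4 * r + 3)} : ℝ) ≤ ε * x.1 := by
  set η := min (ε / 13000) (1 / 8) with hηdef
  have hη : 0 < η := by positivity
  have hη' : 13000 * η ≤ ε := by linarith [min_le_left (ε / 13000) (1 / 8)]
  obtain ⟨e, he, hnt⟩ := exists_nearTrivial (half_pos hη)
  obtain ⟨r, hr⟩ := exists_pow_lt_of_lt_one he (by norm_num : (3 / 4 : ℝ) < 1)
  obtain ⟨k, hk⟩ := exists_nat_ge (max 1 (max (((4 * r + 3 : ℕ) : ℝ) / e) (8 / η)))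
  rw [max_le_iff, max_le_iff, div_le_iff₀ he, div_le_iff₀ hη] at hk
  have hk1 : 1 ≤ k := by exact_mod_cast hk.1
  obtain ⟨s, n₀, hc⟩ := exists_cubeConfig (2 * k)
  refine ⟨r, 2 * k, ?_⟩
  filter_upwards [typical_c5Free, typical_manyTypes s, typical_manyTypes (2 * k),
    typical_manyTypes (2 ^ (2 * k)), typical_of_eventually (eventually_ge_atTop n₀)]
    with ⟨n, G⟩ hG h1 h2 h3 hn
  obtain ⟨c⟩ := hc (V := Fin n) G (by simpa using hn) h1
  have := c.basePartition hG (r := r) (half_pos hη) hη (min_le_right _ _)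
    (fun S hS => hS.elim (h3 S) (h2 S)) (fun S => hnt S) hr.le hk1 (by
      push_cast at hk ⊢; nlinarith [hk.1]) (by push_cast; nlinarith)
  rw [Fintype.card_fin] at this
  refine ⟨c.t, c.t_inj, this.1.mono hη', this.2.trans ?_⟩
  exact mul_le_mul_of_nonneg_right hη' (Nat.cast_nonneg _)

end Base

/-! ### Generic sequences of pairs -/

section Uni

lemma ncard_eq_sum_fiber {α β : Type*} [Fintype α] [Finite β] (R : Set (α × β)) :
    R.ncard = ∑ a, Set.ncard {b | (a, b) ∈ R} := by
  have := Fintype.ofFinite β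
  have h1 : R = ((Finset.univ.sigma fun a => Finset.univ.filter fun b => (a, b) ∈ R).map
      (Equiv.sigmaEquivProd α β).toEmbedding : Finset (α × β)) := by
    ext ⟨a, b⟩
    simp
  rw [h1, Set.ncard_coe_finset, Finset.card_map, Finset.card_sigma]
  refine Finset.sum_congr rfl fun a _ => ?_
  rw [← Set.ncard_coe_finset]
  congr 1
  ext b
  simp

lemma mul_ncard_le {α β : Type*} [Finite α] [Finite β] (R : Set (α × β)) (P : Set α) {x : ℝ}
    (h : ∀ a ∈ P, x ≤ Set.ncard {b | (a, b) ∈ R}) : x * P.ncard ≤ R.ncard := by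
  have := Fintype.ofFinite α
  rw [ncard_eq_sum_fiber, Nat.cast_sum, ← Set.coe_toFinset P, Set.ncard_coe_finset, mul_comm,
    ← nsmul_eq_mul]
  refine (Finset.card_nsmul_le_sum _ _ x fun a ha => h a (by simpa using ha)).trans ?_
  exact Finset.sum_le_sum_of_subset_of_nonneg (Finset.subset_univ _) fun _ _ _ => Nat.cast_nonneg _

lemma exists_fin_pairwise {α : Type*} [Finite α] (B : Set α) (R : α → α → Prop)
    (hR : ∀ p p', R p p' → R p' p) {d : ℝ}
    (h : ∀ p ∈ B, (Set.ncard {p' | R p p'} : ℝ) ≤ d) (q : ℕ) (hq : q * d < B.ncard) (hd : 0 ≤ d) :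
    ∃ g : Fin q → α, (∀ i, g i ∈ B) ∧ ∀ i j, i ≠ j → ¬ R (g i) (g j) := by
  induction q with
  | zero => exact ⟨Fin.elim0, fun i => i.elim0, fun i => i.elim0⟩
  | succ q ih =>
    push_cast at hq
    obtain ⟨g, hg, hgR⟩ := ih (by linarith)
    have hU : ((⋃ i, {p' | R (g i) p'}).ncard : ℝ) ≤ q * d := by
      have h1 : (⋃ i, {p' | R (g i) p'}).ncard ≤ ∑ i, Set.ncard {p' | R (g i) p'} := by
        have := Set.ncard_iUnion_le_of_fintype fun i => {p' | R (g i) p'}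
        exact this
      refine (Nat.cast_le.2 h1).trans ?_
      rw [Nat.cast_sum]
      refine (Finset.sum_le_card_nsmul _ _ d fun i _ => h _ (hg i)).trans ?_
      simp
    obtain ⟨p, hp, hpU⟩ := Set.exists_mem_notMem_of_ncard_lt_ncard
      (s := ⋃ i, {p' | R (g i) p'}) (t := B) (by
        have : ((⋃ i, {p' | R (g i) p'}).ncard : ℝ) < B.ncard := by linarith
        exact_mod_cast this) (Set.toFinite _)
    have hp' : ∀ i, ¬ R (g i) p := fun i hi => hpU (Set.mem_iUnion.2 ⟨i, hi⟩)
    refine ⟨Fin.cons p g, ?_, ?_⟩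
    · intro i
      refine Fin.cases ?_ (fun i => ?_) i
      · simpa using hp
      · simpa using hg i
    · intro i j
      refine Fin.cases ?_ (fun i => ?_) i
      · refine Fin.cases ?_ (fun j => ?_) j
        · simp
        · intro _ hj
          exact hp' j (hR _ _ (by simpa using hj))
      · refine Fin.cases ?_ (fun j => ?_) j
        · intro _ hj
          exact hp' i (by simpa using hj)
        · intro hij hj
          exact hgR i j (fun h => hij (by rw [h])) (by simpa using hj)

lemma exists_independent_pairs {V : Type*} [Fintype V] {Bad : V → V → Prop}
    (hrefl : ∀ b, Bad b b) (hsymm : ∀ b b', Bad b b' → Bad b' b) {σ ξ : ℝ} (hσ : 0 < σ)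
    (hbad : (Set.ncard {p : V × V | Bad p.1 p.2} : ℝ) ≤ σ ^ 2 * (Fintype.card V : ℝ) ^ 2)
    (𝓑 : Set (V × V)) (h𝓑 : ξ * (Fintype.card V : ℝ) ^ 2 ≤ 𝓑.ncard) (q : ℕ)
    (hξ : 2 * σ + σ ^ 2 + 4 * q * σ < ξ) (hV : 0 < Fintype.card V) :
    ∃ f : Fin q × Bool ↪ V, (∀ i, (f (i, false), f (i, true)) ∈ 𝓑) ∧
      ∀ x y, x ≠ y → ¬ Bad (f x) (f y) := by
  set n : ℝ := (Fintype.card V : ℝ) with hn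
  have hn0 : 0 < n := Nat.cast_pos.2 hV
  set D : Set V := {b | σ * n ≤ Set.ncard {b' | Bad b b'}} with hD
  have hDc : (D.ncard : ℝ) ≤ σ * n := by
    have h1 := mul_ncard_le {p : V × V | Bad p.1 p.2} D (x := σ * n) fun a ha => ha
    have h2 : σ * n * D.ncard ≤ σ * n * (σ * n) := by nlinarith
    exact le_of_mul_le_mul_left h2 (by positivity)
  have hcV : ((Set.univ : Set V).ncard : ℝ) = n := by
    rw [Set.ncard_univ, Nat.card_eq_fintype_card]
  set E : Set (V × V) := D ×ˢ Set.univ ∪ Set.univ ×ˢ D ∪ {p : V × V | Bad p.1 p.2} with hE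
  have hEc : (E.ncard : ℝ) ≤ (2 * σ + σ ^ 2) * n ^ 2 := by
    have h1 := (Set.ncard_union_le (D ×ˢ Set.univ ∪ Set.univ ×ˢ D) {p : V × V | Bad p.1 p.2}).trans
      (Nat.add_le_add_right (Set.ncard_union_le _ _) _)
    have h2 := (Nat.cast_le (α := ℝ)).2 h1
    rw [Set.ncard_prod, Set.ncard_prod] at h2
    push_cast at h2
    rw [hcV] at h2
    nlinarith
  have hBc : (4 * q * σ) * n ^ 2 < (𝓑 \ E).ncard := by
    have h1 := (Nat.cast_le (α := ℝ)).2 (Set.le_ncard_sdiff E 𝓑 (Set.toFinite _))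
    have h2 : (𝓑.ncard : ℝ) ≤ (𝓑 \ E).ncard + E.ncard := by
      have := Set.ncard_le_ncard_sdiff_add_ncard 𝓑 E (Set.toFinite _)
      exact_mod_cast this
    have h3 : (2 * σ + σ ^ 2 + 4 * q * σ) * n ^ 2 < ξ * n ^ 2 :=
      mul_lt_mul_of_pos_right hξ (by positivity)
    linarith
  set R : V × V → V × V → Prop := fun p p' => Bad p.1 p'.1 ∨ Bad p.1 p'.2 ∨ Bad p.2 p'.1 ∨
    Bad p.2 p'.2 with hR
  obtain ⟨g, hg, hgR⟩ := exists_fin_pairwise (𝓑 \ E) R (by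
      rintro p p' (h | h | h | h)
      · exact Or.inl (hsymm _ _ h)
      · exact Or.inr (Or.inr (Or.inl (hsymm _ _ h)))
      · exact Or.inr (Or.inl (hsymm _ _ h))
      · exact Or.inr (Or.inr (Or.inr (hsymm _ _ h)))) (d := 4 * σ * n ^ 2) (by
      intro p hp
      have hp1 : ∀ b ∉ D, (Set.ncard {b' | Bad b b'} : ℝ) ≤ σ * n := fun b hb => by
        simp only [hD, Set.mem_ofPred_eq, not_le] at hb
        exact hb.le
      have h1 := hp1 p.1 fun h => hp.2 (Or.inl (Or.inl ⟨h, trivial⟩))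
      have h2 := hp1 p.2 fun h => hp.2 (Or.inl (Or.inr ⟨trivial, h⟩))
      have h3 : {p' | R p p'} ⊆ ({b' | Bad p.1 b'} ×ˢ Set.univ ∪ Set.univ ×ˢ {b' | Bad p.1 b'}) ∪
          ({b' | Bad p.2 b'} ×ˢ Set.univ ∪ Set.univ ×ˢ {b' | Bad p.2 b'}) := by grind
      have h4 := (Nat.cast_le (α := ℝ)).2 ((Set.ncard_le_ncard h3 (Set.toFinite _)).trans
        ((Set.ncard_union_le _ _).trans
          (Nat.add_le_add (Set.ncard_union_le _ _) (Set.ncard_union_le _ _))))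
      simp only [Set.ncard_prod] at h4
      push_cast at h4
      rw [hcV] at h4
      nlinarith) q (by linarith) (by positivity)
  have hbad' : ∀ x y : Fin q × Bool, x ≠ y →
      ¬ Bad (if x.2 then (g x.1).2 else (g x.1).1) (if y.2 then (g y.1).2 else (g y.1).1) := by grind
  refine ⟨⟨fun x => if x.2 then (g x.1).2 else (g x.1).1, fun x y hxy => ?_⟩, fun i => ?_, hbad'⟩
  · by_contra hne
    refine hbad' x y hne ?_
    simp only at hxy
    rw [hxy]
    exact hrefl _
  · exact (hg i).1

/-- Among any dense set of pairs in `X` there are `q` disjoint pairs towards which the vertices of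
`Y` behave generically. -/
def Uni {V : Type*} [Fintype V] (G : SimpleGraph V) (X Y : Finset V) (ξ : ℝ) (q : ℕ) : Prop :=
  ∀ 𝓑 : Set (V × V), (∀ p ∈ 𝓑, p.1 ∈ X ∧ p.2 ∈ X) → ξ * (Fintype.card V : ℝ) ^ 2 ≤ 𝓑.ncard →
    ∃ f : Fin q × Bool ↪ V, (∀ i, (f (i, false), f (i, true)) ∈ 𝓑) ∧ Generic G Y f (ξ / 2)

/-- The three vertices induce a path. -/
def InducesP3 {V : Type*} (G : SimpleGraph V) (b b' v : V) : Prop :=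
  (G.Adj b v ∧ G.Adj v b' ∧ b ≠ b' ∧ ¬ G.Adj b b') ∨
    (G.Adj v b ∧ G.Adj b b' ∧ v ≠ b' ∧ ¬ G.Adj v b') ∨
      (G.Adj v b' ∧ G.Adj b' b ∧ v ≠ b ∧ ¬ G.Adj v b)

lemma InducesP3.symm {V : Type*} {G : SimpleGraph V} {b b' v : V} (h : InducesP3 G b b' v) :
    InducesP3 G b' b v := by
  rcases h with ⟨h1, h2, h3, h4⟩ | h | h
  · exact Or.inl ⟨G.adj_symm h2, G.adj_symm h1, h3.symm, fun h => h4 (G.adj_symm h)⟩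
  · exact Or.inr (Or.inr h)
  · exact Or.inr (Or.inl h)

lemma ncard_inducesP3_le {V : Type*} [Fintype V] (G : SimpleGraph V) (X : Finset V) :
    Set.ncard {y : (V × V) × V | (y.1.1 ∈ X ∧ y.1.2 ∈ X) ∧ y.2 ∈ X ∧
      InducesP3 G y.1.1 y.1.2 y.2} ≤ 3 * P3Count G X := by
  set P : Set (V × V × V) := {z : V × V × V | z.1 ∈ X ∧ z.2.1 ∈ X ∧ z.2.2 ∈ X ∧ G.Adj z.1 z.2.1 ∧
    G.Adj z.2.1 z.2.2 ∧ z.1 ≠ z.2.2 ∧ ¬ G.Adj z.1 z.2.2} with hP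
  have h1 : {y : (V × V) × V | (y.1.1 ∈ X ∧ y.1.2 ∈ X) ∧ y.2 ∈ X ∧ InducesP3 G y.1.1 y.1.2 y.2} ⊆
      ((fun z : V × V × V => ((z.1, z.2.2), z.2.1)) '' P) ∪
        (((fun z : V × V × V => ((z.2.1, z.2.2), z.1)) '' P) ∪
          ((fun z : V × V × V => ((z.2.2, z.2.1), z.1)) '' P)) := by
    rintro ⟨⟨b, b'⟩, v⟩ ⟨⟨hb, hb'⟩, hv, ⟨h1, h2, h3, h4⟩ | ⟨h1, h2, h3, h4⟩ | ⟨h1, h2, h3, h4⟩⟩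
    · exact Or.inl ⟨(b, v, b'), ⟨hb, hv, hb', h1, h2, h3, h4⟩, rfl⟩
    · exact Or.inr (Or.inl ⟨(v, b, b'), ⟨hv, hb, hb', h1, h2, h3, h4⟩, rfl⟩)
    · exact Or.inr (Or.inr ⟨(v, b', b), ⟨hv, hb', hb, h1, h2, h3, h4⟩, rfl⟩)
  refine (Set.ncard_le_ncard h1 (Set.toFinite _)).trans ((Set.ncard_union_le _ _).trans
    ((Nat.add_le_add_left (Set.ncard_union_le _ _) _).trans ?_))
  have h2 : P3Count G X = P.ncard := rfl
  have h3 := fun f : V × V × V → (V × V) × V => Set.ncard_image_le (f := f) (Set.toFinite P)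
  have := h3 fun z => ((z.1, z.2.2), z.2.1)
  have := h3 fun z => ((z.2.1, z.2.2), z.1)
  have := h3 fun z => ((z.2.2, z.2.1), z.1)
  omega

lemma uni_of_P3Count {V : Type*} [Fintype V] {G : SimpleGraph V} {X Y : Finset V} {σ ξ ρ : ℝ}
    {q : ℕ} (hq : 1 ≤ q) (hG : ∀ S : Finset V, S.card = 2 * q → ManyTypes G S)
    (hXY : ∀ v, v ∈ Y ↔ v ∉ X) (hY : (Y.card : ℝ) ≤ (1 / 2 + σ) * Fintype.card V)
    (hP : (P3Count G X : ℝ) ≤ σ ^ 4 * (Fintype.card V : ℝ) ^ 3) (hσ : 0 < σ)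
    (hn : 1 ≤ σ ^ 2 * Fintype.card V) (hξ : 2 * (2 * σ) + (2 * σ) ^ 2 + 4 * q * (2 * σ) < ξ)
    (hρ : 0 ≤ ρ) (hqρ : ((2 * q + 1 : ℕ) : ℝ) ≤ 2 ^ ρ)
    (hb : 8 * (q : ℝ) ^ 3 * σ ^ 2 + ρ + 2 * q * σ + 3 ≤ ξ / 2 * (q / 1500)) :
    Uni G X Y ξ q := by
  intro 𝓑 h𝓑X h𝓑
  set n : ℝ := (Fintype.card V : ℝ) with hnd
  have hn0 : 0 < n := by
    by_contra hcon
    nlinarith [mul_nonneg (sq_nonneg σ) (neg_nonneg.2 (not_lt.1 hcon))]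
  set Bad : V → V → Prop := fun b b' => b = b' ∨ (b ∈ X ∧ b' ∈ X) ∧
    σ ^ 2 * n ≤ Set.ncard {v | v ∈ X ∧ InducesP3 G b b' v} with hBad
  have hbad : (Set.ncard {p : V × V | Bad p.1 p.2} : ℝ) ≤ (2 * σ) ^ 2 * n ^ 2 := by
    have h1 : {p : V × V | Bad p.1 p.2} = {p : V × V | p.1 = p.2} ∪ {p : V × V |
      (p.1 ∈ X ∧ p.2 ∈ X) ∧ σ ^ 2 * n ≤ Set.ncard {v | v ∈ X ∧ InducesP3 G p.1 p.2 v}} := by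
      ext p
      rfl
    have h2 : Set.ncard {p : V × V | p.1 = p.2} ≤ Fintype.card V := by
      have : {p : V × V | p.1 = p.2} = (fun v => (v, v)) '' Set.univ := by
        ext ⟨a, b⟩
        simp [Prod.ext_iff]
      rw [this]
      refine (Set.ncard_image_le (Set.toFinite _)).trans ?_
      rw [Set.ncard_univ, Nat.card_eq_fintype_card]
    have h3 := mul_ncard_le {y : (V × V) × V | (y.1.1 ∈ X ∧ y.1.2 ∈ X) ∧ y.2 ∈ X ∧
      InducesP3 G y.1.1 y.1.2 y.2} {p : V × V | (p.1 ∈ X ∧ p.2 ∈ X) ∧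
        σ ^ 2 * n ≤ Set.ncard {v | v ∈ X ∧ InducesP3 G p.1 p.2 v}} (x := σ ^ 2 * n) (by
        rintro ⟨b, b'⟩ ⟨hbb, h⟩
        refine h.trans (le_of_eq ?_)
        congr 2
        ext v
        exact ⟨fun h => ⟨hbb, h⟩, fun h => h.2⟩)
    have h4 := (Nat.cast_le (α := ℝ)).2 (ncard_inducesP3_le G X)
    push_cast at h4
    have h5 := h3.trans (h4.trans (mul_le_mul_of_nonneg_left hP (by norm_num)))
    have h6 : (Set.ncard {p : V × V | (p.1 ∈ X ∧ p.2 ∈ X) ∧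
        σ ^ 2 * n ≤ Set.ncard {v | v ∈ X ∧ InducesP3 G p.1 p.2 v}} : ℝ) ≤ 3 * σ ^ 2 * n ^ 2 := by
      refine le_of_mul_le_mul_left (h5.trans (le_of_eq ?_)) (by positivity : 0 < σ ^ 2 * n)
      ring
    rw [h1]
    refine (Nat.cast_le.2 (Set.ncard_union_le _ _)).trans ?_
    rw [Nat.cast_add]
    have h7 : (Set.ncard {p : V × V | p.1 = p.2} : ℝ) ≤ n := Nat.cast_le.2 h2
    nlinarith
  obtain ⟨f, hf, hfb⟩ := exists_independent_pairs (Bad := Bad) (fun b => Or.inl rfl) (by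
      rintro b b' (h | ⟨h, h'⟩)
      · exact Or.inl h.symm
      · refine Or.inr ⟨h.symm, h'.trans (le_of_eq ?_)⟩
        congr 2
        ext v
        exact ⟨fun h => ⟨h.1, h.2.symm⟩, fun h => ⟨h.1, h.2.symm⟩⟩)
    (by positivity : 0 < 2 * σ) hbad 𝓑 h𝓑 q hξ (Nat.cast_pos.1 hn0)
  have hfX : ∀ x, f x ∈ X := by
    rintro ⟨i, b⟩
    cases b
    · exact (h𝓑X _ (hf i)).1
    · exact (h𝓑X _ (hf i)).2
  refine ⟨f, hf, ?_⟩
  have hQc : (Finset.univ.map f).card = 2 * q := by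
    rw [Finset.card_map, Finset.card_univ, Fintype.card_prod, Fintype.card_fin,
      Fintype.card_bool, mul_comm]
  set Exc : Finset V := Finset.univ.filter fun v => v ∈ X ∧ ∃ x y, x ≠ y ∧
    InducesP3 G (f x) (f y) v with hExc
  have hExcc : (Exc.card : ℝ) ≤ 4 * (q : ℝ) ^ 2 * (σ ^ 2 * n) := by
    have h1 : (Exc : Set V) ⊆ ⋃ p : (Fin q × Bool) × (Fin q × Bool),
        {v | p.1 ≠ p.2 ∧ v ∈ X ∧ InducesP3 G (f p.1) (f p.2) v} := by
      intro v hv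
      simp only [hExc, Finset.coe_filter, Finset.mem_univ, true_and, Set.mem_ofPred_eq] at hv
      obtain ⟨h1, x, y, h2⟩ := hv
      exact Set.mem_iUnion.2 ⟨(x, y), h2.1, h1, h2.2⟩
    rw [← Set.ncard_coe_finset]
    refine (Nat.cast_le.2 ((Set.ncard_le_ncard h1 (Set.toFinite _)).trans
      (Set.ncard_iUnion_le_of_fintype _))).trans ?_
    rw [Nat.cast_sum]
    refine (Finset.sum_le_card_nsmul _ _ (σ ^ 2 * n) ?_).trans (le_of_eq ?_)
    · rintro ⟨x, y⟩ -
      by_cases hxy : x = y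
      · simp only [hxy, ne_eq, not_true_eq_false, false_and, Set.ofPred_false, Set.ncard_empty]
        rw [Nat.cast_zero]
        positivity
      · simp only [ne_eq, hxy, not_false_eq_true, true_and]
        have := hfb x y hxy
        simp only [hBad, not_or, not_and, not_le] at this
        exact (this.2 ⟨hfX _, hfX _⟩).le
    · simp only [Finset.card_univ, Fintype.card_prod, Fintype.card_fin, Fintype.card_bool,
        nsmul_eq_mul]
      push_cast
      ring
  set 𝓡 : Finset (Finset V) := insert ∅ (Finset.univ.image fun x : Fin q × Bool =>
    (Finset.univ.map f).filter fun w => w = f x ∨ G.Adj (f x) w) with h𝓡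
  have h𝓡c : (𝓡.card : ℝ) ≤ 2 ^ ρ := by
    refine le_trans (Nat.cast_le.2 ?_) hqρ
    refine (Finset.card_insert_le _ _).trans (Nat.add_le_add_right
      (Finset.card_image_le.trans ?_) _)
    simp [mul_comm]
  refine ManyTypes.generic f (hG _ hQc) hq Y Exc (fun x h => (hXY _).1 h (hfX x)) 𝓡 hρ
    (by nlinarith [(Nat.cast_nonneg q : (0 : ℝ) ≤ q)]) ?_ h𝓡c ?_
  · intro v hv hvY hvE
    have hvX : v ∈ X := by
      by_contra h
      exact hvY ((hXY v).2 h)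
    have hvE' : ∀ x y, x ≠ y → ¬ InducesP3 G (f x) (f y) v := by grind
    rw [h𝓡, Finset.mem_insert]
    by_cases h0 : nbrIn G (Finset.univ.map f) v = ∅
    · exact Or.inl h0
    · obtain ⟨w, hw⟩ := Finset.nonempty_of_ne_empty h0
      rw [mem_nbrIn, Finset.mem_map] at hw
      obtain ⟨⟨x, -, rfl⟩, hvx⟩ := hw
      refine Or.inr (Finset.mem_image.2 ⟨x, Finset.mem_univ _, ?_⟩)
      ext w
      rw [Finset.mem_filter, mem_nbrIn]
      refine and_congr_right fun hw => ?_
      obtain ⟨y, -, rfl⟩ := Finset.mem_map.1 hw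
      by_cases hxy : x = y
      · subst hxy
        simp [hvx]
      · have h1 : f x ≠ f y := f.injective.ne hxy
        have h2 := hvE' x y hxy
        have hvy : v ≠ f y := fun h => hv (h ▸ hw)
        constructor
        · rintro (h | h)
          · exact absurd h.symm h1
          · by_contra h3
            exact h2 (Or.inr (Or.inl ⟨hvx, h, hvy, h3⟩))
        · intro h
          refine Or.inr ?_
          by_contra h3
          exact h2 (Or.inl ⟨G.adj_symm hvx, h, h1, h3⟩)
  · have h1 := mul_le_mul_of_nonneg_left hExcc (by positivity : (0 : ℝ) ≤ 2 * q)
    have h2 := mul_le_mul_of_nonneg_left hY (by positivity : (0 : ℝ) ≤ 2 * q)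
    have h3 := mul_le_mul_of_nonneg_right hb hn0.le
    nlinarith

lemma exists_uni {ξ : ℝ} (hξ : 0 < ξ) : ∃ (q n₀ : ℕ) (ε : ℝ), 0 < ε ∧ 1 ≤ q ∧
    ∀ {V : Type} [Fintype V] (G : SimpleGraph V) (X Y : Finset V), n₀ ≤ Fintype.card V →
      (∀ S : Finset V, S.card = 2 * q → ManyTypes G S ∧ ManyTypes Gᶜ S) →
      BasePartition G X Y ε → Uni G X Y ξ q := by
  obtain ⟨q, hq1, hq2, hq3⟩ := ((eventually_ge_atTop 1).and
    ((eventually_poly_le 1 2 (by positivity : 0 < ξ / 6000)).and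
      (tendsto_natCast_atTop_atTop.eventually_ge_atTop (30000 / ξ)))).exists
  rw [div_le_iff₀ hξ] at hq3
  have hq' : (1 : ℝ) ≤ q := by exact_mod_cast hq1
  set σ : ℝ := min 1 ξ / (32 * (q : ℝ) ^ 3) with hσ
  have hmin : 0 < min 1 ξ := lt_min one_pos hξ
  have hσ0 : 0 < σ := by positivity
  have hσq : σ * (32 * (q : ℝ) ^ 3) = min 1 ξ := div_mul_cancel₀ _ (by positivity)
  have hq3' : (q : ℝ) ≤ (q : ℝ) ^ 3 := le_self_pow₀ hq' (by norm_num)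
  have hm1 := min_le_left 1 ξ
  have hm2 := min_le_right 1 ξ
  have hσ1 : σ ≤ 1 := by nlinarith
  have hσσ : σ ^ 2 ≤ σ := by nlinarith
  have hσqq : σ * q ≤ σ * (q : ℝ) ^ 3 := mul_le_mul_of_nonneg_left hq3' hσ0.le
  have hσq1 : σ ≤ σ * q := le_mul_of_one_le_right hσ0.le hq'
  obtain ⟨n₀, hn₀⟩ := exists_nat_ge (1 / σ ^ 2)
  rw [div_le_iff₀ (by positivity)] at hn₀
  have hσ4 : σ ^ 4 ≤ σ := pow_le_of_le_one hσ0.le hσ1 (by norm_num)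
  have key : ∀ {V : Type} [Fintype V] (G : SimpleGraph V) (X Y : Finset V), n₀ ≤ Fintype.card V →
      (∀ S : Finset V, S.card = 2 * q → ManyTypes G S) → (∀ v, v ∈ Y ↔ v ∉ X) →
      (Y.card : ℝ) ≤ (1 / 2 + σ) * Fintype.card V →
      (P3Count G X : ℝ) ≤ σ ^ 4 * (Fintype.card V : ℝ) ^ 3 → Uni G X Y ξ q := by
    intro V _ G X Y hn hS hXY hY hP
    have hn' : (n₀ : ℝ) ≤ Fintype.card V := Nat.cast_le.2 hn
    refine uni_of_P3Count (ρ := ξ / 6000 * q) hq1 hS hXY hY hP hσ0 ?_ ?_ (by positivity) ?_ ?_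
    · nlinarith [sq_nonneg σ]
    · nlinarith
    · refine le_trans ?_ hq2
      push_cast
      rw [pow_one]
      linarith
    · have : (q : ℝ) ^ 3 * σ ^ 2 ≤ (q : ℝ) ^ 3 * σ := mul_le_mul_of_nonneg_left hσσ (by positivity)
      nlinarith
  refine ⟨q, n₀, σ ^ 4, by positivity, hq1, fun {V} _ G X Y hn hS hB => ?_⟩
  have hY : (Y.card : ℝ) ≤ (1 / 2 + σ) * Fintype.card V :=
    hB.card_right.trans (mul_le_mul_of_nonneg_right (by linarith) (Nat.cast_nonneg _))
  rcases hB.left with h | h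
  · exact key G X Y hn (fun S hSc => (hS S hSc).1) hB.mem_iff hY h
  · intro 𝓑 h1 h2
    obtain ⟨f, hf, hf'⟩ := key Gᶜ X Y hn (fun S hSc => (hS S hSc).2) hB.mem_iff hY h 𝓑 h1 h2
    refine ⟨f, hf, ?_⟩
    have := hf'.compl (by
      rintro ⟨i, b⟩ hfY
      refine (hB.mem_iff _).1 hfY ?_
      cases b
      · exact (h1 _ (hf i)).1
      · exact (h1 _ (hf i)).2)
    rwa [compl_compl] at this

end Uni

/-! ### Realising prescribed neighbourhoods on small sets -/

section Pairs

lemma HasMatching.restrict {V : Type*} {ρ ρ' : V → V → Prop} {W W' Z : Finset V} {k k' : ℕ}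
    (h : HasMatching ρ W k) (hk : k' + Z.card ≤ k) (hW : ∀ b ∈ W, b ∉ Z → b ∈ W')
    (hρ : ∀ b ∈ W, b ∉ Z → ∀ b' ∈ W, b' ∉ Z → ρ b b' → ρ' b b') : HasMatching ρ' W' k' := by
  obtain ⟨f, hf, hfρ⟩ := h
  obtain ⟨P, hP⟩ : ∃ P : Fin k → Prop, ∀ i, P i ↔ ∀ c, f (i, c) ∉ Z := ⟨_, fun _ => Iff.rfl⟩
  set good : Finset (Fin k) := Finset.univ.filter P with hgood
  have h1 : (Finset.univ.filter fun i : Fin k => ¬ P i).card ≤ Z.card := by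
    have hex : ∀ i : Fin k, ∃ c, (¬ ∀ c, f (i, c) ∉ Z) → f (i, c) ∈ Z := by
      intro i
      by_cases h : ∃ c, f (i, c) ∈ Z
      · exact ⟨h.choose, fun _ => h.choose_spec⟩
      · exact ⟨true, fun h' => absurd (fun c hc => h ⟨c, hc⟩) h'⟩
    choose c hc using hex
    refine Finset.card_le_card_of_injOn (fun i => f (i, c i)) ?_ ?_
    · intro i hi
      exact hc i (by rw [← hP]; simpa using hi)
    · intro i _ j _ hij
      exact (Prod.mk.inj (f.injective hij)).1
  have h2 : k' ≤ good.card := by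
    have := Finset.card_filter_add_card_filter_not (s := (Finset.univ : Finset (Fin k)))
      P
    rw [Finset.card_univ, Fintype.card_fin] at this
    have h3 : k ≤ good.card + Z.card := this.symm.le.trans
      (Nat.add_le_add (le_of_eq (by rw [hgood])) (by convert h1))
    omega
  obtain ⟨T, hT, hTc⟩ := Finset.exists_subset_card_eq h2
  have g := T.equivFinOfCardEq hTc
  have hg : ∀ (i : Fin k') (c : Bool), f ((g.symm i : Fin k), c) ∉ Z := fun i c =>
    (hP _).1 (Finset.mem_filter.1 (hT (g.symm i).2)).2 c
  refine ⟨⟨fun p => f ((g.symm p.1 : Fin k), p.2), ?_⟩, ?_, ?_⟩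
  · rintro ⟨i, b⟩ ⟨j, c⟩ hij
    have h3 := Prod.mk.inj (f.injective hij)
    exact Prod.ext (g.symm.injective (Subtype.ext h3.1)) h3.2
  · exact fun p => hW _ (hf _) (hg _ _)
  · exact fun i => hρ _ (hf _) (hg _ _) _ (hf _) (hg _ _) (hfρ _)

/-- The neighbourhood of `u` within `Z` is, outside `Q` and up to few errors, everything or the
neighbourhood of a vertex after deleting the edges at `Q`. -/
def Predictable {V : Type*} [Fintype V] (G : SimpleGraph V) (Q Z : Finset V) (e : ℝ) (u : V) :
    Prop :=
  ∃ o : Option V, (Set.ncard {v | v ∈ Z ∧ v ∉ Q ∧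
    ¬ (G.Adj u v ↔ ∀ b ∈ o, (delVerts G Q).Adj b v)} : ℝ) ≤ e * Fintype.card V

/-- Adjacency, non-adjacency, or no condition, on pairs of distinct vertices. -/
def relOf {V : Type*} (k : Fin 3) (G : SimpleGraph V) : V → V → Prop := fun b b' =>
  b ≠ b' ∧ (k = 0 → G.Adj b b') ∧ (k = 1 → ¬ G.Adj b b')

/-- If the neighbourhoods in `X` of the elements of a small set `Q` are predictable then pairs of
vertices of `Y` realise all patterns on `Q`. -/
def PairsProp {V : Type*} [Fintype V] (G : SimpleGraph V) (X Y : Finset V) (e μ : ℝ) (q : ℕ) :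
    Prop :=
  ∀ Q : Finset V, Q.card = q → (∀ u ∈ Q, Predictable G Q X e u) → ∀ k : Fin 3,
    HasMatching (relOf k G) Y ⌈μ * Fintype.card V⌉₊ → ∀ π π', π ⊆ Q → π' ⊆ Q →
      ∀ E : Finset V, (E.card : ℝ) ≤ e * Fintype.card V →
        ∃ b b', (b ∈ Y ∧ b ∉ Q ∧ b ∉ E) ∧ (b' ∈ Y ∧ b' ∉ Q ∧ b' ∉ E) ∧ relOf k G b b' ∧
          nbrIn G Q b = π ∧ nbrIn G Q b' = π'

lemma PairsProp.mono {V : Type*} [Fintype V] {G : SimpleGraph V} {X Y : Finset V} {e e' μ : ℝ}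
    {q : ℕ} (h : PairsProp G X Y e μ q) (he : e' ≤ e) : PairsProp G X Y e' μ q := by
  have h1 : e' * (Fintype.card V : ℝ) ≤ e * Fintype.card V :=
    mul_le_mul_of_nonneg_right he (Nat.cast_nonneg _)
  exact fun Q hQ hP k hk π π' hπ hπ' E hE =>
    h Q hQ (fun u hu => (hP u hu).imp fun o ho => ho.trans h1) k hk π π' hπ hπ' E (hE.trans h1)

/-- The reconstruction of one side of the partition from the graph outside `Q`. -/
def recSide {V : Type*} [Fintype V] (H : SimpleGraph V) {m : ℕ} (t : Fin m → V) (r : ℕ)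
    (c : Bool) (Q : Finset V) : Finset V :=
  Finset.univ.filter fun v => v ∉ Q ∧ (v ∈ midVerts H t (4 * r) (4 * r + 3) ↔ c = true)

lemma mem_recSide {V : Type*} [Fintype V] {H : SimpleGraph V} {m : ℕ} {t : Fin m → V} {r : ℕ}
    {c : Bool} {Q : Finset V} {v : V} : v ∈ recSide H t r c Q ↔
      v ∉ Q ∧ (v ∈ midVerts H t (4 * r) (4 * r + 3) ↔ c = true) := by
  simp [recSide]

/-- The neighbourhood in `Q` predicted by the certificate `γ`. -/
def predNbr {V : Type*} {q : ℕ} (γ : Fin q → V × Option V) (Q : Finset V) (H : SimpleGraph V)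
    (v : V) : Finset V :=
  Q.filter fun w => ∃ i, (γ i).1 = w ∧ ∀ b ∈ (γ i).2, H.Adj b v

lemma mem_predNbr {V : Type*} {q : ℕ} {γ : Fin q → V × Option V} {Q : Finset V}
    {H : SimpleGraph V} {v w : V} : w ∈ predNbr γ Q H v ↔
      w ∈ Q ∧ ∃ i, (γ i).1 = w ∧ ∀ b ∈ (γ i).2, H.Adj b v := by
  simp [predNbr]

lemma ncard_eq_card_filter {V : Type*} [Fintype V] (p : V → Prop) :
    Set.ncard {v | p v} = (Finset.univ.filter p).card := by
  rw [← Set.ncard_coe_finset]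
  congr 1
  ext v
  simp

lemma exists_recon {V : Type*} [Fintype V] {G : SimpleGraph V} {m r q : ℕ} {t : Fin m → V}
    (ht : Function.Injective t) {c : Bool} {X Y Q : Finset V} {e μ : ℝ} (hq : q ≤ 3)
    (hY : ∀ v, v ∈ Y ↔ (v ∈ midVerts G t (4 * r) (4 * r) ↔ c = true)) (hX : ∀ v, v ∈ X ↔ v ∉ Y)
    (hYc : (Y.card : ℝ) ≤ (1 / 2 + e) * Fintype.card V)
    (hin : (Set.ncard {v | v ∈ midVerts G t (4 * r) (4 * r) ∧
      v ∉ midVerts G t (4 * r + 3) (4 * r + 3)} : ℝ) ≤ e * Fintype.card V)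
    (he : 20 * e ≤ μ) (hn : 10 ≤ μ * Fintype.card V) (hQ : Q.card = q)
    (hP : ∀ u ∈ Q, Predictable G Q X e u) {κ : Fin 3}
    (hm : HasMatching (relOf κ G) Y ⌈μ * Fintype.card V⌉₊) {E : Finset V}
    (hE : (E.card : ℝ) ≤ e * Fintype.card V) :
    ∃ (γ : Fin q → V × Option V) (E' : Finset V), (∀ v, v ∉ E' → v ∉ E) ∧
      (E'.card : ℝ) ≤ 5 * e * Fintype.card V ∧
      ((recSide (delVerts G Q) t r c Q).card : ℝ) ≤ (1 / 2 + 2 * e) * Fintype.card V ∧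
      (∀ v, v ∉ Q → v ∉ recSide (delVerts G Q) t r c Q → v ∉ E' →
        nbrIn G Q v = predNbr γ Q (delVerts G Q) v) ∧
      HasMatching (relOf κ (delVerts G Q)) (recSide (delVerts G Q) t r c Q)
        ⌈μ / 2 * Fintype.card V⌉₊ ∧
      ∀ v, v ∈ recSide (delVerts G Q) t r c Q → v ∉ E' → v ∈ Y := by
  have hn0 : (0 : ℝ) ≤ Fintype.card V := Nat.cast_nonneg _
  have hrec := midVerts_delVerts G ht (4 * r) Q (by omega)
  set D : Finset V := Finset.univ.filter fun v => v ∈ midVerts G t (4 * r) (4 * r) ∧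
    v ∉ midVerts G t (4 * r + 3) (4 * r + 3) with hD
  have hDm : ∀ v, v ∉ D → (v ∈ midVerts G t (4 * r) (4 * r) →
      v ∈ midVerts G t (4 * r + 3) (4 * r + 3)) := by grind
  rw [ncard_eq_card_filter] at hin
  have hDc : (D.card : ℝ) ≤ e * Fintype.card V := by convert hin
  have hiff : ∀ v, v ∉ Q → v ∉ D → (v ∈ recSide (delVerts G Q) t r c Q ↔ v ∈ Y) := by
    intro v hvQ hvD
    rw [mem_recSide, hY]
    have : v ∈ midVerts (delVerts G Q) t (4 * r) (4 * r + 3) ↔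
        v ∈ midVerts G t (4 * r) (4 * r) :=
      ⟨hrec.1 v, fun h => hrec.2 v (hDm v hvD h) hvQ⟩
    rw [this]
    exact ⟨fun h => h.2, fun h => ⟨hvQ, h⟩⟩
  choose! o ho using hP
  have g := Q.equivFinOfCardEq hQ
  set Err : Fin q → Finset V := fun i => Finset.univ.filter fun v => v ∈ X ∧ v ∉ Q ∧
    ¬ (G.Adj (g.symm i) v ↔ ∀ b ∈ o (g.symm i), (delVerts G Q).Adj b v) with hErr
  have hErrc : ∀ i, ((Err i).card : ℝ) ≤ e * Fintype.card V := by
    intro i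
    have := ho _ (g.symm i).2
    rw [ncard_eq_card_filter] at this
    convert this
  have hE0 : 0 ≤ e * (Fintype.card V : ℝ) := le_trans (Nat.cast_nonneg _) hE
  have hUc : ((Finset.univ.biUnion Err).card : ℝ) ≤ 3 * (e * Fintype.card V) := by
    refine (Nat.cast_le.2 Finset.card_biUnion_le).trans ?_
    rw [Nat.cast_sum]
    refine (Finset.sum_le_card_nsmul _ _ _ fun i _ => hErrc i).trans ?_
    rw [Finset.card_univ, Fintype.card_fin, nsmul_eq_mul]
    exact mul_le_mul_of_nonneg_right (by exact_mod_cast hq) hE0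
  refine ⟨fun i => ((g.symm i : V), o (g.symm i)), E ∪ (D ∪ Finset.univ.biUnion Err), ?_, ?_, ?_,
    ?_, ?_, ?_⟩
  · exact fun v hv h => hv (Finset.mem_union_left _ h)
  · have h1 := (Nat.cast_le (α := ℝ)).2 ((Finset.card_union_le E (D ∪ Finset.univ.biUnion Err)).trans
      (Nat.add_le_add_left (Finset.card_union_le _ _) _))
    push_cast at h1
    linarith
  · have h1 : recSide (delVerts G Q) t r c Q ⊆ Y ∪ D := by
      intro v hv
      rw [Finset.mem_union]
      by_cases hvD : v ∈ D
      · exact Or.inr hvD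
      · exact Or.inl ((hiff v (mem_recSide.1 hv).1 hvD).1 hv)
    have h2 := (Nat.cast_le (α := ℝ)).2 ((Finset.card_le_card h1).trans (Finset.card_union_le _ _))
    push_cast at h2
    linarith
  · intro v hvQ hvs hvE
    rw [Finset.mem_union, Finset.mem_union, not_or, not_or] at hvE
    have hvX : v ∈ X := (hX v).2 fun h => hvs ((hiff v hvQ hvE.2.1).2 h)
    have h1 : ∀ i, G.Adj (g.symm i) v ↔ ∀ b ∈ o (g.symm i), (delVerts G Q).Adj b v := by
      intro i
      by_contra h
      exact hvE.2.2 (Finset.mem_biUnion.2 ⟨i, Finset.mem_univ _,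
        Finset.mem_filter.2 ⟨Finset.mem_univ _, hvX, hvQ, h⟩⟩)
    ext w
    rw [mem_nbrIn, mem_predNbr]
    refine and_congr_right fun hw => ?_
    constructor
    · intro h
      refine ⟨g ⟨w, hw⟩, by simp, ?_⟩
      have := (h1 (g ⟨w, hw⟩)).1 (by simpa using G.adj_symm h)
      exact this
    · rintro ⟨i, hi, h⟩
      rw [← hi]
      exact G.adj_symm ((h1 i).2 h)
  · refine hm.restrict (Z := Q ∪ D) ?_ ?_ ?_
    · have h1 := (Nat.cast_le (α := ℝ)).2 (Finset.card_union_le Q D)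
      push_cast at h1
      have h2 := Nat.le_ceil (μ * Fintype.card V : ℝ)
      have h3 := Nat.ceil_lt_add_one (by linarith : 0 ≤ μ / 2 * (Fintype.card V : ℝ))
      have h4 : (Q.card : ℝ) ≤ 3 := by rw [hQ]; exact_mod_cast hq
      have h5 := mul_le_mul_of_nonneg_right he hn0
      have h6 : ((⌈μ / 2 * (Fintype.card V : ℝ)⌉₊ + (Q ∪ D).card : ℕ) : ℝ) ≤
          ⌈μ * (Fintype.card V : ℝ)⌉₊ := by
        push_cast
        linarith
      exact_mod_cast h6
    · intro b hb hbZ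
      rw [Finset.mem_union, not_or] at hbZ
      exact (hiff b hbZ.1 hbZ.2).2 hb
    · intro b _ hbZ b' _ hbZ' h
      rw [Finset.mem_union, not_or] at hbZ hbZ'
      have : (delVerts G Q).Adj b b' ↔ G.Adj b b' := by
        rw [delVerts_adj]
        exact ⟨fun h => h.1, fun h => ⟨h, hbZ.1, hbZ'.1⟩⟩
      rw [relOf] at h ⊢
      rwa [this]
  · intro v hv hvE
    rw [Finset.mem_union, Finset.mem_union, not_or, not_or] at hvE
    exact (hiff v (mem_recSide.1 hv).1 hvE.2.1).1 hv

lemma exists_pairsProp_card {q : ℕ} (hq : 1 ≤ q) (hq3 : q ≤ 3) {μ : ℝ} (hμ : 0 < μ) :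
    ∃ e > 0, ∀ r m : ℕ, ∀ᶠ x in typicalGraphs, ∀ t : Fin m → Fin x.1, Function.Injective t →
      ∀ (c : Bool) (X Y : Finset (Fin x.1)),
      (∀ v, v ∈ Y ↔ (v ∈ midVerts x.2 t (4 * r) (4 * r) ↔ c = true)) → (∀ v, v ∈ X ↔ v ∉ Y) →
      (Y.card : ℝ) ≤ (1 / 2 + e) * x.1 →
      (Set.ncard {v | v ∈ midVerts x.2 t (4 * r) (4 * r) ∧
        v ∉ midVerts x.2 t (4 * r + 3) (4 * r + 3)} : ℝ) ≤ e * x.1 →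
      PairsProp x.2 X Y e μ q := by
  obtain ⟨e₀, he₀, hcert⟩ := typical_of_certificate hq (half_pos hμ)
  refine ⟨min e₀ μ / 20, by positivity, fun r m => ?_⟩
  set e := min e₀ μ / 20 with he
  have h1 := min_le_left e₀ μ
  have h2 := min_le_right e₀ μ
  have hb : ∀ n, Fintype.card ((Fin m → Fin n) × Bool × Fin 3 × (Fin q → Fin n × Option (Fin n))) ≤
      (n + 2) ^ (m + 3 + 2 * q) := by
    intro n
    simp only [Fintype.card_prod, Fintype.card_fun, Fintype.card_fin, Fintype.card_bool,
      Fintype.card_option]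
    have h3 : n ^ m ≤ (n + 2) ^ m := Nat.pow_le_pow_left (by omega) m
    have h4 : (n * (n + 1)) ^ q ≤ ((n + 2) ^ 2) ^ q := Nat.pow_le_pow_left (by nlinarith) q
    have h5 : 2 * 3 ≤ (n + 2) ^ 3 := by
      have : 2 ^ 3 ≤ (n + 2) ^ 3 := Nat.pow_le_pow_left (by omega) 3
      omega
    calc n ^ m * (2 * (3 * (n * (n + 1)) ^ q)) = n ^ m * (2 * 3) * (n * (n + 1)) ^ q := by ring
      _ ≤ (n + 2) ^ m * (n + 2) ^ 3 * ((n + 2) ^ 2) ^ q :=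
        Nat.mul_le_mul (Nat.mul_le_mul h3 h5) h4
      _ = (n + 2) ^ (m + 3 + 2 * q) := by rw [pow_add, pow_add, pow_mul _ 2]
  have hc := hcert (fun n => (Fin m → Fin n) × Bool × Fin 3 × (Fin q → Fin n × Option (Fin n)))
    (m + 3 + 2 * q) hb (fun n z Q H => recSide H z.1 r z.2.1 Q)
    (fun n z Q H => predNbr z.2.2.2 Q H) (fun n z H => relOf z.2.2.1 H)
  obtain ⟨n₀, hn₀⟩ := exists_nat_ge (10 / μ)
  rw [div_le_iff₀ hμ] at hn₀
  filter_upwards [hc, typical_of_eventually (eventually_ge_atTop n₀)] with ⟨n, G⟩ hG hn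
  intro t ht c X Y hY hX hYc hin Q hQ hP κ hm π π' hπ hπ' E hE
  simp only at hYc hin hn
  simp only [Fintype.card_fin] at hE hm
  have hn' : (n₀ : ℝ) ≤ n := Nat.cast_le.2 hn
  by_contra hcon
  obtain ⟨γ, E', hEE, hE'c, hsc, hpred, hmat, hrec⟩ :=
    exists_recon (G := G) (e := e) (μ := μ) ht hq3 hY hX
    (by rwa [Fintype.card_fin]) (by rwa [Fintype.card_fin]) (by linarith)
    (by rw [Fintype.card_fin]; nlinarith) hQ hP (by rwa [Fintype.card_fin]) (E := E)
    (by rwa [Fintype.card_fin])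
  rw [Fintype.card_fin] at hE'c hsc hmat
  have hnn : (0 : ℝ) ≤ n := Nat.cast_nonneg _
  refine hG Q hQ ⟨(t, c, κ, γ), E', π, π', hπ, hπ', ?_, ?_, hpred, hmat, ?_⟩
  · exact hE'c.trans (mul_le_mul_of_nonneg_right (by linarith) hnn)
  · exact hsc.trans (mul_le_mul_of_nonneg_right (by linarith) hnn)
  · intro b b' hb hb' hbE hbE' hrel h3 h4
    have hbQ := (mem_recSide.1 hb).1
    have hbQ' := (mem_recSide.1 hb').1
    refine hcon ⟨b, b', ⟨hrec b hb hbE, hbQ, hEE b hbE⟩,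
      ⟨hrec b' hb' hbE', hbQ', hEE b' hbE'⟩, ?_, h3, h4⟩
    have : (delVerts G Q).Adj b b' ↔ G.Adj b b' := by
      rw [delVerts_adj]
      exact ⟨fun h => h.1, fun h => ⟨h, hbQ, hbQ'⟩⟩
    simp only [relOf] at hrel ⊢
    rwa [this] at hrel

lemma exists_pairsProp {μ : ℝ} (hμ : 0 < μ) :
    ∃ e > 0, ∀ r m : ℕ, ∀ᶠ x in typicalGraphs, ∀ t : Fin m → Fin x.1, Function.Injective t →
      ∀ X Y : Finset (Fin x.1), (∀ v, v ∈ X ↔ v ∈ midVerts x.2 t (4 * r) (4 * r)) →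
      (∀ v, v ∈ Y ↔ v ∉ X) → (X.card : ℝ) ≤ (1 / 2 + e) * x.1 →
      (Y.card : ℝ) ≤ (1 / 2 + e) * x.1 →
      (Set.ncard {v | v ∈ midVerts x.2 t (4 * r) (4 * r) ∧
        v ∉ midVerts x.2 t (4 * r + 3) (4 * r + 3)} : ℝ) ≤ e * x.1 →
      ∀ q, 1 ≤ q → q ≤ 3 → PairsProp x.2 X Y e μ q ∧ PairsProp x.2 Y X e μ q := by
  obtain ⟨e₁, he₁, h₁⟩ := exists_pairsProp_card (q := 1) le_rfl (by norm_num) hμ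
  obtain ⟨e₂, he₂, h₂⟩ := exists_pairsProp_card (q := 2) (by norm_num) (by norm_num) hμ
  obtain ⟨e₃, he₃, h₃⟩ := exists_pairsProp_card (q := 3) (by norm_num) le_rfl hμ
  refine ⟨min e₁ (min e₂ e₃), by positivity, fun r m => ?_⟩
  set e := min e₁ (min e₂ e₃) with he
  have l1 : e ≤ e₁ := min_le_left _ _
  have l2 : e ≤ e₂ := (min_le_right _ _).trans (min_le_left _ _)
  have l3 : e ≤ e₃ := (min_le_right _ _).trans (min_le_right _ _)
  filter_upwards [h₁ r m, h₂ r m, h₃ r m] with ⟨n, G⟩ k1 k2 k3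
  intro t ht X Y hX hY hXc hYc hin
  have hnn : (0 : ℝ) ≤ n := Nat.cast_nonneg _
  have hXt : ∀ v, v ∈ X ↔ (v ∈ midVerts G t (4 * r) (4 * r) ↔ true = true) := by
    intro v; rw [hX]; simp
  have hYf : ∀ v, v ∈ Y ↔ (v ∈ midVerts G t (4 * r) (4 * r) ↔ false = true) := by
    intro v; rw [hY, hX]; simp
  have hXY : ∀ v, v ∈ X ↔ v ∉ Y := by
    intro v; rw [hY, not_not]
  have key : ∀ {e' : ℝ} {q : ℕ}, e ≤ e' → (∀ t : Fin m → Fin n, Function.Injective t →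
      ∀ (c : Bool) (X Y : Finset (Fin n)),
      (∀ v, v ∈ Y ↔ (v ∈ midVerts G t (4 * r) (4 * r) ↔ c = true)) → (∀ v, v ∈ X ↔ v ∉ Y) →
      (Y.card : ℝ) ≤ (1 / 2 + e') * n →
      (Set.ncard {v | v ∈ midVerts G t (4 * r) (4 * r) ∧
        v ∉ midVerts G t (4 * r + 3) (4 * r + 3)} : ℝ) ≤ e' * n →
      PairsProp G X Y e' μ q) → PairsProp G X Y e μ q ∧ PairsProp G Y X e μ q := by
    intro e' q hee h
    have m1 : (1 / 2 + e) * (n : ℝ) ≤ (1 / 2 + e') * n :=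
      mul_le_mul_of_nonneg_right (by linarith) hnn
    have m2 : e * (n : ℝ) ≤ e' * n := mul_le_mul_of_nonneg_right hee hnn
    exact ⟨(h t ht false X Y hYf hXY (hYc.trans m1) (hin.trans m2)).mono hee,
      (h t ht true Y X hXt hY (hXc.trans m1) (hin.trans m2)).mono hee⟩
  intro q hq hq3
  interval_cases q
  · exact key l1 k1
  · exact key l2 k2
  · exact key l3 k3

end Pairs

/-! ### One side of the partition is homogeneous, and vertices are simple on one of the sides -/

section Homogeneous

variable {V : Type*} [Fintype V] {G : SimpleGraph V} {X Y : Finset V} {ξ : ℝ} {q : ℕ}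

/-- The number of ordered adjacent pairs in `X`. -/
def eCount {V : Type*} (G : SimpleGraph V) (X : Finset V) : ℕ :=
  Set.ncard {p : V × V | p.1 ∈ X ∧ p.2 ∈ X ∧ G.Adj p.1 p.2}

lemma Uni.compl (h : Uni G X Y ξ q) (hXY : ∀ v ∈ X, v ∉ Y) : Uni Gᶜ X Y ξ q := by
  intro 𝓑 h𝓑 hc
  obtain ⟨f, hf, hg⟩ := h 𝓑 h𝓑 hc
  refine ⟨f, hf, hg.compl fun x => hXY _ ?_⟩
  obtain ⟨i, c⟩ := x
  cases c
  exacts [(h𝓑 _ (hf i)).1, (h𝓑 _ (hf i)).2]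

lemma Uni.exists_adjPat (h : Uni G X Y ξ q) (hξ : 0 < ξ) (hn : 0 < Fintype.card V)
    {𝓑 : Set (V × V)} (h𝓑 : ∀ p ∈ 𝓑, p.1 ∈ X ∧ p.2 ∈ X)
    (hc : ξ * (Fintype.card V : ℝ) ^ 2 ≤ 𝓑.ncard) {𝓐 : Set (V × V × V)}
    (h𝓐 : ∀ y ∈ 𝓐, y.1 ∈ Y ∧ y.2.1 ∈ Y ∧ y.2.2 ∈ Y)
    (ha : ξ * (Fintype.card V : ℝ) ^ 3 ≤ 𝓐.ncard) (p₁ p₂ p₃ : Bool × Bool) :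
    ∃ b b', (b, b') ∈ 𝓑 ∧ ∃ y ∈ 𝓐, AdjPat G y.1 b b' p₁ ∧ AdjPat G y.2.1 b b' p₂ ∧
      AdjPat G y.2.2 b b' p₃ := by
  obtain ⟨f, hf, hg⟩ := h 𝓑 h𝓑 hc
  by_contra hcon
  have h2 : (𝓐.ncard : ℝ) ≤ ξ / 2 * (Fintype.card V : ℝ) ^ 3 := by
    refine le_trans (Nat.cast_le.2 (Set.ncard_le_ncard ?_ (Set.toFinite _))) (hg p₁ p₂ p₃)
    exact fun y hy => ⟨(h𝓐 y hy).1, (h𝓐 y hy).2.1, (h𝓐 y hy).2.2,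
      fun i hi => hcon ⟨_, _, hf i, y, hy, hi⟩⟩
  have h3 : (0 : ℝ) < (Fintype.card V : ℝ) ^ 3 := by positivity
  nlinarith

lemma Uni.P3Count_lt (h : Uni G X Y ξ q) (hC : C5Free G) (hξ : 0 < ξ) (hn : 0 < Fintype.card V)
    (he : ξ * (Fintype.card V : ℝ) ^ 2 ≤ eCount G X) :
    (P3Count G Y : ℝ) < ξ * (Fintype.card V : ℝ) ^ 3 := by
  by_contra hcon
  push Not at hcon
  obtain ⟨b, b', ⟨-, -, hbb⟩, ⟨x, y, z⟩, ⟨-, -, -, hxy, hyz, -, hxz⟩, h1, h2, h3⟩ :=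
    h.exists_adjPat hξ hn (fun p hp => ⟨hp.1, hp.2.1⟩) he
      (fun y hy => ⟨hy.1, hy.2.1, hy.2.2.1⟩) hcon (true, false) (false, false) (false, true)
  simp only [AdjPat, iff_true, Bool.false_eq_true, iff_false] at h1 h2 h3 hbb hxy hyz hxz
  exact hC x y z b' b hxy hyz h3.2 (G.adj_symm hbb) (G.adj_symm h1.1) hxz h1.2 h2.2 h2.1 h3.1

lemma mul_adj_le (G : SimpleGraph V) (Y : Finset V) {Z : Set V} (hZ : ∀ y ∈ Z, y ∈ Y) {h : ℝ}
    (hh : ∀ y ∈ Z, h ≤ Set.ncard {c | c ∈ Y ∧ Gᶜ.Adj y c}) :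
    h * Set.ncard {p : V × V | p.1 ∈ Z ∧ p.2 ∈ Y ∧ G.Adj p.1 p.2} ≤
      (P3Count G Y + P3Count Gᶜ Y : ℝ) := by
  set R : Set ((V × V) × V) := {p | p.1.1 ∈ Z ∧ p.1.2 ∈ Y ∧ G.Adj p.1.1 p.1.2 ∧ p.2 ∈ Y ∧
    Gᶜ.Adj p.1.1 p.2} with hR
  refine (mul_ncard_le R _ ?_).trans ?_
  · rintro ⟨y, a⟩ ⟨h1, h2, h3⟩
    refine (hh y h1).trans (Nat.cast_le.2 (Set.ncard_le_ncard ?_ (Set.toFinite _)))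
    exact fun c hc => ⟨h1, h2, h3, hc⟩
  · have h1 : R ⊆ {p | p ∈ R ∧ G.Adj p.1.2 p.2} ∪ {p | p ∈ R ∧ ¬ G.Adj p.1.2 p.2} := by
      intro p hp
      by_cases h : G.Adj p.1.2 p.2
      exacts [Or.inl ⟨hp, h⟩, Or.inr ⟨hp, h⟩]
    have h2 : Set.ncard {p | p ∈ R ∧ G.Adj p.1.2 p.2} ≤ P3Count G Y := by
      refine Set.ncard_le_ncard_of_injOn (fun p => (p.1.1, p.1.2, p.2)) ?_ ?_ (Set.toFinite _)
      · rintro ⟨⟨y, a⟩, c⟩ ⟨⟨k1, k2, k3, k4, k5⟩, k6⟩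
        exact ⟨hZ _ k1, k2, k4, k3, k6, k5.1, k5.2⟩
      · rintro ⟨⟨y, a⟩, c⟩ - ⟨⟨y', a'⟩, c'⟩ - h
        simp only [Prod.mk.injEq] at h ⊢
        exact ⟨⟨h.1, h.2.1⟩, h.2.2⟩
    have h3 : Set.ncard {p | p ∈ R ∧ ¬ G.Adj p.1.2 p.2} ≤ P3Count Gᶜ Y := by
      refine Set.ncard_le_ncard_of_injOn (fun p => (p.1.1, p.2, p.1.2)) ?_ ?_ (Set.toFinite _)
      · rintro ⟨⟨y, a⟩, c⟩ ⟨⟨k1, k2, k3, k4, k5⟩, k6⟩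
        refine ⟨hZ _ k1, k4, k2, k5, ⟨?_, fun h => k6 (G.adj_symm h)⟩, k3.ne, fun h => h.2 k3⟩
        intro h
        simp only at h k5 k3
        exact k5.2 (h ▸ k3)
      · rintro ⟨⟨y, a⟩, c⟩ - ⟨⟨y', a'⟩, c'⟩ - h
        simp only [Prod.mk.injEq] at h ⊢
        exact ⟨⟨h.1, h.2.2⟩, h.2.1⟩
    exact_mod_cast ((Set.ncard_le_ncard h1 (Set.toFinite _)).trans (Set.ncard_union_le _ _)).trans
      (Nat.add_le_add h2 h3)

lemma ncard_pairs {V : Type*} (S T : Set V) :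
    Set.ncard {p : V × V | p.1 ∈ S ∧ p.2 ∈ T} = S.ncard * T.ncard := Set.ncard_prod

lemma homogeneous_of_P3Count {s : ℝ} (hs : 0 < s) (hY : (Fintype.card V : ℝ) / 4 + 1 ≤ Y.card)
    (h : (P3Count G Y : ℝ) ≤ s ^ 2 * (Fintype.card V : ℝ) ^ 3)
    (h' : (P3Count Gᶜ Y : ℝ) ≤ s ^ 2 * (Fintype.card V : ℝ) ^ 3) (hs1 : s ≤ 1)
    (hn : 0 < Fintype.card V) :
    (eCount G Y : ℝ) ≤ 22 * s * (Fintype.card V : ℝ) ^ 2 ∨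
      (eCount Gᶜ Y : ℝ) ≤ 22 * s * (Fintype.card V : ℝ) ^ 2 := by
  set n : ℝ := (Fintype.card V : ℝ) with hnd
  have hn0 : 0 < n := by rw [hnd]; exact_mod_cast hn
  have hdeg : ∀ y ∈ Y, n / 4 ≤ (Set.ncard {c | c ∈ Y ∧ G.Adj y c} : ℝ) +
      Set.ncard {c | c ∈ Y ∧ Gᶜ.Adj y c} := by
    intro y hy
    have h1 : (Y : Set V) ⊆ {y} ∪ ({c | c ∈ Y ∧ G.Adj y c} ∪ {c | c ∈ Y ∧ Gᶜ.Adj y c}) := by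
      intro c hc
      by_cases h1 : c = y
      · exact Or.inl h1
      by_cases h2 : G.Adj y c
      exacts [Or.inr (Or.inl ⟨hc, h2⟩), Or.inr (Or.inr ⟨hc, fun h => h1 h.symm, h2⟩)]
    have h2 := ((Set.ncard_le_ncard h1 (Set.toFinite _)).trans (Set.ncard_union_le _ _)).trans
      (Nat.add_le_add_left (Set.ncard_union_le _ _) _)
    rw [Set.ncard_coe_finset, Set.ncard_singleton] at h2
    have h3 : (Y.card : ℝ) ≤ 1 + ((Set.ncard {c | c ∈ Y ∧ G.Adj y c} : ℝ) +
      Set.ncard {c | c ∈ Y ∧ Gᶜ.Adj y c}) := by exact_mod_cast h2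
    linarith
  obtain ⟨Z, hZ⟩ : ∃ Z : Set V, ∀ y, y ∈ Z ↔ y ∈ Y ∧ n / 8 ≤ Set.ncard {c | c ∈ Y ∧ Gᶜ.Adj y c} :=
    ⟨{y | y ∈ Y ∧ n / 8 ≤ Set.ncard {c | c ∈ Y ∧ Gᶜ.Adj y c}}, fun _ => Iff.rfl⟩
  obtain ⟨Z', hZ'⟩ : ∃ Z' : Set V, ∀ y, y ∈ Z' ↔ y ∈ Y ∧ y ∉ Z :=
    ⟨{y | y ∈ Y ∧ y ∉ Z}, fun _ => Iff.rfl⟩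
  have e1 := mul_adj_le G Y (Z := Z) (fun y hy => ((hZ y).1 hy).1) (fun y hy => ((hZ y).1 hy).2)
  have e2 := mul_adj_le Gᶜ Y (Z := Z') (h := n / 8) (fun y hy => ((hZ' y).1 hy).1) (by
    intro y hy
    rw [hZ', hZ, not_and] at hy
    have h1 := hdeg y hy.1
    have h2 := not_le.1 (hy.2 hy.1)
    rw [compl_compl]
    linarith)
  rw [compl_compl] at e2
  set a := Set.ncard {p : V × V | p.1 ∈ Z ∧ p.2 ∈ Y ∧ G.Adj p.1 p.2} with ha
  set b := Set.ncard {p : V × V | p.1 ∈ Z' ∧ p.2 ∈ Y ∧ Gᶜ.Adj p.1 p.2} with hb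
  have ha' : (a : ℝ) ≤ 16 * s ^ 2 * n ^ 2 := by
    have : n * a ≤ n * (16 * s ^ 2 * n ^ 2) := by nlinarith
    exact le_of_mul_le_mul_left this hn0
  have hb' : (b : ℝ) ≤ 16 * s ^ 2 * n ^ 2 := by
    have : n * b ≤ n * (16 * s ^ 2 * n ^ 2) := by nlinarith
    exact le_of_mul_le_mul_left this hn0
  have hprod : Z.ncard * Z'.ncard ≤ a + b := by
    rw [← ncard_pairs]
    refine le_trans ?_ ((Set.ncard_union_le _ _).trans (Nat.add_le_add_left
      (Set.ncard_le_ncard_of_injOn (t := {p : V × V | p.1 ∈ Z' ∧ p.2 ∈ Y ∧ Gᶜ.Adj p.1 p.2})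
        (s := {p : V × V | p.2 ∈ Z' ∧ p.1 ∈ Y ∧ Gᶜ.Adj p.2 p.1}) Prod.swap (fun _ h => h)
        (Prod.swap_injective.injOn) (Set.toFinite _)) _))
    refine Set.ncard_le_ncard ?_ (Set.toFinite _)
    rintro ⟨y, c⟩ ⟨h1, h2⟩
    by_cases h3 : G.Adj y c
    · exact Or.inl ⟨h1, ((hZ' _).1 h2).1, h3⟩
    · refine Or.inr ⟨h2, ((hZ _).1 h1).1, ?_, fun h => h3 (G.adj_symm h)⟩
      intro h
      simp only at h h1 h2
      exact ((hZ' _).1 h2).2 (h ▸ h1)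
  have hprod' : (Z.ncard : ℝ) * Z'.ncard ≤ 32 * s ^ 2 * n ^ 2 := by
    have : (Z.ncard : ℝ) * Z'.ncard ≤ a + b := by exact_mod_cast hprod
    linarith
  have hcover : ∀ (H : SimpleGraph V) (T T' : Set V) (c : ℕ), (∀ y ∈ Y, y ∈ T ∨ y ∈ T') →
      c = Set.ncard {p : V × V | p.1 ∈ T ∧ p.2 ∈ Y ∧ H.Adj p.1 p.2} →
      eCount H Y ≤ c + T'.ncard * Fintype.card V := by
    intro H T T' c hT hc
    rw [hc, ← Nat.card_eq_fintype_card, ← Set.ncard_univ, ← ncard_pairs]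
    refine le_trans (Set.ncard_le_ncard ?_ (Set.toFinite _)) (Set.ncard_union_le _ _)
    rintro ⟨y, c⟩ ⟨h1, h2, h3⟩
    rcases hT y h1 with h | h
    exacts [Or.inl ⟨h, h2, h3⟩, Or.inr ⟨h, trivial⟩]
  have hZZ : ∀ y ∈ Y, y ∈ Z ∨ y ∈ Z' := fun y hy => by
    by_cases h : y ∈ Z
    exacts [Or.inl h, Or.inr ((hZ' _).2 ⟨hy, h⟩)]
  have c1 : (eCount G Y : ℝ) ≤ a + Z'.ncard * n := by
    rw [hnd]; exact_mod_cast hcover G Z Z' a hZZ ha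
  have c2 : (eCount Gᶜ Y : ℝ) ≤ b + Z.ncard * n := by
    rw [hnd]; exact_mod_cast hcover Gᶜ Z' Z b (fun y hy => (hZZ y hy).symm) hb
  have hss : 16 * s ^ 2 * n ^ 2 ≤ 16 * s * n ^ 2 := by
    have : s ^ 2 ≤ s := by nlinarith
    nlinarith [sq_nonneg n]
  by_cases hc : (Z'.ncard : ℝ) ≤ 6 * s * n
  · left
    nlinarith
  · right
    have : (Z.ncard : ℝ) ≤ 6 * s * n := by
      by_contra h
      push Not at hc h
      have : (6 * s * n) * (6 * s * n) ≤ (Z.ncard : ℝ) * Z'.ncard :=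
        mul_le_mul h.le hc.le (by positivity) (by positivity)
      nlinarith [mul_pos (pow_pos hs 2) (pow_pos hn0 2)]
    nlinarith

lemma exists_homogeneous_side {s : ℝ} (hs : 0 < s) (hs1 : s ≤ 1) (hC : C5Free G)
    (hY : (Fintype.card V : ℝ) / 4 + 1 ≤ Y.card)
    (hXY : ∀ v ∈ X, v ∉ Y) (hn : 0 < Fintype.card V) (h : Uni G X Y (s ^ 2) q) :
    ∃ Z, (Z = X ∨ Z = Y) ∧ ((eCount G Z : ℝ) ≤ 22 * s * (Fintype.card V : ℝ) ^ 2 ∨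
      (eCount Gᶜ Z : ℝ) ≤ 22 * s * (Fintype.card V : ℝ) ^ 2) := by
  have hs2 : 0 < s ^ 2 := by positivity
  have hss : s ^ 2 * (Fintype.card V : ℝ) ^ 2 ≤ 22 * s * (Fintype.card V : ℝ) ^ 2 :=
    mul_le_mul_of_nonneg_right (by nlinarith) (by positivity)
  by_cases h1 : s ^ 2 * (Fintype.card V : ℝ) ^ 2 ≤ eCount G X
  · by_cases h2 : s ^ 2 * (Fintype.card V : ℝ) ^ 2 ≤ eCount Gᶜ X
    · exact ⟨Y, Or.inr rfl, homogeneous_of_P3Count hs hY (h.P3Count_lt hC hs2 hn h1).le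
        ((h.compl hXY).P3Count_lt hC.compl hs2 hn h2).le hs1 hn⟩
    · exact ⟨X, Or.inl rfl, Or.inr (by linarith)⟩
  · exact ⟨X, Or.inl rfl, Or.inl (by linarith)⟩

/-- The vertex `u` has few neighbours in `X`. -/
def Low {V : Type*} [Fintype V] (G : SimpleGraph V) (X : Finset V) (δ : ℝ) (u : V) : Prop :=
  (Set.ncard {x | x ∈ X ∧ G.Adj u x} : ℝ) ≤ δ * Fintype.card V

lemma Low.predictable {δ e : ℝ} {u : V} {Q : Finset V} (h : Low G X δ u ∨ Low Gᶜ X δ u)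
    (hu : u ∈ Q) (hδ : δ ≤ e) : Predictable G Q X e u := by
  have hδe : δ * (Fintype.card V : ℝ) ≤ e * Fintype.card V :=
    mul_le_mul_of_nonneg_right hδ (Nat.cast_nonneg _)
  rcases h with h | h
  · refine ⟨some u, (Nat.cast_le.2 (Set.ncard_le_ncard ?_ (Set.toFinite _))).trans (h.trans hδe)⟩
    rintro v ⟨h1, h2, h3⟩
    refine ⟨h1, ?_⟩
    by_contra h4
    exact h3 ⟨fun h => absurd h h4, fun h => ((delVerts_adj.1 (h u rfl)).2.1 hu).elim⟩
  · refine ⟨none, (Nat.cast_le.2 (Set.ncard_le_ncard ?_ (Set.toFinite _))).trans (h.trans hδe)⟩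
    rintro v ⟨h1, h2, h3⟩
    refine ⟨h1, fun h => h2 (h ▸ hu), fun h => h3 ⟨fun _ b hb => ?_, fun _ => h⟩⟩
    simp at hb

lemma card_triples_ge {δ ξ₁ : ℝ} {S T : Set V} (hS : ∀ x ∈ S, x ∈ X) (hT : ∀ x ∈ T, x ∈ X)
    (hSc : δ * Fintype.card V ≤ S.ncard) (hTc : δ * Fintype.card V ≤ T.ncard) (hδ : 0 < δ)
    (hd : (eCount Gᶜ X : ℝ) ≤ ξ₁ * (Fintype.card V : ℝ) ^ 2) (h1 : ξ₁ ≤ δ ^ 2 / 4)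
    (hn : 4 ≤ δ ^ 2 * Fintype.card V) (hX : (Fintype.card V : ℝ) / 4 ≤ X.card)
    (hξ : ξ ≤ δ ^ 2 / 8) :
    ξ * (Fintype.card V : ℝ) ^ 3 ≤
      Set.ncard {y : V × V × V | (y.1 ∈ S ∧ y.2.1 ∈ T ∧ G.Adj y.1 y.2.1) ∧ y.2.2 ∈ X} := by
  set n : ℝ := (Fintype.card V : ℝ) with hnd
  have hn0 : 0 ≤ n := Nat.cast_nonneg _
  have h2 : S.ncard * T.ncard ≤ Set.ncard {p : V × V | p.1 ∈ S ∧ p.2 ∈ T ∧ G.Adj p.1 p.2} +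
      (eCount Gᶜ X + Fintype.card V) := by
    rw [← ncard_pairs]
    have h3 : Set.ncard {p : V × V | p.1 = p.2} ≤ Fintype.card V := by
      rw [← Nat.card_eq_fintype_card, ← Set.ncard_univ]
      refine Set.ncard_le_ncard_of_injOn Prod.fst (fun _ _ => trivial) ?_ (Set.toFinite _)
      rintro ⟨a, b⟩ h ⟨c, d⟩ h' h3
      simp only [Set.mem_ofPred_eq] at h h' h3
      rw [← h, ← h', h3]
    refine le_trans ?_ (Nat.add_le_add_left ((Set.ncard_union_le _ _).trans
      (Nat.add_le_add_left h3 _)) _)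
    refine le_trans (Set.ncard_le_ncard ?_ (Set.toFinite _)) (Set.ncard_union_le _ _)
    rintro ⟨a, b⟩ ⟨h1, h2⟩
    by_cases h3 : G.Adj a b
    · exact Or.inl ⟨h1, h2, h3⟩
    by_cases h4 : a = b
    exacts [Or.inr (Or.inr h4), Or.inr (Or.inl ⟨hS _ h1, hT _ h2, h4, h3⟩)]
  have h3 : (S.ncard : ℝ) * T.ncard ≤ Set.ncard {p : V × V | p.1 ∈ S ∧ p.2 ∈ T ∧ G.Adj p.1 p.2} +
      (eCount Gᶜ X + n) := by rw [hnd]; exact_mod_cast h2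
  have h4 : (δ * n) * (δ * n) ≤ (S.ncard : ℝ) * T.ncard :=
    mul_le_mul hSc hTc (by positivity) (by positivity)
  have h5 : δ ^ 2 / 2 * n ^ 2 ≤ Set.ncard {p : V × V | p.1 ∈ S ∧ p.2 ∈ T ∧ G.Adj p.1 p.2} := by
    nlinarith [sq_nonneg n]
  have h6 := mul_ncard_le {z : (V × V) × V | (z.1.1 ∈ S ∧ z.1.2 ∈ T ∧ G.Adj z.1.1 z.1.2) ∧ z.2 ∈ X}
    {p : V × V | p.1 ∈ S ∧ p.2 ∈ T ∧ G.Adj p.1 p.2} (x := n / 4) (fun p hp => by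
      refine hX.trans (Nat.cast_le.2 ?_)
      rw [← Set.ncard_coe_finset]
      exact Set.ncard_le_ncard (fun c hc => ⟨hp, hc⟩) (Set.toFinite _))
  have h7 : Set.ncard {z : (V × V) × V | (z.1.1 ∈ S ∧ z.1.2 ∈ T ∧ G.Adj z.1.1 z.1.2) ∧ z.2 ∈ X} ≤
      Set.ncard {y : V × V × V | (y.1 ∈ S ∧ y.2.1 ∈ T ∧ G.Adj y.1 y.2.1) ∧ y.2.2 ∈ X} := by
    refine Set.ncard_le_ncard_of_injOn (fun p => (p.1.1, p.1.2, p.2)) (fun p hp => hp) ?_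
      (Set.toFinite _)
    rintro ⟨⟨y, a⟩, c⟩ - ⟨⟨y', a'⟩, c'⟩ - h
    simp only [Prod.mk.injEq] at h ⊢
    exact ⟨⟨h.1, h.2.1⟩, h.2.2⟩
  refine le_trans ?_ (h6.trans (Nat.cast_le.2 h7))
  have h8 : n / 4 * (δ ^ 2 / 2 * n ^ 2) ≤ n / 4 *
      Set.ncard {p : V × V | p.1 ∈ S ∧ p.2 ∈ T ∧ G.Adj p.1 p.2} :=
    mul_le_mul_of_nonneg_left h5 (by positivity)
  have h9 : ξ * n ^ 3 ≤ δ ^ 2 / 8 * n ^ 3 := mul_le_mul_of_nonneg_right hξ (by positivity)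
  linarith [h8, h9]

/-- A vertex with many neighbours and many non-neighbours in the near-clique `X` is predictable
on `Y`. -/
lemma Uni.predictable {δ ξ₁ e : ℝ} {u : V} {Q : Finset V} (h : Uni G Y X ξ q) (hC : C5Free G)
    (h1 : ¬ Low G X δ u) (h2 : ¬ Low Gᶜ X δ u) (hδ : 0 < δ) (hξ0 : 0 < ξ)
    (hd : (eCount Gᶜ X : ℝ) ≤ ξ₁ * (Fintype.card V : ℝ) ^ 2) (hξ₁ : ξ₁ ≤ δ ^ 2 / 4)
    (hn : 4 ≤ δ ^ 2 * Fintype.card V) (hX : (Fintype.card V : ℝ) / 4 ≤ X.card)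
    (hξ : ξ ≤ δ ^ 2 / 8) (he : 0 < e) (hξe : ξ ≤ e ^ 2 / 8) (hne : 6 ≤ e * Fintype.card V)
    (hQ : Q.card ≤ 3) (hu : u ∈ Q) : Predictable G Q Y e u := by
  set n : ℝ := (Fintype.card V : ℝ) with hnd
  have hn0 : 0 < n := by
    by_contra h
    have : n ≤ 0 := not_lt.1 h
    nlinarith
  have hn' : 0 < Fintype.card V := by rw [hnd] at hn0; exact_mod_cast hn0
  rw [Low, not_le] at h1 h2
  have h2' : δ * n ≤ Set.ncard {x | x ∈ X ∧ ¬ G.Adj u x} :=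
    h2.le.trans (Nat.cast_le.2 (Set.ncard_le_ncard (fun x hx => ⟨hx.1, hx.2.2⟩) (Set.toFinite _)))
  have ca : (Set.ncard {p : V × V | (p.1 ∈ Y ∧ G.Adj u p.1) ∧ (p.2 ∈ Y ∧ G.Adj u p.2) ∧
      ¬ G.Adj p.1 p.2} : ℝ) < ξ * n ^ 2 := by
    by_contra hcon
    push Not at hcon
    obtain ⟨b, b', ⟨hb, hb', hbb⟩, ⟨x, z, w⟩, ⟨⟨hx, hz, hxz⟩, -⟩, k1, k2, -⟩ :=
      h.exists_adjPat hξ0 hn' (fun p hp => ⟨hp.1.1, hp.2.1.1⟩) hcon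
        (fun y hy => ⟨hy.1.1.1, hy.1.2.1.1, hy.2⟩)
        (card_triples_ge (fun x hx => hx.1) (fun x hx => hx.1) h2' h2' hδ hd hξ₁ hn hX hξ)
        (true, false) (false, true) (true, true)
    simp only [AdjPat, iff_true, Bool.false_eq_true, iff_false] at k1 k2 hb hb' hbb hx hz hxz
    exact hC u b x z b' hb.2 (G.adj_symm k1.1) hxz k2.2 (G.adj_symm hb'.2) hx.2 hz.2
      (fun h => k2.1 (G.adj_symm h)) hbb k1.2
  have cb : (Set.ncard {p : V × V | (p.1 ∈ Y ∧ G.Adj u p.1) ∧ (p.2 ∈ Y ∧ ¬ G.Adj u p.2) ∧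
      G.Adj p.1 p.2} : ℝ) < ξ * n ^ 2 := by
    by_contra hcon
    push Not at hcon
    obtain ⟨b, b', ⟨hb, hb', hbb⟩, ⟨x, z, w⟩, ⟨⟨hx, hz, hxz⟩, -⟩, k1, k2, -⟩ :=
      h.exists_adjPat hξ0 hn' (fun p hp => ⟨hp.1.1, hp.2.1.1⟩) hcon
        (fun y hy => ⟨hy.1.1.1, hy.1.2.1.1, hy.2⟩)
        (card_triples_ge (fun x hx => hx.1) (fun x hx => hx.1) h1.le h2' hδ hd hξ₁ hn hX hξ)
        (false, false) (false, true) (true, true)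
    simp only [AdjPat, iff_true, Bool.false_eq_true, iff_false] at k1 k2 hb hb' hbb hx hz hxz
    exact hC u x z b' b hx.2 hxz k2.2 (G.adj_symm hbb) (G.adj_symm hb.2) hz.2 hb'.2 k1.2 k1.1 k2.1
  by_cases hY1 : (Set.ncard {y | y ∈ Y ∧ G.Adj u y} : ℝ) ≤ e * n
  · exact Low.predictable (Or.inl hY1) hu le_rfl
  by_contra hcon
  have hlow : ∀ b ∈ {b | (b ∈ Y ∧ G.Adj u b) ∧ b ∉ Q}, e * n ≤
      Set.ncard {v | v ∈ Y ∧ ¬ (G.Adj u v ↔ G.Adj b v)} := by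
    rintro b ⟨-, hbQ⟩
    by_contra hb
    refine hcon ⟨some b, le_trans (Nat.cast_le.2 (Set.ncard_le_ncard ?_ (Set.toFinite _)))
      (not_le.1 hb).le⟩
    rintro v ⟨k1, k2, k3⟩
    refine ⟨k1, fun h => k3 (h.trans ?_)⟩
    simp [delVerts_adj, hbQ, k2]
  have hR := mul_ncard_le {p : V × V | (p.1 ∈ Y ∧ G.Adj u p.1) ∧ p.2 ∈ Y ∧
    ¬ (G.Adj u p.2 ↔ G.Adj p.1 p.2)} _ (fun b hb => (hlow b hb).trans (Nat.cast_le.2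
      (Set.ncard_le_ncard (fun v hv => ⟨hb.1, hv⟩) (Set.toFinite _))))
  have hR2 : Set.ncard {p : V × V | (p.1 ∈ Y ∧ G.Adj u p.1) ∧ p.2 ∈ Y ∧
      ¬ (G.Adj u p.2 ↔ G.Adj p.1 p.2)} ≤ _ := (Set.ncard_le_ncard (t := {p : V × V |
      (p.1 ∈ Y ∧ G.Adj u p.1) ∧ (p.2 ∈ Y ∧ G.Adj u p.2) ∧ ¬ G.Adj p.1 p.2} ∪ {p : V × V |
      (p.1 ∈ Y ∧ G.Adj u p.1) ∧ (p.2 ∈ Y ∧ ¬ G.Adj u p.2) ∧ G.Adj p.1 p.2}) (by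
    rintro ⟨b, v⟩ ⟨k1, k2, k3⟩
    by_cases h : G.Adj u v
    · exact Or.inl ⟨k1, ⟨k2, h⟩, fun h' => k3 ⟨fun _ => h', fun _ => h⟩⟩
    · exact Or.inr ⟨k1, ⟨k2, h⟩, by_contra fun h' => k3 ⟨fun h1 => absurd h1 h,
        fun h1 => absurd h1 h'⟩⟩) (Set.toFinite _)).trans (Set.ncard_union_le _ _)
  have hR3 := (Nat.cast_le (α := ℝ)).2 hR2
  push_cast at hR3
  have hQc : Set.ncard {y | y ∈ Y ∧ G.Adj u y} ≤
      Set.ncard {b | (b ∈ Y ∧ G.Adj u b) ∧ b ∉ Q} + 3 := by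
    refine le_trans (Set.ncard_le_ncard (t := {b | (b ∈ Y ∧ G.Adj u b) ∧ b ∉ Q} ∪ Q) ?_
      (Set.toFinite _)) ((Set.ncard_union_le _ _).trans
        (Nat.add_le_add_left (by rwa [Set.ncard_coe_finset]) _))
    intro b hb
    by_cases h : b ∈ Q
    exacts [Or.inr h, Or.inl ⟨hb, h⟩]
  have hQc' : (Set.ncard {y | y ∈ Y ∧ G.Adj u y} : ℝ) ≤
      Set.ncard {b | (b ∈ Y ∧ G.Adj u b) ∧ b ∉ Q} + 3 := by exact_mod_cast hQc
  have hbig : e * n / 2 ≤ Set.ncard {b | (b ∈ Y ∧ G.Adj u b) ∧ b ∉ Q} := by linarith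
  have := mul_le_mul_of_nonneg_left hbig (by positivity : 0 ≤ e * n)
  have h9 : ξ * n ^ 2 ≤ e ^ 2 / 8 * n ^ 2 := mul_le_mul_of_nonneg_right hξe (by positivity)
  nlinarith [mul_pos he hn0]

/-- Few vertices of `Y` have few neighbours in `X`. -/
lemma Uni.card_low_le {s c : ℝ} {W : Finset V} (h : Uni G X Y ξ q) (hW : ∀ y ∈ W, y ∈ Y)
    (hlow : ∀ y ∈ W, Low G X (s ^ 2) y) (hs : 0 < s) (hs8 : s ≤ 1 / 8) (hqs : 4 * q * s ≤ 1)
    (hc : 0 < c) (hξc : ξ < c ^ 3 / 4) (hξ : ξ ≤ 1 / 64) (hX : (Fintype.card V : ℝ) / 4 ≤ X.card)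
    (hn : 0 < Fintype.card V) : (W.card : ℝ) ≤ c * Fintype.card V := by
  by_contra hcon
  push Not at hcon
  set n : ℝ := (Fintype.card V : ℝ) with hnd
  have hn0 : 0 < n := by rw [hnd]; exact_mod_cast hn
  set w : ℝ := (W.card : ℝ) with hw
  have hw0 : 0 < w := lt_trans (by positivity) hcon
  have hE : (Set.ncard {p : V × V | p.1 ∈ W ∧ p.2 ∈ X ∧ G.Adj p.1 p.2} : ℝ) ≤ w * (s ^ 2 * n) := by
    have h1 := ncard_eq_sum_fiber {p : V × V | p.1 ∈ W ∧ p.2 ∈ X ∧ G.Adj p.1 p.2}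
    rw [h1, Nat.cast_sum, ← Finset.sum_subset (Finset.subset_univ W), hw, ← nsmul_eq_mul]
    · refine Finset.sum_le_card_nsmul _ _ _ fun y hy => ?_
      refine le_trans (Nat.cast_le.2 (Set.ncard_le_ncard ?_ (Set.toFinite _))) (hlow y hy)
      exact fun x hx => hx.2
    · intro y _ hy
      rw [Nat.cast_eq_zero, Set.ncard_eq_zero (Set.toFinite _)]
      exact Set.eq_empty_of_forall_notMem fun x hx => hy hx.1
  obtain ⟨S, hS⟩ : ∃ S : Set V, ∀ x, x ∈ S ↔
      x ∈ X ∧ (Set.ncard {y | y ∈ W ∧ G.Adj y x} : ℝ) ≤ s * w :=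
    ⟨{x | x ∈ X ∧ (Set.ncard {y | y ∈ W ∧ G.Adj y x} : ℝ) ≤ s * w}, fun _ => Iff.rfl⟩
  have hS' : (Set.ncard {x | x ∈ X ∧ x ∉ S} : ℝ) ≤ s * n := by
    have h1 := mul_ncard_le {p : V × V | p.2 ∈ W ∧ p.1 ∈ X ∧ G.Adj p.2 p.1} {x | x ∈ X ∧ x ∉ S}
      (x := s * w) (fun x hx => by
        have h2 : s * w < Set.ncard {y | y ∈ W ∧ G.Adj y x} := by
          by_contra h
          exact hx.2 ((hS x).2 ⟨hx.1, not_lt.1 h⟩)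
        exact h2.le.trans (Nat.cast_le.2 (Set.ncard_le_ncard (fun y hy => ⟨hy.1, hx.1, hy.2⟩)
          (Set.toFinite _))))
    have h2 : Set.ncard {p : V × V | p.2 ∈ W ∧ p.1 ∈ X ∧ G.Adj p.2 p.1} ≤
        Set.ncard {p : V × V | p.1 ∈ W ∧ p.2 ∈ X ∧ G.Adj p.1 p.2} :=
      Set.ncard_le_ncard_of_injOn Prod.swap (fun _ h => h) Prod.swap_injective.injOn
        (Set.toFinite _)
    have h3 := (h1.trans (Nat.cast_le.2 h2)).trans hE
    have h4 : (s * w) * Set.ncard {x | x ∈ X ∧ x ∉ S} ≤ (s * w) * (s * n) := by linarith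
    exact le_of_mul_le_mul_left h4 (by positivity)
  have hSc : n / 8 ≤ S.ncard := by
    have h1 : X.card ≤ S.ncard + Set.ncard {x | x ∈ X ∧ x ∉ S} := by
      rw [← Set.ncard_coe_finset]
      refine le_trans (Set.ncard_le_ncard ?_ (Set.toFinite _)) (Set.ncard_union_le _ _)
      intro x hx
      by_cases h : x ∈ S
      exacts [Or.inl h, Or.inr ⟨hx, h⟩]
    have h2 : (X.card : ℝ) ≤ S.ncard + Set.ncard {x | x ∈ X ∧ x ∉ S} := by exact_mod_cast h1
    nlinarith
  obtain ⟨f, hf, hg⟩ := h {p | p.1 ∈ S ∧ p.2 ∈ S}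
    (fun p hp => ⟨((hS _).1 hp.1).1, ((hS _).1 hp.2).1⟩) (by
      rw [ncard_pairs]
      push_cast
      have h1 : n / 8 * (n / 8) ≤ (S.ncard : ℝ) * S.ncard :=
        mul_le_mul hSc hSc (by positivity) (by positivity)
      nlinarith [sq_nonneg n])
  have hfS : ∀ p, f p ∈ S := by
    rintro ⟨i, c⟩
    cases c
    exacts [(hf i).1, (hf i).2]
  obtain ⟨W', hW'⟩ : ∃ W' : Set V, ∀ y, y ∈ W' ↔ y ∈ W ∧ ∀ p, ¬ G.Adj y (f p) :=
    ⟨{y | y ∈ W ∧ ∀ p, ¬ G.Adj y (f p)}, fun _ => Iff.rfl⟩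
  have hWc : w / 2 ≤ W'.ncard := by
    have h1 : W.card ≤ W'.ncard + ∑ p, Set.ncard {y | y ∈ W ∧ G.Adj y (f p)} := by
      rw [← Set.ncard_coe_finset]
      refine le_trans (Set.ncard_le_ncard (t := W' ∪ ⋃ p, {y | y ∈ W ∧ G.Adj y (f p)}) ?_
        (Set.toFinite _)) ((Set.ncard_union_le _ _).trans
          (Nat.add_le_add_left (Set.ncard_iUnion_le_of_fintype _) _))
      intro y hy
      by_cases h : ∀ p, ¬ G.Adj y (f p)
      · exact Or.inl ((hW' y).2 ⟨hy, h⟩)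
      · push Not at h
        obtain ⟨p, hp⟩ := h
        exact Or.inr (Set.mem_iUnion.2 ⟨p, hy, hp⟩)
    have h2 : w ≤ W'.ncard + ∑ p, (Set.ncard {y | y ∈ W ∧ G.Adj y (f p)} : ℝ) := by
      rw [hw]; exact_mod_cast h1
    have h3 : ∑ p, (Set.ncard {y | y ∈ W ∧ G.Adj y (f p)} : ℝ) ≤ (2 * q : ℝ) * (s * w) := by
      refine (Finset.sum_le_card_nsmul _ _ (s * w) fun p _ => ((hS _).1 (hfS p)).2).trans ?_
      rw [nsmul_eq_mul, Finset.card_univ, Fintype.card_prod, Fintype.card_fin, Fintype.card_bool]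
      push_cast
      linarith
    nlinarith
  have h1 := hg (true, true) (true, true) (true, true)
  have h2 : Set.ncard {y : V × V × V | y.1 ∈ W' ∧ y.2 ∈ {z : V × V | z.1 ∈ W' ∧ z.2 ∈ W'}} ≤ _ :=
    Set.ncard_le_ncard (t := {y : V × V × V | y.1 ∈ Y ∧ y.2.1 ∈ Y ∧ y.2.2 ∈ Y ∧
      ∀ i, ¬ (AdjPat G y.1 (f (i, false)) (f (i, true)) (true, true) ∧
        AdjPat G y.2.1 (f (i, false)) (f (i, true)) (true, true) ∧
        AdjPat G y.2.2 (f (i, false)) (f (i, true)) (true, true))}) (by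
      rintro ⟨a, b, c⟩ ⟨k1, k2, k3⟩
      exact ⟨hW _ ((hW' _).1 k1).1, hW _ ((hW' _).1 k2).1, hW _ ((hW' _).1 k3).1,
        fun i hi => ((hW' _).1 k1).2 _ (hi.1.1.2 rfl)⟩) (Set.toFinite _)
  have h3 : Set.ncard {y : V × V × V | y.1 ∈ W' ∧ y.2 ∈ {z : V × V | z.1 ∈ W' ∧ z.2 ∈ W'}} =
      W'.ncard * (W'.ncard * W'.ncard) := by
    rw [← ncard_pairs W' W']
    exact Set.ncard_prod
  rw [h3] at h2
  have h4 := (Nat.cast_le (α := ℝ)).2 h2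
  push_cast at h4
  have h5 : (c * n / 2) ^ 3 ≤ (W'.ncard : ℝ) ^ 3 :=
    pow_le_pow_left₀ (by positivity) (by linarith) 3
  have h6 : ξ / 2 * n ^ 3 < c ^ 3 / 8 * n ^ 3 := mul_lt_mul_of_pos_right (by linarith) (by positivity)
  nlinarith

/-- Few vertices of a near-clique `X` have many non-neighbours in `X`. -/
lemma card_not_low_le {δ ξ₁ : ℝ} {S : Set V} (hS : ∀ x ∈ S, x ∈ X ∧ ¬ Low Gᶜ X δ x)
    (hd : (eCount Gᶜ X : ℝ) ≤ ξ₁ * (Fintype.card V : ℝ) ^ 2) (hδ : 0 < δ)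
    (hn : 0 < Fintype.card V) : (S.ncard : ℝ) ≤ ξ₁ / δ * Fintype.card V := by
  have hn0 : (0 : ℝ) < Fintype.card V := by exact_mod_cast hn
  have h1 := mul_ncard_le {p : V × V | p.1 ∈ X ∧ p.2 ∈ X ∧ Gᶜ.Adj p.1 p.2} S
    (x := δ * Fintype.card V) (fun x hx => (not_le.1 (hS x hx).2).le.trans (Nat.cast_le.2
      (Set.ncard_le_ncard (fun y hy => ⟨(hS x hx).1, hy⟩) (Set.toFinite _))))
  have h2 := h1.trans hd
  have h3 : (δ * Fintype.card V) * (S.ncard : ℝ) ≤ (δ * Fintype.card V) *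
      (ξ₁ / δ * Fintype.card V) := by
    refine h2.trans (le_of_eq ?_)
    field_simp
  exact le_of_mul_le_mul_left h3 (by positivity)

end Homogeneous

/-! ### The structure of typical graphs without induced five-cycles -/

section Structure

variable {V : Type*}

lemma exists_cover_of_not_hasMatching {ρ : V → V → Prop} (hρ : ∀ a b, ρ a b → ρ b a) (k : ℕ) :
    ∀ W : Finset V, ¬ HasMatching ρ W k → ∃ T : Finset V, T.card ≤ 2 * k ∧
      ∀ b ∈ W, b ∉ T → ∀ b' ∈ W, b' ∉ T → b ≠ b' → ¬ ρ b b' := by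
  induction k with
  | zero =>
    intro W h
    exact (h ⟨⟨fun p => p.1.elim0, fun p => p.1.elim0⟩, fun p => p.1.elim0,
      fun i => i.elim0⟩).elim
  | succ k ih =>
    intro W h
    by_cases hW : ∃ b ∈ W, ∃ b' ∈ W, b ≠ b' ∧ ρ b b'
    · obtain ⟨b, hb, b', hb', hne, hbb⟩ := hW
      obtain ⟨T, hT, hTW⟩ := ih (W.filter fun v => v ≠ b ∧ v ≠ b') (by
        rintro ⟨f, hf, hfρ⟩
        have hf1 : ∀ p, f p ∈ W ∧ f p ≠ b ∧ f p ≠ b' := fun p => by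
          have := hf p
          rwa [Finset.mem_filter] at this
        obtain ⟨g, hg0, hg⟩ : ∃ g : Fin (k + 1) × Bool → V,
            (∀ c, g (0, c) = if c = true then b' else b) ∧ ∀ i c, g (Fin.succ i, c) = f (i, c) :=
          ⟨fun p => Fin.cases (motive := fun _ => V) (if p.2 = true then b' else b)
            (fun i => f (i, p.2)) p.1, fun _ => rfl, fun _ _ => rfl⟩
        have hgi : Function.Injective g := by
          rintro ⟨i, c⟩ ⟨j, d⟩
          refine Fin.cases ?_ (fun i => ?_) i <;> refine Fin.cases ?_ (fun j => ?_) j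
          · cases c <;> cases d <;> simp [hg0, hne, hne.symm]
          · rw [hg0, hg]
            cases c <;> simp [(hf1 (j, d)).2.1.symm, (hf1 (j, d)).2.2.symm]
          · rw [hg0, hg]
            cases d <;> simp [(hf1 (i, c)).2.1, (hf1 (i, c)).2.2]
          · rw [hg, hg]
            intro h
            have := Prod.mk.inj (f.injective h)
            exact Prod.ext (congrArg Fin.succ this.1) this.2
        refine h ⟨⟨g, hgi⟩, ?_, ?_⟩
        · rintro ⟨i, c⟩
          refine Fin.cases ?_ (fun i => ?_) i
          · show g (0, c) ∈ W
            cases c <;> simp [hg0, hb, hb']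
          · show g (i.succ, c) ∈ W
            rw [hg]
            exact (hf1 _).1
        · intro i
          refine Fin.cases ?_ (fun i => ?_) i
          · show ρ (g (0, false)) (g (0, true))
            simpa [hg0] using hbb
          · show ρ (g (i.succ, false)) (g (i.succ, true))
            rw [hg, hg]
            exact hfρ i)
      refine ⟨T ∪ {b, b'}, ?_, ?_⟩
      · refine (Finset.card_union_le _ _).trans ?_
        have := Finset.card_le_two (a := b) (b := b')
        omega
      · intro u hu huT v hv hvT huv
        simp only [Finset.mem_union, Finset.mem_insert, Finset.mem_singleton, not_or] at huT hvT
        exact hTW u (Finset.mem_filter.2 ⟨hu, huT.2⟩) huT.1 v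
          (Finset.mem_filter.2 ⟨hv, hvT.2⟩) hvT.1 huv
    · push Not at hW
      exact ⟨∅, by simp, fun b hb _ b' hb' _ hne => hW b hb b' hb' hne⟩

lemma hasMatching_of_pairwise {ρ : V → V → Prop} (hρ : ∀ a b, ρ a b → ρ b a) {W T : Finset V}
    {k : ℕ} (h : ∀ b ∈ W, b ∉ T → ∀ b' ∈ W, b' ∉ T → b ≠ b' → ρ b b')
    (hk : 2 * k + T.card + 2 ≤ W.card) : HasMatching ρ W k := by
  by_contra hcon
  obtain ⟨T', hT', hTW⟩ := exists_cover_of_not_hasMatching hρ k W hcon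
  have h1 : 1 < (W \ (T ∪ T')).card := by grind
  obtain ⟨b, hb, b', hb', hne⟩ := Finset.one_lt_card.1 h1
  simp only [Finset.mem_sdiff, Finset.mem_union, not_or] at hb hb'
  exact hTW b hb.1 hb.2.2 b' hb'.1 hb'.2.2 hne (h b hb.1 hb.2.1 b' hb'.1 hb'.2.1 hne)

lemma relOf_symm (k : Fin 3) (G : SimpleGraph V) (a b : V) (h : relOf k G a b) : relOf k G b a :=
  ⟨h.1.symm, fun hk => G.adj_symm (h.2.1 hk), fun hk h' => h.2.2 hk (G.adj_symm h')⟩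

lemma adj_iff_of_nbrIn {G : SimpleGraph V} {Q π : Finset V} {b w : V} (h : nbrIn G Q b = π)
    (hw : w ∈ Q) : G.Adj b w ↔ w ∈ π := by
  rw [← h, mem_nbrIn]
  simp [hw]

variable [Fintype V] {G : SimpleGraph V} {X Y : Finset V}

lemma hasMatching_of_eCount (hX : (Fintype.card V : ℝ) / 4 ≤ X.card)
    (hd : (eCount Gᶜ X : ℝ) ≤ 1 / 100000 * (Fintype.card V : ℝ) ^ 2)
    (hn : (1000 : ℝ) ≤ Fintype.card V) {k : ℕ} (hk : (k : ℝ) ≤ Fintype.card V / 40) :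
    HasMatching (relOf 0 G) X k := by
  by_contra hcon
  obtain ⟨T, hT, hTX⟩ := exists_cover_of_not_hasMatching (relOf_symm 0 G) k X hcon
  set n : ℝ := (Fintype.card V : ℝ) with hnd
  have h1 : X.card ≤ (X \ T).card + T.card := by
    have := Finset.le_card_sdiff T X
    omega
  have h2 : n / 5 ≤ (X \ T).card := by
    have h3 : (X.card : ℝ) ≤ (X \ T).card + 2 * k := by exact_mod_cast h1.trans (by omega)
    linarith
  have h3 : (X \ T).card * (X \ T).card ≤ eCount Gᶜ X + Fintype.card V := by
    have h4 : Set.ncard {p : V × V | p.1 = p.2} ≤ Fintype.card V := by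
      rw [← Nat.card_eq_fintype_card, ← Set.ncard_univ]
      refine Set.ncard_le_ncard_of_injOn Prod.fst (fun _ _ => trivial) ?_ (Set.toFinite _)
      rintro ⟨a, b⟩ h ⟨c, d⟩ h' h3
      simp only [Set.mem_ofPred_eq] at h h' h3
      rw [← h, ← h', h3]
    refine le_trans ?_ (Nat.add_le_add_left h4 _)
    have h5 := ncard_pairs (V := V) ((X \ T : Finset V) : Set V) ((X \ T : Finset V) : Set V)
    rw [Set.ncard_coe_finset] at h5
    rw [← h5]
    refine le_trans (Set.ncard_le_ncard ?_ (Set.toFinite _)) (Set.ncard_union_le _ _)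
    rintro ⟨a, b⟩ ⟨ha, hb⟩
    simp only [Finset.mem_coe, Finset.mem_sdiff] at ha hb
    by_cases hab : a = b
    · exact Or.inr hab
    · refine Or.inl ⟨ha.1, hb.1, hab, fun h => hTX a ha.1 ha.2 b hb.1 hb.2 hab
        ⟨hab, fun _ => h, fun h => absurd h (by decide)⟩⟩
  have h6 : ((X \ T).card : ℝ) * (X \ T).card ≤ eCount Gᶜ X + n := by
    rw [hnd]; exact_mod_cast h3
  have h7 : n / 5 * (n / 5) ≤ ((X \ T).card : ℝ) * (X \ T).card :=
    mul_le_mul h2 h2 (by positivity) (by positivity)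
  nlinarith

/-- `S` induces a disjoint union of cliques, and all but few of its vertices are isolated. -/
def Kind0 (G : SimpleGraph V) (S : Set V) (ν : ℝ) : Prop :=
  P3FreeOn G S ∧ ∃ J : Finset V, (J.card : ℝ) ≤ ν * Fintype.card V ∧ (∀ v ∈ J, v ∈ S) ∧
    ∀ v ∈ S, v ∉ J → ∀ w ∈ S, ¬ G.Adj v w

/-- `S` induces a disjoint union of cliques, one of which contains almost all vertices. -/
def Kind2 (G : SimpleGraph V) (S : Set V) (ν : ℝ) : Prop :=
  P3FreeOn G S ∧ ∃ J : Finset V, (J.card : ℝ) ≤ ν * Fintype.card V ∧ (∀ v ∈ J, v ∈ S) ∧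
    ∀ v ∈ S, v ∉ J → ∀ w ∈ S, (G.Adj v w ↔ w ∉ J ∧ v ≠ w)

/-- The exceptional structures, which are rare. -/
def Exceptional (G : SimpleGraph V) (ν : ℝ) : Prop :=
  ∃ A : Set V, (Kind2 G A ν ∧ Kind2 G Aᶜ ν) ∨ (Kind0 Gᶜ A ν ∧ Kind0 G Aᶜ ν)

lemma kind2_of_mem {S : Set V} {ν : ℝ} (h : P3FreeOn G S) {v₀ : V} (hv₀ : v₀ ∈ S)
    (hν : (Set.ncard {w | w ∈ S ∧ Gᶜ.Adj v₀ w} : ℝ) ≤ ν * Fintype.card V) : Kind2 G S ν := by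
  refine ⟨h, (Set.toFinite {w | w ∈ S ∧ Gᶜ.Adj v₀ w}).toFinset, ?_, ?_, ?_⟩
  · rwa [← Set.ncard_eq_toFinset_card]
  · intro v hv
    rw [Set.Finite.mem_toFinset] at hv
    exact hv.1
  · intro v hv hvJ w hw
    rw [Set.Finite.mem_toFinset] at hvJ ⊢
    have hK : ∀ {w}, w ∈ S → (¬ (w ∈ S ∧ Gᶜ.Adj v₀ w) ↔ v₀ = w ∨ G.Adj v₀ w) := by
      intro w hw
      rw [SimpleGraph.compl_adj]
      by_cases h1 : v₀ = w <;> by_cases h2 : G.Adj v₀ w <;> simp [hw, h1, h2]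
    have hv' := (hK hv).1 hvJ
    refine Iff.trans ?_ (and_congr_left' (hK hw).symm)
    rcases hv' with rfl | hv'
    · exact ⟨fun h => ⟨Or.inr h, h.ne⟩, fun h => h.1.resolve_left h.2⟩
    · refine ⟨fun h1 => ⟨?_, h1.ne⟩, ?_⟩
      · by_cases h2 : v₀ = w
        · exact Or.inl h2
        · exact Or.inr (h v₀ hv₀ v hv w hw hv' h1 h2)
      · rintro ⟨rfl | h1, h2⟩
        · exact G.adj_symm hv'
        · exact h v hv v₀ hv₀ w hw (G.adj_symm hv') h1 h2

lemma kind0_of_cover {S : Set V} {ν : ℝ} (h : P3FreeOn G S) (T : Finset V)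
    (hT : ∀ v ∈ S, v ∉ T → ∀ w ∈ S, w ∉ T → ¬ G.Adj v w)
    (hν : (2 * T.card : ℝ) ≤ ν * Fintype.card V) : Kind0 G S ν := by
  obtain ⟨J, hJ⟩ : ∃ J : Finset V, ∀ v, v ∈ J ↔ v ∈ S ∧ ∃ w ∈ S, G.Adj v w :=
    ⟨(Set.toFinite {v | v ∈ S ∧ ∃ w ∈ S, G.Adj v w}).toFinset, fun v => by simp⟩
  refine ⟨h, J, ?_, fun v hv => ((hJ v).1 hv).1, fun v hv hvJ w hw hvw =>
    hvJ ((hJ v).2 ⟨hv, w, hw, hvw⟩)⟩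
  have h1 : (J \ T).card ≤ T.card := by
    have hex : ∀ v : V, ∃ w, v ∈ J → w ∈ S ∧ G.Adj v w := fun v => by
      by_cases hv : v ∈ J
      · obtain ⟨-, w, hw⟩ := (hJ v).1 hv
        exact ⟨w, fun _ => hw⟩
      · exact ⟨v, fun h => absurd h hv⟩
    choose g hg using hex
    refine Finset.card_le_card_of_injOn g ?_ ?_
    · intro v hv
      have hv' := Finset.mem_sdiff.1 (Finset.mem_coe.1 hv)
      by_contra hc
      exact hT v ((hJ v).1 hv'.1).1 hv'.2 _ (hg v hv'.1).1 hc (hg v hv'.1).2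
    · intro v hv v' hv' hvv
      have k1 := Finset.mem_sdiff.1 (Finset.mem_coe.1 hv)
      have k2 := Finset.mem_sdiff.1 (Finset.mem_coe.1 hv')
      by_contra hne
      have s1 := ((hJ v).1 k1.1).1
      have s2 := ((hJ v').1 k2.1).1
      refine hT v s1 k1.2 v' s2 k2.2 (h v s1 _ (hg v k1.1).1 v' s2 (hg v k1.1).2 ?_ hne)
      rw [hvv]
      exact G.adj_symm (hg v' k2.1).2
  have h2 : J.card ≤ 2 * T.card := by
    have := Finset.le_card_sdiff T J
    omega
  have h3 : (J.card : ℝ) ≤ 2 * T.card := by exact_mod_cast h2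
  exact h3.trans hν

/-- The data available for a typical graph, where `X` is nearly a clique and `A` is the set of
vertices which are nearly complete or nearly anticomplete to `X`. -/
structure Setup (G : SimpleGraph V) (X Y A : Finset V) (e₁ e₂ δ : ℝ) : Prop where
  c5Free : C5Free G
  mem_iff : ∀ v, v ∈ Y ↔ v ∉ X
  card_left : (Fintype.card V : ℝ) / 4 ≤ X.card
  card_right : (Fintype.card V : ℝ) / 4 ≤ Y.card
  pairs : ∀ q, 1 ≤ q → q ≤ 3 → PairsProp G X Y e₁ (1 / 1000) q ∧ PairsProp G Y X e₁ (1 / 1000) q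
  pairs_fine : PairsProp G X Y e₂ (e₁ / 10) 2
  dense : (eCount Gᶜ X : ℝ) ≤ 1 / 100000 * (Fintype.card V : ℝ) ^ 2
  mem_A : ∀ v, v ∈ A ↔ Low G X δ v ∨ Low Gᶜ X δ v
  predictable : ∀ u, u ∉ A → ∀ Q : Finset V, u ∈ Q → Q.card ≤ 3 → Predictable G Q Y e₁ u
  left_diff : ((X \ A).card : ℝ) ≤ e₂ / 10 * Fintype.card V
  right_inter : ((Y ∩ A).card : ℝ) ≤ e₂ / 10 * Fintype.card V
  e₁_le : e₁ ≤ 1 / 1000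
  e₂_le : e₂ ≤ e₁
  δ_le : 3 * δ ≤ e₂
  δ_nonneg : 0 ≤ δ
  large : 1000 ≤ e₂ * Fintype.card V

namespace Setup

variable {A : Finset V} {e₁ e₂ δ : ℝ}

lemma le_card (S : Setup G X Y A e₁ e₂ δ) : (1000000 : ℝ) ≤ Fintype.card V := by
  have h1 := S.large
  have h2 : e₂ * (Fintype.card V : ℝ) ≤ 1 / 1000 * Fintype.card V :=
    mul_le_mul_of_nonneg_right (S.e₂_le.trans S.e₁_le) (Nat.cast_nonneg _)
  linarith

lemma e₂_mul_le (S : Setup G X Y A e₁ e₂ δ) :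
    e₂ * (Fintype.card V : ℝ) ≤ e₁ * Fintype.card V :=
  mul_le_mul_of_nonneg_right S.e₂_le (Nat.cast_nonneg _)

lemma e₁_mul_le (S : Setup G X Y A e₁ e₂ δ) :
    e₁ * (Fintype.card V : ℝ) ≤ 1 / 1000 * Fintype.card V :=
  mul_le_mul_of_nonneg_right S.e₁_le (Nat.cast_nonneg _)

lemma ceil_le (S : Setup G X Y A e₁ e₂ δ) :
    (⌈(1 / 1000 : ℝ) * Fintype.card V⌉₊ : ℝ) ≤ 2 / 1000 * Fintype.card V := by
  have h1 := S.le_card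
  have := Nat.ceil_lt_add_one (by positivity : 0 ≤ (1 / 1000 : ℝ) * (Fintype.card V : ℝ))
  linarith

/-- Prescribed patterns on sets of vertices outside `A` are realised by an edge of `X`. -/
lemma exists_left (S : Setup G X Y A e₁ e₂ δ) {Q : Finset V} (hQ : ∀ u ∈ Q, u ∉ A)
    (h1 : 1 ≤ Q.card) (h3 : Q.card ≤ 3) {π π' : Finset V} (hπ : π ⊆ Q) (hπ' : π' ⊆ Q)
    {E : Finset V} (hE : (E.card : ℝ) ≤ e₁ * Fintype.card V) :
    ∃ y y', y ∈ X ∧ y ∉ E ∧ y' ∈ X ∧ y' ∉ E ∧ G.Adj y y' ∧ nbrIn G Q y = π ∧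
      nbrIn G Q y' = π' := by
  have h := S.le_card
  have h5 := S.ceil_le
  obtain ⟨y, y', k1, k2, k3, k4⟩ := (S.pairs _ h1 h3).2 Q rfl
    (fun u hu => S.predictable u (hQ u hu) Q hu h3) 0
    (hasMatching_of_eCount S.card_left S.dense (by linarith) (by linarith)) π π' hπ hπ' E hE
  exact ⟨y, y', k1.1, k1.2.2, k2.1, k2.2.2, k3.2.1 rfl, k4⟩

lemma predictable_left (S : Setup G X Y A e₁ e₂ δ) {Q : Finset V} (hQ : ∀ u ∈ Q, u ∈ A) {e : ℝ}
    (he : e₂ ≤ e) : ∀ u ∈ Q, Predictable G Q X e u := fun u hu =>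
  Low.predictable ((S.mem_A u).1 (hQ u hu)) hu (by linarith [S.δ_le, S.δ_nonneg])

lemma p3FreeOn_compl (S : Setup G X Y A e₁ e₂ δ) : P3FreeOn G (A : Set V)ᶜ := by
  intro b hb b' hb' b'' hb'' h1 h2 hne
  by_contra h3
  have hb1 : b ∉ A := hb
  have hb2 : b' ∉ A := hb'
  have hb3 : b'' ∉ A := hb''
  have hc : ({b, b', b''} : Finset V).card = 3 :=
    Finset.card_eq_three.2 ⟨_, _, _, h1.ne, hne, h2.ne, rfl⟩
  obtain ⟨x, z, -, -, -, -, hxz, hx, hz⟩ := S.exists_left (Q := {b, b', b''}) (π := {b})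
    (π' := {b''}) (E := ∅) (by simp [hb1, hb2, hb3]) (by omega) (by omega) (by simp) (by simp) (by
      rw [Finset.card_empty, Nat.cast_zero]
      linarith [S.e₂_mul_le, S.large])
  refine S.c5Free x b b' b'' z ((adj_iff_of_nbrIn hx (by simp)).2 (by simp)) h1 h2
    (G.adj_symm ((adj_iff_of_nbrIn hz (by simp)).2 (by simp))) (G.adj_symm hxz)
    (fun h => ?_) (fun h => ?_) h3 (fun h => ?_) (fun h => ?_)
  · exact h1.ne' (by simpa using (adj_iff_of_nbrIn hx (by simp)).1 h)
  · exact hne.symm (by simpa using (adj_iff_of_nbrIn hx (by simp)).1 h)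
  · exact hne (by simpa using (adj_iff_of_nbrIn hz (by simp)).1 (G.adj_symm h))
  · exact h2.ne (by simpa using (adj_iff_of_nbrIn hz (by simp)).1 (G.adj_symm h))

lemma kind2_of_low (S : Setup G X Y A e₁ e₂ δ) {a : V} (ha : Low G X δ a) :
    Kind2 G (A : Set V) (1 / 20) ∧ Kind2 G (A : Set V)ᶜ (1 / 20) := by
  have hn := S.le_card
  have hceil := S.ceil_le
  have l1 := S.e₂_mul_le
  have l2 := S.e₁_mul_le
  have l3 := S.large
  have l4 := S.left_diff
  have l5 := S.right_inter
  have l6 := S.card_left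
  have l7 := S.card_right
  have l8 := mul_le_mul_of_nonneg_right S.δ_le (Nat.cast_nonneg (α := ℝ) (Fintype.card V))
  have haA : a ∈ A := (S.mem_A a).2 (Or.inl ha)
  have hcl : ∀ b b', b ∉ A → b' ∉ A → G.Adj a b → G.Adj a b' → b ≠ b' → G.Adj b b' := by
    intro b b' hb hb' hab hab' hne
    by_contra hbb
    obtain ⟨y, y', hy, hyE, hy', hyE', hyy, k1, k2⟩ := S.exists_left (Q := {b, b'}) (π := {b})
      (π' := {b'}) (E := X.filter fun x => G.Adj a x) (by simp [hb, hb'])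
      (by rw [Finset.card_pair hne]; norm_num) (by rw [Finset.card_pair hne]; norm_num) (by simp)
      (by simp) (by
        have h1 : ((X.filter fun x => G.Adj a x).card : ℝ) ≤ δ * Fintype.card V := by
          rw [← Set.ncard_coe_finset]
          refine le_trans (Nat.cast_le.2 (Set.ncard_le_ncard ?_ (Set.toFinite _))) ha
          exact fun x hx => Finset.mem_filter.1 hx
        have h2 := mul_nonneg S.δ_nonneg (Nat.cast_nonneg (α := ℝ) (Fintype.card V))
        linarith)
    have hay : ¬ G.Adj a y := fun h => hyE (Finset.mem_filter.2 ⟨hy, h⟩)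
    have hay' : ¬ G.Adj a y' := fun h => hyE' (Finset.mem_filter.2 ⟨hy', h⟩)
    refine S.c5Free b y y' b' a (G.adj_symm ((adj_iff_of_nbrIn k1 (by simp)).2 (by simp))) hyy
      ((adj_iff_of_nbrIn k2 (by simp)).2 (by simp)) (G.adj_symm hab') hab (fun h => ?_) hbb
      (fun h => ?_) (fun h => hay (G.adj_symm h)) (fun h => hay' (G.adj_symm h))
    · exact hne (by simpa using (adj_iff_of_nbrIn k2 (by simp)).1 (G.adj_symm h))
    · exact hne.symm (by simpa using (adj_iff_of_nbrIn k1 (by simp)).1 h)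
  have hno : ¬ HasMatching (relOf 1 G) Y ⌈(1 / 1000 : ℝ) * Fintype.card V⌉₊ := by
    intro hm
    obtain ⟨b, b', ⟨k1, -, k2⟩, ⟨k3, -, k4⟩, ⟨k5, -, k6⟩, k7, k8⟩ :=
      (S.pairs 1 le_rfl (by norm_num)).1 {a} (by simp)
      (S.predictable_left (by simp [haA]) S.e₂_le) 1 hm {a} {a} (by simp) (by simp) (Y ∩ A)
      (by linarith)
    have hbA : b ∉ A := fun h => k2 (Finset.mem_inter.2 ⟨k1, h⟩)
    have hbA' : b' ∉ A := fun h => k4 (Finset.mem_inter.2 ⟨k3, h⟩)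
    exact k6 rfl (hcl b b' hbA hbA' (G.adj_symm ((adj_iff_of_nbrIn k7 (by simp)).2 (by simp)))
      (G.adj_symm ((adj_iff_of_nbrIn k8 (by simp)).2 (by simp))) k5)
  obtain ⟨T, hT, hTY⟩ := exists_cover_of_not_hasMatching (relOf_symm 1 G) _ Y hno
  have hTc : (T.card : ℝ) ≤ 4 / 1000 * Fintype.card V := by
    have : (T.card : ℝ) ≤ 2 * ⌈(1 / 1000 : ℝ) * Fintype.card V⌉₊ := by exact_mod_cast hT
    linarith
  have hTY' : ∀ b ∈ Y, b ∉ T → ∀ b' ∈ Y, b' ∉ T → b ≠ b' → G.Adj b b' := by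
    intro b hb hbT b' hb' hbT' hne
    by_contra h
    exact hTY b hb hbT b' hb' hbT' hne ⟨hne, fun h => absurd h (by decide), fun _ => h⟩
  have hmY : HasMatching (relOf 0 G) Y ⌈(1 / 1000 : ℝ) * Fintype.card V⌉₊ := by
    refine hasMatching_of_pairwise (relOf_symm 0 G) (T := T) ?_ ?_
    · exact fun b hb hbT b' hb' hbT' hne => ⟨hne, fun _ => hTY' b hb hbT b' hb' hbT' hne,
        fun h => absurd h (by decide)⟩
    · have : ((2 * ⌈(1 / 1000 : ℝ) * Fintype.card V⌉₊ + T.card + 2 : ℕ) : ℝ) ≤ Y.card := by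
        push_cast
        linarith
      exact_mod_cast this
  have hA3 : P3FreeOn G (A : Set V) := by
    intro a₁ h₁ a₂ h₂ a₃ h₃ h12 h23 hne
    by_contra h13
    have h₁' : a₁ ∈ A := h₁
    have h₂' : a₂ ∈ A := h₂
    have h₃' : a₃ ∈ A := h₃
    obtain ⟨y, y', -, -, ⟨-, hyy, -⟩, k1, k2⟩ := (S.pairs 3 (by norm_num) le_rfl).1 {a₁, a₂, a₃}
      (Finset.card_eq_three.2 ⟨_, _, _, h12.ne, hne, h23.ne, rfl⟩)
      (S.predictable_left (by simp [h₁', h₂', h₃']) S.e₂_le) 0 hmY {a₁} {a₃} (by simp) (by simp) ∅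
      (by rw [Finset.card_empty, Nat.cast_zero]; linarith)
    refine S.c5Free y a₁ a₂ a₃ y' ((adj_iff_of_nbrIn k1 (by simp)).2 (by simp)) h12 h23
      (G.adj_symm ((adj_iff_of_nbrIn k2 (by simp)).2 (by simp))) (G.adj_symm (hyy rfl))
      (fun h => ?_) (fun h => ?_) h13 (fun h => ?_) (fun h => ?_)
    · exact h12.ne' (by simpa using (adj_iff_of_nbrIn k1 (by simp)).1 h)
    · exact hne.symm (by simpa using (adj_iff_of_nbrIn k1 (by simp)).1 h)
    · exact hne (by simpa using (adj_iff_of_nbrIn k2 (by simp)).1 (G.adj_symm h))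
    · exact h23.ne (by simpa using (adj_iff_of_nbrIn k2 (by simp)).1 (G.adj_symm h))
  constructor
  · have hb := card_not_low_le (S := {x | x ∈ X ∧ ¬ Low Gᶜ X (1 / 100) x}) (fun x hx => hx) S.dense
      (by norm_num) (by exact_mod_cast (by linarith : (0 : ℝ) < Fintype.card V))
    obtain ⟨v₀, hv₀, hv₀'⟩ := Set.exists_mem_notMem_of_ncard_lt_ncard
      (s := {x | x ∈ X ∧ ¬ Low Gᶜ X (1 / 100) x} ∪ (X \ A : Finset V)) (t := X) (by
        have h1 := Set.ncard_union_le {x | x ∈ X ∧ ¬ Low Gᶜ X (1 / 100) x} (X \ A : Finset V)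
        rw [Set.ncard_coe_finset (X \ A)] at h1
        have h2 : (Set.ncard ({x | x ∈ X ∧ ¬ Low Gᶜ X (1 / 100) x} ∪ (X \ A : Finset V)) : ℝ) <
            X.card := by
          refine lt_of_le_of_lt (Nat.cast_le.2 h1) ?_
          push_cast
          linarith
        rw [Set.ncard_coe_finset]
        exact_mod_cast h2) (Set.toFinite _)
    have hX : v₀ ∈ X := hv₀
    have hA : v₀ ∈ A := by grind
    have hlow : Low Gᶜ X (1 / 100) v₀ := by
      by_contra h
      exact hv₀' (Or.inl ⟨hX, h⟩)
    refine kind2_of_mem hA3 hA ?_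
    have h1 : Set.ncard {w | w ∈ (A : Set V) ∧ Gᶜ.Adj v₀ w} ≤
        Set.ncard {x | x ∈ X ∧ Gᶜ.Adj v₀ x} + (Y ∩ A).card := by
      rw [← Set.ncard_coe_finset]
      refine le_trans (Set.ncard_le_ncard ?_ (Set.toFinite _)) (Set.ncard_union_le _ _)
      rintro w ⟨h1, h2⟩
      by_cases hw : w ∈ X
      · exact Or.inl ⟨hw, h2⟩
      · exact Or.inr (Finset.mem_coe.2 (Finset.mem_inter.2 ⟨(S.mem_iff w).2 hw, h1⟩))
    rw [Low] at hlow
    refine (Nat.cast_le.2 h1).trans ?_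
    push_cast
    linarith
  · obtain ⟨v₀, hv₀, hv₀'⟩ := Finset.exists_mem_notMem_of_card_lt_card (s := T ∪ (Y ∩ A)) (t := Y) (by
      have h2 : ((T ∪ (Y ∩ A)).card : ℝ) < Y.card := by
        refine lt_of_le_of_lt (Nat.cast_le.2 (Finset.card_union_le _ _)) ?_
        push_cast
        linarith
      exact_mod_cast h2)
    rw [Finset.mem_union, Finset.mem_inter, not_or, not_and] at hv₀'
    refine kind2_of_mem S.p3FreeOn_compl (v₀ := v₀) (hv₀'.2 hv₀) ?_
    have h1 : Set.ncard {w | w ∈ (A : Set V)ᶜ ∧ Gᶜ.Adj v₀ w} ≤ T.card + (X \ A).card := by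
      rw [← Set.ncard_coe_finset, ← Set.ncard_coe_finset]
      refine le_trans (Set.ncard_le_ncard ?_ (Set.toFinite _)) (Set.ncard_union_le _ _)
      rintro w ⟨h1, h2, h3⟩
      by_cases hw : w ∈ X
      · exact Or.inr (Finset.mem_coe.2 (Finset.mem_sdiff.2 ⟨hw, h1⟩))
      · left
        by_contra hwT
        exact h3 (hTY' v₀ hv₀ hv₀'.1 w ((S.mem_iff w).2 hw) hwT h2)
    refine (Nat.cast_le.2 h1).trans ?_
    push_cast
    linarith

lemma coUnipolar_or_kind0 (S : Setup G X Y A e₁ e₂ δ) (hlow : ∀ a ∈ A, Low Gᶜ X δ a) {a a' : V}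
    (ha : a ∈ A) (ha' : a' ∈ A) (hne : a ≠ a') (haa : ¬ G.Adj a a') :
    IsCoUnipolar G ∨ (Kind0 Gᶜ (A : Set V) (1 / 20) ∧ Kind0 G (A : Set V)ᶜ (1 / 20)) := by
  have hn := S.le_card
  have hceil := S.ceil_le
  have l1 := S.e₂_mul_le
  have l2 := S.e₁_mul_le
  have l3 := S.large
  have l4 := S.left_diff
  have l5 := S.right_inter
  have l7 := S.card_right
  have l8 := mul_le_mul_of_nonneg_right S.δ_le (Nat.cast_nonneg (α := ℝ) (Fintype.card V))
  have hnoB : ∀ b b', b ∉ A → b' ∉ A → G.Adj b b' → G.Adj b a → ¬ G.Adj b a' → G.Adj b' a' →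
      ¬ G.Adj b' a → False := by
    intro b b' hb hb' hbb h1 h2 h3 h4
    obtain ⟨y, -, hy, hyE, -, -, -, k1, -⟩ := S.exists_left (Q := {b, b'}) (π := ∅) (π' := ∅)
      (E := (X.filter fun x => Gᶜ.Adj a x) ∪ ((X.filter fun x => Gᶜ.Adj a' x) ∪ {a, a'}))
      (by simp [hb, hb']) (by rw [Finset.card_pair hbb.ne]; norm_num)
      (by rw [Finset.card_pair hbb.ne]; norm_num) (by simp) (by simp) (by
        have h1 : ∀ {a}, a ∈ A → ((X.filter fun x => Gᶜ.Adj a x).card : ℝ) ≤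
            δ * Fintype.card V := by
          intro a ha
          rw [← Set.ncard_coe_finset]
          refine le_trans (Nat.cast_le.2 (Set.ncard_le_ncard ?_ (Set.toFinite _))) (hlow a ha)
          exact fun x hx => Finset.mem_filter.1 hx
        have h2 := (Nat.cast_le (α := ℝ)).2 ((Finset.card_union_le (X.filter fun x => Gᶜ.Adj a x)
          ((X.filter fun x => Gᶜ.Adj a' x) ∪ {a, a'})).trans
            (Nat.add_le_add_left (Finset.card_union_le _ _) _))
        push_cast [Finset.card_pair hne] at h2
        linarith [h1 ha, h1 ha'])
    simp only [Finset.mem_union, Finset.mem_filter, Finset.mem_insert, Finset.mem_singleton,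
      not_or, not_and, SimpleGraph.compl_adj, not_not, hy, true_implies] at hyE
    have hya := hyE.1 fun h => hyE.2.2.1 h.symm
    have hya' := hyE.2.1 fun h => hyE.2.2.2 h.symm
    exact S.c5Free a y a' b' b hya (G.adj_symm hya') (G.adj_symm h3) (G.adj_symm hbb) h1
      haa (fun h => h4 (G.adj_symm h)) (fun h => by simpa using (adj_iff_of_nbrIn k1 (by simp)).1 h)
      (fun h => by simpa using (adj_iff_of_nbrIn k1 (by simp)).1 h) (fun h => h2 (G.adj_symm h))
  have hno : ¬ HasMatching (relOf 0 G) Y ⌈e₁ / 10 * (Fintype.card V : ℝ)⌉₊ := by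
    intro hm
    obtain ⟨b, b', ⟨k1, -, k2⟩, ⟨k3, -, k4⟩, ⟨-, k6, -⟩, k7, k8⟩ :=
      S.pairs_fine {a, a'} (Finset.card_pair hne)
      (S.predictable_left (by simp [ha, ha']) le_rfl) 0 hm {a} {a'} (by simp) (by simp) (Y ∩ A)
      (by linarith)
    exact hnoB b b' (fun h => k2 (Finset.mem_inter.2 ⟨k1, h⟩))
      (fun h => k4 (Finset.mem_inter.2 ⟨k3, h⟩)) (k6 rfl)
      ((adj_iff_of_nbrIn k7 (by simp)).2 (by simp))
      (fun h => hne.symm (by simpa using (adj_iff_of_nbrIn k7 (by simp)).1 h))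
      ((adj_iff_of_nbrIn k8 (by simp)).2 (by simp))
      (fun h => hne (by simpa using (adj_iff_of_nbrIn k8 (by simp)).1 h))
  obtain ⟨T, hT, hTY⟩ := exists_cover_of_not_hasMatching (relOf_symm 0 G) _ Y hno
  have hTY' : ∀ b ∈ Y, b ∉ T → ∀ b' ∈ Y, b' ∉ T → ¬ G.Adj b b' := by
    intro b hb hbT b' hb' hbT' h
    exact hTY b hb hbT b' hb' hbT' h.ne ⟨h.ne, fun _ => h, fun h => absurd h (by decide)⟩
  have hTc : (T.card : ℝ) ≤ 2 / 10 * (e₁ * Fintype.card V) + 2 := by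
    have h1 : (T.card : ℝ) ≤ 2 * ⌈e₁ / 10 * (Fintype.card V : ℝ)⌉₊ := by exact_mod_cast hT
    have h2 := Nat.ceil_lt_add_one (by linarith : 0 ≤ e₁ / 10 * (Fintype.card V : ℝ))
    linarith
  have hmY : ∀ k : Fin 3, k ≠ 0 → HasMatching (relOf k G) Y ⌈(1 / 1000 : ℝ) * Fintype.card V⌉₊ := by
    intro k hk
    refine hasMatching_of_pairwise (relOf_symm k G) (T := T) ?_ ?_
    · exact fun b hb hbT b' hb' hbT' hne => ⟨hne, fun h => absurd h hk,
        fun _ => hTY' b hb hbT b' hb' hbT'⟩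
    · have : ((2 * ⌈(1 / 1000 : ℝ) * Fintype.card V⌉₊ + T.card + 2 : ℕ) : ℝ) ≤ Y.card := by
        push_cast
        linarith
      exact_mod_cast this
  have hA3 : P3FreeOn Gᶜ (A : Set V) := by
    intro a₁ h₁ a₂ h₂ a₃ h₃ h12 h23 hne
    by_contra h13
    have h₁' : a₁ ∈ A := h₁
    have h₂' : a₂ ∈ A := h₂
    have h₃' : a₃ ∈ A := h₃
    obtain ⟨y, y', ⟨-, m1, -⟩, ⟨-, m2, -⟩, ⟨hyne, -, hyy⟩, k1, k2⟩ :=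
      (S.pairs 3 (by norm_num) le_rfl).1 {a₁, a₂, a₃}
      (Finset.card_eq_three.2 ⟨_, _, _, h12.1, hne, h23.1, rfl⟩)
      (S.predictable_left (by simp [h₁', h₂', h₃']) S.e₂_le) 1 (hmY 1 (by decide)) {a₂, a₃} {a₁, a₂}
      (by simp) (by simp [Finset.insert_subset_iff]) ∅
      (by rw [Finset.card_empty, Nat.cast_zero]; linarith)
    simp only [Finset.mem_insert, Finset.mem_singleton, not_or] at m1 m2
    have n12 := h12.1
    have n23 := h23.1
    have q1 : ∀ w, w ∈ ({a₁, a₂, a₃} : Finset V) → (G.Adj y w ↔ w = a₂ ∨ w = a₃) := fun w hw => by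
      rw [adj_iff_of_nbrIn k1 hw]; simp
    have q2 : ∀ w, w ∈ ({a₁, a₂, a₃} : Finset V) → (G.Adj w y' ↔ w = a₁ ∨ w = a₂) := fun w hw => by
      rw [G.adj_comm, adj_iff_of_nbrIn k2 hw]; simp
    refine S.c5Free.compl y a₁ a₂ a₃ y' ⟨m1.1, ?_⟩ h12 h23 ⟨Ne.symm m2.2.2, ?_⟩
      ⟨hyne.symm, fun h => hyy rfl (G.adj_symm h)⟩ (fun h => h.2 ?_) (fun h => h.2 ?_) h13
      (fun h => h.2 ?_) (fun h => h.2 ?_)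
    · rw [q1 _ (by simp)]; simp [n12, hne]
    · rw [q2 _ (by simp)]; simp [n23.symm, hne.symm]
    · rw [q1 _ (by simp)]; simp
    · rw [q1 _ (by simp)]; simp
    · rw [q2 _ (by simp)]; simp
    · rw [q2 _ (by simp)]; simp
  by_cases hB : ∃ b b', b ∉ A ∧ b' ∉ A ∧ G.Adj b b'
  swap
  · left
    refine ⟨(A : Set V)ᶜ, isUnipolarArrangement_iff.2 ⟨?_, by rwa [compl_compl]⟩⟩
    intro b hb b' hb' hbb
    exact ⟨hbb, fun h => hB ⟨b, b', hb, hb', h⟩⟩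
  obtain ⟨b, b', hb, hb', hbb⟩ := hB
  right
  have hdeg : ∀ b, b ∉ A → ((Y.filter fun y => G.Adj b y).card : ℝ) ≤
      e₂ / 10 * Fintype.card V + (2 / 10 * (e₁ * Fintype.card V) + 2) + 1 := by
    intro b hb
    have h1 : (Y.filter fun y => G.Adj b y) ⊆ ((Y ∩ A) ∪ T) ∪
        (Y.filter fun y => G.Adj b y ∧ y ∉ A ∧ y ∉ T) := by grind
    have h2 : (Y.filter fun y => G.Adj b y ∧ y ∉ A ∧ y ∉ T).card ≤ 1 := by
      refine Finset.card_le_one.2 fun y hy z hz => ?_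
      rw [Finset.mem_filter] at hy hz
      by_contra hyz
      exact hTY' y hy.1 hy.2.2.2 z hz.1 hz.2.2.2 (S.p3FreeOn_compl y hy.2.2.1 b hb z hz.2.2.1
        (G.adj_symm hy.2.1) hz.2.1 hyz)
    have h3 := (Nat.cast_le (α := ℝ)).2 ((Finset.card_le_card h1).trans
      ((Finset.card_union_le _ _).trans (Nat.add_le_add (Finset.card_union_le _ _) h2)))
    push_cast at h3
    linarith
  have hnoA : ∀ x x', x ∈ A → x' ∈ A → x ≠ x' → ¬ G.Adj x x' → G.Adj x b → ¬ G.Adj x b' →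
      G.Adj x' b' → ¬ G.Adj x' b → False := by
    intro x x' hx hx' hxne hxx h1 h2 h3 h4
    obtain ⟨y, -, ⟨hy, -, hyE⟩, -, -, k1, -⟩ := (S.pairs 2 (by norm_num) (by norm_num)).1 {x, x'}
      (Finset.card_pair hxne) (S.predictable_left (by simp [hx, hx']) S.e₂_le) 2
      (hmY 2 (by decide)) {x, x'} {x, x'} subset_rfl subset_rfl
      ((Y.filter fun y => G.Adj b y) ∪ (Y.filter fun y => G.Adj b' y)) (by
        have h5 := (Nat.cast_le (α := ℝ)).2 (Finset.card_union_le (Y.filter fun y => G.Adj b y)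
          (Y.filter fun y => G.Adj b' y))
        push_cast at h5
        linarith [hdeg b hb, hdeg b' hb'])
    simp only [Finset.mem_union, Finset.mem_filter, hy, true_and, not_or] at hyE
    exact S.c5Free y x b b' x' ((adj_iff_of_nbrIn k1 (by simp)).2 (by simp)) h1 hbb
      (G.adj_symm h3) (G.adj_symm ((adj_iff_of_nbrIn k1 (by simp)).2 (by simp)))
      (fun h => hyE.1 (G.adj_symm h)) (fun h => hyE.2 (G.adj_symm h)) h2 hxx
      (fun h => h4 (G.adj_symm h))
  have hnoX : ¬ HasMatching (relOf 1 G) X ⌈(1 / 1000 : ℝ) * Fintype.card V⌉₊ := by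
    intro hm
    obtain ⟨x, x', ⟨k1, -, k2⟩, ⟨k3, -, k4⟩, ⟨k5, -, k6⟩, k7, k8⟩ :=
      (S.pairs 2 (by norm_num) (by norm_num)).2 {b, b'} (Finset.card_pair hbb.ne)
      (fun u hu => S.predictable u (by
        simp only [Finset.mem_insert, Finset.mem_singleton] at hu
        rcases hu with rfl | rfl <;> assumption) _ hu (by rw [Finset.card_pair hbb.ne]; norm_num))
      1 hm {b} {b'} (by simp) (by simp) (X \ A) (by linarith)
    have hx : x ∈ A := by
      by_contra h
      exact k2 (Finset.mem_sdiff.2 ⟨k1, h⟩)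
    have hx' : x' ∈ A := by
      by_contra h
      exact k4 (Finset.mem_sdiff.2 ⟨k3, h⟩)
    exact hnoA x x' hx hx' k5 (k6 rfl) ((adj_iff_of_nbrIn k7 (by simp)).2 (by simp))
      (fun h => hbb.ne' (by simpa using (adj_iff_of_nbrIn k7 (by simp)).1 h))
      ((adj_iff_of_nbrIn k8 (by simp)).2 (by simp))
      (fun h => hbb.ne (by simpa using (adj_iff_of_nbrIn k8 (by simp)).1 h))
  obtain ⟨T', hT', hTX⟩ := exists_cover_of_not_hasMatching (relOf_symm 1 G) _ X hnoX
  have hTc' : (T'.card : ℝ) ≤ 4 / 1000 * Fintype.card V := by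
    have : (T'.card : ℝ) ≤ 2 * ⌈(1 / 1000 : ℝ) * Fintype.card V⌉₊ := by exact_mod_cast hT'
    linarith
  constructor
  · refine kind0_of_cover hA3 (T' ∪ (Y ∩ A)) ?_ ?_
    · intro v hv hvT w hw hwT hvw
      rw [Finset.mem_union, Finset.mem_inter, not_or] at hvT hwT
      have hvX : v ∈ X := by
        by_contra h
        exact hvT.2 ⟨(S.mem_iff v).2 h, hv⟩
      have hwX : w ∈ X := by
        by_contra h
        exact hwT.2 ⟨(S.mem_iff w).2 h, hw⟩
      exact hTX v hvX hvT.1 w hwX hwT.1 hvw.1 ⟨hvw.1, fun h => absurd h (by decide),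
        fun _ => hvw.2⟩
    · have := (Nat.cast_le (α := ℝ)).2 (Finset.card_union_le T' (Y ∩ A))
      push_cast at this
      linarith
  · refine kind0_of_cover S.p3FreeOn_compl (T ∪ (X \ A)) ?_ ?_
    · intro v hv hvT w hw hwT hvw
      rw [Finset.mem_union, Finset.mem_sdiff, not_or] at hvT hwT
      have hvY : v ∈ Y := (S.mem_iff v).2 fun h => hvT.2 ⟨h, hv⟩
      have hwY : w ∈ Y := (S.mem_iff w).2 fun h => hwT.2 ⟨h, hw⟩
      exact hTY' v hvY hvT.1 w hwY hwT.1 hvw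
    · have := (Nat.cast_le (α := ℝ)).2 (Finset.card_union_le T (X \ A))
      push_cast at this
      linarith

lemma structure_cases (S : Setup G X Y A e₁ e₂ δ) :
    IsUnipolar G ∨ IsCoUnipolar G ∨ Exceptional G (1 / 20) := by
  by_cases h1 : ∃ a ∈ A, Low G X δ a
  · obtain ⟨a, -, ha⟩ := h1
    exact Or.inr (Or.inr ⟨A, Or.inl (S.kind2_of_low ha)⟩)
  have hlow : ∀ a ∈ A, Low Gᶜ X δ a := fun a ha =>
    ((S.mem_A a).1 ha).resolve_left fun h => h1 ⟨a, ha, h⟩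
  by_cases h2 : G.IsClique (A : Set V)
  · exact Or.inl ⟨A, isUnipolarArrangement_iff.2 ⟨h2, S.p3FreeOn_compl⟩⟩
  · simp only [SimpleGraph.IsClique, Set.Pairwise] at h2
    push Not at h2
    obtain ⟨a, ha, a', ha', hne, haa⟩ := h2
    rcases S.coUnipolar_or_kind0 hlow ha ha' hne haa with h | h
    exacts [Or.inr (Or.inl h), Or.inr (Or.inr ⟨A, Or.inr h⟩)]

end Setup

end Structure

/-! ### The structure of typical perfect graphs -/

/-- A base partition with all the genericity properties used to determine the structure. -/
structure Ready {V : Type*} [Fintype V] (G : SimpleGraph V) (X Y : Finset V) (e₁ e₂ ξc s : ℝ)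
    (qc q : ℕ) : Prop where
  c5Free : C5Free G
  mem_iff : ∀ v, v ∈ Y ↔ v ∉ X
  card_left : (Fintype.card V : ℝ) / 4 + 1 ≤ X.card
  card_right : (Fintype.card V : ℝ) / 4 + 1 ≤ Y.card
  pairs : ∀ q, 1 ≤ q → q ≤ 3 → PairsProp G X Y e₁ (1 / 1000) q ∧ PairsProp G Y X e₁ (1 / 1000) q
  pairs_fine : PairsProp G X Y e₂ (e₁ / 10) 2 ∧ PairsProp G Y X e₂ (e₁ / 10) 2
  coarse : Uni G X Y ξc qc ∧ Uni G Y X ξc qc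
  fine : Uni G X Y (s ^ 2) q ∧ Uni G Y X (s ^ 2) q

lemma Ready.symm {V : Type*} [Fintype V] {G : SimpleGraph V} {X Y : Finset V} {e₁ e₂ ξc s : ℝ}
    {qc q : ℕ} (h : Ready G X Y e₁ e₂ ξc s qc q) : Ready G Y X e₁ e₂ ξc s qc q :=
  ⟨h.c5Free, fun v => by rw [h.mem_iff v, not_not], h.card_right, h.card_left,
    fun q h1 h2 => (h.pairs q h1 h2).symm, h.pairs_fine.symm, h.coarse.symm, h.fine.symm⟩

lemma Ready.structure_cases {V : Type*} [Fintype V] {G : SimpleGraph V} {X Y : Finset V}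
    {e₁ e₂ s : ℝ} {qc q : ℕ}
    (h : Ready G X Y e₁ e₂ ((e₂ / 20) ^ 3 / 8) ((s ^ 2) ^ 2 * e₂ / 1000) qc q)
    (he₂ : 0 < e₂) (he : e₂ ≤ e₁) (he₁ : e₁ ≤ 1 / 1000) (hs : 0 < s) (hs8 : s ≤ 1 / 8)
    (hqs : 4 * qc * s ≤ 1) (hse : 3 * s ≤ e₂) (hn : 1000 ≤ e₂ * Fintype.card V)
    (hns : 4 ≤ (s ^ 2) ^ 2 * Fintype.card V)
    (hd : (eCount Gᶜ X : ℝ) ≤ 22 * ((s ^ 2) ^ 2 * e₂ / 1000) * (Fintype.card V : ℝ) ^ 2) :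
    IsUnipolar G ∨ IsCoUnipolar G ∨ Exceptional G (1 / 20) := by
  set δ : ℝ := s ^ 2 with hδ
  have hδ0 : 0 < δ := by positivity
  have hδ1 : δ ≤ 1 / 64 := by rw [hδ]; nlinarith
  have hδs : δ ≤ s := by rw [hδ]; nlinarith
  have he1' : 0 < e₁ := he₂.trans_le he
  have hnpos : 0 < Fintype.card V := by
    rcases Nat.eq_zero_or_pos (Fintype.card V) with h0 | h0
    · rw [h0] at hn; norm_num at hn
    · exact h0
  have hX := h.card_left
  have hY := h.card_right
  have hδδ : δ ^ 2 ≤ 1 / 4096 := by nlinarith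
  have hξ : δ ^ 2 * e₂ / 1000 ≤ e₂ / 1000 := by nlinarith
  have hξ' : δ ^ 2 * e₂ / 1000 ≤ δ / 1000 := by
    have : δ ^ 2 * e₂ ≤ δ * 1 := by rw [pow_two, mul_assoc]; gcongr; nlinarith
    linarith
  have hξ0 : 0 < δ ^ 2 * e₂ / 1000 := by positivity
  have hc1 : (e₂ / 20) ^ 3 ≤ (1 / 4) ^ 3 :=
    pow_le_pow_left₀ (by positivity) (by linarith) 3
  have hc0 : 0 < (e₂ / 20) ^ 3 := by positivity
  have low : ∀ (H : SimpleGraph V) (W : Finset V), Uni H X Y ((e₂ / 20) ^ 3 / 8) qc →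
      (∀ y ∈ W, y ∈ Y) → (∀ y ∈ W, Low H X δ y) → (W.card : ℝ) ≤ e₂ / 20 * Fintype.card V :=
    fun H W hU hW hlow => hU.card_low_le hW hlow hs hs8 hqs (by positivity) (by linarith)
      (by linarith) (by linarith) hnpos
  obtain ⟨A, hA⟩ : ∃ A : Finset V, ∀ v, v ∈ A ↔ Low G X δ v ∨ Low Gᶜ X δ v :=
    ⟨Finset.univ.filter fun v => Low G X δ v ∨ Low Gᶜ X δ v, fun v => by simp⟩
  refine Setup.structure_cases (X := X) (Y := Y) (A := A) (e₁ := e₁) (e₂ := e₂) (δ := δ)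
    ⟨h.c5Free, h.mem_iff, by linarith, by linarith, h.pairs, h.pairs_fine.1, hd.trans ?_, hA, ?_,
      ?_, ?_, he₁, he, by linarith, hδ0.le, hn⟩
  · gcongr
    nlinarith
  · intro u hu Q huQ hQ
    rw [hA, not_or] at hu
    refine h.fine.2.predictable h.c5Free hu.1 hu.2 hδ0 (by positivity) hd ?_ hns (by linarith) ?_
      he1' ?_ ?_ hQ huQ
    · nlinarith
    · nlinarith
    · nlinarith
    · nlinarith [(Nat.cast_nonneg _ : (0 : ℝ) ≤ Fintype.card V)]
  · have := card_not_low_le (G := G) (X := X) (δ := δ) (S := ((X \ A : Finset V) : Set V))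
      (fun x hx => by
        have := Finset.mem_sdiff.1 (Finset.mem_coe.1 hx)
        rw [hA, not_or] at this
        exact ⟨this.1, this.2.2⟩) hd hδ0 hnpos
    rw [Set.ncard_coe_finset] at this
    refine this.trans ?_
    refine mul_le_mul_of_nonneg_right ?_ (Nat.cast_nonneg _)
    rw [div_le_iff₀ hδ0]
    nlinarith [mul_pos hδ0 he₂]
  · have h1 := low G (Y.filter fun y => Low G X δ y) h.coarse.1
      (fun y hy => (Finset.mem_filter.1 hy).1) (fun y hy => (Finset.mem_filter.1 hy).2)
    have h2 := low Gᶜ (Y.filter fun y => Low Gᶜ X δ y)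
      (h.coarse.1.compl fun v hv hv' => (h.mem_iff v).1 hv' hv)
      (fun y hy => (Finset.mem_filter.1 hy).1) (fun y hy => (Finset.mem_filter.1 hy).2)
    have h3 : (Y ∩ A).card ≤ (Y.filter fun y => Low G X δ y).card +
        (Y.filter fun y => Low Gᶜ X δ y).card := by
      refine le_trans (Finset.card_le_card fun y hy => ?_) (Finset.card_union_le _ _)
      rw [Finset.mem_inter, hA] at hy
      simpa [hy.1] using hy.2
    have h4 : ((Y ∩ A).card : ℝ) ≤ ((Y.filter fun y => Low G X δ y).card : ℝ) +
        (Y.filter fun y => Low Gᶜ X δ y).card := by exact_mod_cast h3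
    linarith

lemma typical_comp_compl {P : (Σ n, SimpleGraph (Fin n)) → Prop} (h : ∀ᶠ x in typicalGraphs, P x) :
    ∀ᶠ x in typicalGraphs, P ⟨x.1, x.2ᶜ⟩ :=
  typical_compl (P := fun n G => P ⟨n, G⟩) h

/-- Almost all perfect graphs are unipolar, co-unipolar or of an exceptional (rare) shape. -/
theorem typical_structure : ∀ᶠ x in typicalGraphs,
    IsUnipolar x.2 ∨ IsCoUnipolar x.2 ∨ Exceptional x.2 (1 / 20) ∨ Exceptional x.2ᶜ (1 / 20) := by
  obtain ⟨f₁, hf₁, hp₁⟩ := exists_pairsProp (μ := 1 / 1000) (by norm_num)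
  obtain ⟨e₁, he₁0, he₁f, he₁⟩ : ∃ e : ℝ, 0 < e ∧ e ≤ f₁ ∧ e ≤ 1 / 1000 :=
    ⟨min f₁ (1 / 1000), by positivity, min_le_left _ _, min_le_right _ _⟩
  obtain ⟨f₂, hf₂, hp₂⟩ := exists_pairsProp (μ := e₁ / 10) (by positivity)
  obtain ⟨e₂, he₂0, he₂f, he₂⟩ : ∃ e : ℝ, 0 < e ∧ e ≤ f₂ ∧ e ≤ e₁ :=
    ⟨min f₂ e₁, by positivity, min_le_left _ _, min_le_right _ _⟩
  obtain ⟨qc, nc, εc, hεc, hqc, hUc⟩ := exists_uni (ξ := (e₂ / 20) ^ 3 / 8) (by positivity)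
  have hqc0 : (0 : ℝ) < qc := by exact_mod_cast hqc
  obtain ⟨s, hs0, hs⟩ : ∃ s : ℝ, 0 < s ∧ s ≤ 1 / 8 ∧ 4 * qc * s ≤ 1 ∧ 3 * s ≤ e₂ := by
    refine ⟨min (1 / 8) (min (1 / (4 * qc)) (e₂ / 3)), by positivity, min_le_left _ _, ?_, ?_⟩
    · have := (min_le_right (1 / 8 : ℝ) (min (1 / (4 * qc)) (e₂ / 3))).trans (min_le_left _ _)
      rw [le_div_iff₀ (by positivity)] at this
      linarith
    · have := (min_le_right (1 / 8 : ℝ) (min (1 / (4 * qc)) (e₂ / 3))).trans (min_le_right _ _)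
      linarith
  obtain ⟨σ, hσ⟩ : ∃ σ, σ = (s ^ 2) ^ 2 * e₂ / 1000 := ⟨_, rfl⟩
  have hσ0 : 0 < σ := by rw [hσ]; positivity
  have hσ1 : σ ≤ 1 := by
    have h1 : (s ^ 2) ^ 2 ≤ 1 := pow_le_one₀ (by positivity) (pow_le_one₀ hs0.le (by linarith))
    have h2 : e₂ ≤ 1 / 1000 := he₂.trans he₁
    rw [hσ]
    nlinarith
  obtain ⟨q, n₀, εf, hεf, hq, hUf⟩ := exists_uni (ξ := σ ^ 2) (by positivity)
  obtain ⟨ε, hε0, lε1, lε2, lε3, lε4, lε5⟩ :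
      ∃ ε : ℝ, 0 < ε ∧ ε ≤ εc ∧ ε ≤ εf ∧ ε ≤ 1 / 8 ∧ ε ≤ f₁ ∧ ε ≤ f₂ :=
    ⟨min εc (min εf (min (1 / 8) (min f₁ f₂))), by positivity, by simp, by simp, by simp, by simp,
      by simp⟩
  obtain ⟨r, m, hbase⟩ := exists_base hε0
  have large : ∀ᶠ n : ℕ in atTop, nc ≤ n ∧ n₀ ≤ n ∧ 20 ≤ n ∧ 1000 / e₂ ≤ (n : ℝ) ∧
      4 / (s ^ 2) ^ 2 ≤ (n : ℝ) :=
    (eventually_ge_atTop _).and ((eventually_ge_atTop _).and ((eventually_ge_atTop _).and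
      ((tendsto_natCast_atTop_atTop.eventually_ge_atTop _).and
        (tendsto_natCast_atTop_atTop.eventually_ge_atTop _))))
  filter_upwards [hbase, hp₁ r m, typical_comp_compl (hp₁ r m), hp₂ r m, typical_comp_compl (hp₂ r m),
    typical_manyTypes (2 * qc), typical_comp_compl (typical_manyTypes (2 * qc)),
    typical_manyTypes (2 * q), typical_comp_compl (typical_manyTypes (2 * q)), typical_c5Free,
    typical_of_eventually large] with ⟨n, G⟩ hb p1 p1c p2 p2c mc mcc mf mfc hC5 hn
  obtain ⟨t, ht, hB, hin⟩ := hb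
  simp only at p1 p1c p2 p2c mc mcc mf mfc hC5 hn ht hB hin ⊢
  obtain ⟨hn1, hn2, hn3, hn4, hn5⟩ := hn
  rw [div_le_iff₀' he₂0] at hn4
  rw [div_le_iff₀' (by positivity)] at hn5
  have hmid : midVerts Gᶜ t (4 * r) (4 * r) = midVerts G t (4 * r) (4 * r) := midVerts_compl ..
  have hmid' : midVerts Gᶜ t (4 * r + 3) (4 * r + 3) = midVerts G t (4 * r + 3) (4 * r + 3) :=
    midVerts_compl ..
  have p1' := p1 t ht (midVerts G t (4 * r) (4 * r))
  have p2' := p2 t ht (midVerts G t (4 * r) (4 * r))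
  have p1c' := p1c t ht (midVerts G t (4 * r) (4 * r))
  have p2c' := p2c t ht (midVerts G t (4 * r) (4 * r))
  rw [hmid, hmid'] at p1c' p2c'
  clear p1 p2 p1c p2c hmid hmid'
  generalize midVerts G t (4 * r) (4 * r) = X at *
  generalize otherVerts X = Y at *
  have hn0 : (0 : ℝ) ≤ n := Nat.cast_nonneg n
  have hn20 : (20 : ℝ) ≤ n := by exact_mod_cast hn3
  have hcard : Fintype.card (Fin n) = n := Fintype.card_fin n
  have hXl := hB.card_left
  have hYl := hB.card_right
  rw [hcard] at hXl hYl
  have hle : ∀ f, ε ≤ f → (1 / 2 + ε) * (n : ℝ) ≤ (1 / 2 + f) * n ∧ ε * (n : ℝ) ≤ f * n :=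
    fun f hf => ⟨by gcongr, by gcongr⟩
  have hsum : (X.card : ℝ) + Y.card = n := by
    have hYc : Y = Finset.univ \ X := by
      ext v; simp [hB.mem_iff v]
    have h2 := Finset.card_sdiff_add_card_eq_card (Finset.subset_univ X)
    rw [← hYc, Finset.card_univ, hcard] at h2
    have : ((Y.card + X.card : ℕ) : ℝ) = n := by rw [h2]
    push_cast at this
    linarith
  have h8 : (1 / 2 + ε) * (n : ℝ) ≤ 5 / 8 * n := by nlinarith
  have ready : ∀ H : SimpleGraph (Fin n), C5Free H → BasePartition H X Y ε →
      (∀ S : Finset (Fin n), S.card = 2 * qc → ManyTypes H S ∧ ManyTypes Hᶜ S) →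
      (∀ S : Finset (Fin n), S.card = 2 * q → ManyTypes H S ∧ ManyTypes Hᶜ S) →
      (∀ q, 1 ≤ q → q ≤ 3 → PairsProp H X Y f₁ (1 / 1000) q ∧ PairsProp H Y X f₁ (1 / 1000) q) →
      (∀ q, 1 ≤ q → q ≤ 3 → PairsProp H X Y f₂ (e₁ / 10) q ∧ PairsProp H Y X f₂ (e₁ / 10) q) →
      Ready H X Y e₁ e₂ ((e₂ / 20) ^ 3 / 8) σ qc q := by
    intro H hH hHB hMc hMf hp hp'
    refine ⟨hH, hB.mem_iff, by rw [hcard]; linarith, by rw [hcard]; linarith, fun q h1 h2 =>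
      ⟨(hp q h1 h2).1.mono he₁f, (hp q h1 h2).2.mono he₁f⟩,
      ⟨(hp' 2 (by norm_num) (by norm_num)).1.mono he₂f,
        (hp' 2 (by norm_num) (by norm_num)).2.mono he₂f⟩,
      ⟨hUc H X Y (by rwa [hcard]) hMc (hHB.mono lε1),
        hUc H Y X (by rwa [hcard]) hMc (hHB.symm.mono lε1)⟩,
      ⟨hUf H X Y (by rwa [hcard]) hMf (hHB.mono lε2),
        hUf H Y X (by rwa [hcard]) hMf (hHB.symm.mono lε2)⟩⟩
  have r1 := ready G hC5 hB (fun S hS => ⟨mc S hS, mcc S hS⟩) (fun S hS => ⟨mf S hS, mfc S hS⟩)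
    (p1' Y (fun v => Iff.rfl) hB.mem_iff (hXl.trans (hle _ lε4).1)
      (hYl.trans (hle _ lε4).1) (hin.trans (hle _ lε4).2))
    (p2' Y (fun v => Iff.rfl) hB.mem_iff (hXl.trans (hle _ lε5).1)
      (hYl.trans (hle _ lε5).1) (hin.trans (hle _ lε5).2))
  have r2 := ready Gᶜ hC5.compl hB.compl (fun S hS => ⟨mcc S hS, by rw [compl_compl]; exact mc S hS⟩)
    (fun S hS => ⟨mfc S hS, by rw [compl_compl]; exact mf S hS⟩)
    (p1c' Y (fun v => Iff.rfl) hB.mem_iff (hXl.trans (hle _ lε4).1)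
      (hYl.trans (hle _ lε4).1) (hin.trans (hle _ lε4).2))
    (p2c' Y (fun v => Iff.rfl) hB.mem_iff (hXl.trans (hle _ lε5).1)
      (hYl.trans (hle _ lε5).1) (hin.trans (hle _ lε5).2))
  have fin : ∀ (H : SimpleGraph (Fin n)) (Z W : Finset (Fin n)),
      Ready H Z W e₁ e₂ ((e₂ / 20) ^ 3 / 8) σ qc q →
      (eCount Hᶜ Z : ℝ) ≤ 22 * σ * (Fintype.card (Fin n) : ℝ) ^ 2 →
      IsUnipolar H ∨ IsCoUnipolar H ∨ Exceptional H (1 / 20) := fun H Z W hr hd =>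
    (hσ ▸ hr).structure_cases he₂0 he₂ he₁ hs0 hs.1 hs.2.1 hs.2.2
      (by rw [hcard]; exact hn4) (by rw [hcard]; exact hn5) (hσ ▸ hd)
  have two : ∀ Z W, Ready G Z W e₁ e₂ ((e₂ / 20) ^ 3 / 8) σ qc q →
      Ready Gᶜ Z W e₁ e₂ ((e₂ / 20) ^ 3 / 8) σ qc q →
      ((eCount G Z : ℝ) ≤ 22 * σ * (Fintype.card (Fin n) : ℝ) ^ 2 ∨
        (eCount Gᶜ Z : ℝ) ≤ 22 * σ * (Fintype.card (Fin n) : ℝ) ^ 2) →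
      IsUnipolar G ∨ IsCoUnipolar G ∨ Exceptional G (1 / 20) ∨ Exceptional Gᶜ (1 / 20) := by
    intro Z W h1 h2 h
    rcases h with h | h
    · have := fin Gᶜ Z W h2 (by rwa [compl_compl])
      unfold IsCoUnipolar at *
      rw [compl_compl] at this
      tauto
    · have := fin G Z W h1 h
      tauto
  obtain ⟨Z, hZ, hZe⟩ := exists_homogeneous_side hσ0 hσ1 hC5 r1.card_right
    (fun v hv hv' => (hB.mem_iff v).1 hv' hv) (by rw [hcard]; omega) r1.fine.1
  rcases hZ with rfl | rfl
  · exact two _ _ r1 r2 hZe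
  · exact two _ _ r1.symm r2.symm hZe

/-! ### Exceptional graphs are rare -/

section ExceptionalCount

lemma ncard_le_of_fibres {α β : Type*} [Finite α] [Finite β] {S : Set α} {D : Set β}
    {φ : α → β → Prop} {M : ℝ} (h : ∀ a ∈ S, ∃ d ∈ D, φ a d)
    (hf : ∀ d ∈ D, (Set.ncard {a | a ∈ S ∧ φ a d} : ℝ) ≤ M) :
    (S.ncard : ℝ) ≤ D.ncard * M := by
  have := Fintype.ofFinite α
  have := Fintype.ofFinite β
  have h1 : S.ncard ≤ ∑ d ∈ D.toFinset, Set.ncard {a | a ∈ S ∧ φ a d} := by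
    have h2 : S.toFinset ⊆ D.toFinset.biUnion fun d => {a | a ∈ S ∧ φ a d}.toFinset := by
      intro a ha
      rw [Set.mem_toFinset] at ha
      obtain ⟨d, hd, had⟩ := h a ha
      exact Finset.mem_biUnion.2 ⟨d, Set.mem_toFinset.2 hd, Set.mem_toFinset.2 ⟨ha, had⟩⟩
    have h3 := (Finset.card_le_card h2).trans Finset.card_biUnion_le
    simpa only [← Set.ncard_eq_toFinset_card'] using h3
  calc (S.ncard : ℝ) ≤ ∑ d ∈ D.toFinset, (Set.ncard {a | a ∈ S ∧ φ a d} : ℝ) := by exact_mod_cast h1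
    _ ≤ ∑ d ∈ D.toFinset, M := Finset.sum_le_sum fun d hd => hf d (Set.mem_toFinset.1 hd)
    _ = _ := by rw [Finset.sum_const, nsmul_eq_mul, Set.ncard_eq_toFinset_card' D]

variable {V : Type*}

/-- The leader of the class of `v` in a disjoint union of cliques. -/
lemma exists_leader {G : SimpleGraph V} {J : Finset V} (h : P3FreeOn G (J : Set V)) :
    ∃ g : V → V, (∀ v, v ∉ J → g v = v) ∧ ∀ u ∈ J, ∀ v ∈ J, G.Adj u v ↔ u ≠ v ∧ g u = g v := by
  let r : Setoid V := ⟨fun u v => u = v ∨ (u ∈ J ∧ v ∈ J ∧ G.Adj u v), fun u => Or.inl rfl, by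
    rintro u v (h | h)
    exacts [Or.inl h.symm, Or.inr ⟨h.2.1, h.1, h.2.2.symm⟩], by
    rintro u v w (rfl | h1) (rfl | h2)
    · exact Or.inl rfl
    · exact Or.inr h2
    · exact Or.inr h1
    · by_cases huw : u = w
      · exact Or.inl huw
      · exact Or.inr ⟨h1.1, h2.2.1, h u h1.1 v h1.2.1 w h2.2.1 h1.2.2 h2.2.2 huw⟩⟩
  refine ⟨fun v => (Quotient.mk r v).out, fun v hv => ?_, fun u hu v hv => ?_⟩
  · rcases Quotient.exact (Quotient.out_eq (Quotient.mk r v)) with h | h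
    exacts [h, absurd h.2.1 hv]
  · have h1 : (Quotient.mk r u).out = (Quotient.mk r v).out ↔ r u v :=
      Quotient.out_inj.trans Quotient.eq
    rw [h1]
    show _ ↔ u ≠ v ∧ (u = v ∨ (u ∈ J ∧ v ∈ J ∧ G.Adj u v))
    have := fun h : G.Adj u v => h.ne
    tauto

/-- The data `(J, g)` describes the graph induced on `S`; `c` tells whether the vertices of
`S \ J` form a clique or an independent set. -/
def KindData (c : Prop) (G : SimpleGraph V) (S : Set V) (p : Finset V × (V → V)) : Prop :=
  (∀ u ∈ p.1, ∀ v ∈ p.1, G.Adj u v ↔ u ≠ v ∧ p.2 u = p.2 v) ∧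
    ∀ v ∈ S, v ∉ p.1 → ∀ w ∈ S, G.Adj v w ↔ c ∧ w ∉ p.1 ∧ v ≠ w

lemma KindData.adj_iff {c : Prop} {G G' : SimpleGraph V} {S : Set V} {p : Finset V × (V → V)}
    (h : KindData c G S p) (h' : KindData c G' S p) {u v : V} (hu : u ∈ S) (hv : v ∈ S) :
    G.Adj u v ↔ G'.Adj u v := by
  by_cases h1 : u ∈ p.1
  · by_cases h2 : v ∈ p.1
    · rw [h.1 u h1 v h2, h'.1 u h1 v h2]
    · rw [G.adj_comm, G'.adj_comm, h.2 v hv h2 u hu, h'.2 v hv h2 u hu]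
  · rw [h.2 u hu h1 v hv, h'.2 u hu h1 v hv]

/-- Descriptions of disjoint unions of cliques on few vertices. -/
def smallData (V : Type*) [Fintype V] (ν : ℝ) : Set (Finset V × (V → V)) :=
  {p | (p.1.card : ℝ) ≤ ν * Fintype.card V ∧ ∀ v, v ∉ p.1 → p.2 v = v}

lemma ncard_eq_off_le [Fintype V] (J : Finset V) :
    Set.ncard {g : V → V | ∀ v, v ∉ J → g v = v} ≤ Fintype.card V ^ J.card := by
  have h : (Finset.univ : Finset (J → V)).card = Fintype.card V ^ J.card := by
    rw [Finset.card_univ, Fintype.card_fun, Fintype.card_coe]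
  rw [← h, ← Set.ncard_coe_finset]
  refine Set.ncard_le_ncard_of_injOn (fun g v => g v)
    (fun g _ => Finset.mem_coe.2 (Finset.mem_univ _)) ?_
    (Set.toFinite _)
  intro g hg g' hg' h
  funext v
  by_cases hv : v ∈ J
  · exact congrFun h ⟨v, hv⟩
  · rw [hg v hv, hg' v hv]

lemma ncard_smallData_le [Fintype V] {ν : ℝ} (hV : 1 ≤ Fintype.card V) :
    ((smallData V ν).ncard : ℝ) ≤
      2 ^ Fintype.card V * (Fintype.card V : ℝ) ^ (ν * Fintype.card V) := by
  have hV' : (1 : ℝ) ≤ Fintype.card V := by exact_mod_cast hV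
  refine (ncard_le_of_fibres (D := {J : Finset V | (J.card : ℝ) ≤ ν * Fintype.card V})
    (φ := fun p J => p.1 = J) (fun p hp => ⟨p.1, hp.1, rfl⟩)
    (M := (Fintype.card V : ℝ) ^ (ν * Fintype.card V)) fun J hJ => ?_).trans ?_
  · have h1 : Set.ncard {a : Finset V × (V → V) | a ∈ smallData V ν ∧ a.1 = J} ≤
        Set.ncard {g : V → V | ∀ v, v ∉ J → g v = v} := by
      refine Set.ncard_le_ncard_of_injOn Prod.snd ?_ ?_ (Set.toFinite _)
      · rintro p ⟨hp, h⟩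
        exact h ▸ hp.2
      · rintro p ⟨-, h⟩ p' ⟨-, h'⟩ h2
        exact Prod.ext (h.trans h'.symm) h2
    refine (Nat.cast_le.2 (h1.trans (ncard_eq_off_le J))).trans ?_
    push_cast
    rw [← Real.rpow_natCast]
    exact Real.rpow_le_rpow_of_exponent_le hV' hJ
  · gcongr
    have := Set.ncard_le_ncard (Set.subset_univ {J : Finset V | (J.card : ℝ) ≤ ν * Fintype.card V})
    rw [Set.ncard_univ, Nat.card_eq_fintype_card, Fintype.card_finset] at this
    exact_mod_cast this

/-- Graphs which agree inside `A` and inside `Aᶜ` differ only in the edges between them. -/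
lemma ncard_cross_le [Fintype V] {S : Set (SimpleGraph V)} (A : Set V)
    (h : ∀ G ∈ S, ∀ G' ∈ S, ∀ u v, (u ∈ A ↔ v ∈ A) → (G.Adj u v ↔ G'.Adj u v)) :
    (S.ncard : ℝ) ≤ 2 ^ ((Fintype.card V : ℝ) ^ 2 / 4) := by
  have h1 : S.ncard ≤ (A.toFinset ×ˢ Aᶜ.toFinset).powerset.card := by
    rw [← Set.ncard_coe_finset]
    refine Set.ncard_le_ncard_of_injOn
      (fun G => (A.toFinset ×ˢ Aᶜ.toFinset).filter fun p => G.Adj p.1 p.2) ?_ ?_ (Set.toFinite _)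
    · intro G _
      exact Finset.mem_coe.2 (Finset.mem_powerset.2 (Finset.filter_subset _ _))
    · intro G hG G' hG' he
      have hx : ∀ u v, u ∈ A → v ∉ A → (G.Adj u v ↔ G'.Adj u v) := by
        intro u v hu hv
        have := Finset.ext_iff.1 he (u, v)
        simpa [hu, hv] using this
      ext u v
      by_cases hu : u ∈ A <;> by_cases hv : v ∈ A
      · exact h G hG G' hG' u v (by simp [hu, hv])
      · exact hx u v hu hv
      · rw [G.adj_comm, G'.adj_comm]
        exact hx v u hv hu
      · exact h G hG G' hG' u v (by simp [hu, hv])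
  rw [Finset.card_powerset, Finset.card_product] at h1
  have h2 : A.toFinset.card + Aᶜ.toFinset.card = Fintype.card V := by
    rw [Set.toFinset_compl, Finset.card_add_card_compl]
  have h3 : (A.toFinset.card : ℝ) + Aᶜ.toFinset.card = Fintype.card V := by exact_mod_cast h2
  refine (Nat.cast_le.2 h1).trans ?_
  push_cast
  rw [← Real.rpow_natCast]
  refine Real.rpow_le_rpow_of_exponent_le (by norm_num) ?_
  push_cast
  rw [← h3]
  nlinarith [sq_nonneg ((A.toFinset.card : ℝ) - Aᶜ.toFinset.card)]

lemma Kind2.exists_data [Fintype V] {G : SimpleGraph V} {S : Set V} {ν : ℝ} (h : Kind2 G S ν) :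
    ∃ p ∈ smallData V ν, KindData True G S p := by
  obtain ⟨h1, J, h2, h3, h4⟩ := h
  obtain ⟨g, h5, h6⟩ := exists_leader (G := G) (J := J)
    fun u hu v hv w hw => h1 u (h3 u hu) v (h3 v hv) w (h3 w hw)
  exact ⟨(J, g), ⟨h2, h5⟩, h6, fun v hv hvJ w hw => by rw [h4 v hv hvJ w hw]; simp⟩

lemma Kind0.exists_data [Fintype V] {G : SimpleGraph V} {S : Set V} {ν : ℝ} (h : Kind0 G S ν) :
    ∃ p ∈ smallData V ν, KindData False G S p := by
  obtain ⟨h1, J, h2, h3, h4⟩ := h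
  obtain ⟨g, h5, h6⟩ := exists_leader (G := G) (J := J)
    fun u hu v hv w hw => h1 u (h3 u hu) v (h3 v hv) w (h3 w hw)
  exact ⟨(J, g), ⟨h2, h5⟩, h6, fun v hv hvJ w hw => by simpa using h4 v hv hvJ w hw⟩

lemma ncard_exceptional_le [Fintype V] {ν : ℝ} (hV : 1 ≤ Fintype.card V) :
    (Set.ncard {G : SimpleGraph V | Exceptional G ν} : ℝ) ≤
      2 * 2 ^ Fintype.card V * (2 ^ Fintype.card V *
        (Fintype.card V : ℝ) ^ (ν * Fintype.card V)) ^ 2 *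
          2 ^ ((Fintype.card V : ℝ) ^ 2 / 4) := by
  have key := ncard_le_of_fibres (S := {G : SimpleGraph V | Exceptional G ν})
    (D := ((Set.univ : Set (Bool × Set V)) ×ˢ (smallData V ν ×ˢ smallData V ν)))
    (φ := fun G d => (d.1.1 = true → KindData True G d.1.2 d.2.1 ∧ KindData True G d.1.2ᶜ d.2.2) ∧
      (d.1.1 = false → KindData False Gᶜ d.1.2 d.2.1 ∧ KindData False G d.1.2ᶜ d.2.2))
    (M := 2 ^ ((Fintype.card V : ℝ) ^ 2 / 4)) ?_ ?_
  · refine key.trans ?_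
    rw [Set.ncard_prod, Set.ncard_prod, Set.ncard_univ, Nat.card_eq_fintype_card,
      Fintype.card_prod, Fintype.card_bool, Fintype.card_set]
    push_cast
    rw [← pow_two]
    gcongr
    exact ncard_smallData_le hV
  · rintro G ⟨A, ⟨h1, h2⟩ | ⟨h1, h2⟩⟩
    all_goals
      obtain ⟨p, hp, hp'⟩ := h1.exists_data
      obtain ⟨q, hq, hq'⟩ := h2.exists_data
    · exact ⟨((true, A), (p, q)), ⟨Set.mem_univ _, hp, hq⟩, by simp [hp', hq']⟩
    · exact ⟨((false, A), (p, q)), ⟨Set.mem_univ _, hp, hq⟩, by simp [hp', hq']⟩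
  · rintro ⟨⟨b, A⟩, p, q⟩ -
    refine ncard_cross_le A ?_
    rintro G ⟨-, h1, h2⟩ G' ⟨-, h1', h2'⟩ u v huv
    by_cases hu : u ∈ A
    · have hv := huv.1 hu
      cases b
      · have := (h2 rfl).1.adj_iff (h2' rfl).1 hu hv
        rw [SimpleGraph.compl_adj, SimpleGraph.compl_adj] at this
        by_cases hne : u = v
        · subst hne; simp
        · simpa [hne, not_iff_not] using this
      · exact (h1 rfl).1.adj_iff (h1' rfl).1 hu hv
    · have hv : v ∉ A := fun h => hu (huv.2 h)
      cases b
      · exact (h2 rfl).2.adj_iff (h2' rfl).2 hu hv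
      · exact (h1 rfl).2.adj_iff (h1' rfl).2 hu hv

end ExceptionalCount

lemma ncard_compl_eq {V : Type*} [Finite V] (P : SimpleGraph V → Prop) :
    Set.ncard {G : SimpleGraph V | P Gᶜ} = Set.ncard {G : SimpleGraph V | P G} := by
  have : {G : SimpleGraph V | P G} = compl '' {G : SimpleGraph V | P Gᶜ} := by
    ext G
    exact ⟨fun h => ⟨Gᶜ, by simpa using h, compl_compl G⟩, by rintro ⟨G, h, rfl⟩; exact h⟩
  rw [this, Set.ncard_image_of_injective _ compl_injective]

lemma eventually_exceptional_le {ε : ℝ} (hε : 0 < ε) : ∀ᶠ n in atTop,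
    (Set.ncard {G : SimpleGraph (Fin n) | Exceptional G (1 / 20)} : ℝ) ≤ ε * countUnipolar n := by
  filter_upwards [eventually_le_mul_countUnipolar 16 (by norm_num) hε, eventually_ge_atTop 1]
    with n hn h1
  refine le_trans ((ncard_exceptional_le (by simpa using h1)).trans ?_) hn
  simp only [Fintype.card_fin]
  have hn1 : (1 : ℝ) ≤ n := by exact_mod_cast h1
  refine mul_le_mul_of_nonneg_right ?_ (by positivity)
  have e1 : (2 : ℝ) * 2 ^ n ≤ 2 ^ n * 2 ^ n := by
    gcongr
    exact le_self_pow₀ (by norm_num) (by omega)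
  have e2 : ((n : ℝ) ^ (1 / 20 * (n : ℝ))) ^ 2 ≤ (n : ℝ) ^ ((n : ℝ) / 5) := by
    rw [← Real.rpow_natCast, ← Real.rpow_mul (by positivity)]
    refine Real.rpow_le_rpow_of_exponent_le hn1 ?_
    push_cast
    linarith
  calc _ = (2 * 2 ^ n) * ((2 ^ n) ^ 2 * ((n : ℝ) ^ (1 / 20 * (n : ℝ))) ^ 2) := by ring
    _ ≤ (2 ^ n * 2 ^ n) * ((2 ^ n) ^ 2 * (n : ℝ) ^ ((n : ℝ) / 5)) := by gcongr
    _ = (2 ^ n * 2 ^ n * (2 ^ n * 2 ^ n)) * (n : ℝ) ^ ((n : ℝ) / 5) := by ring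
    _ = _ := by rw [← mul_pow, ← mul_pow]; norm_num

/-! ### Row sums of random zero-one matrices -/

section Matrices

variable {ι κ : Type*}

/-- The number of ones in row `i`. -/
def rowSize (f : ι → κ → Bool) (i : ι) : ℕ := Set.ncard {b | f i b = true}

/-- The score of row `i` exceeds all other scores by at least `r`. -/
def Margin (g : ι → ℕ) (r : ℕ) (f : ι → κ → Bool) (i : ι) : Prop :=
  ∀ i', i' ≠ i → g i' + rowSize f i' + r ≤ g i + rowSize f i

/-- Matrices where the leading score exceeds the others by exactly `r`. -/
def marginSet (κ : Type*) (g : ι → ℕ) (h r : ℕ) : Set (ι → κ → Bool) :=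
  {f | ((∃ i, Margin g r f i) ∧ ¬ ∃ i, Margin g (r + 1) f i) ∧ ∀ i, rowSize f i ≤ h + r}

variable [Fintype ι] [Fintype κ]

lemma ncard_marginSet_step [Nonempty ι] (g : ι → ℕ) (h r : ℕ) :
    ((Fintype.card κ : ℝ) - h - r) * (marginSet κ g h r).ncard ≤
      (h + r + 1) * (marginSet κ g h (r + 1)).ncard := by
  have htop : ∀ f : ι → κ → Bool, ∃ i, ∀ i', g i' + rowSize f i' ≤ g i + rowSize f i := by
    intro f
    obtain ⟨i, -, hi⟩ := Finset.exists_max_image Finset.univ (fun i => g i + rowSize f i)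
      Finset.univ_nonempty
    exact ⟨i, fun i' => hi i' (Finset.mem_univ _)⟩
  choose top htop using htop
  have htop' : ∀ f r i, Margin g r f i → Margin g r f (top f) := by
    intro f r i hi j hj
    have h1 := htop f i
    by_cases hti : top f = i
    · rw [hti] at hj ⊢
      exact hi j hj
    · have h2 := hi _ hti
      have h3 := htop f j
      omega
  have huniq : ∀ f r i, Margin g (r + 1) f i → top f = i := by
    intro f r i hi
    by_contra hne
    have h1 := hi _ hne
    have h2 := htop f i
    omega
  set P : Set ((ι → κ → Bool) × κ) := {p | p.1 ∈ marginSet κ g h r ∧ p.1 (top p.1) p.2 = false}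
    with hP
  set Q : Set ((ι → κ → Bool) × κ) :=
    {p | p.1 ∈ marginSet κ g h (r + 1) ∧ p.1 (top p.1) p.2 = true} with hQ
  have h1 : ((Fintype.card κ : ℝ) - h - r) * (marginSet κ g h r).ncard ≤ P.ncard := by
    refine mul_ncard_le P _ fun f hf => ?_
    have e1 : {b | (f, b) ∈ P} = {b | f (top f) b = true}ᶜ := by
      ext b
      simp [hP, hf]
    have e2 := Set.ncard_add_ncard_compl {b | f (top f) b = true}
    rw [← e1, Nat.card_eq_fintype_card] at e2
    have e3 : Set.ncard {b | f (top f) b = true} ≤ h + r := hf.2 (top f)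
    have e4 : (Fintype.card κ : ℝ) = Set.ncard {b | f (top f) b = true} +
      Set.ncard {b | (f, b) ∈ P} := by exact_mod_cast e2.symm
    have e5 : (Set.ncard {b | f (top f) b = true} : ℝ) ≤ h + r := by exact_mod_cast e3
    linarith
  have h2 : (Q.ncard : ℝ) ≤ (marginSet κ g h (r + 1)).ncard * (h + r + 1 : ℝ) := by
    refine ncard_le_of_fibres (φ := fun p f => p.1 = f) (fun p hp => ⟨p.1, hp.1, rfl⟩) fun f hf => ?_
    have e1 : Set.ncard {a : (ι → κ → Bool) × κ | a ∈ Q ∧ a.1 = f} ≤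
        Set.ncard {b | f (top f) b = true} := by
      refine Set.ncard_le_ncard_of_injOn Prod.snd ?_ ?_ (Set.toFinite _)
      · rintro p ⟨hp, hpf⟩
        have := hp.2
        rwa [hpf] at this
      · rintro p ⟨-, hp⟩ p' ⟨-, hp'⟩ he
        exact Prod.ext (hp.trans hp'.symm) he
    exact_mod_cast e1.trans (hf.2 (top f))
  have h3 : P.ncard ≤ Q.ncard := by
    set up : (ι → κ → Bool) × κ → (ι → κ → Bool) := fun p =>
      Function.update p.1 (top p.1) (Function.update (p.1 (top p.1)) p.2 true) with hup
    have hrow : ∀ p ∈ P, rowSize (up p) (top p.1) = rowSize p.1 (top p.1) + 1 ∧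
        ∀ j, j ≠ top p.1 → rowSize (up p) j = rowSize p.1 j := by
      intro p hp
      constructor
      · have e : {b | up p (top p.1) b = true} = insert p.2 {b | p.1 (top p.1) b = true} := by
          ext b
          by_cases hb : b = p.2
          · simp [hup, hb]
          · simp [hup, hb]
        rw [rowSize, e, Set.ncard_insert_of_notMem (by simp [hp.2]) (Set.toFinite _)]
        rfl
      · intro j hj
        simp only [rowSize, hup, Function.update_of_ne hj]
    have hm : ∀ p ∈ P, Margin g (r + 1) (up p) (top p.1) := by
      intro p hp j hj
      obtain ⟨r1, r2⟩ := hrow p hp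
      obtain ⟨i, hi⟩ := hp.1.1.1
      have := htop' _ _ _ hi j hj
      rw [r1, r2 j hj]
      omega
    have ht : ∀ p ∈ P, top (up p) = top p.1 := fun p hp => huniq _ _ _ (hm p hp)
    refine Set.ncard_le_ncard_of_injOn (fun p => (up p, p.2)) ?_ ?_ (Set.toFinite _)
    · intro p hp
      obtain ⟨r1, r2⟩ := hrow p hp
      refine ⟨⟨⟨⟨_, hm p hp⟩, ?_⟩, ?_⟩, ?_⟩
      · rintro ⟨i, hi⟩
        have hi' := huniq _ _ _ hi
        rw [ht p hp] at hi'
        subst hi'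
        refine hp.1.1.2 ⟨top p.1, fun j hj => ?_⟩
        have := hi j hj
        rw [r1, r2 j hj] at this
        omega
      · intro j
        have e := hp.1.2 j
        by_cases hj : j = top p.1
        · subst hj
          rw [r1]
          omega
        · rw [r2 j hj]
          omega
      · show up p (top (up p)) p.2 = true
        rw [ht p hp]
        simp [hup]
    · intro p hp p' hp' he
      have he1 := (Prod.mk.inj he).1
      have he2 : p.2 = p'.2 := (Prod.mk.inj he).2
      have htt : top p.1 = top p'.1 := by rw [← ht p hp, ← ht p' hp', he1]
      refine Prod.ext ?_ he2
      funext j b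
      by_cases hj : j = top p.1
      · by_cases hb : b = p.2
        · subst hj hb
          rw [hp.2, htt, he2, hp'.2]
        · have := congrFun (congrFun he1 j) b
          have hb' : b ≠ p'.2 := he2 ▸ hb
          simp only [hup] at this
          rw [← htt, hj] at this
          simpa [hb, hb', htt, hj] using this
      · have hj' : j ≠ top p'.1 := htt ▸ hj
        have := congrFun (congrFun he1 j) b
        simpa [hup, hj, hj'] using this
  calc _ ≤ _ := h1
    _ ≤ (Q.ncard : ℝ) := Nat.cast_le.2 h3
    _ ≤ _ := h2
    _ = _ := mul_comm _ _

/-- The leading score is rarely attained twice. -/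
lemma ncard_marginSet_zero_le [Nonempty ι] (g : ι → ℕ) {L h : ℕ} (hL : 1 ≤ L)
    (hh : (h : ℝ) + L ≤ (1 / 2 + 1 / (8 * L)) * Fintype.card κ) :
    (L : ℝ) * (marginSet κ g h 0).ncard ≤ 2 * 2 ^ (Fintype.card ι * Fintype.card κ) := by
  have hL' : (1 : ℝ) ≤ L := by exact_mod_cast hL
  set N : ℝ := (Fintype.card κ : ℝ) with hN
  have hN0 : 0 ≤ N := Nat.cast_nonneg _
  obtain ⟨c, hc⟩ : ∃ c : ℝ, c = 1 / (2 * L) := ⟨_, rfl⟩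
  have hc0 : 0 < c := by rw [hc]; positivity
  have hcL : (L : ℝ) * c = 1 / 2 := by rw [hc]; field_simp
  have hc1 : c ≤ 1 / 2 := by nlinarith
  have hh' : (h : ℝ) + L ≤ (1 / 2 + c / 4) * N := by
    refine hh.trans (le_of_eq ?_)
    rw [hc]
    congr 2
    field_simp
    norm_num
  have step : ∀ r < L, (1 - c) * ((marginSet κ g h r).ncard : ℝ) ≤
      (marginSet κ g h (r + 1)).ncard := by
    intro r hr
    have hr' : (r : ℝ) + 1 ≤ L := by exact_mod_cast hr
    have h1 := ncard_marginSet_step (κ := κ) g h r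
    have h2 : (1 - c) * (h + r + 1 : ℝ) ≤ N - h - r := by
      have h3 : (1 - c) * (h + r + 1 : ℝ) ≤ (1 - c) * ((1 / 2 + c / 4) * N) := by
        gcongr
        · linarith
        · linarith
      nlinarith [mul_nonneg (sq_nonneg c) hN0]
    have h4 : (0 : ℝ) < h + r + 1 := by positivity
    have h5 : (0 : ℝ) ≤ (marginSet κ g h r).ncard := Nat.cast_nonneg _
    refine le_of_mul_le_mul_left (le_trans ?_ h1) h4
    calc _ = ((1 - c) * (h + r + 1 : ℝ)) * (marginSet κ g h r).ncard := by ring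
      _ ≤ _ := mul_le_mul_of_nonneg_right h2 h5
  have hpow : ∀ r ≤ L, (1 - c) ^ r * ((marginSet κ g h 0).ncard : ℝ) ≤
      (marginSet κ g h r).ncard := by
    intro r
    induction r with
    | zero => simp
    | succ r ih =>
      intro hr
      refine le_trans ?_ (step r hr)
      rw [pow_succ', mul_assoc]
      exact mul_le_mul_of_nonneg_left (ih (by omega)) (by linarith)
  have hhalf : ∀ r ∈ Finset.range L, (1 / 2 : ℝ) * (marginSet κ g h 0).ncard ≤
      (marginSet κ g h r).ncard := by
    intro r hr
    rw [Finset.mem_range] at hr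
    refine le_trans ?_ (hpow r hr.le)
    gcongr
    have h1 := one_add_mul_le_pow (a := -c) (by linarith) r
    have h2 : (r : ℝ) * c ≤ L * c := by
      gcongr
    have h3 : (1 : ℝ) + -c = 1 - c := by ring
    rw [h3] at h1
    linarith
  have hmono : ∀ {r s : ℕ} {f : ι → κ → Bool} {i}, r ≤ s → Margin g s f i → Margin g r f i :=
    fun hrs hm j hj => le_trans (by omega) (hm j hj)
  have hdisj : ∑ r ∈ Finset.range L, (marginSet κ g h r).ncard ≤
      2 ^ (Fintype.card ι * Fintype.card κ) := by
    have h1 : ∀ r, (marginSet κ g h r).ncard = (marginSet κ g h r).toFinset.card :=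
      fun r => Set.ncard_eq_toFinset_card' _
    simp only [h1]
    rw [← Finset.card_biUnion]
    · refine (Finset.card_le_univ _).trans (le_of_eq ?_)
      rw [Fintype.card_fun, Fintype.card_fun, Fintype.card_bool, ← pow_mul, mul_comm]
    · have key : ∀ r s, r < s → Disjoint (marginSet κ g h r).toFinset
          (marginSet κ g h s).toFinset := by
        intro r s hrs
        rw [Finset.disjoint_left]
        intro f hf hf'
        rw [Set.mem_toFinset] at hf hf'
        obtain ⟨i, hi⟩ := hf'.1.1
        exact hf.1.2 ⟨i, hmono hrs hi⟩
      intro r _ s _ hne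
      rcases lt_or_gt_of_ne hne with h' | h'
      exacts [key r s h', (key s r h').symm]
  have h1 := Finset.sum_le_sum hhalf
  rw [Finset.sum_const, Finset.card_range, nsmul_eq_mul] at h1
  have h2 : (∑ r ∈ Finset.range L, ((marginSet κ g h r).ncard : ℝ)) ≤
      2 ^ (Fintype.card ι * Fintype.card κ) := by exact_mod_cast hdisj
  linarith

lemma ncard_tail_le {η : ℝ} (hη : 0 ≤ η) :
    (Set.ncard {x : κ → Bool | (1 / 2 + η) * Fintype.card κ ≤ Set.ncard {b | x b = true}} : ℝ) ≤
      Real.exp (-2 * η ^ 2 * Fintype.card κ) * 2 ^ Fintype.card κ := by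
  set N : ℝ := (Fintype.card κ : ℝ) with hN
  set s : Bool → ℝ := fun c => if c = true then 2 * η else -(2 * η) with hs
  have h1 : ∀ x : κ → Bool, ∑ b, s (x b) = 2 * η * (2 * (Set.ncard {b | x b = true} : ℝ) - N) := by
    intro x
    have e1 : ∀ c, s c = 4 * η * (if c = true then 1 else 0) - 2 * η := by
      intro c; cases c <;> simp [hs] ; ring
    simp only [e1]
    rw [Finset.sum_sub_distrib, ← Finset.mul_sum, Finset.sum_boole, Finset.sum_const,
      Finset.card_univ, nsmul_eq_mul, Set.ncard_eq_toFinset_card', Set.toFinset_ofPred]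
    ring
  have h2 : ∑ x : κ → Bool, Real.exp (∑ b, s (x b)) =
      (Real.exp (2 * η) + Real.exp (-(2 * η))) ^ Fintype.card κ := by
    have := Finset.prod_univ_sum (fun _ : κ => (Finset.univ : Finset Bool))
      (fun _ c => Real.exp (s c))
    rw [Fintype.piFinset_univ] at this
    simp only [Real.exp_sum]
    rw [← this]
    simp [hs]
  have h3 : Real.exp (2 * η) + Real.exp (-(2 * η)) ≤ 2 * Real.exp (2 * η ^ 2) := by
    have := Real.cosh_le_exp_half_sq (2 * η)
    rw [Real.cosh_eq] at this
    have e : (2 * η) ^ 2 / 2 = 2 * η ^ 2 := by ring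
    rw [e] at this
    linarith
  have h4 : (Set.ncard {x : κ → Bool | (1 / 2 + η) * N ≤ Set.ncard {b | x b = true}} : ℝ) *
      Real.exp (4 * η ^ 2 * N) ≤ (2 * Real.exp (2 * η ^ 2)) ^ Fintype.card κ := by
    refine le_trans ?_ (pow_le_pow_left₀ (by positivity) h3 _)
    rw [← h2, Set.ncard_eq_toFinset_card', ← nsmul_eq_mul, ← Finset.sum_const]
    refine le_trans (Finset.sum_le_sum fun x hx => ?_)
      (Finset.sum_le_univ_sum_of_nonneg fun x => (Real.exp_pos _).le)
    rw [Set.mem_toFinset, Set.mem_ofPred_eq] at hx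
    rw [h1]
    refine Real.exp_le_exp.2 ?_
    nlinarith
  rw [mul_pow, ← Real.exp_nat_mul] at h4
  have h5 : (0 : ℝ) < Real.exp (4 * η ^ 2 * N) := Real.exp_pos _
  refine le_of_mul_le_mul_right (h4.trans (le_of_eq ?_)) h5
  rw [mul_right_comm, ← Real.exp_add, mul_comm]
  congr 2
  rw [← hN]
  ring

lemma ncard_exists_row_le {B : ι → Set (κ → Bool)} {p : ℝ}
    (hB : ∀ i, ((B i).ncard : ℝ) ≤ p * 2 ^ Fintype.card κ) :
    (Set.ncard {f : ι → κ → Bool | ∃ i, f i ∈ B i} : ℝ) ≤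
      Fintype.card ι * (p * 2 ^ (Fintype.card ι * Fintype.card κ)) := by
  have h := ncard_le_of_fibres (S := {f : ι → κ → Bool | ∃ i, f i ∈ B i}) (D := (Set.univ : Set ι))
    (φ := fun f i => f i ∈ B i) (M := p * 2 ^ (Fintype.card ι * Fintype.card κ))
    (fun f ⟨i, hi⟩ => ⟨i, Set.mem_univ _, hi⟩) fun i _ => ?_
  · rwa [Set.ncard_univ, Nat.card_eq_fintype_card] at h
  have h1 : Set.ncard {f : ι → κ → Bool | f ∈ {f : ι → κ → Bool | ∃ i, f i ∈ B i} ∧ f i ∈ B i} ≤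
      Set.ncard (B i ×ˢ (Set.univ : Set ({j // j ≠ i} → κ → Bool))) := by
    refine Set.ncard_le_ncard_of_injOn (fun f => (f i, fun j => f j)) ?_ ?_ (Set.toFinite _)
    · rintro f ⟨-, hf⟩
      exact ⟨hf, Set.mem_univ _⟩
    · intro f _ f' _ he
      funext j
      by_cases hj : j = i
      · subst hj
        exact (Prod.mk.inj he).1
      · exact congrFun (Prod.mk.inj he).2 ⟨j, hj⟩
  rw [Set.ncard_prod, Set.ncard_univ, Nat.card_eq_fintype_card, Fintype.card_fun, Fintype.card_fun,
    Fintype.card_bool, ← pow_mul, Fintype.card_subtype_compl, Fintype.card_subtype_eq] at h1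
  have h2 : Fintype.card ι * Fintype.card κ = Fintype.card κ +
      Fintype.card κ * (Fintype.card ι - 1) := by
    have : 1 ≤ Fintype.card ι := Fintype.card_pos_iff.2 ⟨i⟩
    obtain ⟨a, ha⟩ := Nat.exists_eq_add_of_le this
    rw [ha, Nat.add_sub_cancel_left]
    ring
  refine (Nat.cast_le.2 h1).trans ?_
  rw [h2, pow_add]
  push_cast
  rw [← mul_assoc]
  gcongr
  exact hB i

end Matrices

section TypicalMatrices

lemma eventually_mul_exp_le {η ε : ℝ} (hη : 0 < η) (hε : 0 < ε) :
    ∀ᶠ N : ℕ in atTop, 2 * (N : ℝ) * Real.exp (-2 * η ^ 2 * N) ≤ ε := by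
  have h1 : Tendsto (fun N : ℕ => 2 * η ^ 2 * (N : ℝ)) atTop atTop :=
    tendsto_natCast_atTop_atTop.const_mul_atTop (by positivity)
  have h2 := (Real.tendsto_pow_mul_exp_neg_atTop_nhds_zero 1).comp h1
  filter_upwards [h2.eventually_le_const (show (0 : ℝ) < ε * η ^ 2 by positivity)] with N hN
  simp only [Function.comp_apply, pow_one] at hN
  rw [show -2 * η ^ 2 * (N : ℝ) = -(2 * η ^ 2 * N) by ring]
  refine le_of_mul_le_mul_right ?_ (show 0 < η ^ 2 by positivity)
  linarith

lemma eventually_rowSize_lt {η ε : ℝ} (hη : 0 < η) (hε : 0 < ε) :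
    ∀ᶠ N : ℕ in atTop, ∀ (ι κ : Type) [Fintype ι] [Fintype κ], Fintype.card κ = N →
      Fintype.card ι ≤ 2 * N →
      (Set.ncard {f : ι → κ → Bool | ∃ i, (1 / 2 + η) * N ≤ rowSize f i} : ℝ) ≤
        ε * 2 ^ (Fintype.card ι * Fintype.card κ) := by
  filter_upwards [eventually_mul_exp_le hη hε] with N hN ι κ _ _ hκ hι
  refine (ncard_exists_row_le (ι := ι)
    (B := fun _ => {x : κ → Bool | (1 / 2 + η) * N ≤ (Set.ncard {b | x b = true} : ℝ)})
    (p := Real.exp (-2 * η ^ 2 * N)) fun i => ?_).trans ?_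
  · rw [← hκ]
    exact ncard_tail_le hη.le
  · rw [← mul_assoc]
    refine mul_le_mul_of_nonneg_right (le_trans ?_ hN) (by positivity)
    exact mul_le_mul_of_nonneg_right (by exact_mod_cast hι) (Real.exp_pos _).le

lemma rowSize_not {ι κ : Type*} [Fintype κ] (f : ι → κ → Bool) (i : ι) :
    rowSize (fun i b => !f i b) i + rowSize f i = Fintype.card κ := by
  have e1 : {b | (!f i b) = true} = {b | f i b = true}ᶜ := by ext b; simp
  have e2 := Set.ncard_add_ncard_compl {b | f i b = true}
  rw [Nat.card_eq_fintype_card] at e2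
  unfold rowSize
  rw [e1]
  omega

lemma eventually_lt_rowSize {η ε : ℝ} (hη : 0 < η) (hε : 0 < ε) :
    ∀ᶠ N : ℕ in atTop, ∀ (ι κ : Type) [Fintype ι] [Fintype κ], Fintype.card κ = N →
      Fintype.card ι ≤ 2 * N →
      (Set.ncard {f : ι → κ → Bool | ∃ i, (rowSize f i : ℝ) ≤ (1 / 2 - η) * N} : ℝ) ≤
        ε * 2 ^ (Fintype.card ι * Fintype.card κ) := by
  filter_upwards [eventually_rowSize_lt hη hε] with N hN ι κ _ _ hκ hι
  refine le_trans (Nat.cast_le.2 ?_) (hN ι κ hκ hι)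
  refine Set.ncard_le_ncard_of_injOn (fun f i b => !f i b) ?_ ?_ (Set.toFinite _)
  · rintro f ⟨i, hi⟩
    refine ⟨i, ?_⟩
    have h1 : (rowSize (fun i b => !f i b) i : ℝ) + rowSize f i = N := by
      rw [← hκ]; exact_mod_cast rowSize_not f i
    linarith
  · intro f _ f' _ h
    funext i b
    simpa using congrFun (congrFun h i) b

lemma ncard_transpose_le {ι κ : Type*} [Finite ι] [Finite κ] (P : (κ → ι → Bool) → Prop)
    {σ : Bool → Bool} (hσ : Function.Injective σ) :
    Set.ncard {f : ι → κ → Bool | P (fun b i => σ (f i b))} ≤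
      Set.ncard {f : κ → ι → Bool | P f} := by
  refine Set.ncard_le_ncard_of_injOn (fun f b i => σ (f i b)) (fun f hf => hf) ?_ (Set.toFinite _)
  intro f _ f' _ h
  funext i b
  exact hσ (congrFun (congrFun h b) i)

lemma eventually_margin {ε : ℝ} (hε : 0 < ε) :
    ∀ᶠ N : ℕ in atTop, ∀ (ι κ : Type) [Fintype ι] [Fintype κ] [Nonempty ι] (g : ι → ℕ),
      Fintype.card κ = N → Fintype.card ι ≤ 2 * N →
      (Set.ncard {f : ι → κ → Bool | ¬ ∃ i, Margin g 1 f i} : ℝ) ≤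
        ε * 2 ^ (Fintype.card ι * Fintype.card κ) := by
  obtain ⟨L, hL⟩ := exists_nat_ge (4 / ε + 1)
  have hL1 : (1 : ℝ) ≤ L := by have : 0 < 4 / ε := by positivity
                               linarith
  obtain ⟨η, hη⟩ : ∃ η : ℝ, η = 1 / (16 * L) := ⟨_, rfl⟩
  have hη0 : 0 < η := by rw [hη]; positivity
  filter_upwards [eventually_rowSize_lt hη0 (half_pos hε),
    tendsto_natCast_atTop_atTop.eventually_ge_atTop ((1 + L) / η)] with N hN hN2 ι κ _ _ _ g hκ hι
  obtain ⟨h, hh⟩ : ∃ h : ℕ, h = ⌈(1 / 2 + η) * N⌉₊ := ⟨_, rfl⟩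
  have h1 : (h : ℝ) < (1 / 2 + η) * N + 1 := by rw [hh]; exact Nat.ceil_lt_add_one (by positivity)
  have h2 : (1 / 2 + η) * N ≤ h := by rw [hh]; exact Nat.le_ceil _
  have h3 : (1 : ℝ) + L ≤ N * η := (div_le_iff₀ hη0).1 hN2
  have h4 := ncard_marginSet_zero_le (κ := κ) g (L := L) (h := h) (by exact_mod_cast hL1) (by
    rw [show (1 : ℝ) / (8 * L) = 2 * η by rw [hη]; field_simp; norm_num, hκ]
    linarith)
  have h5 : {f : ι → κ → Bool | ¬ ∃ i, Margin g 1 f i} ⊆ marginSet κ g h 0 ∪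
      {f : ι → κ → Bool | ∃ i, (1 / 2 + η) * N ≤ rowSize f i} := by
    intro f hf
    by_cases hr : ∃ i, (1 / 2 + η) * N ≤ rowSize f i
    · exact Or.inr hr
    · push Not at hr
      refine Or.inl ⟨⟨?_, hf⟩, fun i => ?_⟩
      · obtain ⟨i, -, hi⟩ := Finset.exists_max_image Finset.univ (fun i => g i + rowSize f i)
          Finset.univ_nonempty
        exact ⟨i, fun i' _ => hi i' (Finset.mem_univ _)⟩
      · have h6 := (hr i).trans_le h2
        have h7 : rowSize f i < h := by exact_mod_cast h6
        omega
  have h6 : (Set.ncard {f : ι → κ → Bool | ¬ ∃ i, Margin g 1 f i} : ℝ) ≤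
      (marginSet κ g h 0).ncard +
        Set.ncard {f : ι → κ → Bool | ∃ i, (1 / 2 + η) * N ≤ rowSize f i} := by
    exact_mod_cast (Set.ncard_le_ncard h5 (Set.toFinite _)).trans (Set.ncard_union_le _ _)
  have h7 := hN ι κ hκ hι
  obtain ⟨X, hX⟩ : ∃ X : ℝ, X = 2 ^ (Fintype.card ι * Fintype.card κ) := ⟨_, rfl⟩
  have hX0 : 0 < X := by rw [hX]; positivity
  rw [← hX] at h4 h7 ⊢
  have h8 : 4 ≤ L * ε := by
    have : 4 / ε ≤ L := by linarith
    exact (div_le_iff₀ hε).1 this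
  have h9 : ((marginSet κ g h 0).ncard : ℝ) ≤ ε / 2 * X := by
    refine le_of_mul_le_mul_left (h4.trans ?_) (show (0 : ℝ) < L by linarith)
    nlinarith
  linarith

end TypicalMatrices

/-! ### Unipolar graphs with a given central clique and given other cliques -/

section Fibres

/-- There is a unique vertex of maximum degree. -/
def UniqueMax {V : Type*} (G : SimpleGraph V) : Prop :=
  ∃ v, ∀ w, w ≠ v → (G.neighborSet w).ncard < (G.neighborSet v).ncard

lemma UniqueMax.edgeChromaticNumber_eq {V : Type*} [Fintype V] {G : SimpleGraph V}
    (h : UniqueMax G) : edgeChromaticNumber G = G.maxDegree := by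
  obtain ⟨v, hv⟩ := h
  have e1 : ∀ w, (G.neighborSet w).ncard = G.degree w := by
    intro w
    rw [← SimpleGraph.card_neighborSet_eq_degree, ← Nat.card_eq_fintype_card]
    rfl
  simp only [e1] at hv
  have e2 : ∀ w, G.degree w = G.maxDegree → w = v := by
    intro w hw
    by_contra hne
    have h1 := hv w hne
    have h2 := G.degree_le_maxDegree v
    omega
  exact edgeChromaticNumber_eq_maxDegree G fun u w hu hw => (e2 u hu).trans (e2 w hw).symm

variable {V : Type*} [Fintype V]

/-- The adjacencies between `C` and its complement. -/
def crossMatrix (G : SimpleGraph V) (C : Set V) : ↥C → ↥Cᶜ → Bool := fun a b => decide (G.Adj a b)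

/-- The graphs in which `C` is a clique and which agree with `R` outside `C`. -/
def fibre (C : Set V) (R : SimpleGraph V) : Set (SimpleGraph V) :=
  {G | G.IsClique C ∧ ∀ u ∉ C, ∀ v ∉ C, (G.Adj u v ↔ R.Adj u v)}

/-- The number of `R`-neighbours of `b` outside `C`. -/
def outDegree (C : Set V) (R : SimpleGraph V) (b : ↥Cᶜ) : ℕ := Set.ncard {b' : ↥Cᶜ | R.Adj b b'}

/-- The number of vertices outside `C` which are not `R`-adjacent to `b`. -/
def outCodegree (C : Set V) (R : SimpleGraph V) (b : ↥Cᶜ) : ℕ :=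
  Set.ncard {b' : ↥Cᶜ | b ≠ b' ∧ ¬ R.Adj b b'}

lemma ncard_split (C : Set V) (p : V → Prop) :
    Set.ncard {v | p v} = Set.ncard {a : ↥C | p a} + Set.ncard {b : ↥Cᶜ | p b} := by
  have e1 : {v | p v} = (Subtype.val '' {a : ↥C | p a}) ∪ (Subtype.val '' {b : ↥Cᶜ | p b}) := by
    ext v
    by_cases hv : v ∈ C <;> simp [hv]
  rw [e1, Set.ncard_union_eq, Set.ncard_image_of_injective _ Subtype.val_injective,
    Set.ncard_image_of_injective _ Subtype.val_injective]
  rw [Set.disjoint_left]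
  rintro _ ⟨a, -, rfl⟩ ⟨b, -, hb⟩
  exact b.2 (hb ▸ a.2)

lemma outDegree_add (C : Set V) (R : SimpleGraph V) (b : ↥Cᶜ) :
    outDegree C R b + outCodegree C R b + 1 = Nat.card ↥Cᶜ := by
  have e1 : {b' : ↥Cᶜ | b ≠ b' ∧ ¬ R.Adj b b'} = ({b' : ↥Cᶜ | R.Adj b b'} ∪ {b})ᶜ := by
    ext b'
    simp only [Set.mem_ofPred_eq, Set.mem_compl_iff, Set.mem_union, Set.mem_singleton_iff, eq_comm,
      ne_eq]
    tauto
  have e2 := Set.ncard_add_ncard_compl ({b' : ↥Cᶜ | R.Adj b b'} ∪ {b})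
  rw [Set.ncard_union_eq (by simp) (Set.toFinite _) (Set.toFinite _), Set.ncard_singleton] at e2
  unfold outDegree outCodegree
  rw [e1]
  omega

variable {C : Set V} {R G : SimpleGraph V}

lemma degree_inside (hG : G ∈ fibre C R) (a : ↥C) :
    (G.neighborSet a).ncard + 1 = Nat.card ↥C + rowSize (crossMatrix G C) a := by
  have h1 := ncard_split C (fun v => G.Adj a v)
  have e1 : {a' : ↥C | G.Adj a a'} = {a}ᶜ := by
    ext a'
    simp only [Set.mem_ofPred_eq, Set.mem_compl_iff, Set.mem_singleton_iff]
    refine ⟨fun h e => G.loopless.irrefl _ (e ▸ h), fun h => hG.1 a.2 a'.2 fun e => h ?_⟩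
    exact (Subtype.ext e).symm
  have e2 := Set.ncard_add_ncard_compl ({a} : Set ↥C)
  rw [Set.ncard_singleton] at e2
  rw [e1] at h1
  unfold rowSize crossMatrix
  simp only [decide_eq_true_eq]
  change Set.ncard {v | G.Adj a v} + 1 = _
  omega

lemma degree_outside (hG : G ∈ fibre C R) (b : ↥Cᶜ) :
    (G.neighborSet b).ncard =
      rowSize (fun b a => crossMatrix G C a b) b + outDegree C R b := by
  have h1 := ncard_split C (fun v => G.Adj b v)
  have e1 : {b' : ↥Cᶜ | G.Adj b b'} = {b' : ↥Cᶜ | R.Adj b b'} := by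
    ext b'
    exact hG.2 b b.2 b' b'.2
  unfold rowSize crossMatrix outDegree
  simp only [decide_eq_true_eq]
  rw [← e1, show {a : ↥C | G.Adj a b} = {a : ↥C | G.Adj b a} by ext a; exact G.adj_comm _ _]
  exact h1

lemma codegree_inside (hG : G ∈ fibre C R) (a : ↥C) :
    (Gᶜ.neighborSet a).ncard + rowSize (crossMatrix G C) a = Nat.card ↥Cᶜ := by
  have h1 := ncard_split C (fun v => Gᶜ.Adj a v)
  have e1 : {a' : ↥C | Gᶜ.Adj a a'} = ∅ := by
    ext a'
    simp only [SimpleGraph.compl_adj, Set.mem_ofPred_eq, Set.mem_empty_iff_false, iff_false]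
    exact fun h => h.2 (hG.1 a.2 a'.2 h.1)
  have e2 : {b : ↥Cᶜ | Gᶜ.Adj a b} = {b : ↥Cᶜ | crossMatrix G C a b = true}ᶜ := by
    ext b
    simp only [SimpleGraph.compl_adj, Set.mem_ofPred_eq, Set.mem_compl_iff, crossMatrix,
      decide_eq_true_eq]
    exact ⟨fun h => h.2, fun h => ⟨fun e => b.2 (e ▸ a.2), h⟩⟩
  have e3 := Set.ncard_add_ncard_compl {b : ↥Cᶜ | crossMatrix G C a b = true}
  rw [e1, e2, Set.ncard_empty] at h1
  unfold rowSize
  change Set.ncard {v | Gᶜ.Adj a v} + _ = _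
  omega

lemma codegree_outside (hG : G ∈ fibre C R) (b : ↥Cᶜ) :
    (Gᶜ.neighborSet b).ncard =
      outCodegree C R b + rowSize (fun b a => !crossMatrix G C a b) b := by
  have h1 := ncard_split C (fun v => Gᶜ.Adj b v)
  have e1 : {b' : ↥Cᶜ | Gᶜ.Adj b b'} = {b' : ↥Cᶜ | b ≠ b' ∧ ¬ R.Adj b b'} := by
    ext b'
    simp only [SimpleGraph.compl_adj, Set.mem_ofPred_eq, hG.2 b b.2 b' b'.2, ne_eq,
      Subtype.ext_iff]
  have e2 : {a : ↥C | Gᶜ.Adj b a} = {a : ↥C | (!crossMatrix G C a b) = true} := by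
    ext a
    simp only [SimpleGraph.compl_adj, Set.mem_ofPred_eq, crossMatrix, G.adj_comm b a,
      Bool.not_eq_true', decide_eq_false_iff_not]
    exact ⟨fun h => h.2, fun h => ⟨fun e => b.2 (e ▸ a.2), h⟩⟩
  unfold rowSize outCodegree
  rw [← e1, ← e2, add_comm]
  exact h1

lemma uniqueMax_of_margin (hG : G ∈ fibre C R) {k m : ℝ} (hk : k = Nat.card ↥C)
    (hm : m = Nat.card ↥Cᶜ) (hn : 40 ≤ k + m) (hR : ∀ b, 5 * (outDegree C R b : ℝ) ≤ 2 * (k + m))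
    (h1 : ∀ a, 19 / 40 * m ≤ rowSize (crossMatrix G C) a ∧
      (rowSize (crossMatrix G C) a : ℝ) ≤ 21 / 40 * m)
    (h2 : ∀ b, 19 / 40 * k ≤ rowSize (fun b a => crossMatrix G C a b) b ∧
      (rowSize (fun b a => crossMatrix G C a b) b : ℝ) ≤ 21 / 40 * k)
    (h3 : ∃ a, Margin (fun _ => 0) 1 (crossMatrix G C) a)
    (h4 : ∃ b, Margin (outCodegree C R) 1 (fun b a => !crossMatrix G C a b) b) :
    UniqueMax G ∧ UniqueMax Gᶜ := by
  constructor
  · obtain ⟨a, ha⟩ := h3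
    refine ⟨a, fun w hw => ?_⟩
    have e1 := degree_inside hG a
    by_cases hwC : w ∈ C
    · have e2 := degree_inside hG ⟨w, hwC⟩
      have e3 := ha ⟨w, hwC⟩ fun e => hw (congrArg Subtype.val e)
      simp only [zero_add] at e3 e2
      omega
    · have e2 := degree_outside hG ⟨w, hwC⟩
      have e3 := hR ⟨w, hwC⟩
      have e4 := h2 ⟨w, hwC⟩
      have e5 := h1 a
      have e6 : ((G.neighborSet a).ncard : ℝ) + 1 = k + rowSize (crossMatrix G C) a := by
        rw [hk]; exact_mod_cast e1
      have e7 : ((G.neighborSet w).ncard : ℝ) = _ := congrArg Nat.cast e2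
      rw [Nat.cast_add] at e7
      have e8 : ((G.neighborSet w).ncard : ℝ) < (G.neighborSet a).ncard := by linarith
      exact_mod_cast e8
  · obtain ⟨b, hb⟩ := h4
    refine ⟨b, fun w hw => ?_⟩
    have e1 := codegree_outside hG b
    by_cases hwC : w ∈ C
    · have e2 := codegree_inside hG ⟨w, hwC⟩
      have e3 := hR b
      have e4 := h2 b
      have e5 := h1 ⟨w, hwC⟩
      have e6 : ((Gᶜ.neighborSet w).ncard : ℝ) + rowSize (crossMatrix G C) ⟨w, hwC⟩ = m := by
        rw [hm]; exact_mod_cast e2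
      have e7 : ((Gᶜ.neighborSet b).ncard : ℝ) = _ := congrArg Nat.cast e1
      rw [Nat.cast_add] at e7
      have e9 : (outDegree C R b : ℝ) + outCodegree C R b + 1 = m := by
        rw [hm]; exact_mod_cast outDegree_add C R b
      have e10 : (rowSize (fun b a => !crossMatrix G C a b) b : ℝ) +
          rowSize (fun b a => crossMatrix G C a b) b = k := by
        rw [hk, Nat.card_eq_fintype_card]
        exact_mod_cast rowSize_not (fun b a => crossMatrix G C a b) b
      have e8 : ((Gᶜ.neighborSet w).ncard : ℝ) < (Gᶜ.neighborSet b).ncard := by linarith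
      exact_mod_cast e8
    · have e2 := codegree_outside hG ⟨w, hwC⟩
      have e3 := hb ⟨w, hwC⟩ fun e => hw (congrArg Subtype.val e)
      simp only at e2
      omega

lemma crossMatrix_injOn : Set.InjOn (fun G => crossMatrix G C) (fibre C R) := by
  intro G hG G' hG' h
  have h1 : ∀ (a : ↥C) (b : ↥Cᶜ), (G.Adj a b ↔ G'.Adj a b) := by
    intro a b
    have := congrFun (congrFun h a) b
    simpa [crossMatrix] using this
  ext u v
  by_cases hu : u ∈ C <;> by_cases hv : v ∈ C
  · constructor
    · exact fun h => hG'.1 hu hv h.ne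
    · exact fun h => hG.1 hu hv h.ne
  · exact h1 ⟨u, hu⟩ ⟨v, hv⟩
  · rw [G.adj_comm, G'.adj_comm]
    exact h1 ⟨v, hv⟩ ⟨u, hu⟩
  · rw [hG.2 u hu v hv, hG'.2 u hu v hv]

lemma le_ncard_fibre (C : Set V) (R : SimpleGraph V) :
    2 ^ (Fintype.card ↥C * Fintype.card ↥Cᶜ) ≤ (fibre C R).ncard := by
  have e1 : (Set.univ : Set (↥C → ↥Cᶜ → Bool)).ncard = 2 ^ (Fintype.card ↥C * Fintype.card ↥Cᶜ) := by
    rw [Set.ncard_univ, Nat.card_eq_fintype_card]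
    simp only [Fintype.card_fun, Fintype.card_bool]
    rw [← pow_mul, mul_comm]
  rw [← e1]
  obtain ⟨F, hF⟩ : ∃ F : (↥C → ↥Cᶜ → Bool) → SimpleGraph V, ∀ f u v, (F f).Adj u v ↔ u ≠ v ∧
      ((u ∈ C ∧ v ∈ C) ∨ (u ∉ C ∧ v ∉ C ∧ R.Adj u v) ∨ ∃ a b, f a b = true ∧
        ((a.1 = u ∧ b.1 = v) ∨ (a.1 = v ∧ b.1 = u))) :=
    ⟨fun f =>
      { Adj := fun u v => u ≠ v ∧ ((u ∈ C ∧ v ∈ C) ∨ (u ∉ C ∧ v ∉ C ∧ R.Adj u v) ∨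
          ∃ a b, f a b = true ∧ ((a.1 = u ∧ b.1 = v) ∨ (a.1 = v ∧ b.1 = u)))
        symm := ⟨fun u v h => ⟨h.1.symm, h.2.imp (fun h => h.symm) (Or.imp
          (fun h => ⟨h.2.1, h.1, h.2.2.symm⟩) fun ⟨a, b, h, h'⟩ => ⟨a, b, h, h'.symm⟩)⟩⟩
        loopless := ⟨fun u h => h.1 rfl⟩ }, fun f u v => Iff.rfl⟩
  refine Set.ncard_le_ncard_of_injOn F (fun f _ => ⟨?_, ?_⟩) ?_ (Set.toFinite _)
  · exact fun u hu v hv h => (hF f u v).2 ⟨h, Or.inl ⟨hu, hv⟩⟩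
  · intro u hu v hv
    rw [hF]
    constructor
    · rintro ⟨-, h | h | ⟨a, b, -, ⟨h, -⟩ | ⟨h, -⟩⟩⟩
      · exact absurd h.1 hu
      · exact h.2.2
      · exact absurd (h ▸ a.2) hu
      · exact absurd (h ▸ a.2) hv
    · exact fun h => ⟨h.ne, Or.inr (Or.inl ⟨hu, hv, h⟩)⟩
  · have e2 : ∀ f (a : ↥C) (b : ↥Cᶜ), (F f).Adj a b ↔ f a b = true := by grind
    intro f _ f' _ h
    funext a b
    have h1 := e2 f a b
    rw [h, e2 f' a b] at h1
    exact (Bool.eq_iff_iff.2 h1).symm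

lemma ncard_fibre_inter_le {P : SimpleGraph V → Prop} {Q : (↥C → ↥Cᶜ → Bool) → Prop} {ε : ℝ}
    (hPQ : ∀ G ∈ fibre C R, P G → Q (crossMatrix G C))
    (hQ : (Set.ncard {f | Q f} : ℝ) ≤ ε * 2 ^ (Fintype.card ↥C * Fintype.card ↥Cᶜ)) (hε : 0 ≤ ε) :
    (Set.ncard {G | G ∈ fibre C R ∧ P G} : ℝ) ≤ ε * (fibre C R).ncard := by
  have h1 : Set.ncard {G | G ∈ fibre C R ∧ P G} ≤ Set.ncard {f | Q f} :=
    Set.ncard_le_ncard_of_injOn (fun G => crossMatrix G C) (fun G hG => hPQ G hG.1 hG.2)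
      (fun G hG G' hG' h => crossMatrix_injOn hG.1 hG'.1 h) (Set.toFinite _)
  refine (Nat.cast_le.2 h1).trans (hQ.trans (mul_le_mul_of_nonneg_left ?_ hε))
  exact_mod_cast le_ncard_fibre C R

end Fibres

lemma eventually_three_ones {ε : ℝ} (hε : 0 < ε) :
    ∀ᶠ n : ℕ in atTop, ∀ (ι κ : Type) [Fintype ι] [Fintype κ] (T : Finset κ),
      Fintype.card ι ≤ n → Fintype.card κ ≤ n → n ≤ T.card ^ 4 →
      (Set.ncard {f : ι → κ → Bool | ∃ i, ¬ ∃ b₁ ∈ T, ∃ b₂ ∈ T, ∃ b₃ ∈ T, (b₁ ≠ b₂ ∧ b₁ ≠ b₃ ∧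
        b₂ ≠ b₃) ∧ f i b₁ = true ∧ f i b₂ = true ∧ f i b₃ = true} : ℝ) ≤
        ε * 2 ^ (Fintype.card ι * Fintype.card κ) := by
  obtain ⟨t₀, ht₀⟩ := eventually_atTop.1 (eventually_poly_le 12 (2 / ε) one_pos)
  filter_upwards [eventually_ge_atTop (t₀ ^ 4)] with n hn ι κ _ _ T hι hκ hT
  obtain ⟨t, ht⟩ : ∃ t, t = T.card := ⟨_, rfl⟩
  have htt : t₀ ≤ t := by
    by_contra hlt
    have := Nat.pow_lt_pow_left (not_le.1 hlt) (show 4 ≠ 0 by norm_num)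
    rw [← ht] at hT
    omega
  have hpoly := ht₀ t htt
  rw [one_mul, Real.rpow_natCast] at hpoly
  obtain ⟨B, hB⟩ : ∃ B : Set (κ → Bool), B = {x | ¬ ∃ b₁ ∈ T, ∃ b₂ ∈ T, ∃ b₃ ∈ T, (b₁ ≠ b₂ ∧
    b₁ ≠ b₃ ∧ b₂ ≠ b₃) ∧ x b₁ = true ∧ x b₂ = true ∧ x b₃ = true} := ⟨_, rfl⟩
  have hTκ : t ≤ Fintype.card κ := ht ▸ Finset.card_le_univ T
  have h1 : (B.ncard : ℝ) ≤ ((Fintype.card κ : ℝ) ^ 2 + 1) * 2 ^ (Fintype.card κ - t) := by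
    have h2 := ncard_le_of_fibres (S := B) (D := (Set.univ : Set (Option (κ × κ))))
      (φ := fun x d => ∀ b ∈ T, (x b = true ↔ ∃ p ∈ d, b = p.1 ∨ b = p.2))
      (M := 2 ^ (Fintype.card κ - t)) ?_ ?_
    · rw [Set.ncard_univ, Nat.card_eq_fintype_card, Fintype.card_option, Fintype.card_prod] at h2
      push_cast at h2
      rwa [← sq] at h2
    · intro x hx
      rw [hB] at hx
      by_cases hp : ∃ p ∈ T, x p = true
      · obtain ⟨p, hpT, hp⟩ := hp
        by_cases hq : ∃ q ∈ T, p ≠ q ∧ x q = true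
        · obtain ⟨q, hqT, hpq, hq⟩ := hq
          refine ⟨some (p, q), Set.mem_univ _, fun b hb => ?_⟩
          simp only [Option.mem_some_iff, exists_eq_left']
          constructor
          · intro hxb
            by_contra hne
            push Not at hne
            exact hx ⟨p, hpT, q, hqT, b, hb, ⟨hpq, hne.1.symm, hne.2.symm⟩, hp, hq, hxb⟩
          · rintro (rfl | rfl) <;> assumption
        · push Not at hq
          refine ⟨some (p, p), Set.mem_univ _, fun b hb => ?_⟩
          simp only [Option.mem_some_iff, exists_eq_left', or_self]
          constructor
          · intro hxb
            by_contra hne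
            exact hq b hb (Ne.symm hne) hxb
          · rintro rfl; assumption
      · push Not at hp
        exact ⟨none, Set.mem_univ _, fun b hb => by simp [hp b hb]⟩
    · intro d _
      have e1 : (Set.univ : Set ({b // b ∉ T} → Bool)).ncard = 2 ^ (Fintype.card κ - t) := by
        rw [Set.ncard_univ, Nat.card_eq_fintype_card]
        simp [Fintype.card_subtype_compl, ht]
      have h3 : Set.ncard {x | x ∈ B ∧ ∀ b ∈ T, (x b = true ↔ ∃ p ∈ d, b = p.1 ∨ b = p.2)} ≤
          2 ^ (Fintype.card κ - t) := by
        rw [← e1]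
        refine Set.ncard_le_ncard_of_injOn (fun x b => x b.1) (fun _ _ => Set.mem_univ _) ?_
          (Set.toFinite _)
        intro x hx y hy hxy
        funext b
        by_cases hb : b ∈ T
        · rw [Bool.eq_iff_iff, hx.2 b hb, hy.2 b hb]
        · exact congrFun hxy ⟨b, hb⟩
      exact_mod_cast h3
  have h2 := ncard_exists_row_le (ι := ι) (B := fun _ => B)
    (p := ((Fintype.card κ : ℝ) ^ 2 + 1) / 2 ^ t) fun _ => by
      refine h1.trans (le_of_eq ?_)
      rw [pow_sub₀ _ two_ne_zero hTκ]
      ring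
  rw [hB] at h2
  refine h2.trans ?_
  rw [← mul_assoc]
  refine mul_le_mul_of_nonneg_right ?_ (by positivity)
  have hnt : (n : ℝ) ≤ (t : ℝ) ^ 4 := by rw [ht]; exact_mod_cast hT
  have hk : (Fintype.card ι : ℝ) ≤ ((t : ℝ) + 2) ^ 4 := by
    have h3 : (Fintype.card ι : ℝ) ≤ n := by exact_mod_cast hι
    refine h3.trans (hnt.trans (pow_le_pow_left₀ (Nat.cast_nonneg _) (by linarith) _))
  have hm : (Fintype.card κ : ℝ) ≤ ((t : ℝ) + 2) ^ 4 := by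
    have h3 : (Fintype.card κ : ℝ) ≤ n := by exact_mod_cast hκ
    refine h3.trans (hnt.trans (pow_le_pow_left₀ (Nat.cast_nonneg _) (by linarith) _))
  have hY : (1 : ℝ) ≤ ((t : ℝ) + 2) ^ 4 :=
    one_le_pow₀ (by have : (0 : ℝ) ≤ t := Nat.cast_nonneg _
                    linarith)
  obtain ⟨Y, hYd⟩ : ∃ Y : ℝ, Y = ((t : ℝ) + 2) ^ 4 := ⟨_, rfl⟩
  rw [← hYd] at hk hm hY
  have h3 : (Fintype.card κ : ℝ) ^ 2 + 1 ≤ 2 * Y ^ 2 := by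
    have := pow_le_pow_left₀ (Nat.cast_nonneg _) hm 2
    nlinarith
  have h4 : (Fintype.card ι : ℝ) * ((Fintype.card κ : ℝ) ^ 2 + 1) ≤ 2 * Y ^ 3 := by
    calc _ ≤ Y * (2 * Y ^ 2) := mul_le_mul hk h3 (by positivity) (by linarith)
      _ = 2 * Y ^ 3 := by ring
  have h5 : 2 * Y ^ 3 ≤ ε * 2 ^ t := by
    have : Y ^ 3 = ((t : ℝ) + 2) ^ 12 := by rw [hYd]; ring
    rw [this]
    have h6 : (2 / ε) * ((t : ℝ) + 2) ^ 12 = 2 * ((t : ℝ) + 2) ^ 12 / ε := by ring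
    rw [h6, div_le_iff₀ hε] at hpoly
    linarith
  rw [← mul_div_assoc, div_le_iff₀ (by positivity)]
  exact h4.trans h5

section GoodIndices

/-- Every vertex of `C` has three independent neighbours outside `C`. -/
def Spread {V : Type*} (G : SimpleGraph V) (C : Set V) : Prop :=
  ∀ c ∈ C, ∃ b₁ ∉ C, ∃ b₂ ∉ C, ∃ b₃ ∉ C, (b₁ ≠ b₂ ∧ b₁ ≠ b₃ ∧ b₂ ≠ b₃) ∧
    (¬ G.Adj b₁ b₂ ∧ ¬ G.Adj b₁ b₃ ∧ ¬ G.Adj b₂ b₃) ∧ G.Adj c b₁ ∧ G.Adj c b₂ ∧ G.Adj c b₃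

/-- `C` and the cliques of `R` have moderate sizes, and `R` has many cliques. -/
def GoodIndex {V : Type*} [Fintype V] (C : Set V) (R : SimpleGraph V) : Prop :=
  (2 * Fintype.card V ≤ 5 * Nat.card ↥C ∧ 5 * Nat.card ↥C ≤ 3 * Fintype.card V) ∧
    (∀ b, 5 * outDegree C R b ≤ 2 * Fintype.card V) ∧
    ∃ T : Finset ↥Cᶜ, (∀ b ∈ T, ∀ b' ∈ T, ¬ R.Adj b b') ∧ Fintype.card V ≤ T.card ^ 4

lemma Spread.subset {V : Type*} {G : SimpleGraph V} {C C' : Set V} (h : Spread G C)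
    (hC : G.IsClique C') (hP : P3FreeOn G C'ᶜ) : C ⊆ C' := by
  intro c hc
  by_contra hcC
  obtain ⟨b₁, -, b₂, -, b₃, -, ⟨n12, n13, n23⟩, ⟨a12, a13, a23⟩, c1, c2, c3⟩ := h c hc
  have key : ∀ u v, u ≠ v → ¬ G.Adj u v → G.Adj c u → G.Adj c v → u ∈ C' ∨ v ∈ C' := by
    intro u v huv hna hu hv
    by_contra hno
    push Not at hno
    exact hna (hP u hno.1 c hcC v hno.2 hu.symm hv huv)
  have key2 : ∀ u v, u ≠ v → ¬ G.Adj u v → u ∈ C' → v ∈ C' → False :=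
    fun u v huv hna hu hv => hna (hC hu hv huv)
  have := key _ _ n12 a12 c1 c2
  have := key _ _ n13 a13 c1 c3
  have := key _ _ n23 a23 c2 c3
  have := key2 _ _ n12 a12
  have := key2 _ _ n13 a13
  have := key2 _ _ n23 a23
  tauto

lemma ncard_or_le {α : Type*} [Finite α] {P Q : α → Prop} {x y : ℝ}
    (hP : (Set.ncard {a | P a} : ℝ) ≤ x) (hQ : (Set.ncard {a | Q a} : ℝ) ≤ y) :
    (Set.ncard {a | P a ∨ Q a} : ℝ) ≤ x + y := by
  have h : (Set.ncard {a | P a ∨ Q a} : ℝ) ≤ Set.ncard {a | P a} + Set.ncard {a | Q a} := by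
    exact_mod_cast Set.ncard_union_le _ _
  linarith

lemma eventually_spread {ε : ℝ} (hε : 0 < ε) :
    ∀ᶠ n : ℕ in atTop, ∀ (C : Set (Fin n)) (R : SimpleGraph (Fin n)), GoodIndex C R →
      (Set.ncard {G | G ∈ fibre C R ∧ ¬ Spread G C} : ℝ) ≤ ε * (fibre C R).ncard := by
  filter_upwards [eventually_three_ones hε] with n hn C R ⟨_, _, T, hT, hTn⟩
  rw [Fintype.card_fin] at hTn
  have hc1 : Fintype.card ↥C ≤ n := (Fintype.card_subtype_le _).trans_eq (Fintype.card_fin n)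
  have hc2 : Fintype.card ↥Cᶜ ≤ n := (Fintype.card_subtype_le _).trans_eq (Fintype.card_fin n)
  refine ncard_fibre_inter_le ?_ (hn ↥C ↥Cᶜ T hc1 hc2 hTn) hε.le
  intro G hG hs
  by_contra hno
  push Not at hno
  refine hs fun c hc => ?_
  obtain ⟨b₁, h1, b₂, h2, b₃, h3, ⟨n12, n13, n23⟩, c1, c2, c3⟩ := hno ⟨c, hc⟩
  have hne : ∀ b b' : ↥Cᶜ, b ≠ b' → b.1 ≠ b'.1 := fun b b' h e => h (Subtype.ext e)
  have hna : ∀ b ∈ T, ∀ b' ∈ T, ¬ G.Adj b.1 b'.1 := fun b hb b' hb' h =>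
    hT b hb b' hb' ((hG.2 b.1 b.2 b'.1 b'.2).1 h)
  refine ⟨b₁, b₁.2, b₂, b₂.2, b₃, b₃.2, ⟨hne _ _ n12, hne _ _ n13, hne _ _ n23⟩,
    ⟨hna _ h1 _ h2, hna _ h1 _ h3, hna _ h2 _ h3⟩, ?_, ?_, ?_⟩
  · simpa [crossMatrix] using c1
  · simpa [crossMatrix] using c2
  · simpa [crossMatrix] using c3

lemma eventually_uniqueMax {ε : ℝ} (hε : 0 < ε) :
    ∀ᶠ n : ℕ in atTop, ∀ (C : Set (Fin n)) (R : SimpleGraph (Fin n)), GoodIndex C R →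
      (Set.ncard {G | G ∈ fibre C R ∧ ¬ (UniqueMax G ∧ UniqueMax Gᶜ)} : ℝ) ≤
        ε * (fibre C R).ncard := by
  have hε' : 0 < ε / 6 := by positivity
  have hη : (0 : ℝ) < 1 / 40 := by norm_num
  obtain ⟨N₁, h1⟩ := eventually_atTop.1 (eventually_rowSize_lt hη hε')
  obtain ⟨N₂, h2⟩ := eventually_atTop.1 (eventually_lt_rowSize hη hε')
  obtain ⟨N₃, h3⟩ := eventually_atTop.1 (eventually_margin hε')
  filter_upwards [eventually_ge_atTop (40 + 5 * (N₁ + N₂ + N₃))] with n hn C R hg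
  obtain ⟨⟨hk1, hk2⟩, hR, -⟩ := hg
  rw [Fintype.card_fin] at hk1 hk2
  have hkm : Nat.card ↥C + Nat.card ↥Cᶜ = n := by
    have := Set.ncard_add_ncard_compl C
    rwa [Nat.card_eq_fintype_card, Fintype.card_fin] at this
  obtain ⟨k, hk⟩ : ∃ k, k = Fintype.card ↥C := ⟨_, rfl⟩
  obtain ⟨m, hm⟩ : ∃ m, m = Fintype.card ↥Cᶜ := ⟨_, rfl⟩
  rw [Nat.card_eq_fintype_card, ← hk] at hk1 hk2
  rw [Nat.card_eq_fintype_card, Nat.card_eq_fintype_card, ← hk, ← hm] at hkm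
  have : Nonempty ↥C := Fintype.card_pos_iff.1 (by omega)
  have : Nonempty ↥Cᶜ := Fintype.card_pos_iff.1 (by omega)
  have a1 := h1 m (by omega) ↥C ↥Cᶜ hm.symm (by omega)
  have a2 := h2 m (by omega) ↥C ↥Cᶜ hm.symm (by omega)
  have a3 := h3 m (by omega) ↥C ↥Cᶜ (fun _ => 0) hm.symm (by omega)
  have b1 := h1 k (by omega) ↥Cᶜ ↥C hk.symm (by omega)
  have b2 := h2 k (by omega) ↥Cᶜ ↥C hk.symm (by omega)
  have b3 := h3 k (by omega) ↥Cᶜ ↥C (outCodegree C R) hk.symm (by omega)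
  rw [mul_comm (Fintype.card ↥Cᶜ)] at b1 b2 b3
  have b1' := (Nat.cast_le.2 (ncard_transpose_le (ι := ↥C) (κ := ↥Cᶜ) _
    (Function.injective_id (α := Bool)))).trans b1
  have b2' := (Nat.cast_le.2 (ncard_transpose_le (ι := ↥C) (κ := ↥Cᶜ) _
    (Function.injective_id (α := Bool)))).trans b2
  have b3' := (Nat.cast_le.2 (ncard_transpose_le (ι := ↥C) (κ := ↥Cᶜ) _
    (Function.Involutive.injective Bool.not_not))).trans b3
  have hall := ncard_or_le a1 (ncard_or_le a2 (ncard_or_le a3 (ncard_or_le b1'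
    (ncard_or_le b2' b3'))))
  refine ncard_fibre_inter_le ?_ (hall.trans (le_of_eq (by ring))) hε.le
  intro G hG hu
  by_contra hno
  simp only [not_or, not_exists, not_le, id] at hno
  obtain ⟨c1, c2, c3, c4, c5, c6⟩ := hno
  refine hu (uniqueMax_of_margin hG (k := k) (m := m) (by rw [hk, Nat.card_eq_fintype_card])
    (by rw [hm, Nat.card_eq_fintype_card]) ?_ ?_ ?_ ?_ ?_ ?_)
  · exact_mod_cast (show 40 ≤ k + m by omega)
  · intro b
    have := hR b
    rw [Fintype.card_fin] at this
    rw [show (k : ℝ) + m = n by exact_mod_cast hkm]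
    exact_mod_cast this
  · exact fun a => ⟨by linarith [c2 a], by linarith [c1 a]⟩
  · exact fun b => ⟨by linarith [c5 b], by linarith [c4 b]⟩
  · exact not_forall_not.1 c3
  · exact not_forall_not.1 c6

lemma ncard_le_of_disjoint {α β : Type*} [Finite α] [Finite β] {S U : Set α} {D : Set β}
    {φ ψ : β → Set α} {ε : ℝ} (hε : 0 ≤ ε) (hS : ∀ a ∈ S, ∃ d ∈ D, a ∈ φ d)
    (h : ∀ d ∈ D, ((φ d).ncard : ℝ) ≤ ε * (ψ d).ncard) (hU : ∀ d ∈ D, ψ d ⊆ U)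
    (hψ : ∀ d ∈ D, ∀ d' ∈ D, ∀ a, a ∈ ψ d → a ∈ ψ d' → d = d') :
    (S.ncard : ℝ) ≤ ε * U.ncard := by
  have := Fintype.ofFinite α
  have := Fintype.ofFinite β
  simp only [Set.ncard_eq_toFinset_card'] at h ⊢
  have h1 : S.toFinset ⊆ D.toFinset.biUnion fun d => (φ d).toFinset := by
    intro a ha
    obtain ⟨d, hd, had⟩ := hS a (Set.mem_toFinset.1 ha)
    exact Finset.mem_biUnion.2 ⟨d, Set.mem_toFinset.2 hd, Set.mem_toFinset.2 had⟩
  have h2 : (D.toFinset.biUnion fun d => (ψ d).toFinset) ⊆ U.toFinset := by grind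
  have h3 := (Finset.card_le_card h1).trans Finset.card_biUnion_le
  have h4 := Finset.card_le_card h2
  rw [Finset.card_biUnion fun d hd d' hd' hne => Finset.disjoint_left.2 fun a ha ha' =>
    hne (hψ d (Set.mem_toFinset.1 hd) d' (Set.mem_toFinset.1 hd') a (Set.mem_toFinset.1 ha)
      (Set.mem_toFinset.1 ha'))] at h4
  calc (S.toFinset.card : ℝ) ≤ ∑ d ∈ D.toFinset, ((φ d).toFinset.card : ℝ) := by exact_mod_cast h3
    _ ≤ ∑ d ∈ D.toFinset, ε * ((ψ d).toFinset.card : ℝ) :=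
      Finset.sum_le_sum fun d hd => h d (Set.mem_toFinset.1 hd)
    _ = ε * ∑ d ∈ D.toFinset, ((ψ d).toFinset.card : ℝ) := (Finset.mul_sum _ _ _).symm
    _ ≤ ε * U.toFinset.card := mul_le_mul_of_nonneg_left (by exact_mod_cast h4) hε

/-- The graph obtained from `G` by removing the edges meeting `C`. -/
def outsideGraph {V : Type*} (G : SimpleGraph V) (C : Set V) : SimpleGraph V where
  Adj u v := u ∉ C ∧ v ∉ C ∧ G.Adj u v
  symm := ⟨fun _ _ h => ⟨h.2.1, h.1, h.2.2.symm⟩⟩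
  loopless := ⟨fun _ h => h.2.2.ne rfl⟩

lemma mem_fibre_outsideGraph {V : Type*} {G : SimpleGraph V} {C : Set V} (h : G.IsClique C) :
    G ∈ fibre C (outsideGraph G C) :=
  ⟨h, fun _ hu _ hv => ⟨fun h => ⟨hu, hv, h⟩, fun h => h.2.2⟩⟩

lemma eventually_goodIndex_le {ε : ℝ} (hε : 0 < ε) :
    ∀ᶠ n : ℕ in atTop,
      (Set.ncard {G : SimpleGraph (Fin n) | (∃ C, IsUnipolarArrangement G C ∧
        GoodIndex C (outsideGraph G C)) ∧ ¬ (UniqueMax G ∧ UniqueMax Gᶜ)} : ℝ) ≤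
        ε * countUnipolar n := by
  filter_upwards [eventually_uniqueMax (half_pos hε), eventually_spread (half_pos one_pos)]
    with n h1 h2
  have hP3 : ∀ (G : SimpleGraph (Fin n)) (C : Set (Fin n)) (R : SimpleGraph (Fin n)),
      G ∈ fibre C R → (P3FreeOn R Cᶜ ↔ P3FreeOn G Cᶜ) := by
    intro G C R hG
    constructor
    · intro h u hu v hv w hw h1 h2 h3
      exact (hG.2 u hu w hw).2
        (h u hu v hv w hw ((hG.2 u hu v hv).1 h1) ((hG.2 v hv w hw).1 h2) h3)
    · intro h u hu v hv w hw h1 h2 h3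
      exact (hG.2 u hu w hw).1
        (h u hu v hv w hw ((hG.2 u hu v hv).2 h1) ((hG.2 v hv w hw).2 h2) h3)
  refine ncard_le_of_disjoint (β := Set (Fin n) × SimpleGraph (Fin n))
    (D := {d | GoodIndex d.1 d.2 ∧ P3FreeOn d.2 d.1ᶜ ∧ ∀ u v, d.2.Adj u v → u ∉ d.1 ∧ v ∉ d.1})
    (φ := fun d => {G | G ∈ fibre d.1 d.2 ∧ ¬ (UniqueMax G ∧ UniqueMax Gᶜ)})
    (ψ := fun d => {G | G ∈ fibre d.1 d.2 ∧ Spread G d.1}) hε.le ?_ ?_ ?_ ?_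
  · rintro G ⟨⟨C, hC, hg⟩, hu⟩
    rw [isUnipolarArrangement_iff] at hC
    have hf := mem_fibre_outsideGraph hC.1
    exact ⟨(C, outsideGraph G C), ⟨hg, (hP3 _ _ _ hf).2 hC.2, fun u v h => ⟨h.1, h.2.1⟩⟩, hf, hu⟩
  · rintro ⟨C, R⟩ ⟨hg, -, -⟩
    have e1 := h1 C R hg
    have e2 := h2 C R hg
    have e3 : (fibre C R).ncard ≤ Set.ncard {G | G ∈ fibre C R ∧ Spread G C} +
        Set.ncard {G | G ∈ fibre C R ∧ ¬ Spread G C} := by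
      refine le_trans (Set.ncard_le_ncard (fun G hG => ?_) (Set.toFinite _))
        (Set.ncard_union_le _ _)
      by_cases hs : Spread G C
      exacts [Or.inl ⟨hG, hs⟩, Or.inr ⟨hG, hs⟩]
    have e4 : ((fibre C R).ncard : ℝ) ≤ Set.ncard {G | G ∈ fibre C R ∧ Spread G C} +
        Set.ncard {G | G ∈ fibre C R ∧ ¬ Spread G C} := by exact_mod_cast e3
    have e5 : ((fibre C R).ncard : ℝ) ≤ 2 * Set.ncard {G | G ∈ fibre C R ∧ Spread G C} := by
      linarith
    have e6 := mul_le_mul_of_nonneg_left e5 (half_pos hε).le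
    refine e1.trans (e6.trans (le_of_eq (by ring)))
  · rintro ⟨C, R⟩ ⟨-, hR, -⟩ G ⟨hG, -⟩
    exact ⟨C, isUnipolarArrangement_iff.2 ⟨hG.1, (hP3 _ _ _ hG).1 hR⟩⟩
  · rintro ⟨C, R⟩ ⟨-, hR, hRC⟩ ⟨C', R'⟩ ⟨-, hR', hRC'⟩ G ⟨hG, hs⟩ ⟨hG', hs'⟩
    have e1 : C = C' := (hs.subset hG'.1 ((hP3 _ _ _ hG').1 hR')).antisymm
      (hs'.subset hG.1 ((hP3 _ _ _ hG).1 hR))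
    subst e1
    have e2 : R = R' := by
      ext u v
      constructor
      · intro h
        obtain ⟨hu, hv⟩ := hRC u v h
        exact (hG'.2 u hu v hv).1 ((hG.2 u hu v hv).2 h)
      · intro h
        obtain ⟨hu, hv⟩ := hRC' u v h
        exact (hG.2 u hu v hv).1 ((hG'.2 u hu v hv).2 h)
    rw [e2]

end GoodIndices

section BadIndices

lemma ncard_le_of_codes {V : Type*} [Fintype V] {S : Set (SimpleGraph V)}
    {X : Set V → Set V → Set (V → V)} {M E : ℝ} (hX : ∀ C K, ((X C K).ncard : ℝ) ≤ M)
    (hS : ∀ G ∈ S, ∃ (C K : Set V) (g : V → V), g ∈ X C K ∧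
      (Nat.card ↥C : ℝ) * Nat.card ↥Cᶜ ≤ E ∧ G.IsClique C ∧
      ∀ u ∉ C, ∀ v ∉ C, (G.Adj u v ↔ u ≠ v ∧ g u = g v)) :
    (S.ncard : ℝ) ≤ 4 ^ Fintype.card V * M * 2 ^ E := by
  obtain ⟨D, hD⟩ : ∃ D : Set ((Set V × Set V) × (V → V)),
      D = {d : (Set V × Set V) × (V → V) | d.2 ∈ X d.1.1 d.1.2 ∧
    (Nat.card ↥d.1.1 : ℝ) * Nat.card ↥d.1.1ᶜ ≤ E} := ⟨_, rfl⟩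
  have h1 : (D.ncard : ℝ) ≤ 4 ^ Fintype.card V * M := by
    have h2 := ncard_le_of_fibres (S := D) (D := Set.univ) (φ := fun d c => d.1 = c) (M := M)
      (fun d _ => ⟨d.1, Set.mem_univ _, rfl⟩) fun c _ => ?_
    · rw [Set.ncard_univ, Nat.card_eq_fintype_card, Fintype.card_prod, Fintype.card_set,
        ← mul_pow] at h2
      exact_mod_cast h2
    · refine le_trans (Nat.cast_le.2 ?_) (hX c.1 c.2)
      refine Set.ncard_le_ncard_of_injOn (fun d => d.2) ?_ ?_ (Set.toFinite _)
      · rintro d ⟨hd, rfl⟩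
        rw [hD] at hd
        exact hd.1
      · intro d hd d' hd' h
        exact Prod.ext (hd.2.trans hd'.2.symm) h
  refine (ncard_le_of_fibres (S := S) (D := D) (M := 2 ^ E) (φ := fun G d => G.IsClique d.1.1 ∧
      ∀ u ∉ d.1.1, ∀ v ∉ d.1.1, (G.Adj u v ↔ u ≠ v ∧ d.2 u = d.2 v)) ?_ ?_).trans
    (mul_le_mul_of_nonneg_right h1 (by positivity))
  · intro G hG
    obtain ⟨C, K, g, hg, hE, hC, h⟩ := hS G hG
    exact ⟨((C, K), g), by rw [hD]; exact ⟨hg, hE⟩, hC, h⟩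
  · rintro ⟨⟨C, K⟩, g⟩ hd
    rw [hD] at hd
    obtain ⟨F, hF⟩ : ∃ F, F = {G | G ∈ S ∧ G.IsClique C ∧
      ∀ u ∉ C, ∀ v ∉ C, (G.Adj u v ↔ u ≠ v ∧ g u = g v)} := ⟨_, rfl⟩
    change (Set.ncard {G | G ∈ S ∧ G.IsClique C ∧
      ∀ u ∉ C, ∀ v ∉ C, (G.Adj u v ↔ u ≠ v ∧ g u = g v)} : ℝ) ≤ _
    rw [← hF]
    rcases F.eq_empty_or_nonempty with h0 | ⟨G₀, hG₀⟩
    · rw [h0, Set.ncard_empty, Nat.cast_zero]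
      positivity
    · rw [hF] at hG₀
      have h2 : F ⊆ fibre C G₀ := by
        intro G hG
        rw [hF] at hG
        exact ⟨hG.2.1, fun u hu v hv => (hG.2.2 u hu v hv).trans (hG₀.2.2 u hu v hv).symm⟩
      have h3 : F.ncard ≤ 2 ^ (Nat.card ↥C * Nat.card ↥Cᶜ) := by
        refine (Set.ncard_le_ncard_of_injOn (t := Set.univ) _ (fun _ _ => Set.mem_univ _)
          (crossMatrix_injOn.mono h2) (Set.toFinite _)).trans (le_of_eq ?_)
        rw [Set.ncard_univ, Nat.card_fun, Nat.card_fun, Nat.card_eq_fintype_card (α := Bool),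
          Fintype.card_bool, ← pow_mul, mul_comm]
      calc (F.ncard : ℝ) ≤ 2 ^ (Nat.card ↥C * Nat.card ↥Cᶜ) := by exact_mod_cast h3
        _ = (2 : ℝ) ^ ((Nat.card ↥C : ℝ) * Nat.card ↥Cᶜ) := by
          rw [← Nat.cast_mul, Real.rpow_natCast]
        _ ≤ 2 ^ E := Real.rpow_le_rpow_of_exponent_le one_le_two hd.2

lemma ncard_constant_le {n : ℕ} (C K : Set (Fin n)) (hCK : Disjoint C K)
    (hC : 2 * n ≤ 5 * C.ncard) (hK : 2 * n ≤ 5 * K.ncard) (hn : 1 ≤ n) :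
    (Set.ncard {g : Fin n → Fin n | (∀ v ∈ C, g v = v) ∧ ∀ u ∈ K, ∀ v ∈ K, g u = g v} : ℝ) ≤
      n * (n : ℝ) ^ ((n : ℝ) / 5) := by
  obtain ⟨p, hp⟩ : K.Nonempty := (Set.ncard_pos (Set.toFinite _)).1 (by omega)
  have h1 : Set.ncard {g : Fin n → Fin n | (∀ v ∈ C, g v = v) ∧ ∀ u ∈ K, ∀ v ∈ K, g u = g v} ≤
      n * n ^ (Set.ncard (C ∪ K)ᶜ) := by
    refine (Set.ncard_le_ncard_of_injOn (t := Set.univ)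
      (fun g => ((g p, fun v => g v.1) : Fin n × (↥(C ∪ K)ᶜ → Fin n)))
      (fun _ _ => Set.mem_univ _) ?_ (Set.toFinite _)).trans (le_of_eq ?_)
    · intro g hg g' hg' h
      obtain ⟨e1, e2⟩ := Prod.mk.inj h
      funext v
      by_cases hv : v ∈ C
      · rw [hg.1 v hv, hg'.1 v hv]
      · by_cases hvK : v ∈ K
        · rw [hg.2 v hvK p hp, hg'.2 v hvK p hp, e1]
        · exact congrFun e2 ⟨v, fun h => h.elim hv hvK⟩
    · rw [Set.ncard_univ, Nat.card_prod, Nat.card_fun, Nat.card_fin]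
      rfl
  have h2 := Set.ncard_add_ncard_compl (C ∪ K)
  rw [Set.ncard_union_eq hCK, Nat.card_fin] at h2
  have h3 : (Set.ncard (C ∪ K)ᶜ : ℝ) ≤ (n : ℝ) / 5 := by
    rw [le_div_iff₀ (by norm_num)]
    exact_mod_cast (show Set.ncard (C ∪ K)ᶜ * 5 ≤ n by omega)
  refine (Nat.cast_le.2 h1).trans ?_
  rw [Nat.cast_mul, Nat.cast_pow, ← Real.rpow_natCast]
  exact mul_le_mul_of_nonneg_left
    (Real.rpow_le_rpow_of_exponent_le (by exact_mod_cast hn) h3) (Nat.cast_nonneg _)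

lemma ncard_small_range_le {n : ℕ} (C K : Set (Fin n)) (hC : 5 * Cᶜ.ncard ≤ 3 * n)
    (hK : K.ncard ^ 4 < n) :
    (Set.ncard {g : Fin n → Fin n | (∀ v ∈ C, g v = v) ∧ ∀ v ∉ C, g v ∈ K} : ℝ) ≤
      n * (n : ℝ) ^ ((n : ℝ) / 5) := by
  have hn : (1 : ℝ) ≤ n := by exact_mod_cast (show 1 ≤ n by omega)
  have h1 : Set.ncard {g : Fin n → Fin n | (∀ v ∈ C, g v = v) ∧ ∀ v ∉ C, g v ∈ K} ≤
      K.ncard ^ Cᶜ.ncard := by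
    rw [← Nat.card_coe_set_eq K, ← Nat.card_coe_set_eq Cᶜ, ← Nat.card_fun, ← Nat.card_coe_set_eq]
    refine Nat.card_le_card_of_injective (fun g v => ⟨g.1 v.1, g.2.2 v.1 v.2⟩) ?_
    intro g g' h
    refine Subtype.ext (funext fun v => ?_)
    by_cases hv : v ∈ C
    · rw [g.2.1 v hv, g'.2.1 v hv]
    · exact congrArg Subtype.val (congrFun h ⟨v, hv⟩)
  have h2 : (K.ncard : ℝ) ≤ (n : ℝ) ^ ((1 : ℝ) / 4) := by
    rw [one_div, Real.le_rpow_inv_iff_of_pos (Nat.cast_nonneg _) (Nat.cast_nonneg _) (by norm_num)]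
    rw [show (4 : ℝ) = ((4 : ℕ) : ℝ) by norm_num, Real.rpow_natCast]
    exact_mod_cast hK.le
  have h3 : (Cᶜ.ncard : ℝ) * 5 ≤ 3 * n := by exact_mod_cast (show Cᶜ.ncard * 5 ≤ 3 * n by omega)
  calc _ ≤ ((K.ncard : ℝ)) ^ Cᶜ.ncard := by exact_mod_cast h1
    _ ≤ ((n : ℝ) ^ ((1 : ℝ) / 4)) ^ Cᶜ.ncard := pow_le_pow_left₀ (Nat.cast_nonneg _) h2 _
    _ = (n : ℝ) ^ ((1 : ℝ) / 4 * Cᶜ.ncard) := by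
      rw [← Real.rpow_natCast, ← Real.rpow_mul (Nat.cast_nonneg _)]
    _ ≤ (n : ℝ) ^ ((n : ℝ) / 5) := Real.rpow_le_rpow_of_exponent_le hn (by linarith)
    _ ≤ n * (n : ℝ) ^ ((n : ℝ) / 5) := le_mul_of_one_le_left (by positivity) hn

/-- Arrangements which are not good have an atypical size, a large clique, or few cliques. -/
lemma code_of_not_goodIndex {n : ℕ} {G : SimpleGraph (Fin n)} {C : Set (Fin n)}
    (hC : IsUnipolarArrangement G C) (h : ¬ GoodIndex C (outsideGraph G C)) :
    ∃ g : Fin n → Fin n, (∀ u ∉ C, ∀ v ∉ C, (G.Adj u v ↔ u ≠ v ∧ g u = g v)) ∧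
      ((5 * C.ncard < 2 * n ∨ 3 * n < 5 * C.ncard) ∨ 2 * n ≤ 5 * C.ncard ∧
        (∃ K, (Disjoint C K ∧ 2 * n ≤ 5 * K.ncard) ∧
          (∀ v ∈ C, g v = v) ∧ ∀ u ∈ K, ∀ v ∈ K, g u = g v) ∨
        5 * Cᶜ.ncard ≤ 3 * n ∧ ∃ K : Set (Fin n), K.ncard ^ 4 < n ∧
          (∀ v ∈ C, g v = v) ∧ ∀ v ∉ C, g v ∈ K) := by
  have hcc := Set.ncard_add_ncard_compl C
  rw [Nat.card_fin] at hcc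
  rw [isUnipolarArrangement_iff] at hC
  obtain ⟨g, hg, hgG⟩ := exists_leader (G := G) (J := Set.toFinset Cᶜ)
    (by rw [Set.coe_toFinset]; exact hC.2)
  simp only [Set.mem_toFinset, Set.mem_compl_iff, not_not] at hg hgG
  have hg' : ∀ v ∈ C, g v = v := hg
  refine ⟨g, fun u hu v hv => hgG u hu v hv, ?_⟩
  by_cases ha : 5 * C.ncard < 2 * n ∨ 3 * n < 5 * C.ncard
  · exact Or.inl ha
  · push Not at ha
    refine Or.inr ?_
    by_cases hb : ∃ b, 2 * n < 5 * outDegree C (outsideGraph G C) b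
    · obtain ⟨b, hb⟩ := hb
      refine Or.inl ⟨ha.1, Subtype.val '' {b' : ↥Cᶜ | (outsideGraph G C).Adj b b'}, ⟨?_, ?_⟩, hg', ?_⟩
      · rw [Set.disjoint_left]
        rintro _ hv ⟨b', -, rfl⟩
        exact b'.2 hv
      · rw [Set.ncard_image_of_injective _ Subtype.val_injective]
        exact hb.le
      · have h1 : ∀ u ∈ Subtype.val '' {b' : ↥Cᶜ | (outsideGraph G C).Adj b b'}, g u = g b := by
          rintro _ ⟨b', hb', rfl⟩
          exact ((hgG b b.2 b' b'.2).1 hb'.2.2).2.symm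
        exact fun u hu v hv => (h1 u hu).trans (h1 v hv).symm
    · push Not at hb
      refine Or.inr ⟨by omega, g '' Cᶜ, ?_, hg', fun v hv => ⟨v, hv, rfl⟩⟩
      by_contra hK
      refine h ⟨?_, ?_, ?_⟩
      · rw [Fintype.card_fin]
        exact ha
      · rw [Fintype.card_fin]
        exact hb
      · have hch : ∀ x : ↥(g '' Cᶜ), ∃ b : ↥Cᶜ, g b = x := fun ⟨_, v, hv, e⟩ => ⟨⟨v, hv⟩, e⟩
        choose σ hσ using hch
        refine ⟨Finset.univ.image σ, ?_, ?_⟩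
        · simp only [Finset.mem_image, Finset.mem_univ, true_and]
          rintro _ ⟨x, rfl⟩ _ ⟨y, rfl⟩ hxy
          have h1 := (hgG _ (σ x).2 _ (σ y).2).1 hxy.2.2
          rw [hσ, hσ] at h1
          exact h1.1 (by rw [Subtype.ext h1.2])
        · rw [Finset.card_image_of_injective _ fun x y hxy => Subtype.ext (by
            rw [← hσ x, ← hσ y, hxy]), Finset.card_univ, Fintype.card_fin,
            ← Nat.card_eq_fintype_card]
          exact not_lt.1 hK

lemma eventually_not_goodIndex_le {ε : ℝ} (hε : 0 < ε) :
    ∀ᶠ n : ℕ in atTop,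
      (Set.ncard {G : SimpleGraph (Fin n) | ∃ C, IsUnipolarArrangement G C ∧
        ¬ GoodIndex C (outsideGraph G C)} : ℝ) ≤ ε * countUnipolar n := by
  filter_upwards [eventually_le_mul_countUnipolar 8 (by norm_num) (show 0 < ε / 3 by positivity),
    eventually_poly_le 1 1 (show (0 : ℝ) < 1 / 100 by norm_num), eventually_ge_atTop 1]
    with n hU hpoly hn
  have hn' : (1 : ℝ) ≤ n := by exact_mod_cast hn
  have hkm : ∀ C : Set (Fin n), (Nat.card ↥C : ℝ) + Nat.card ↥Cᶜ = n := by
    intro C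
    have h := Set.ncard_add_ncard_compl C
    rw [Nat.card_fin] at h
    exact_mod_cast h
  have hquarter : ∀ C : Set (Fin n), (Nat.card ↥C : ℝ) * Nat.card ↥Cᶜ ≤ (n : ℝ) ^ 2 / 4 := by
    intro C
    rw [← hkm C]
    nlinarith [sq_nonneg ((Nat.card ↥C : ℝ) - Nat.card ↥Cᶜ)]
  have h2n : (n : ℝ) ≤ 2 ^ n := by exact_mod_cast n.lt_two_pow_self.le
  have h48 : (4 : ℝ) ^ n * 2 ^ n = 8 ^ n := by rw [← mul_pow]; norm_num
  have hbig : 4 ^ n * (n * (n : ℝ) ^ ((n : ℝ) / 5)) * 2 ^ ((n : ℝ) ^ 2 / 4) ≤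
      ε / 3 * countUnipolar n := by
    refine le_trans (mul_le_mul_of_nonneg_right ?_ (by positivity)) hU
    rw [← mul_assoc, ← h48]
    gcongr
  have hlog : (4 : ℝ) ^ n * (n : ℝ) ^ n * 2 ^ (6 / 25 * (n : ℝ) ^ 2) ≤ ε / 3 * countUnipolar n := by
    have h1 : (n : ℝ) ^ n ≤ 2 ^ (1 / 100 * (n : ℝ) ^ 2) := by
      calc (n : ℝ) ^ n ≤ (2 ^ (1 / 100 * (n : ℝ))) ^ n :=
            pow_le_pow_left₀ (by positivity) (by linarith) _
        _ = _ := by rw [← Real.rpow_natCast, ← Real.rpow_mul (by norm_num)]; congr 1; ring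
    have h2 : (1 : ℝ) ≤ n * (n : ℝ) ^ ((n : ℝ) / 5) :=
      one_le_mul_of_one_le_of_one_le hn' (Real.one_le_rpow hn' (by positivity))
    refine le_trans ?_ hbig
    calc (4 : ℝ) ^ n * (n : ℝ) ^ n * 2 ^ (6 / 25 * (n : ℝ) ^ 2)
        ≤ 4 ^ n * 2 ^ (1 / 100 * (n : ℝ) ^ 2) * 2 ^ (6 / 25 * (n : ℝ) ^ 2) := by gcongr
      _ = 4 ^ n * 1 * 2 ^ ((n : ℝ) ^ 2 / 4) := by
        rw [mul_assoc, ← Real.rpow_add two_pos, mul_one]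
        congr 2
        ring
      _ ≤ _ := by gcongr
  obtain ⟨code, hcode⟩ : ∃ code : SimpleGraph (Fin n) → Set (Fin n) → (Fin n → Fin n) → Prop,
      ∀ G C g, code G C g ↔ G.IsClique C ∧ ∀ u ∉ C, ∀ v ∉ C, (G.Adj u v ↔ u ≠ v ∧ g u = g v) :=
    ⟨_, fun _ _ _ => Iff.rfl⟩
  have hA : (Set.ncard {G | ∃ C g, code G C g ∧ (5 * C.ncard < 2 * n ∨ 3 * n < 5 * C.ncard)} : ℝ) ≤
      ε / 3 * countUnipolar n := by
    refine (ncard_le_of_codes (X := fun _ _ => Set.univ) (M := (n : ℝ) ^ n)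
      (E := 6 / 25 * (n : ℝ) ^ 2) (fun C K => ?_) ?_).trans
      (by rwa [Fintype.card_fin])
    · rw [Set.ncard_univ, Nat.card_fun, Nat.card_fin]
      exact_mod_cast le_rfl
    · rintro G ⟨C, g, hc, hs⟩
      rw [hcode] at hc
      refine ⟨C, ∅, g, Set.mem_univ _, ?_, hc⟩
      have h1 := hkm C
      have h2 : (5 * (Nat.card ↥C : ℝ) < 2 * n ∨ 3 * (n : ℝ) < 5 * Nat.card ↥C) := by
        rcases hs with h | h
        · exact Or.inl (by exact_mod_cast h)
        · exact Or.inr (by exact_mod_cast h)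
      obtain ⟨k, hk⟩ : ∃ k : ℝ, k = Nat.card ↥C := ⟨_, rfl⟩
      obtain ⟨m, hm⟩ : ∃ m : ℝ, m = Nat.card ↥Cᶜ := ⟨_, rfl⟩
      rw [← hk, ← hm] at h1 ⊢
      rw [← hk] at h2
      obtain rfl : m = n - k := by linarith
      rcases h2 with h | h <;> nlinarith
  have hB : (Set.ncard {G | ∃ C g, code G C g ∧ 2 * n ≤ 5 * C.ncard ∧
      ∃ K, (Disjoint C K ∧ 2 * n ≤ 5 * K.ncard) ∧
        (∀ v ∈ C, g v = v) ∧ ∀ u ∈ K, ∀ v ∈ K, g u = g v} : ℝ) ≤ ε / 3 * countUnipolar n := by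
    refine (ncard_le_of_codes (X := fun C K => {g | (2 * n ≤ 5 * C.ncard ∧ Disjoint C K ∧
      2 * n ≤ 5 * K.ncard) ∧ (∀ v ∈ C, g v = v) ∧ ∀ u ∈ K, ∀ v ∈ K, g u = g v})
      (M := n * (n : ℝ) ^ ((n : ℝ) / 5)) (E := (n : ℝ) ^ 2 / 4) (fun C K => ?_) ?_).trans
      (by rwa [Fintype.card_fin])
    · by_cases hc : 2 * n ≤ 5 * C.ncard ∧ Disjoint C K ∧ 2 * n ≤ 5 * K.ncard
      · simp only [hc, true_and]
        exact ncard_constant_le C K hc.2.1 hc.1 hc.2.2 hn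
      · simp only [hc, false_and, Set.ofPred_false, Set.ncard_empty, Nat.cast_zero]
        positivity
    · rintro G ⟨C, g, hc, h1, K, h2, h3⟩
      exact ⟨C, K, g, ⟨⟨h1, h2⟩, h3⟩, hquarter C, (hcode _ _ _).1 hc⟩
  have hD : (Set.ncard {G | ∃ C g, code G C g ∧ 5 * Cᶜ.ncard ≤ 3 * n ∧
      ∃ K : Set (Fin n), K.ncard ^ 4 < n ∧ (∀ v ∈ C, g v = v) ∧ ∀ v ∉ C, g v ∈ K} : ℝ) ≤
      ε / 3 * countUnipolar n := by
    refine (ncard_le_of_codes (X := fun C K => {g | (5 * Cᶜ.ncard ≤ 3 * n ∧ K.ncard ^ 4 < n) ∧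
      (∀ v ∈ C, g v = v) ∧ ∀ v ∉ C, g v ∈ K})
      (M := n * (n : ℝ) ^ ((n : ℝ) / 5)) (E := (n : ℝ) ^ 2 / 4) (fun C K => ?_) ?_).trans
      (by rwa [Fintype.card_fin])
    · by_cases hc : 5 * Cᶜ.ncard ≤ 3 * n ∧ K.ncard ^ 4 < n
      · simp only [hc, true_and]
        exact ncard_small_range_le C K hc.1 hc.2
      · simp only [hc, false_and, Set.ofPred_false, Set.ncard_empty, Nat.cast_zero]
        positivity
    · rintro G ⟨C, g, hc, h1, K, h2, h3⟩
      exact ⟨C, K, g, ⟨⟨h1, h2⟩, h3⟩, hquarter C, (hcode _ _ _).1 hc⟩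
  refine le_trans (Nat.cast_le.2 (Set.ncard_le_ncard ?_ (Set.toFinite _)))
    ((ncard_or_le hA (ncard_or_le hB hD)).trans (le_of_eq (by ring)))
  rintro G ⟨C, hC, hg⟩
  obtain ⟨g, hgG, h⟩ := code_of_not_goodIndex hC hg
  have hc := (hcode G C g).2 ⟨(isUnipolarArrangement_iff.1 hC).1, hgG⟩
  exact h.imp (fun h => ⟨C, g, hc, h⟩) (Or.imp (fun h => ⟨C, g, hc, h⟩) fun h => ⟨C, g, hc, h⟩)

lemma eventually_not_uniqueMax_le {ε : ℝ} (hε : 0 < ε) :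
    ∀ᶠ n : ℕ in atTop,
      (Set.ncard {G : SimpleGraph (Fin n) | IsUnipolar G ∧ ¬ (UniqueMax G ∧ UniqueMax Gᶜ)} : ℝ) ≤
        ε * countUnipolar n := by
  filter_upwards [eventually_goodIndex_le (half_pos hε),
    eventually_not_goodIndex_le (half_pos hε)] with n h1 h2
  refine le_trans (Nat.cast_le.2 (Set.ncard_le_ncard ?_ (Set.toFinite _)))
    ((ncard_or_le h1 h2).trans (le_of_eq (by ring)))
  rintro G ⟨⟨C, hC⟩, hu⟩
  by_cases hg : GoodIndex C (outsideGraph G C)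
  · exact Or.inl ⟨⟨C, hC, hg⟩, hu⟩
  · exact Or.inr ⟨C, hC, hg⟩

end BadIndices

lemma ncard_isCoUnipolar (n : ℕ) :
    Set.ncard {G : SimpleGraph (Fin n) | IsCoUnipolar G} = countUnipolar n :=
  ncard_compl_eq IsUnipolar

lemma eventually_not_classOne_le {ε : ℝ} (hε : 0 < ε) :
    ∀ᶠ n : ℕ in atTop,
      (Set.ncard {G : SimpleGraph (Fin n) | IsPerfect G ∧ edgeChromaticNumber G ≠ G.maxDegree} : ℝ) ≤
        ε * countUnipolar n := by
  obtain ⟨P, hP⟩ : ∃ P : (n : ℕ) → SimpleGraph (Fin n) → Prop, ∀ n G, P n G ↔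
      ¬ (IsUnipolar G ∨ IsCoUnipolar G ∨ Exceptional G (1 / 20) ∨ Exceptional Gᶜ (1 / 20)) :=
    ⟨_, fun _ _ => Iff.rfl⟩
  have hrare : Rare P := by
    have h := eventually_typicalGraphs.1 typical_structure
    have e : P = fun n G => ¬ (IsUnipolar G ∨ IsCoUnipolar G ∨ Exceptional G (1 / 20) ∨
        Exceptional Gᶜ (1 / 20)) := by
      funext n G
      exact propext (hP n G)
    rw [e]
    exact h
  have hexc : ∀ {δ : ℝ}, 0 < δ → ∀ᶠ n : ℕ in atTop,
      (Set.ncard {G : SimpleGraph (Fin n) | Exceptional Gᶜ (1 / 20)} : ℝ) ≤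
        δ * countUnipolar n := by
    intro δ hδ
    filter_upwards [eventually_exceptional_le hδ] with n hn
    rwa [ncard_compl_eq fun G => Exceptional G (1 / 20)]
  obtain ⟨K, hK0, hK⟩ := countC5Free_le_of_rare hrare (B := 4) (by
    filter_upwards [eventually_exceptional_le one_pos, hexc one_pos] with n h1 h2
    have h3 : (Set.ncard {G : SimpleGraph (Fin n) | IsUnipolar G} : ℝ) ≤ countUnipolar n := le_rfl
    have h4 : (Set.ncard {G : SimpleGraph (Fin n) | IsCoUnipolar G} : ℝ) ≤ countUnipolar n := by
      rw [ncard_isCoUnipolar]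
    refine le_trans (Nat.cast_le.2 (Set.ncard_le_ncard ?_ (Set.toFinite _)))
      ((ncard_or_le h3 (ncard_or_le h4 (ncard_or_le h1 h2))).trans (le_of_eq (by ring)))
    exact fun G hG => by_contra fun h => hG.2 ((hP n G).2 h))
  have hε' : 0 < ε / 5 := by positivity
  filter_upwards [hrare.eventually_le hK0 hK hε', eventually_exceptional_le hε', hexc hε',
    eventually_not_uniqueMax_le hε'] with n h1 h2 h3 h4
  have h5 : (Set.ncard {G : SimpleGraph (Fin n) | IsUnipolar Gᶜ ∧
      ¬ (UniqueMax Gᶜ ∧ UniqueMax Gᶜᶜ)} : ℝ) ≤ ε / 5 * countUnipolar n := by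
    rwa [ncard_compl_eq fun G => IsUnipolar G ∧ ¬ (UniqueMax G ∧ UniqueMax Gᶜ)]
  refine le_trans (Nat.cast_le.2 (Set.ncard_le_ncard ?_ (Set.toFinite _)))
    ((ncard_or_le h1 (ncard_or_le h2 (ncard_or_le h3 (ncard_or_le h4 h5)))).trans
      (le_of_eq (by ring)))
  rintro G ⟨hG, hne⟩
  have hu : ¬ UniqueMax G := fun h => hne h.edgeChromaticNumber_eq
  by_cases hPG : P n G
  · exact Or.inl ⟨hG.c5Free, hPG⟩
  · rw [hP, not_not] at hPG
    rcases hPG with h | h | h | h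
    · exact Or.inr (Or.inr (Or.inr (Or.inl ⟨h, fun h' => hu h'.1⟩)))
    · refine Or.inr (Or.inr (Or.inr (Or.inr ⟨h, fun h' => hu ?_⟩)))
      rw [compl_compl] at h'
      exact h'.2
    · exact Or.inr (Or.inl h)
    · exact Or.inr (Or.inr (Or.inl h))

lemma countUnipolar_le_perfectCount (n : ℕ) : countUnipolar n ≤ perfectCount n :=
  Set.ncard_le_ncard (t := {G : SimpleGraph (Fin n) | IsPerfect G}) (fun _ h => h.isPerfect)
    (Set.toFinite _)

lemma card_classOne_add (n : ℕ) :
    Nat.card {G : SimpleGraph (Fin n) // IsPerfect G ∧ edgeChromaticNumber G = G.maxDegree} +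
      Set.ncard {G : SimpleGraph (Fin n) | IsPerfect G ∧ edgeChromaticNumber G ≠ G.maxDegree} =
      perfectCount n := by
  change Set.ncard {G : SimpleGraph (Fin n) | IsPerfect G ∧ edgeChromaticNumber G = G.maxDegree} +
    _ = Set.ncard {G : SimpleGraph (Fin n) | IsPerfect G}
  rw [← Set.ncard_union_eq (Set.disjoint_left.2 fun _ h h' => h'.2 h.2) (Set.toFinite _)
    (Set.toFinite _)]
  congr 1
  ext G
  simp only [Set.mem_union, Set.mem_ofPred_eq]
  tauto

/-- Almost all perfect graphs are class one: the probability that a uniformly random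
perfect graph on `{1,…,n}` has chromatic index equal to its maximum degree tends to 1. -/
theorem almost_all_perfect_class_one :
    Tendsto (fun n : ℕ =>
        (Nat.card {G : SimpleGraph (Fin n) // IsPerfect G ∧
            edgeChromaticNumber G = G.maxDegree} : ℝ) / (perfectCount n : ℝ))
      atTop (nhds 1) := by
  have hpos : ∀ n, (0 : ℝ) < perfectCount n := fun n => by
    exact_mod_cast (one_le_countUnipolar n).trans (countUnipolar_le_perfectCount n)
  refine tendsto_order.2 ⟨fun a ha => ?_, fun a ha => Eventually.of_forall fun n => ?_⟩
  · filter_upwards [eventually_not_classOne_le (half_pos (sub_pos.2 ha))] with n hn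
    have h1 : (countUnipolar n : ℝ) ≤ perfectCount n :=
      Nat.cast_le.2 (countUnipolar_le_perfectCount n)
    have h2 := congrArg (Nat.cast (R := ℝ)) (card_classOne_add n)
    rw [Nat.cast_add] at h2
    rw [lt_div_iff₀ (hpos n)]
    have h3 := mul_le_mul_of_nonneg_left h1 (half_pos (sub_pos.2 ha)).le
    have h4 := mul_pos (sub_pos.2 ha) (hpos n)
    linarith
  · refine lt_of_le_of_lt ?_ ha
    rw [div_le_one (hpos n)]
    exact Nat.cast_le.2 ((Nat.le_add_right _ _).trans_eq (card_classOne_add n))
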